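/- Let T be an obtuse triangle (one interior angle strictly greater than π/2). Then every second Neumann eigenfunction u of T has no critical points. -/

import Mathlib

open Set

noncomputable section

abbrev E2 : Type := EuclideanSpace ℝ (Fin 2)

/-- The closed triangle: convex hull of the three vertices. -/
def Tri (v₁ v₂ v₃ : E2) : Set E2 := convexHull ℝ {v₁, v₂, v₃}

/-- The vertex set of the triangle. -/
def Vtx (v₁ v₂ v₃ : E2) : Set E2 := {v₁, v₂, v₃}

/-- The triangle minus its vertices. -/
def TriDom (v₁ v₂ v₃ : E2) : Set E2 := Tri v₁ v₂ v₃ \ Vtx v₁ v₂ v₃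

/-- Second (mixed) directional derivative of `u` at `p`: first in direction `v`, then `w`. -/
def mixedDeriv (u : E2 → ℝ) (p v w : E2) : ℝ :=
  fderiv ℝ (fun y => fderiv ℝ u y v) p w

/-- The (geometers') Laplacian `−(∂ₓ² + ∂_y²) u` at `p`. -/
def negLap (u : E2 → ℝ) (p : E2) : ℝ :=
  -(mixedDeriv u p (EuclideanSpace.single 0 1) (EuclideanSpace.single 0 1)
    + mixedDeriv u p (EuclideanSpace.single 1 1) (EuclideanSpace.single 1 1))

/-- `u` satisfies Neumann conditions along the segment `[a,b]`: at every non-endpoint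
point of the segment, the derivative of `u` (within `S`) annihilates every vector
orthogonal to the direction of the side; equivalently the normal derivative vanishes. -/
def NeumannOn (S : Set E2) (a b : E2) (u : E2 → ℝ) : Prop :=
  ∀ p ∈ segment ℝ a b, p ≠ a → p ≠ b →
    ∀ w : E2, @inner ℝ _ _ w (b - a) = 0 → fderivWithin ℝ u S p w = 0

/-- `u` is a Neumann eigenfunction of the triangle with vertices `v₁ v₂ v₃`,
with eigenvalue `μ > 0`. -/
structure IsNeumannEigenfun (v₁ v₂ v₃ : E2) (μ : ℝ) (u : E2 → ℝ) : Prop where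
  pos : 0 < μ
  nonconst : ¬ ∃ c : ℝ, ∀ z ∈ Tri v₁ v₂ v₃, u z = c
  cont : ContinuousOn u (Tri v₁ v₂ v₃)
  smooth : ContDiffOn ℝ (⊤ : ℕ∞) u (TriDom v₁ v₂ v₃)
  eqn : ∀ p ∈ interior (Tri v₁ v₂ v₃), negLap u p = μ * u p
  neumann₁₂ : NeumannOn (TriDom v₁ v₂ v₃) v₁ v₂ u
  neumann₂₃ : NeumannOn (TriDom v₁ v₂ v₃) v₂ v₃ u
  neumann₃₁ : NeumannOn (TriDom v₁ v₂ v₃) v₃ v₁ u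

/-- `u` is a second Neumann eigenfunction: a Neumann eigenfunction whose eigenvalue is
the least `μ > 0` admitting a Neumann eigenfunction. -/
def IsSecondNeumannEigenfun (v₁ v₂ v₃ : E2) (u : E2 → ℝ) : Prop :=
  ∃ μ : ℝ, IsNeumannEigenfun v₁ v₂ v₃ μ u ∧
    ∀ (μ' : ℝ) (u' : E2 → ℝ), IsNeumannEigenfun v₁ v₂ v₃ μ' u' → μ ≤ μ'

/-- `p` is a critical point of `u`: a non-vertex point of the triangle at which the
derivative (within the triangle minus vertices) vanishes. -/
def IsCritPt (v₁ v₂ v₃ : E2) (u : E2 → ℝ) (p : E2) : Prop :=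
  p ∈ TriDom v₁ v₂ v₃ ∧ fderivWithin ℝ u (TriDom v₁ v₂ v₃) p = 0

/-- `(a, b)` is (an ordering of) a side of the triangle `v₁ v₂ v₃`. -/
def IsSide (v₁ v₂ v₃ a b : E2) : Prop :=
  (a = v₁ ∧ b = v₂) ∨ (a = v₂ ∧ b = v₃) ∨ (a = v₃ ∧ b = v₁)

/-- Reflection of `z` across the line through `a` and `b`. -/
def lineReflect (a b z : E2) : E2 :=
  (2 : ℝ) • (a + ((@inner ℝ _ _ (z - a) (b - a)) / (@inner ℝ _ _ (b - a) (b - a))) • (b - a)) - z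

/-- Determinant of the Hessian of `w` at `p` (in the standard coordinates). -/
def hessDet (w : E2 → ℝ) (p : E2) : ℝ :=
  mixedDeriv w p (EuclideanSpace.single 0 1) (EuclideanSpace.single 0 1) *
      mixedDeriv w p (EuclideanSpace.single 1 1) (EuclideanSpace.single 1 1) -
    mixedDeriv w p (EuclideanSpace.single 0 1) (EuclideanSpace.single 1 1) *
      mixedDeriv w p (EuclideanSpace.single 1 1) (EuclideanSpace.single 0 1)

/-- The Hessian at `p` of the extension of `u` by reflection across the side `[a,b]`
satisfies the predicate `P`: there is a smooth local extension `w` of `u` near `p`,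
invariant under the reflection across the line through `a, b`, with `P (hessDet w p)`. -/
def ReflHessAt (v₁ v₂ v₃ a b : E2) (u : E2 → ℝ) (p : E2) (P : ℝ → Prop) : Prop :=
  ∃ (U : Set E2) (w : E2 → ℝ), IsOpen U ∧ p ∈ U ∧ ContDiffOn ℝ (⊤ : ℕ∞) w U ∧
    (∀ z ∈ U ∩ Tri v₁ v₂ v₃, w z = u z) ∧
    (∀ z ∈ U, lineReflect a b z ∈ U → w (lineReflect a b z) = w z) ∧
    P (hessDet w p)

/-- `p` is an isolated local extremum of `u` on the triangle: the connected component
of the level set `{z ∈ T : u z = u p}` containing `p` is `{p}`. -/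
def IsIsolatedExtremum (v₁ v₂ v₃ : E2) (u : E2 → ℝ) (p : E2) : Prop :=
  connectedComponentIn {z ∈ Tri v₁ v₂ v₃ | u z = u p} p = {p}

noncomputable section
namespace HS
open Complex Filter Topology MeasureTheory
open scoped ContDiff

/-- directional derivative -/
def dd (v : ℂ) (f : ℂ → ℝ) (z : ℂ) : ℝ := fderiv ℝ f z v

/-- Laplacian -/
def Lap (f : ℂ → ℝ) (z : ℂ) : ℝ := dd 1 (dd 1 f) z + dd I (dd I f) z

/-- dot product -/
def dot (a b : ℂ) : ℝ := a.re * b.re + a.im * b.im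

lemma lin_apply (L : ℂ →L[ℝ] ℝ) (v : ℂ) : L v = v.re * L 1 + v.im * L I := by
  have : v = v.re • (1 : ℂ) + v.im • I := by
    apply Complex.ext <;> simp
  conv_lhs => rw [this]
  rw [map_add, map_smul, map_smul]; simp

lemma dd_lin (v : ℂ) (f : ℂ → ℝ) (z : ℂ) :
    dd v f z = v.re * dd 1 f z + v.im * dd I f z := lin_apply _ _

lemma dd_congr {f g : ℂ → ℝ} {z : ℂ} (h : f =ᶠ[𝓝 z] g) (v : ℂ) : dd v f z = dd v g z := by
  unfold dd; rw [h.fderiv_eq]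

lemma dd_congr' {f g : ℂ → ℝ} {z : ℂ} (h : f =ᶠ[𝓝 z] g) (v : ℂ) : dd v f =ᶠ[𝓝 z] dd v g := by
  filter_upwards [h.eventuallyEq_nhds] with y hy using dd_congr hy v

lemma Lap_congr {f g : ℂ → ℝ} {z : ℂ} (h : f =ᶠ[𝓝 z] g) : Lap f z = Lap g z := by
  unfold Lap
  rw [dd_congr (dd_congr' h 1), dd_congr (dd_congr' h I)]

lemma contDiff_dd {f : ℂ → ℝ} (hf : ContDiff ℝ ∞ f) (v : ℂ) : ContDiff ℝ ∞ (dd v f) := by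
  have : ContDiff ℝ ∞ (fderiv ℝ f) := hf.fderiv_right (by simp)
  exact this.clm_apply contDiff_const

lemma contDiffAt_dd {f : ℂ → ℝ} {z : ℂ} (hf : ContDiffAt ℝ ∞ f z) (v : ℂ) :
    ContDiffAt ℝ ∞ (dd v f) z := by
  have : ContDiffAt ℝ ∞ (fderiv ℝ f) z := hf.fderiv_right (by simp)
  exact this.clm_apply contDiffAt_const

lemma cdd {f : ℂ → ℝ} (hf : ContDiff ℝ ∞ f) (z : ℂ) : DifferentiableAt ℝ f z :=
  (hf.differentiable (by simp)) z

lemma cdda {f : ℂ → ℝ} {z : ℂ} (hf : ContDiffAt ℝ ∞ f z) : DifferentiableAt ℝ f z :=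
  hf.differentiableAt (by simp)

lemma dd_comm {f : ℂ → ℝ} {z : ℂ} (hf : ContDiffAt ℝ ∞ f z) (v w : ℂ) :
    dd v (dd w f) z = dd w (dd v f) z := by
  have hs : IsSymmSndFDerivAt ℝ f z := by
    apply hf.isSymmSndFDerivAt
    simp only [minSmoothness_of_isRCLikeNormedField]
    exact WithTop.coe_le_coe.2 le_top
  have hd : DifferentiableAt ℝ (fderiv ℝ f) z :=
    (hf.fderiv_right (m := ∞) (by simp)).differentiableAt (by simp)
  have key : ∀ a b : ℂ, dd a (dd b f) z = fderiv ℝ (fderiv ℝ f) z a b := by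
    intro a b
    unfold dd
    rw [fderiv_clm_apply hd (differentiableAt_const b)]
    simp
  rw [key, key]
  exact hs v w

lemma dd_add {f g : ℂ → ℝ} {z : ℂ} (hf : DifferentiableAt ℝ f z) (hg : DifferentiableAt ℝ g z)
    (v : ℂ) : dd v (fun y => f y + g y) z = dd v f z + dd v g z := by
  unfold dd; rw [fderiv_fun_add hf hg]; rfl

lemma dd_sub {f g : ℂ → ℝ} {z : ℂ} (hf : DifferentiableAt ℝ f z) (hg : DifferentiableAt ℝ g z)
    (v : ℂ) : dd v (fun y => f y - g y) z = dd v f z - dd v g z := by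
  unfold dd; rw [fderiv_fun_sub hf hg]; rfl

lemma dd_mul {f g : ℂ → ℝ} {z : ℂ} (hf : DifferentiableAt ℝ f z) (hg : DifferentiableAt ℝ g z)
    (v : ℂ) : dd v (fun y => f y * g y) z = f z * dd v g z + g z * dd v f z := by
  unfold dd; rw [fderiv_fun_mul hf hg]; simp

lemma dd_const_mul {f : ℂ → ℝ} {z : ℂ} (hf : DifferentiableAt ℝ f z) (c : ℝ)
    (v : ℂ) : dd v (fun y => c * f y) z = c * dd v f z := by
  unfold dd; rw [fderiv_const_mul hf]; rfl

lemma dd_const (c : ℝ) (v z : ℂ) : dd v (fun _ => c) z = 0 := by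
  unfold dd; simp

lemma dd_comb {f g : ℂ → ℝ} {z : ℂ} (hf : DifferentiableAt ℝ f z) (hg : DifferentiableAt ℝ g z)
    (a b : ℝ) (v : ℂ) : dd v (fun y => a * f y + b * g y) z = a * dd v f z + b * dd v g z := by
  rw [dd_add (hf.const_mul a) (hg.const_mul b), dd_const_mul hf, dd_const_mul hg]

lemma Lap_comb {f g : ℂ → ℝ} {z : ℂ} (hf : ContDiffAt ℝ ∞ f z) (hg : ContDiffAt ℝ ∞ g z)
    (a b : ℝ) : Lap (fun y => a * f y + b * g y) z = a * Lap f z + b * Lap g z := by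
  have key : ∀ v, dd v (fun y => a * f y + b * g y) =ᶠ[𝓝 z] fun y => a * dd v f y + b * dd v g y := by
    intro v
    filter_upwards [(hf.of_le (m := 1) (by simp)).eventually (by simp),
      (hg.of_le (m := 1) (by simp)).eventually (by simp)] with y h1 h2
    exact dd_comb (h1.differentiableAt (by simp)) (h2.differentiableAt (by simp)) a b v
  unfold Lap
  rw [dd_congr (key 1), dd_congr (key I), dd_comb (cdda (contDiffAt_dd hf _)) (cdda (contDiffAt_dd hg _)),
    dd_comb (cdda (contDiffAt_dd hf _)) (cdda (contDiffAt_dd hg _))]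
  ring

lemma ev_cd {f : ℂ → ℝ} {z : ℂ} (hf : ContDiffAt ℝ ∞ f z) : ∀ᶠ y in 𝓝 z, DifferentiableAt ℝ f y := by
  filter_upwards [(hf.of_le (m := 1) (by simp)).eventually (by simp)] with y h1
  exact h1.differentiableAt (by simp)

lemma Lap_mul {f g : ℂ → ℝ} {z : ℂ} (hf : ContDiffAt ℝ ∞ f z) (hg : ContDiffAt ℝ ∞ g z) :
    Lap (fun y => f y * g y) z = f z * Lap g z + g z * Lap f z
      + 2 * (dd 1 f z * dd 1 g z + dd I f z * dd I g z) := by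
  have key : ∀ v, dd v (fun y => f y * g y) =ᶠ[𝓝 z] fun y => f y * dd v g y + g y * dd v f y := by
    intro v
    filter_upwards [ev_cd hf, ev_cd hg] with y h1 h2
    exact dd_mul h1 h2 v
  have k2 : ∀ v, dd v (fun y => f y * dd v g y + g y * dd v f y) z =
      f z * dd v (dd v g) z + g z * dd v (dd v f) z + 2 * (dd v f z * dd v g z) := by
    intro v
    have a1 := cdda hf
    have a2 := cdda hg
    have a3 := cdda (contDiffAt_dd hf v)
    have a4 := cdda (contDiffAt_dd hg v)
    rw [dd_add (a1.fun_mul a4) (a2.fun_mul a3), dd_mul a1 a4, dd_mul a2 a3]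
    ring
  unfold Lap
  rw [dd_congr (key 1), dd_congr (key I), k2, k2]
  ring

lemma Lap_dd {f : ℂ → ℝ} {z : ℂ} (hf : ContDiffAt ℝ ∞ f z) (v : ℂ) :
    Lap (dd v f) z = dd v (Lap f) z := by
  have hev : ∀ᶠ y in 𝓝 z, ContDiffAt ℝ ∞ f y ∨ True := by simp
  have h3 : ∀ᶠ y in 𝓝 z, ContDiffAt ℝ 4 f y :=
    (hf.of_le (m := 4) (WithTop.coe_le_coe.2 le_top)).eventually (by simp)
  have key : ∀ w, dd w (dd v f) =ᶠ[𝓝 z] dd v (dd w f) := by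
    intro w
    filter_upwards [h3] with y hy
    have hs : IsSymmSndFDerivAt ℝ f y := by
      apply hy.isSymmSndFDerivAt
      simp; norm_num
    have hd : DifferentiableAt ℝ (fderiv ℝ f) y :=
      (hy.fderiv_right (m := 1) (by norm_num)).differentiableAt (by simp)
    have key : ∀ a b : ℂ, dd a (dd b f) y = fderiv ℝ (fderiv ℝ f) y a b := by
      intro a b
      unfold dd
      rw [fderiv_clm_apply hd (differentiableAt_const b)]
      simp
    rw [key, key]
    exact hs w v
  have e : Lap f = fun y => dd 1 (dd 1 f) y + dd I (dd I f) y := rfl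
  rw [e, dd_add (cdda (contDiffAt_dd (contDiffAt_dd hf _) _)) (cdda (contDiffAt_dd (contDiffAt_dd hf _) _))]
  unfold Lap
  rw [dd_congr (key 1), dd_congr (key I), dd_comm (contDiffAt_dd hf 1), dd_comm (contDiffAt_dd hf I)]

lemma dd_dd_lin {f : ℂ → ℝ} {z : ℂ} (hf : ContDiffAt ℝ ∞ f z) (v w : ℂ) :
    dd v (dd w f) z = v.re * w.re * dd 1 (dd 1 f) z
      + (v.re * w.im + v.im * w.re) * dd 1 (dd I f) z + v.im * w.im * dd I (dd I f) z := by
  have e : dd w f = fun y => w.re * dd 1 f y + w.im * dd I f y := by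
    ext y; exact dd_lin w f y
  rw [e, dd_comb (cdda (contDiffAt_dd hf _)) (cdda (contDiffAt_dd hf _)),
    dd_lin v (dd 1 f), dd_lin v (dd I f), dd_comm hf I 1]
  ring

/-- rotation invariance of the Laplacian -/
lemma Lap_rot {f : ℂ → ℝ} {z : ℂ} (hf : ContDiffAt ℝ ∞ f z) {τ ν : ℂ}
    (h1 : dot τ τ = 1) (h2 : dot ν ν = 1) (h3 : dot τ ν = 0) :
    Lap f z = dd τ (dd τ f) z + dd ν (dd ν f) z := by
  unfold dot at *
  have hν : ∃ s : ℝ, s ^ 2 = 1 ∧ ν.re = - s * τ.im ∧ ν.im = s * τ.re := by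
    refine ⟨τ.re * ν.im - τ.im * ν.re, ?_, ?_, ?_⟩
    · have : (τ.re * ν.im - τ.im * ν.re) ^ 2 = (τ.re * τ.re + τ.im * τ.im) * (ν.re * ν.re + ν.im * ν.im)
        - (τ.re * ν.re + τ.im * ν.im) ^ 2 := by ring
      rw [this, h1, h2, h3]; norm_num
    · linear_combination (-ν.re) * h1 + τ.re * h3
    · linear_combination (-ν.im) * h1 + τ.im * h3
  obtain ⟨s, hs, hr, hi⟩ := hν
  rw [dd_dd_lin hf τ τ, dd_dd_lin hf ν ν, hr, hi]
  unfold Lap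
  linear_combination (-(dd 1 (dd 1 f) z) - dd I (dd I f) z) * h1 - (τ.im * τ.im * dd 1 (dd 1 f) z
    + τ.re * τ.re * dd I (dd I f) z - 2 * τ.re * τ.im * dd 1 (dd I f) z) * hs

lemma hasDerivAt_line {f : ℂ → ℝ} {z v : ℂ} {t : ℝ} (hf : DifferentiableAt ℝ f (z + t • v)) :
    HasDerivAt (fun s : ℝ => f (z + s • v)) (dd v f (z + t • v)) t := by
  have h1 : HasDerivAt (fun s : ℝ => z + s • v) v t := by
    have := ((hasDerivAt_id t).smul_const v).const_add z
    simpa using this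
  exact hf.hasFDerivAt.comp_hasDerivAt t h1

lemma dd_dd_nonpos_of_isLocalMax {f : ℂ → ℝ} {z : ℂ} (hf : ContDiffAt ℝ ∞ f z)
    (hm : IsLocalMax f z) (v : ℂ) : dd v (dd v f) z ≤ 0 := by
  by_contra hcon
  push Not at hcon
  have hz : z + (0 : ℝ) • v = z := by simp
  have hcont : Tendsto (fun s : ℝ => z + s • v) (𝓝 0) (𝓝 z) := by
    have : Continuous (fun s : ℝ => z + s • v) := by fun_prop
    simpa using this.tendsto 0
  have hd1 : ∀ᶠ s in 𝓝 (0:ℝ), HasDerivAt (fun s : ℝ => f (z + s • v)) (dd v f (z + s • v)) s := by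
    filter_upwards [hcont.eventually (ev_cd hf)] with s hs using hasDerivAt_line hs
  have hd2 : HasDerivAt (fun s : ℝ => dd v f (z + s • v)) (dd v (dd v f) z) 0 := by
    have := hasDerivAt_line (f := dd v f) (z := z) (v := v) (t := 0)
      (by rw [hz]; exact cdda (contDiffAt_dd hf v))
    rwa [hz] at this
  have hderiv : deriv (fun s : ℝ => f (z + s • v)) =ᶠ[𝓝 0] fun s => dd v f (z + s • v) := by
    filter_upwards [hd1] with s hs using hs.deriv
  have hmax : IsLocalMax (fun s : ℝ => f (z + s • v)) 0 := by
    have := hcont.eventually hm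
    filter_upwards [this] with s hs
    simpa using hs
  have h0 : deriv (fun s : ℝ => f (z + s • v)) 0 = 0 := hmax.deriv_eq_zero
  have h2 : 0 < deriv (deriv (fun s : ℝ => f (z + s • v))) 0 := by
    rw [hderiv.deriv_eq, hd2.deriv]; exact hcon
  have hmin := isLocalMin_of_deriv_deriv_pos h2 h0 (hd1.self_of_nhds.continuousAt)
  -- locally constant
  have hc : (fun s : ℝ => f (z + s • v)) =ᶠ[𝓝 0] fun _ => f z := by
    filter_upwards [hmax, hmin] with s h1 h2
    simp at h1 h2
    exact le_antisymm h1 h2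
  have : deriv (fun s : ℝ => f (z + s • v)) =ᶠ[𝓝 0] fun _ => 0 := by
    filter_upwards [hc.eventuallyEq_nhds] with s hs
    rw [hs.deriv_eq]; simp
  rw [this.deriv_eq] at h2
  simp at h2

lemma Lap_nonpos_of_isLocalMax {f : ℂ → ℝ} {z : ℂ} (hf : ContDiffAt ℝ ∞ f z)
    (hm : IsLocalMax f z) : Lap f z ≤ 0 :=
  add_nonpos (dd_dd_nonpos_of_isLocalMax hf hm 1) (dd_dd_nonpos_of_isLocalMax hf hm I)

end HS
end

noncomputable section
namespace HS
open Complex Filter Topology MeasureTheory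
open scoped ContDiff

lemma hasDerivAt_param {p p' : ℝ → ℝ → ℝ} (hp : Continuous (fun x : ℝ × ℝ => p x.1 x.2))
    (hp' : Continuous (fun x : ℝ × ℝ => p' x.1 x.2))
    (hd : ∀ r t, HasDerivAt (fun s => p s t) (p' r t) r) (a b r : ℝ) :
    HasDerivAt (fun s => ∫ t in a..b, p s t) (∫ t in a..b, p' r t) r := by
  obtain ⟨C, hC⟩ := ((isCompact_Icc (a := r - 1) (b := r + 1)).prod
    (isCompact_uIcc (a := a) (b := b))).exists_bound_of_continuousOn hp'.continuousOn
  have := intervalIntegral.hasDerivAt_integral_of_dominated_loc_of_deriv_le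
    (μ := volume) (F := p) (F' := p') (x₀ := r) (s := Metric.ball r 1) (a := a) (b := b)
    (bound := fun _ => C) (Metric.ball_mem_nhds r one_pos)
    (Eventually.of_forall fun s => ((hp.comp (by fun_prop : Continuous fun t : ℝ => (s, t))).aestronglyMeasurable))
    ((hp.comp (by fun_prop : Continuous fun t : ℝ => (r, t))).intervalIntegrable _ _)
    ((hp'.comp (by fun_prop : Continuous fun t : ℝ => (r, t))).aestronglyMeasurable)
    (Eventually.of_forall fun t ht x hx => by
      have hx' := abs_lt.1 (by simpa [Real.dist_eq] using hx)
      exact hC (x, t) ⟨⟨by linarith, by linarith⟩, uIoc_subset_uIcc ht⟩)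
    (by simp) (Eventually.of_forall fun t _ x _ => hd x t)
  exact this.2

/-- unit circle parametrisation -/
def ee (t : ℝ) : ℂ := (Real.cos t : ℂ) + (Real.sin t : ℂ) * I

@[simp] lemma ee_re (t : ℝ) : (ee t).re = Real.cos t := by
  unfold ee; rw [add_re, mul_re, ofReal_re, ofReal_re, ofReal_im, I_re, I_im]; ring
@[simp] lemma ee_im (t : ℝ) : (ee t).im = Real.sin t := by
  unfold ee; rw [add_im, mul_im, ofReal_re, ofReal_im, ofReal_im, I_re, I_im]; ring

lemma ee_cont : Continuous ee := by unfold ee; fun_prop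

lemma ee_deriv (t : ℝ) : HasDerivAt ee (I * ee t) t := by
  have h1 : HasDerivAt (fun t : ℝ => (Real.cos t : ℂ)) ((-Real.sin t : ℝ) : ℂ) t :=
    (Real.hasDerivAt_cos t).ofReal_comp
  have h2 : HasDerivAt (fun t : ℝ => (Real.sin t : ℂ)) ((Real.cos t : ℝ) : ℂ) t :=
    (Real.hasDerivAt_sin t).ofReal_comp
  have := h1.add (h2.mul_const I)
  refine this.congr_deriv ?_
  unfold ee
  push_cast
  linear_combination (-(sin (t:ℂ))) * I_mul_I

lemma norm_ee (t : ℝ) : ‖ee t‖ = 1 := by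
  have : ‖ee t‖ ^ 2 = 1 := by
    rw [← Complex.normSq_eq_norm_sq, Complex.normSq_apply]
    simp; nlinarith [Real.sin_sq_add_cos_sq t]
  nlinarith [norm_nonneg (ee t)]

lemma ee_unit (t : ℝ) : dot (ee t) (ee t) = 1 := by
  unfold dot; simp; nlinarith [Real.sin_sq_add_cos_sq t]

/-- circle mean -/
def MM (f : ℂ → ℝ) (r : ℝ) : ℝ := ∫ t in (-Real.pi)..Real.pi, f (r • ee t)

lemma MM_deriv {f : ℂ → ℝ} (hf : ContDiff ℝ ∞ f) (r : ℝ) :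
    HasDerivAt (MM f) (∫ t in (-Real.pi)..Real.pi,
      (Real.cos t * dd 1 f (r • ee t) + Real.sin t * dd I f (r • ee t))) r := by
  have hec := ee_cont
  have c1 : Continuous f := hf.continuous
  have c2 : Continuous (dd 1 f) := (contDiff_dd hf 1).continuous
  have c3 : Continuous (dd I f) := (contDiff_dd hf I).continuous
  have := hasDerivAt_param (p := fun s t => f (s • ee t))
    (p' := fun r t => (Real.cos t * dd 1 f (r • ee t) + Real.sin t * dd I f (r • ee t)))
    (by fun_prop) (by fun_prop) (fun r t => by
      have h := hasDerivAt_line (z := 0) (v := ee t) (t := r) (cdd hf (0 + r • ee t))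
      simp only [zero_add] at h
      rw [dd_lin, ee_re, ee_im] at h
      exact h) (-Real.pi) Real.pi r
  exact this

lemma circ_theta {g : ℂ → ℝ} (hg : ContDiff ℝ ∞ g) (r t : ℝ) :
    HasDerivAt (fun t => g (r • ee t)) (r * (-Real.sin t * dd 1 g (r • ee t) + Real.cos t * dd I g (r • ee t))) t := by
  have h1 : HasDerivAt (fun t => r • ee t) (r • (I * ee t)) t := (ee_deriv t).const_smul r
  have h2 := (cdd hg (r • ee t)).hasFDerivAt.comp_hasDerivAt t h1
  have e : (fderiv ℝ g (r • ee t)) (r • (I * ee t)) = r * dd (I * ee t) g (r • ee t) := by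
    rw [map_smul]; rfl
  rw [e, dd_lin] at h2
  simp only [mul_re, mul_im, I_re, I_im, ee_re, ee_im] at h2
  refine h2.congr_deriv ?_
  ring

lemma NN_deriv {f : ℂ → ℝ} (hf : ContDiff ℝ ∞ f) (r : ℝ) :
    HasDerivAt (fun r => r * ∫ t in (-Real.pi)..Real.pi,
      (Real.cos t * dd 1 f (r • ee t) + Real.sin t * dd I f (r • ee t)))
      (r * ∫ t in (-Real.pi)..Real.pi, Lap f (r • ee t)) r := by
  have hec := ee_cont
  have s1 := contDiff_dd hf 1
  have s2 := contDiff_dd hf I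
  have c2 : Continuous (dd 1 f) := s1.continuous
  have c3 : Continuous (dd I f) := s2.continuous
  have c4 : Continuous (dd 1 (dd 1 f)) := (contDiff_dd s1 1).continuous
  have c5 : Continuous (dd I (dd 1 f)) := (contDiff_dd s1 I).continuous
  have c6 : Continuous (dd 1 (dd I f)) := (contDiff_dd s2 1).continuous
  have c7 : Continuous (dd I (dd I f)) := (contDiff_dd s2 I).continuous
  have line : ∀ {g : ℂ → ℝ} (_ : ContDiff ℝ ∞ g) (r t : ℝ), HasDerivAt (fun s : ℝ => g (s • ee t))
      (Real.cos t * dd 1 g (r • ee t) + Real.sin t * dd I g (r • ee t)) r := by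
    intro g hg r t
    have h := hasDerivAt_line (z := 0) (v := ee t) (t := r) (cdd hg (0 + r • ee t))
    simp only [zero_add] at h
    rwa [dd_lin, ee_re, ee_im] at h
  have h1 := hasDerivAt_param
    (p := fun r t => (Real.cos t * dd 1 f (r • ee t) + Real.sin t * dd I f (r • ee t)))
    (p' := fun r t => Real.cos t * (Real.cos t * dd 1 (dd 1 f) (r • ee t) + Real.sin t * dd I (dd 1 f) (r • ee t))
      + Real.sin t * (Real.cos t * dd 1 (dd I f) (r • ee t) + Real.sin t * dd I (dd I f) (r • ee t)))
    (by fun_prop) (by fun_prop) (fun r t =>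
      ((line s1 r t).const_mul (Real.cos t)).add ((line s2 r t).const_mul (Real.sin t))) (-Real.pi) Real.pi r
  have h2 := (hasDerivAt_id r).mul h1
  -- theta derivative integrates to zero
  have h3 : ∫ t in (-Real.pi)..Real.pi, ((-Real.cos t * dd 1 f (r • ee t) + -Real.sin t *
        (r * (-Real.sin t * dd 1 (dd 1 f) (r • ee t) + Real.cos t * dd I (dd 1 f) (r • ee t))))
      + (-Real.sin t * dd I f (r • ee t) + Real.cos t *
        (r * (-Real.sin t * dd 1 (dd I f) (r • ee t) + Real.cos t * dd I (dd I f) (r • ee t))))) = 0 := by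
    rw [intervalIntegral.integral_eq_sub_of_hasDerivAt
      (f := fun t => -Real.sin t * dd 1 f (r • ee t) + Real.cos t * dd I f (r • ee t))]
    · have : ee (-Real.pi) = ee Real.pi := by
        apply Complex.ext <;> simp
      simp [this]
    · intro t _
      exact ((Real.hasDerivAt_sin t).neg.mul (circ_theta s1 r t)).add
        ((Real.hasDerivAt_cos t).mul (circ_theta s2 r t))
    · apply Continuous.intervalIntegrable
      fun_prop
  refine h2.congr_deriv ?_
  simp only [id, one_mul]
  rw [← intervalIntegral.integral_const_mul, ← intervalIntegral.integral_const_mul]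
  rw [← add_zero ((intervalIntegral _ _ _ _) + _), ← h3]
  rw [← intervalIntegral.integral_add (Continuous.intervalIntegrable (by fun_prop) _ _)
      (Continuous.intervalIntegrable (by fun_prop) _ _),
    ← intervalIntegral.integral_add (Continuous.intervalIntegrable (by fun_prop) _ _)
      (Continuous.intervalIntegrable (by fun_prop) _ _)]
  apply intervalIntegral.integral_congr
  intro t _
  simp only [Lap]
  linear_combination (-(-(r * dd 1 (dd 1 f) (r • ee t)) - r * dd I (dd I f) (r • ee t))) * (Real.sin_sq_add_cos_sq t)

lemma MM_zero {f : ℂ → ℝ} (hf : ContDiff ℝ ∞ f) {lam R : ℝ} (hl : 0 ≤ lam) (hR : lam * R ^ 2 < 4)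
    (he : ∀ z, ‖z‖ < R → Lap f z = - lam * f z) (h0 : f 0 = 0) {r : ℝ} (hr : 0 ≤ r) (hrR : r < R) :
    MM f r = 0 := by
  have hMd := MM_deriv hf
  have hcont : Continuous (MM f) := by
    rw [continuous_iff_continuousAt]; exact fun x => (hMd x).continuousAt
  obtain ⟨s, hs, hmax⟩ := (isCompact_Icc (a := (0:ℝ)) (b := r)).exists_isMaxOn
    ⟨0, by simp [hr]⟩ (f := fun x => |MM f x|) (by fun_prop)
  set S := |MM f s| with hS
  have hmax' : ∀ x ∈ Icc (0:ℝ) r, |MM f x| ≤ S := fun x hx => hmax hx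
  have hM0 : MM f 0 = 0 := by simp [MM, h0]
  have hN : ∀ x ∈ Icc (0:ℝ) r, ‖x * ∫ t in (-Real.pi)..Real.pi,
      (Real.cos t * dd 1 f (x • ee t) + Real.sin t * dd I f (x • ee t))‖ ≤ lam * S * x ^ 2 / 2 := by
    refine fun x hx => image_norm_le_of_norm_deriv_right_le_deriv_boundary (B := fun x => lam * S * x ^ 2 / 2)
      (f := fun x => x * ∫ t in (-Real.pi)..Real.pi, (Real.cos t * dd 1 f (x • ee t) + Real.sin t * dd I f (x • ee t)))
      (f' := fun x => x * ∫ t in (-Real.pi)..Real.pi, Lap f (x • ee t))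
      (B' := fun x => lam * S * x) ?_ ?_ ?_ ?_ ?_ hx
    · exact fun x _ => (NN_deriv hf x).continuousAt.continuousWithinAt
    · exact fun x _ => (NN_deriv hf x).hasDerivWithinAt
    · simp
    · intro x
      have := ((hasDerivAt_pow 2 x).const_mul (lam * S)).div_const 2
      refine this.congr_deriv ?_
      simp; ring
    · intro x hx
      have e : ∫ t in (-Real.pi)..Real.pi, Lap f (x • ee t) = - lam * MM f x := by
        rw [MM, ← intervalIntegral.integral_const_mul]
        apply intervalIntegral.integral_congr
        intro t _
        apply he
        rw [norm_smul, norm_ee, mul_one, Real.norm_eq_abs, abs_of_nonneg hx.1]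
        linarith [hx.2]
      rw [e, Real.norm_eq_abs, abs_mul, abs_mul, abs_neg, abs_of_nonneg hx.1, abs_of_nonneg hl]
      have := hmax' x ⟨hx.1, hx.2.le⟩
      have h3 := mul_le_mul_of_nonneg_left this (mul_nonneg hx.1 hl)
      nlinarith
  have hMb : ∀ x ∈ Icc (0:ℝ) r, ‖MM f x‖ ≤ lam * S * x ^ 2 / 4 := by
    refine fun x hx => image_norm_le_of_norm_deriv_right_le_deriv_boundary (B := fun x => lam * S * x ^ 2 / 4)
      (f' := fun x => ∫ t in (-Real.pi)..Real.pi, (Real.cos t * dd 1 f (x • ee t) + Real.sin t * dd I f (x • ee t)))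
      (B' := fun x => lam * S * x / 2) ?_ ?_ ?_ ?_ ?_ hx
    · exact hcont.continuousOn
    · exact fun x _ => (hMd x).hasDerivWithinAt
    · simp [hM0]
    · intro x
      have := ((hasDerivAt_pow 2 x).const_mul (lam * S)).div_const 4
      refine this.congr_deriv ?_
      simp; ring
    · intro x hx
      rcases eq_or_lt_of_le hx.1 with h | h
      · subst h
        have : ∫ t in (-Real.pi)..Real.pi, (Real.cos t * dd 1 f ((0:ℝ) • ee t) + Real.sin t * dd I f ((0:ℝ) • ee t)) = 0 := by
          simp only [zero_smul]
          rw [intervalIntegral.integral_add (Continuous.intervalIntegrable (by fun_prop) _ _)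
            (Continuous.intervalIntegrable (by fun_prop) _ _), intervalIntegral.integral_mul_const,
            intervalIntegral.integral_mul_const]
          simp
        rw [this]; simp
      · have := hN x ⟨hx.1, hx.2.le⟩
        rw [norm_mul, Real.norm_eq_abs x, abs_of_pos h] at this
        have h5 : x * (lam * S * x / 2) = lam * S * x ^ 2 / 2 := by ring
        rw [← h5] at this
        exact le_of_mul_le_mul_left this h
  have hSs := hMb s hs
  rw [Real.norm_eq_abs, ← hS] at hSs
  have hS0 : 0 ≤ S := abs_nonneg _
  have hsR : s ^ 2 ≤ R ^ 2 := by nlinarith [hs.1, hs.2]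
  have hS1 : S ≤ 0 := by
    by_contra hcon
    push Not at hcon
    have : lam * s ^ 2 ≤ lam * R ^ 2 := mul_le_mul_of_nonneg_left hsR hl
    nlinarith
  have := hmax' r ⟨hr, le_rfl⟩
  exact abs_eq_zero.1 (le_antisymm (this.trans hS1) (abs_nonneg _))

lemma radial_zero {f : ℂ → ℝ} (hf : ContDiff ℝ ∞ f) {lam R : ℝ} (hl : 0 ≤ lam) (hR : lam * R ^ 2 < 4)
    (he : ∀ z, ‖z‖ < R → Lap f z = - lam * f z) (h0 : f 0 = 0) {k : ℝ → ℝ} (hk : Continuous k)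
    (hk0 : ∀ r, R ≤ r → k r = 0) : ∫ z, k ‖z‖ * f z = 0 := by
  have hec := ee_cont
  have hfc := hf.continuous
  rw [← Complex.integral_comp_polarCoord_symm]
  have e : ∀ p : ℝ × ℝ, p ∈ polarCoord.target → p.1 • (k ‖Complex.polarCoord.symm p‖ * f (Complex.polarCoord.symm p))
      = p.1 * k p.1 * f (p.1 • ee p.2) := by
    intro p hp
    have h1 : Complex.polarCoord.symm p = p.1 • ee p.2 := by
      rw [Complex.polarCoord_symm_apply, Complex.real_smul]; rfl
    have h2 : 0 < p.1 := by
      rw [polarCoord_target] at hp; exact hp.1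
    rw [h1, norm_smul, norm_ee, mul_one, Real.norm_eq_abs, abs_of_pos h2]
    simp; ring
  rw [setIntegral_congr_fun polarCoord.open_target.measurableSet e, polarCoord_target]
  rw [Measure.volume_eq_prod, setIntegral_prod]
  · rw [setIntegral_eq_zero_of_forall_eq_zero]
    intro r hr
    have hr : 0 < r := hr
    simp only
    rw [integral_const_mul]
    by_cases h : R ≤ r
    · rw [hk0 r h]; simp
    · have := MM_zero hf hl hR he h0 hr.le (not_le.1 h)
      rw [MM, intervalIntegral.integral_of_le (by linarith [Real.pi_pos])] at this
      rw [integral_Ioc_eq_integral_Ioo] at this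
      rw [this]; simp
  · have hc : Continuous (fun z : ℝ × ℝ => z.1 * k z.1 * f (z.1 • ee z.2)) := by fun_prop
    have h1 : IntegrableOn (fun z : ℝ × ℝ => z.1 * k z.1 * f (z.1 • ee z.2))
        (Icc 0 R ×ˢ Icc (-Real.pi) Real.pi) (volume.prod volume) :=
      hc.continuousOn.integrableOn_compact (isCompact_Icc.prod isCompact_Icc)
    rw [← integrable_indicator_iff (measurableSet_Ioi.prod measurableSet_Ioo)]
    rw [← integrable_indicator_iff (measurableSet_Icc.prod measurableSet_Icc)] at h1
    refine h1.mono ?_ ?_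
    · exact hc.measurable.indicator (measurableSet_Ioi.prod measurableSet_Ioo) |>.aestronglyMeasurable
    · refine Eventually.of_forall fun z => ?_
      by_cases hz : z ∈ Ioi (0:ℝ) ×ˢ Ioo (-Real.pi) Real.pi
      · rw [indicator_of_mem hz]
        by_cases h : R ≤ z.1
        · rw [hk0 _ h]; simp
        · rw [indicator_of_mem]
          exact ⟨⟨(show 0 < z.1 from hz.1).le, (not_le.1 h).le⟩, ⟨hz.2.1.le, hz.2.2.le⟩⟩
      · rw [indicator_of_notMem hz]; simp

end HS
end

noncomputable section
namespace HS
open Complex Filter Topology MeasureTheory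
open scoped ContDiff Convolution

/-- radial kernel -/
def ker (ρ : ℝ) (z : ℂ) : ℝ := Real.smoothTransition (1 - (‖z‖ / ρ) ^ 2)

lemma ker_contDiff (ρ : ℝ) : ContDiff ℝ ∞ (ker ρ) := by
  have : ker ρ = fun z => Real.smoothTransition (1 - ‖z‖ ^ 2 / ρ ^ 2) := by
    ext z; unfold ker; rw [div_pow]
  rw [this]
  exact Real.smoothTransition.contDiff.comp (contDiff_const.sub ((contDiff_norm_sq ℝ).div_const _))

lemma ker_cont (ρ : ℝ) : Continuous (ker ρ) := (ker_contDiff ρ).continuous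
lemma ker_nonneg (ρ : ℝ) (z : ℂ) : 0 ≤ ker ρ z := Real.smoothTransition.nonneg _
lemma ker_le_one (ρ : ℝ) (z : ℂ) : ker ρ z ≤ 1 := Real.smoothTransition.le_one _
lemma ker_zero {ρ : ℝ} (hρ : 0 < ρ) {z : ℂ} (hz : ρ ≤ ‖z‖) : ker ρ z = 0 := by
  apply Real.smoothTransition.zero_of_nonpos
  have : 1 ≤ ‖z‖ / ρ := by rwa [le_div_iff₀ hρ, one_mul]
  nlinarith
lemma ker_pos {ρ : ℝ} (hρ : 0 < ρ) {z : ℂ} (hz : ‖z‖ < ρ) : 0 < ker ρ z := by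
  apply Real.smoothTransition.pos_of_pos
  have : ‖z‖ / ρ < 1 := by rwa [div_lt_one hρ]
  have h0 : 0 ≤ ‖z‖ / ρ := by positivity
  nlinarith
lemma ker_norm {ρ : ℝ} {z w : ℂ} (h : ‖z‖ = ‖w‖) : ker ρ z = ker ρ w := by unfold ker; rw [h]
lemma ker_tsupport {ρ : ℝ} (hρ : 0 < ρ) : tsupport (ker ρ) ⊆ Metric.closedBall 0 ρ := by
  apply closure_minimal _ Metric.isClosed_closedBall
  intro z hz
  by_contra h
  simp at h
  exact hz (ker_zero hρ h.le)
lemma ker_compact {ρ : ℝ} (hρ : 0 < ρ) : HasCompactSupport (ker ρ) :=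
  HasCompactSupport.of_support_subset_isCompact (isCompact_closedBall 0 ρ)
    (subset_closure.trans (ker_tsupport hρ))
lemma ker_int {ρ : ℝ} (hρ : 0 < ρ) : Integrable (ker ρ) :=
  (ker_cont ρ).integrable_of_hasCompactSupport (ker_compact hρ)

def c0 : ℝ := ∫ z, ker 1 z

lemma c0_pos : 0 < c0 := by
  unfold c0
  apply (integral_pos_iff_support_of_nonneg (ker_nonneg 1) (ker_int one_pos)).2
  apply (IsOpen.measure_pos _ ((ker_cont 1).isOpen_support))
  exact ⟨0, by simpa using (ker_pos one_pos (z := 0) (by simp)).ne'⟩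

lemma ker_scale {ρ : ℝ} (hρ : 0 < ρ) (z : ℂ) : ker ρ z = ker 1 (ρ⁻¹ • z) := by
  unfold ker; rw [norm_smul]; simp [abs_of_pos hρ]; ring_nf

lemma ker_integral {ρ : ℝ} (hρ : 0 < ρ) : ∫ z, ker ρ z = ρ ^ 2 * c0 := by
  simp_rw [ker_scale hρ]
  rw [Measure.integral_comp_inv_smul]
  simp [c0, abs_of_pos hρ]

/-- normalising constant -/
def mc (lam ρ : ℝ) : ℝ := ∫ z, ker ρ z * Real.cos (√lam * z.re)

lemma mc_lower {lam ρ : ℝ} (hl : 0 ≤ lam) (hρ : 0 < ρ) (h : lam * ρ ^ 2 ≤ 1) :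
    c0 * ρ ^ 2 / 2 ≤ mc lam ρ := by
  have : c0 * ρ ^ 2 / 2 = ∫ z, ker ρ z * (1 / 2) := by
    rw [integral_mul_const, ker_integral hρ]; ring
  rw [this]
  unfold mc
  apply integral_mono ((ker_int hρ).mul_const _)
  · apply Continuous.integrable_of_hasCompactSupport
    · have := ker_cont ρ; fun_prop
    · exact (ker_compact hρ).mul_right
  · intro z
    by_cases hz : ρ ≤ ‖z‖
    · simp [ker_zero hρ hz]
    · apply mul_le_mul_of_nonneg_left _ (ker_nonneg _ _)
      have h1 := Real.one_sub_sq_div_two_le_cos (x := √lam * z.re)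
      have h2 : (√lam * z.re) ^ 2 ≤ 1 := by
        rw [mul_pow, Real.sq_sqrt hl]
        have h3 : z.re ^ 2 ≤ ρ ^ 2 := by
          apply sq_le_sq'
          · linarith [(abs_le.1 (Complex.abs_re_le_norm z)).1]
          · linarith [(abs_le.1 (Complex.abs_re_le_norm z)).2]
        exact (mul_le_mul_of_nonneg_left h3 hl).trans h
      linarith

lemma mc_pos {lam ρ : ℝ} (hl : 0 ≤ lam) (hρ : 0 < ρ) (h : lam * ρ ^ 2 ≤ 1) : 0 < mc lam ρ := by
  have := mc_lower hl hρ h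
  have := c0_pos
  have : 0 < c0 * ρ ^ 2 / 2 := by positivity
  linarith

lemma dd_trans (f : ℂ → ℝ) (x v : ℂ) : dd v (fun z => f (x + z)) = fun z => dd v f (x + z) := by
  ext z; unfold dd; rw [fderiv_comp_add_left]

lemma Lap_trans (f : ℂ → ℝ) (x z : ℂ) : Lap (fun z => f (x + z)) z = Lap f (x + z) := by
  unfold Lap; simp only [dd_trans]

lemma hasFDerivAt_re (z : ℂ) : HasFDerivAt (fun z : ℂ => z.re) Complex.reCLM z :=
  Complex.reCLM.hasFDerivAt

lemma Lap_cos (a : ℝ) (z : ℂ) : Lap (fun z : ℂ => Real.cos (a * z.re)) z = - a ^ 2 * Real.cos (a * z.re) := by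
  have e1 : ∀ v : ℂ, dd v (fun z : ℂ => Real.cos (a * z.re)) = fun z => -(a * v.re) * Real.sin (a * z.re) := by
    intro v; ext z
    unfold dd
    have := ((hasFDerivAt_re z).const_mul a).cos
    rw [this.fderiv]; simp; ring
  have e2 : ∀ v : ℂ, dd v (fun z : ℂ => Real.sin (a * z.re)) z = (a * v.re) * Real.cos (a * z.re) := by
    intro v
    unfold dd
    have := ((hasFDerivAt_re z).const_mul a).sin
    rw [this.fderiv]; simp; ring
  have hd : DifferentiableAt ℝ (fun z : ℂ => Real.sin (a * z.re)) z :=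
    ((hasFDerivAt_re z).const_mul a).sin.differentiableAt
  unfold Lap
  rw [e1, e1, dd_const_mul hd, dd_const_mul hd, e2, e2]
  simp; ring

lemma mean_value {G : ℂ → ℝ} (hG : ContDiff ℝ ∞ G) {lam ρ : ℝ} {x : ℂ} (hl : 0 ≤ lam)
    (hρ : 0 < ρ) (h : lam * ρ ^ 2 ≤ 1) (he : ∀ z, ‖z - x‖ < ρ → Lap G z = - lam * G z) :
    ∫ y, ker ρ (x - y) * G y = mc lam ρ * G x := by
  have hcos : ContDiff ℝ ∞ (fun z : ℂ => Real.cos (√lam * z.re)) :=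
    Real.contDiff_cos.comp (contDiff_const.mul Complex.reCLM.contDiff)
  have ht : ContDiff ℝ ∞ (fun z => G (x + z)) := hG.comp (contDiff_const.add contDiff_id)
  set f : ℂ → ℝ := fun z => 1 * G (x + z) + (-G x) * Real.cos (√lam * z.re) with hf
  have hfs : ContDiff ℝ ∞ f := (contDiff_const.mul ht).add (contDiff_const.mul hcos)
  have key := radial_zero (f := f) hfs (lam := lam) (R := ρ) hl (by linarith) (by
    intro z hz
    rw [hf, Lap_comb ht.contDiffAt hcos.contDiffAt, Lap_trans, Lap_cos, he _ (by simpa using hz),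
      Real.sq_sqrt hl]
    ring) (by simp [hf]) (k := fun r => Real.smoothTransition (1 - (r / ρ) ^ 2))
      (by have := Real.smoothTransition.continuous; fun_prop)
      (by
        intro r hr
        apply Real.smoothTransition.zero_of_nonpos
        have : 1 ≤ r / ρ := by rwa [le_div_iff₀ hρ, one_mul]
        nlinarith)
  have e : (fun z : ℂ => Real.smoothTransition (1 - (‖z‖ / ρ) ^ 2) * f z) =
      fun z => ker ρ z * G (x + z) - (ker ρ z * Real.cos (√lam * z.re)) * G x := by
    ext z; simp only [hf, ker]; ring
  rw [e, integral_sub, integral_mul_const] at key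
  · have e2 : ∫ y, ker ρ (x - y) * G y = ∫ z, ker ρ z * G (x + z) := by
      rw [← integral_add_left_eq_self _ x]
      congr 1; ext z
      congr 1
      apply ker_norm; simp
    rw [e2]
    unfold mc; linarith
  · apply Continuous.integrable_of_hasCompactSupport
    · have := ker_cont ρ; have := hG.continuous; fun_prop
    · exact (ker_compact hρ).mul_right
  · apply Continuous.integrable_of_hasCompactSupport
    · have := ker_cont ρ; fun_prop
    · exact (ker_compact hρ).mul_right.mul_right

/-- convolution -/
def cv (k g : ℂ → ℝ) (x : ℂ) : ℝ := ∫ y, k (x - y) * g y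

lemma cv_eq (k g : ℂ → ℝ) : cv k g = (k ⋆[ContinuousLinearMap.lsmul ℝ ℝ, volume] g) := by
  ext x; rw [convolution_lsmul_swap]; rfl

lemma cv_contDiff {k g : ℂ → ℝ} (hk : ContDiff ℝ ∞ k) (hc : HasCompactSupport k) (hg : LocallyIntegrable g) :
    ContDiff ℝ ∞ (cv k g) := by
  rw [cv_eq]; exact hc.contDiff_convolution_left _ hk hg

lemma dd_compact {k : ℂ → ℝ} (hc : HasCompactSupport k) (v : ℂ) : HasCompactSupport (dd v k) :=
  hc.fderiv_apply (𝕜 := ℝ) v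

lemma dd_cv {k g : ℂ → ℝ} (hk : ContDiff ℝ ∞ k) (hc : HasCompactSupport k) (hg : LocallyIntegrable g)
    (v : ℂ) : dd v (cv k g) = cv (dd v k) g := by
  ext x
  rw [cv_eq]
  unfold dd
  rw [(hc.hasFDerivAt_convolution_left _ (hk.of_le (by simp)) hg x).fderiv]
  rw [convolution_eq_swap, ContinuousLinearMap.integral_apply]
  · rfl
  · have hcc : HasCompactSupport (fderiv ℝ k) := hc.fderiv ℝ
    have := hcc.convolutionExists_left ((ContinuousLinearMap.lsmul ℝ ℝ).precompL ℂ)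
      (hk.continuous_fderiv (by simp)) hg (μ := volume) x
    exact this.integrable_swap

lemma Lap_cv {k g : ℂ → ℝ} (hk : ContDiff ℝ ∞ k) (hc : HasCompactSupport k) (hg : LocallyIntegrable g)
    (x : ℂ) : Lap (cv k g) x = cv (Lap k) g x := by
  unfold Lap
  rw [dd_cv hk hc hg, dd_cv hk hc hg, dd_cv (contDiff_dd hk _) (dd_compact hc _) hg,
    dd_cv (contDiff_dd hk _) (dd_compact hc _) hg]
  unfold cv
  rw [← integral_add]
  · simp_rw [add_mul]
  all_goals
    exact ((dd_compact (dd_compact hc _) _).convolutionExists_left (ContinuousLinearMap.lsmul ℝ ℝ)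
      (contDiff_dd (contDiff_dd hk _) _).continuous hg (μ := volume) x).integrable_swap

lemma cv_comm {k ψ g : ℂ → ℝ} (hk : Continuous k) (hkc : HasCompactSupport k)
    (hψ : Continuous ψ) (hψc : HasCompactSupport ψ) (hg : Integrable g) (x : ℂ) :
    cv k (cv ψ g) x = cv ψ (cv k g) x := by
  have key : ∀ {k ψ : ℂ → ℝ} (hk : Continuous k) (hkc : HasCompactSupport k)
    (hψ : Continuous ψ) (hψc : HasCompactSupport ψ),
      cv k (cv ψ g) x = ∫ t, (∫ y, k (x - y) * ψ (y - t)) * g t := by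
    intro k ψ hk hkc hψ hψc
    unfold cv
    simp_rw [← integral_const_mul]
    rw [integral_integral_swap]
    · congr 1; ext t
      rw [← integral_mul_const]
      congr 1; ext y; ring
    · obtain ⟨C, hC⟩ := hψ.bounded_above_of_compact_support hψc
      have h1 : Integrable (fun y => k (x - y)) :=
        (hk.integrable_of_hasCompactSupport hkc).comp_sub_left x
      have h2 := (h1.mul_prod hg).bdd_mul (f := fun p : ℂ × ℂ => ψ (p.1 - p.2)) (c := C)
        (by apply Continuous.aestronglyMeasurable; fun_prop) (Eventually.of_forall fun p => hC _)
      refine h2.congr (Eventually.of_forall fun p => ?_)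
      simp only [Function.uncurry]; ring
  rw [key hk hkc hψ hψc, key hψ hψc hk hkc]
  congr 1; ext t
  congr 1
  rw [← integral_sub_left_eq_self _ _ (x + t)]
  congr 1; ext y
  rw [mul_comm]; congr 2 <;> ring

end HS
end

noncomputable section
namespace HS
open Complex Filter Topology MeasureTheory
open scoped ContDiff Convolution

lemma dd_refl {f : ℂ → ℝ} (hf : Differentiable ℝ f) (x v : ℂ) :
    dd v (fun y => f (x - y)) = fun y => - dd v f (x - y) := by
  ext y
  unfold dd
  have h1 : HasFDerivAt (fun y : ℂ => x - y) (-(ContinuousLinearMap.id ℝ ℂ)) y :=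
    (hasFDerivAt_id y).const_sub x
  have := ((hf (x - y)).hasFDerivAt.comp y h1).fderiv
  simp only [Function.comp_def] at this
  rw [this]; simp

lemma Lap_refl {f : ℂ → ℝ} (hf : ContDiff ℝ ∞ f) (x y : ℂ) :
    Lap (fun y => f (x - y)) y = Lap f (x - y) := by
  have h : ∀ v, dd v (dd v (fun y => f (x - y))) y = dd v (dd v f) (x - y) := by
    intro v
    rw [dd_refl (hf.differentiable (by simp))]
    have h2 := (contDiff_dd hf v).differentiable (by simp)
    have e : (fun y => - dd v f (x - y)) = fun y => (-1 : ℝ) * dd v f (x - y) := by ext; ring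
    have hd : DifferentiableAt ℝ (fun y => dd v f (x - y)) y :=
      (h2 (x - y)).comp y ((differentiableAt_const x).sub differentiableAt_id)
    rw [e, dd_const_mul hd, dd_refl h2]
    ring
  unfold Lap; rw [h, h]

lemma helm_cv {g : ℂ → ℝ} (hg : Integrable g) {lam R ρ : ℝ} {p : ℂ}
    (h : ∀ φ : ℂ → ℝ, ContDiff ℝ ∞ φ → tsupport φ ⊆ Metric.ball p R →
      ∫ y, g y * (Lap φ y + lam * φ y) = 0)
    {k : ℂ → ℝ} (hk : ContDiff ℝ ∞ k) (hs : tsupport k ⊆ Metric.closedBall 0 ρ) {x : ℂ}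
    (hx : ‖x - p‖ + ρ < R) : Lap (cv k g) x = - lam * cv k g x := by
  have hc : HasCompactSupport k := HasCompactSupport.of_support_subset_isCompact
    (isCompact_closedBall 0 ρ) (subset_closure.trans hs)
  rw [Lap_cv hk hc hg.locallyIntegrable]
  have := h (fun y => k (x - y)) (hk.comp (contDiff_const.sub contDiff_id)) (by
    have h1 : tsupport (fun y => k (x - y)) ⊆ Metric.closedBall x ρ := by
      apply closure_minimal _ Metric.isClosed_closedBall
      intro y hy
      have := hs (subset_closure (show x - y ∈ Function.support k from hy))
      simpa [dist_eq_norm, norm_sub_rev] using this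
    intro y hy
    have h2 := h1 hy
    rw [Metric.mem_closedBall, dist_eq_norm] at h2
    rw [Metric.mem_ball, dist_eq_norm]
    have h3 := norm_add_le (y - x) (x - p)
    rw [sub_add_sub_cancel] at h3
    linarith)
  simp only [Lap_refl hk] at this
  have e : (fun y => g y * (Lap k (x - y) + lam * k (x - y))) =
      fun y => Lap k (x - y) * g y + lam * (k (x - y) * g y) := by ext y; ring
  rw [e, integral_add, integral_const_mul] at this
  · unfold cv; linarith
  · have hL : ContDiff ℝ ∞ (Lap k) :=
      (contDiff_dd (contDiff_dd hk _) _).add (contDiff_dd (contDiff_dd hk _) _)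
    have hLc : HasCompactSupport (Lap k) :=
      HasCompactSupport.add (dd_compact (dd_compact hc _) _) (dd_compact (dd_compact hc _) _)
    exact (hLc.convolutionExists_left (ContinuousLinearMap.lsmul ℝ ℝ)
      hL.continuous hg.locallyIntegrable (μ := volume) x).integrable_swap
  · have := (hc.convolutionExists_left (ContinuousLinearMap.lsmul ℝ ℝ)
      hk.continuous hg.locallyIntegrable (μ := volume) x).integrable_swap
    exact Integrable.const_mul this _

theorem weyl {g : ℂ → ℝ} (hg : Integrable g) {lam R : ℝ} {p : ℂ} (hl : 0 ≤ lam) (hR : 0 < R)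
    (hlR : lam * R ^ 2 ≤ 1)
    (h : ∀ φ : ℂ → ℝ, ContDiff ℝ ∞ φ → tsupport φ ⊆ Metric.ball p R →
      ∫ y, g y * (Lap φ y + lam * φ y) = 0) :
    ContDiff ℝ ∞ (fun x => (mc lam (R / 4))⁻¹ * cv (ker (R / 4)) g x) ∧
    (∀ x ∈ Metric.ball p (R / 2), Lap (fun x => (mc lam (R / 4))⁻¹ * cv (ker (R / 4)) g x) x =
      - lam * ((mc lam (R / 4))⁻¹ * cv (ker (R / 4)) g x)) ∧
    ∀ᵐ x, x ∈ Metric.ball p (R / 2) → (mc lam (R / 4))⁻¹ * cv (ker (R / 4)) g x = g x := by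
  have hR4 : 0 < R / 4 := by positivity
  have hl4 : lam * (R / 4) ^ 2 ≤ 1 := by nlinarith [mul_nonneg hl (sq_nonneg R)]
  have hm := mc_pos hl hR4 hl4
  have hcs := cv_contDiff (ker_contDiff (R / 4)) (ker_compact hR4) hg.locallyIntegrable
  refine ⟨contDiff_const.mul hcs, ?_, ?_⟩
  · intro x hx
    rw [Metric.mem_ball, dist_eq_norm] at hx
    have := helm_cv hg h (ker_contDiff (R / 4)) (ker_tsupport hR4) (x := x) (by linarith)
    have h2 := Lap_comb (hcs.contDiffAt (x := x)) (hcs.contDiffAt (x := x)) (mc lam (R / 4))⁻¹ 0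
    simp only [zero_mul, add_zero] at h2
    rw [h2, this]; ring
  · let b : ℕ → ContDiffBump (0 : ℂ) := fun n =>
      ⟨(R / 8) / (n + 1), 2 * ((R / 8) / (n + 1)), by positivity, by
        have : 0 < (R / 8) / ((n : ℝ) + 1) := by positivity
        linarith⟩
    have hb : Tendsto (fun n => (b n).rOut) atTop (𝓝 0) := by
      have : Tendsto (fun n : ℕ => (R / 8) / ((n : ℝ) + 1)) atTop (𝓝 0) :=
        tendsto_const_nhds.div_atTop (tendsto_atTop_add_const_right _ _ tendsto_natCast_atTop_atTop)
      simpa using this.const_mul 2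
    have hae := ContDiffBump.ae_convolution_tendsto_right_of_locallyIntegrable (φ := b) (l := atTop)
      (K := 2) hb (Eventually.of_forall fun n => le_rfl) hg.locallyIntegrable
    filter_upwards [hae] with x hx hxp
    rw [Metric.mem_ball, dist_eq_norm] at hxp
    have h1 := ContDiffBump.convolution_tendsto_right_of_continuous (μ := volume) hb hcs.continuous x
    have hev : ∀ n, cv (b n |>.normed volume) (cv (ker (R / 4)) g) x
        = mc lam (R / 4) * cv (b n |>.normed volume) g x := by
      intro n
      have hbs : ContDiff ℝ ∞ ((b n).normed volume) := (b n).contDiff_normed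
      have hbc : HasCompactSupport ((b n).normed volume) := (b n).hasCompactSupport_normed
      have hbt : tsupport ((b n).normed volume) ⊆ Metric.closedBall 0 (R / 4) := by
        rw [(b n).tsupport_normed_eq]
        apply Metric.closedBall_subset_closedBall
        show 2 * ((R / 8) / ((n : ℝ) + 1)) ≤ R / 4
        have : (R / 8) / ((n : ℝ) + 1) ≤ R / 8 := div_le_self (by positivity) (by linarith [Nat.cast_nonneg (α := ℝ) n])
        linarith
      rw [← cv_comm (ker_cont _) (ker_compact hR4) hbs.continuous hbc hg]
      exact mean_value (cv_contDiff hbs hbc hg.locallyIntegrable) hl hR4 hl4 (by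
        intro z hz
        refine helm_cv hg h hbs hbt ?_
        have h3 := norm_add_le (z - x) (x - p)
        rw [sub_add_sub_cancel] at h3
        linarith)
    simp only [← cv_eq] at h1 hx
    simp only [hev] at h1
    have h2 := tendsto_nhds_unique h1 (hx.const_mul (mc lam (R / 4)))
    rw [h2]; field_simp

/-- integrals of derivatives of compactly supported functions vanish -/
lemma integral_dd_zero {f : ℂ → ℝ} (hf : ContDiff ℝ ∞ f) (hc : HasCompactSupport f) (v : ℂ) :
    ∫ z, dd v f z = 0 := by
  have h1 : Integrable (dd v f) := (contDiff_dd hf v).continuous.integrable_of_hasCompactSupport (dd_compact hc v)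
  have e : (fun x => (fun _ : ℂ => (1:ℝ)) x * fderiv ℝ f x v) = dd v f := by
    ext x; simp [dd]
  have := integral_mul_fderiv_eq_neg_fderiv_mul_of_integrable (μ := (volume : Measure ℂ)) (f := fun _ : ℂ => (1:ℝ)) (g := f) (v := v)
    (by simp) (by rw [e]; exact h1) (by simpa using hf.continuous.integrable_of_hasCompactSupport hc)
    (by intro x _; simp) (fun x _ => hf.differentiable (by simp) x)
  rw [e] at this
  rw [this]; simp

lemma helm_dd {G : ℂ → ℝ} (hG : ContDiff ℝ ∞ G) {lam ρ : ℝ} {x : ℂ}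
    (he : ∀ z, ‖z - x‖ < ρ → Lap G z = - lam * G z) (v : ℂ) :
    ∀ z, ‖z - x‖ < ρ → Lap (dd v G) z = - lam * dd v G z := by
  intro z hz
  rw [Lap_dd hG.contDiffAt]
  have : Lap G =ᶠ[𝓝 z] fun y => -lam * G y := by
    have : Metric.ball x ρ ∈ 𝓝 z := Metric.isOpen_ball.mem_nhds (by simpa [dist_eq_norm] using hz)
    filter_upwards [this] with y hy
    exact he y (by simpa [dist_eq_norm] using hy)
  rw [dd_congr this, dd_const_mul (cdd hG z)]

lemma dd_ker_zero {ρ : ℝ} (hρ : 0 < ρ) {z : ℂ} (hz : ρ ≤ ‖z‖) (v : ℂ) : dd v (ker ρ) z = 0 := by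
  have : IsLocalMin (ker ρ) z := by
    apply Eventually.of_forall; intro y
    rw [ker_zero hρ hz]; exact ker_nonneg _ _
  unfold dd; rw [this.fderiv_eq_zero]; simp

lemma dd_ker_bound : ∃ C : ℝ, 0 < C ∧ ∀ ρ : ℝ, 0 < ρ → ∀ v : ℂ, ‖v‖ ≤ 1 → ∀ z, |dd v (ker ρ) z| ≤ C / ρ := by
  obtain ⟨C, hC⟩ := ((ker_contDiff 1).continuous_fderiv (by simp)).bounded_above_of_compact_support
    ((ker_compact one_pos).fderiv ℝ)
  have hC0 : 0 ≤ C := (norm_nonneg _).trans (hC 0)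
  refine ⟨C + 1, by positivity, fun ρ hρ v hv z => ?_⟩
  have e : ker ρ = fun z => ker 1 (ρ⁻¹ • z) := by ext z; exact ker_scale hρ z
  have h1 : dd v (ker ρ) z = ρ⁻¹ * dd v (ker 1) (ρ⁻¹ • z) := by
    unfold dd
    rw [e, fderiv_comp_smul]; simp
  rw [h1, abs_mul, abs_of_pos (inv_pos.2 hρ), div_eq_inv_mul]
  apply mul_le_mul_of_nonneg_left _ (inv_pos.2 hρ).le
  have := (fderiv ℝ (ker 1) (ρ⁻¹ • z)).le_opNorm v
  have h3 := hC (ρ⁻¹ • z)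
  have h4 : ‖fderiv ℝ (ker 1) (ρ⁻¹ • z)‖ * ‖v‖ ≤ C * 1 := mul_le_mul h3 hv (norm_nonneg _) hC0
  unfold dd
  rw [← Real.norm_eq_abs]; linarith

theorem grad_est : ∃ C : ℝ, 0 < C ∧ ∀ (lam ρ : ℝ) (G : ℂ → ℝ) (x : ℂ) (c K : ℝ), 0 ≤ lam → 0 < ρ →
    lam * ρ ^ 2 ≤ 1 → ContDiff ℝ ∞ G → (∀ z, ‖z - x‖ < ρ → Lap G z = - lam * G z) →
    (∀ z, ‖z - x‖ < ρ → |G z - c| ≤ K) → ∀ v : ℂ, ‖v‖ ≤ 1 → |dd v G x| ≤ C / ρ * K := by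
  obtain ⟨C1, hC1, hb⟩ := dd_ker_bound
  have hc0 := c0_pos
  refine ⟨2 * C1 * Real.pi / c0, by positivity, ?_⟩
  intro lam ρ G x c K hl hρ hlρ hG he hK v hv
  have hK0 : 0 ≤ K := (abs_nonneg _).trans (hK x (by simpa using hρ))
  have mv := mean_value (contDiff_dd hG v) hl hρ hlρ (helm_dd hG he v)
  have hks : ContDiff ℝ ∞ (fun y => ker ρ (x - y)) := (ker_contDiff ρ).comp (contDiff_const.sub contDiff_id)
  have hkc : HasCompactSupport (fun y => ker ρ (x - y)) :=
    (ker_compact hρ).comp_homeomorph (Homeomorph.subLeft x)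
  have hGc : ContDiff ℝ ∞ (fun y => G y - c) := hG.sub contDiff_const
  have h0 := integral_dd_zero (hks.mul hGc) (hkc.mul_right) v
  have e : dd v (fun y => ker ρ (x - y) * (G y - c)) =
      fun y => ker ρ (x - y) * dd v G y - (G y - c) * dd v (ker ρ) (x - y) := by
    ext y
    rw [dd_mul (cdd hks y) (cdd hGc y), dd_sub (cdd hG y) (differentiableAt_const c), dd_const,
      dd_refl ((ker_contDiff ρ).differentiable (by simp))]
    ring
  have c1 := ker_cont ρ
  have c2 : Continuous (dd v G) := (contDiff_dd hG v).continuous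
  have c3 : Continuous (dd v (ker ρ)) := (contDiff_dd (ker_contDiff ρ) v).continuous
  have c4 := hG.continuous
  have hdc : HasCompactSupport (fun y => dd v (ker ρ) (x - y)) :=
    (dd_compact (ker_compact hρ) v).comp_homeomorph (Homeomorph.subLeft x)
  rw [e, integral_sub, mv] at h0
  rotate_left
  · exact Continuous.integrable_of_hasCompactSupport (by fun_prop) hkc.mul_right
  · exact Continuous.integrable_of_hasCompactSupport (by fun_prop) hdc.mul_left
  have h1 : |∫ y, (G y - c) * dd v (ker ρ) (x - y)| ≤ (K * (C1 / ρ)) * (Real.pi * ρ ^ 2) := by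
    rw [← setIntegral_eq_integral_of_forall_compl_eq_zero (s := Metric.ball x ρ)]
    · have hvol : (volume : Measure ℂ).real (Metric.ball x ρ) = Real.pi * ρ ^ 2 := by
        rw [Measure.real, Complex.volume_ball]
        simp [hρ.le]; ring
      rw [← hvol, ← Real.norm_eq_abs]
      apply norm_setIntegral_le_of_norm_le_const
      · exact measure_ball_lt_top
      · intro y hy
        rw [Metric.mem_ball, dist_eq_norm] at hy
        rw [norm_mul]
        exact mul_le_mul (hK y hy) (hb ρ hρ v hv _) (norm_nonneg _) hK0
    · intro y hy
      rw [Metric.mem_ball, dist_eq_norm, not_lt] at hy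
      rw [dd_ker_zero hρ (by rwa [norm_sub_rev]), mul_zero]
  have hm := mc_lower hl hρ hlρ
  have h2 : mc lam ρ * |dd v G x| ≤ (K * (C1 / ρ)) * (Real.pi * ρ ^ 2) := by
    have : mc lam ρ * dd v G x = ∫ y, (G y - c) * dd v (ker ρ) (x - y) := by linarith
    rw [← abs_of_pos (mc_pos hl hρ hlρ), ← abs_mul, this]; exact h1
  have h3 : c0 * ρ ^ 2 / 2 * |dd v G x| ≤ (K * (C1 / ρ)) * (Real.pi * ρ ^ 2) :=
    (mul_le_mul_of_nonneg_right hm (abs_nonneg _)).trans h2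
  have h4 : c0 * ρ ^ 2 / 2 * (2 * C1 * Real.pi / c0 / ρ * K) = (K * (C1 / ρ)) * (Real.pi * ρ ^ 2) := by
    field_simp
  rw [← h4] at h3
  exact le_of_mul_le_mul_left h3 (by positivity)

theorem l2_est {lam ρ : ℝ} {G : ℂ → ℝ} {x : ℂ} (hl : 0 ≤ lam) (hρ : 0 < ρ) (hlρ : lam * ρ ^ 2 ≤ 1)
    (hG : ContDiff ℝ ∞ G) (he : ∀ z, ‖z - x‖ < ρ → Lap G z = - lam * G z) :
    G x ^ 2 * ρ ^ 2 ≤ 4 / c0 * ∫ y in Metric.ball x ρ, G y ^ 2 := by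
  have hc0 := c0_pos
  have mv := mean_value hG hl hρ hlρ he
  have hkc : HasCompactSupport (fun y => ker ρ (x - y)) :=
    (ker_compact hρ).comp_homeomorph (Homeomorph.subLeft x)
  have c1 := ker_cont ρ
  have c4 := hG.continuous
  set A := ∫ y, ker ρ (x - y) * G y ^ 2 with hA
  have hAle : A ≤ ∫ y in Metric.ball x ρ, G y ^ 2 := by
    rw [hA, ← integral_indicator measurableSet_ball]
    apply integral_mono
    · exact Continuous.integrable_of_hasCompactSupport (by fun_prop) hkc.mul_right
    · rw [integrable_indicator_iff measurableSet_ball]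
      exact ((c4.pow 2).continuousOn.integrableOn_compact (isCompact_closedBall x ρ)).mono_set Metric.ball_subset_closedBall
    · intro y
      by_cases hy : y ∈ Metric.ball x ρ
      · rw [indicator_of_mem hy]
        have := ker_le_one ρ (x - y)
        nlinarith [sq_nonneg (G y)]
      · rw [indicator_of_notMem hy]
        rw [Metric.mem_ball, dist_eq_norm, not_lt] at hy
        simp only
        rw [ker_zero hρ (by rwa [norm_sub_rev]), zero_mul]
  have hk1 : ∫ y, ker ρ (x - y) = ρ ^ 2 * c0 := by
    rw [integral_sub_left_eq_self (fun y => ker ρ y), ker_integral hρ]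
  have quad : ∀ s : ℝ, 0 ≤ A - 2 * s * (mc lam ρ * G x) + s ^ 2 * (ρ ^ 2 * c0) := by
    intro s
    have i1 : Integrable (fun y => ker ρ (x - y) * G y ^ 2) :=
      Continuous.integrable_of_hasCompactSupport (by fun_prop) hkc.mul_right
    have i2 : Integrable (fun y => 2 * s * (ker ρ (x - y) * G y)) :=
      (Continuous.integrable_of_hasCompactSupport (by fun_prop) hkc.mul_right).const_mul _
    have i3 : Integrable (fun y => s ^ 2 * (ker ρ (x - y))) :=
      (Continuous.integrable_of_hasCompactSupport (by fun_prop) hkc).const_mul _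
    have : 0 ≤ ∫ y, (ker ρ (x - y) * G y ^ 2 - 2 * s * (ker ρ (x - y) * G y) + s ^ 2 * (ker ρ (x - y))) := by
      apply integral_nonneg
      intro y
      have := mul_nonneg (ker_nonneg ρ (x - y)) (sq_nonneg (G y - s))
      simp only [Pi.zero_apply]
      linarith
    have i12 : Integrable (fun y => ker ρ (x - y) * G y ^ 2 - 2 * s * (ker ρ (x - y) * G y)) := i1.sub i2
    rw [integral_add i12 i3, integral_sub i1 i2, integral_const_mul, integral_const_mul, hk1, mv] at this
    exact this
  have h1 := quad (mc lam ρ * G x / (ρ ^ 2 * c0))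
  have hp : 0 < ρ ^ 2 * c0 := by positivity
  have h2 : (mc lam ρ * G x) ^ 2 ≤ A * (ρ ^ 2 * c0) := by
    have e : A - 2 * (mc lam ρ * G x / (ρ ^ 2 * c0)) * (mc lam ρ * G x) + (mc lam ρ * G x / (ρ ^ 2 * c0)) ^ 2 * (ρ ^ 2 * c0)
      = (A * (ρ ^ 2 * c0) - (mc lam ρ * G x) ^ 2) / (ρ ^ 2 * c0) := by field_simp; ring
    rw [e] at h1
    have := (div_nonneg_iff.1 h1)
    rcases this with h | h
    · linarith [h.1]
    · linarith [h.2]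
  have hm := mc_lower hl hρ hlρ
  have h3 : (c0 * ρ ^ 2 / 2) ^ 2 ≤ mc lam ρ ^ 2 := by
    apply pow_le_pow_left₀ (by positivity) hm
  have h4 : (c0 * ρ ^ 2 / 2) ^ 2 * G x ^ 2 ≤ A * (ρ ^ 2 * c0) := by
    have := mul_le_mul_of_nonneg_right h3 (sq_nonneg (G x))
    nlinarith
  have h5 : G x ^ 2 * ρ ^ 2 ≤ 4 / c0 * A := by
    have e1 : (c0 * ρ ^ 2 / 2) ^ 2 * G x ^ 2 = (c0 ^ 2 * ρ ^ 2 / 4) * (G x ^ 2 * ρ ^ 2) := by ring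
    have e2 : A * (ρ ^ 2 * c0) = (c0 ^ 2 * ρ ^ 2 / 4) * (4 / c0 * A) := by field_simp
    rw [e1, e2] at h4
    exact le_of_mul_le_mul_left h4 (by positivity)
  have : 4 / c0 * A ≤ 4 / c0 * ∫ y in Metric.ball x ρ, G y ^ 2 :=
    mul_le_mul_of_nonneg_left hAle (by positivity)
  linarith

theorem strong_pos {lam ρ : ℝ} {G : ℂ → ℝ} {x : ℂ} (hl : 0 ≤ lam) (hρ : 0 < ρ) (hlρ : lam * ρ ^ 2 ≤ 1)
    (hG : ContDiff ℝ ∞ G) (he : ∀ z, ‖z - x‖ < ρ → Lap G z = - lam * G z)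
    (hpos : ∀ z, ‖z - x‖ < ρ → 0 ≤ G z) (h0 : G x = 0) : ∀ z, ‖z - x‖ < ρ → G z = 0 := by
  have mv := mean_value hG hl hρ hlρ he
  have hkc : HasCompactSupport (fun y => ker ρ (x - y)) :=
    (ker_compact hρ).comp_homeomorph (Homeomorph.subLeft x)
  have c1 := ker_cont ρ
  have c4 := hG.continuous
  have hc : Continuous (fun y => ker ρ (x - y) * G y) := by fun_prop
  have hn : ∀ y, 0 ≤ ker ρ (x - y) * G y := by
    intro y
    by_cases hy : ρ ≤ ‖x - y‖
    · rw [ker_zero hρ hy, zero_mul]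
    · exact mul_nonneg (ker_nonneg _ _) (hpos y (by rw [norm_sub_rev]; exact not_le.1 hy))
  intro z hz
  by_contra hne
  have hz2 : (fun y => ker ρ (x - y) * G y) z ≠ 0 :=
    mul_ne_zero (ker_pos hρ (by rwa [norm_sub_rev])).ne' hne
  have := hc.integral_pos_of_hasCompactSupport_nonneg_nonzero (μ := volume) hkc.mul_right hn hz2
  rw [mv, h0] at this
  simp at this

end HS
end

noncomputable section
namespace HS
open Complex Filter Topology MeasureTheory
open scoped ContDiff Convolution

structure Cfg where
  P : Fin 3 → ℂ
  ν : Fin 3 → ℂ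
  τ : Fin 3 → ℂ
  c : Fin 3 → ℝ
  h : Fin 3 → ℝ
  hν : ∀ j, dot (ν j) (ν j) = 1
  hτ : ∀ j, dot (τ j) (τ j) = 1
  hτν : ∀ j, dot (τ j) (ν j) = 0
  τre : ∀ j, 0 < (τ j).re
  τim : ∀ j, 0 < (τ j).im
  hpos : ∀ j, 0 < h j
  hP : ∀ j k, dot (ν j) (P k) + c j = if j = k then h j else 0
  sum1 : ∀ z, ∑ j, (dot (ν j) z + c j) / h j = 1
  sumP : ∀ z, ∑ j, ((dot (ν j) z + c j) / h j) • P j = z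

lemma dot_self (a : ℂ) : dot a a = ‖a‖ ^ 2 := by
  rw [Complex.sq_norm, Complex.normSq_apply]; rfl

lemma abs_dot_le (a b : ℂ) : |dot a b| ≤ ‖a‖ * ‖b‖ := by
  apply abs_le_of_sq_le_sq _ (by positivity)
  rw [mul_pow, ← dot_self, ← dot_self]
  unfold dot
  nlinarith [sq_nonneg (a.re * b.im - a.im * b.re)]

lemma dot_add (a b c : ℂ) : dot a (b + c) = dot a b + dot a c := by simp [dot]; ring
lemma dot_sub (a b c : ℂ) : dot a (b - c) = dot a b - dot a c := by simp [dot]; ring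
lemma dot_smul (a b : ℂ) (t : ℝ) : dot a (t • b) = t * dot a b := by simp [dot]; ring
lemma dot_comm (a b : ℂ) : dot a b = dot b a := by simp [dot]; ring

namespace Cfg
variable (C : Cfg)

def l (j : Fin 3) (z : ℂ) : ℝ := dot (C.ν j) z + C.c j
def T : Set ℂ := {z | ∀ j, 0 ≤ C.l j z}
def T0 : Set ℂ := {z | ∀ j, 0 < C.l j z}
def V : Set ℂ := range C.P
def dV (z : ℂ) : ℝ := Metric.infDist z C.V

lemma nν (j : Fin 3) : ‖C.ν j‖ = 1 := by
  have := C.hν j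
  rw [dot_self] at this
  have h := norm_nonneg (C.ν j)
  nlinarith
lemma nτ (j : Fin 3) : ‖C.τ j‖ = 1 := by
  have := C.hτ j
  rw [dot_self] at this
  have h := norm_nonneg (C.τ j)
  nlinarith

lemma l_add (j : Fin 3) (z v : ℂ) : C.l j (z + v) = C.l j z + dot (C.ν j) v := by
  unfold l; rw [dot_add]; ring
lemma l_sub_l (j : Fin 3) (y z : ℂ) : C.l j y - C.l j z = dot (C.ν j) (y - z) := by
  unfold l; rw [dot_sub]; ring
lemma l_lip (j : Fin 3) (y z : ℂ) : |C.l j y - C.l j z| ≤ ‖y - z‖ := by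
  rw [l_sub_l]; have := abs_dot_le (C.ν j) (y - z); rwa [C.nν, one_mul] at this
lemma l_le (j : Fin 3) (y z : ℂ) : C.l j y ≤ C.l j z + ‖y - z‖ := by
  have := (abs_le.1 (C.l_lip j y z)).2; linarith
lemma l_contDiff (j : Fin 3) : ContDiff ℝ ∞ (C.l j) := by
  unfold l dot
  have h1 : ContDiff ℝ ∞ (fun z : ℂ => z.re) := Complex.reCLM.contDiff
  have h2 : ContDiff ℝ ∞ (fun z : ℂ => z.im) := Complex.imCLM.contDiff
  fun_prop
lemma l_cont (j : Fin 3) : Continuous (C.l j) := (C.l_contDiff j).continuous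
lemma dd_l (j : Fin 3) (v z : ℂ) : dd v (C.l j) z = dot (C.ν j) v := by
  unfold dd
  have h1 : HasFDerivAt (fun z : ℂ => z.re) Complex.reCLM z := Complex.reCLM.hasFDerivAt
  have h2 : HasFDerivAt (fun z : ℂ => z.im) Complex.imCLM z := Complex.imCLM.hasFDerivAt
  have := ((h1.const_mul (C.ν j).re).fun_add (h2.const_mul (C.ν j).im)).add_const (C.c j)
  have e := this.fderiv
  change fderiv ℝ (C.l j) z = _ at e
  rw [e]; simp [dot]

lemma l_P (j k : Fin 3) : C.l j (C.P k) = if j = k then C.h j else 0 := C.hP j k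
lemma l_P_self (j : Fin 3) : C.l j (C.P j) = C.h j := by rw [l_P, if_pos rfl]
lemma l_P_ne {j k : Fin 3} (h : j ≠ k) : C.l j (C.P k) = 0 := by rw [l_P, if_neg h]
lemma P_mem (k : Fin 3) : C.P k ∈ C.T := by
  intro j; rw [l_P]; split_ifs
  · exact (C.hpos j).le
  · exact le_rfl
lemma s1 (z : ℂ) : ∑ j, C.l j z / C.h j = 1 := C.sum1 z
lemma sP (z : ℂ) : ∑ j, (C.l j z / C.h j) • C.P j = z := C.sumP z

lemma T0_sub : C.T0 ⊆ C.T := fun _ hz j => (hz j).le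
lemma T0_open : IsOpen C.T0 := by
  have : C.T0 = ⋂ j, {z | 0 < C.l j z} := by ext; simp [T0]
  rw [this]; exact isOpen_iInter_of_finite fun j => isOpen_lt continuous_const (C.l_cont j)
lemma T_closed : IsClosed C.T := by
  have : C.T = ⋂ j, {z | 0 ≤ C.l j z} := by ext; simp [T]
  rw [this]; exact isClosed_iInter fun j => isClosed_le continuous_const (C.l_cont j)
lemma l_comb (j : Fin 3) (x y : ℂ) {a b : ℝ} (hab : a + b = 1) :
    C.l j (a • x + b • y) = a * C.l j x + b * C.l j y := by
  unfold l; rw [dot_add, dot_smul, dot_smul]; linear_combination (-C.c j) * hab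
lemma T_convex : Convex ℝ C.T := by
  intro x hx y hy a b ha hb hab j
  rw [l_comb C j x y hab]
  have := hx j; have := hy j; positivity
lemma T0_convex : Convex ℝ C.T0 := by
  intro x hx y hy a b ha hb hab j
  rw [l_comb C j x y hab]
  have h1 := hx j; have h2 := hy j
  rcases ha.eq_or_lt with h | h
  · subst h; have : b = 1 := by linarith
    subst this; simpa using h2
  · have := mul_pos h h1; have := mul_nonneg hb h2.le; linarith
lemma ball_sub {z : ℂ} {ρ : ℝ} (hb : Metric.ball z ρ ⊆ C.T) {t : ℝ} (ht : 0 ≤ t) (htρ : t < ρ) (j : Fin 3) :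
    t ≤ C.l j z := by
  have : z + (-t) • C.ν j ∈ C.T := hb (by simp [C.nν, abs_of_nonneg ht, htρ])
  have := this j
  rw [l_add, dot_smul, C.hν] at this
  linarith
lemma interior_T : interior C.T = C.T0 := by
  apply subset_antisymm _ (interior_maximal C.T0_sub C.T0_open)
  intro z hz j
  rw [mem_interior_iff_mem_nhds, Metric.mem_nhds_iff] at hz
  obtain ⟨ρ, hρ, hb⟩ := hz
  have := C.ball_sub hb (half_pos hρ).le (half_lt_self hρ) j
  linarith
lemma T0_nonempty : (C.T0).Nonempty := by
  refine ⟨(1/3 : ℝ) • C.P 0 + (2/3 : ℝ) • ((1/2 : ℝ) • C.P 1 + (1/2 : ℝ) • C.P 2), fun j => ?_⟩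
  rw [l_comb C j _ _ (by norm_num), l_comb C j _ _ (by norm_num), l_P, l_P, l_P]
  have := C.hpos j
  fin_cases j <;> simp <;> simpa using this
lemma a_le {z : ℂ} (hz : z ∈ C.T) (j : Fin 3) : C.l j z / C.h j ≤ 1 := by
  rw [← C.s1 z]
  exact Finset.single_le_sum (f := fun j => C.l j z / C.h j) (fun i _ => div_nonneg (hz i) (C.hpos i).le) (Finset.mem_univ j)
lemma a_nonneg {z : ℂ} (hz : z ∈ C.T) (j : Fin 3) : 0 ≤ C.l j z / C.h j := div_nonneg (hz j) (C.hpos j).le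
lemma T_bounded : Bornology.IsBounded C.T := by
  rw [isBounded_iff_forall_norm_le]
  refine ⟨∑ j, ‖C.P j‖, fun z hz => ?_⟩
  conv_lhs => rw [← C.sP z]
  refine (norm_sum_le _ _).trans (Finset.sum_le_sum fun j _ => ?_)
  rw [norm_smul, Real.norm_of_nonneg (C.a_nonneg hz j)]
  exact mul_le_of_le_one_left (norm_nonneg _) (C.a_le hz j)
lemma T_compact : IsCompact C.T := Metric.isCompact_of_isClosed_isBounded C.T_closed C.T_bounded
lemma T_meas : MeasurableSet C.T := C.T_closed.measurableSet
lemma T_ae : ∀ᵐ z ∂(volume.restrict C.T), z ∈ C.T0 := by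
  rw [ae_restrict_iff' C.T_meas]
  have := C.T_convex.addHaar_frontier volume
  rw [C.T_closed.frontier_eq, interior_T] at this
  have h2 : ∀ᵐ z, z ∉ C.T \ C.T0 := by rwa [ae_iff, show {a | ¬ a ∉ C.T \ C.T0} = C.T \ C.T0 by ext; simp]
  filter_upwards [h2] with z hz hzT
  by_contra h; exact hz ⟨hzT, h⟩
lemma T_uniq : UniqueDiffOn ℝ C.T :=
  uniqueDiffOn_convex C.T_convex (by rw [interior_T]; exact C.T0_nonempty)
lemma T_eq_hull : C.T = convexHull ℝ (range C.P) := by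
  apply subset_antisymm
  · intro z hz
    rw [← C.sP z]
    exact (convex_convexHull ℝ _).sum_mem (fun j _ => C.a_nonneg hz j) (C.s1 z)
      (fun j _ => subset_convexHull ℝ _ (mem_range_self j))
  · apply convexHull_min _ C.T_convex
    rintro _ ⟨k, rfl⟩; exact C.P_mem k
instance : IsFiniteMeasure (volume.restrict C.T) := ⟨by
  rw [Measure.restrict_apply_univ]; exact C.T_compact.measure_lt_top⟩

/-- foot point on side j -/
lemma foot : ∃ K : ℝ, 0 < K ∧ ∀ j, ∀ z ∈ C.T, ∃ y ∈ C.T, C.l j y = 0 ∧ ‖z - y‖ ≤ K * C.l j z := by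
  refine ⟨1 + ∑ j, ∑ k, ‖C.P k - C.P j‖ / C.h j, ?_, fun j z hz => ?_⟩
  · have : 0 ≤ ∑ j, ∑ k, ‖C.P k - C.P j‖ / C.h j :=
      Finset.sum_nonneg fun j _ => Finset.sum_nonneg fun k _ => div_nonneg (norm_nonneg _) (C.hpos j).le
    linarith
  obtain ⟨k, hk⟩ : ∃ k : Fin 3, k ≠ j := exists_ne j
  have hl (i : Fin 3) : C.l i (z + (C.l j z / C.h j) • (C.P k - C.P j)) =
      C.l i z + (C.l j z / C.h j) * (C.l i (C.P k) - C.l i (C.P j)) := by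
    rw [l_add, dot_smul, l_sub_l]
  refine ⟨z + (C.l j z / C.h j) • (C.P k - C.P j), fun i => ?_, ?_, ?_⟩
  · rw [hl]
    by_cases hi : i = j
    · subst hi
      rw [l_P_self, l_P_ne C hk.symm]
      have := (C.hpos i).ne'
      field_simp; simp
    · rw [l_P_ne C hi]
      have := C.a_nonneg hz j
      have := hz i
      have := C.P_mem k i
      simp only [sub_zero]
      positivity
  · rw [hl, l_P_self, l_P_ne C hk.symm]
    have := (C.hpos j).ne'
    field_simp; simp
  · rw [sub_add_cancel_left, norm_neg, norm_smul, Real.norm_of_nonneg (C.a_nonneg hz j)]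
    have h1 : ‖C.P k - C.P j‖ / C.h j ≤ ∑ j, ∑ k, ‖C.P k - C.P j‖ / C.h j := by
      refine le_trans ?_ (Finset.single_le_sum (f := fun j => ∑ k, ‖C.P k - C.P j‖ / C.h j)
        (fun j _ => Finset.sum_nonneg fun k _ => div_nonneg (norm_nonneg _) (C.hpos j).le) (Finset.mem_univ j))
      exact Finset.single_le_sum (f := fun k => ‖C.P k - C.P j‖ / C.h j)
        (fun k _ => div_nonneg (norm_nonneg _) (C.hpos j).le) (Finset.mem_univ k)
    calc C.l j z / C.h j * ‖C.P k - C.P j‖ = (‖C.P k - C.P j‖ / C.h j) * C.l j z := by ring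
      _ ≤ _ := mul_le_mul_of_nonneg_right (by linarith) (hz j)

lemma far : ∃ M : ℝ, 0 < M ∧ ∀ z ∈ C.T, ∀ i j k : Fin 3, i ≠ j → j ≠ k → k ≠ i →
    ‖z - C.P k‖ ≤ M * (C.l i z + C.l j z) := by
  set M0 := ∑ j, ∑ k, ‖C.P k - C.P j‖ / C.h j with hM0
  have hm (j k : Fin 3) : ‖C.P j - C.P k‖ / C.h j ≤ M0 := by
    rw [norm_sub_rev]
    refine le_trans ?_ (Finset.single_le_sum (f := fun j => ∑ k, ‖C.P k - C.P j‖ / C.h j)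
        (fun j _ => Finset.sum_nonneg fun k _ => div_nonneg (norm_nonneg _) (C.hpos j).le) (Finset.mem_univ j))
    exact Finset.single_le_sum (f := fun k => ‖C.P k - C.P j‖ / C.h j)
        (fun k _ => div_nonneg (norm_nonneg _) (C.hpos j).le) (Finset.mem_univ k)
  have hM0n : 0 ≤ M0 := by
    have := hm 0 0
    have h2 := div_nonneg (norm_nonneg (C.P 0 - C.P 0)) (C.hpos 0).le
    linarith
  refine ⟨1 + M0, by linarith, fun z hz i j k hij hjk hki => ?_⟩
  have h3 (f : Fin 3 → ℂ) : ∑ m, f m = f i + f j + f k := by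
    fin_cases i <;> fin_cases j <;> fin_cases k <;> simp [Fin.sum_univ_three] at hij hjk hki ⊢ <;> ring
  have h3' (f : Fin 3 → ℝ) : ∑ m, f m = f i + f j + f k := by
    fin_cases i <;> fin_cases j <;> fin_cases k <;> simp [Fin.sum_univ_three] at hij hjk hki ⊢ <;> ring
  have e : z - C.P k = (C.l i z / C.h i) • (C.P i - C.P k) + (C.l j z / C.h j) • (C.P j - C.P k) := by
    have e1 := C.sP z
    have e2 := C.s1 z
    rw [h3] at e1; rw [h3'] at e2
    have e3 : C.l k z / C.h k = 1 - C.l i z / C.h i - C.l j z / C.h j := by linarith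
    rw [e3] at e1
    conv_lhs => rw [← e1]
    module
  rw [e]
  refine (norm_add_le _ _).trans ?_
  rw [norm_smul, norm_smul, Real.norm_of_nonneg (C.a_nonneg hz i), Real.norm_of_nonneg (C.a_nonneg hz j)]
  have a1 := mul_le_mul_of_nonneg_right (hm i k) (hz i)
  have a2 := mul_le_mul_of_nonneg_right (hm j k) (hz j)
  have b1 := hz i
  have b2 := hz j
  calc _ = ‖C.P i - C.P k‖ / C.h i * C.l i z + ‖C.P j - C.P k‖ / C.h j * C.l j z := by ring
    _ ≤ _ := by nlinarith

lemma V_fin : C.V.Finite := finite_range _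
lemma V_ne : C.V.Nonempty := range_nonempty _
lemma dV_le (z : ℂ) (k : Fin 3) : C.dV z ≤ ‖z - C.P k‖ := by
  rw [← dist_eq_norm]; exact Metric.infDist_le_dist_of_mem (mem_range_self k)
lemma dV_pos {z : ℂ} : 0 < C.dV z ↔ z ∉ C.V :=
  (C.V_fin.isClosed.notMem_iff_infDist_pos C.V_ne).symm
lemma dV_nonneg (z : ℂ) : 0 ≤ C.dV z := Metric.infDist_nonneg
lemma dV_lip (y z : ℂ) : C.dV y ≤ C.dV z + ‖y - z‖ := by
  rw [← dist_eq_norm]; exact Metric.infDist_le_infDist_add_dist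
lemma dV_exists (z : ℂ) : ∃ k, C.dV z = ‖z - C.P k‖ := by
  obtain ⟨y, ⟨k, rfl⟩, hk⟩ := C.V_fin.isCompact.exists_infDist_eq_dist C.V_ne z
  exact ⟨k, by rw [← dist_eq_norm]; exact hk⟩

def SideBall (j : Fin 3) (p : ℂ) (ρ : ℝ) : Prop :=
  C.l j p = 0 ∧ ∀ k, k ≠ j → ∀ y ∈ Metric.ball p ρ, 0 < C.l k y

lemma cases_ball : ∃ c : ℝ, 0 < c ∧ c ≤ 1 / 8 ∧ ∀ z ∈ C.T, z ∉ C.V →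
    (Metric.ball z (c * C.dV z) ⊆ C.T) ∨
    ∃ j, C.SideBall j (z - C.l j z • C.ν j) (8 * c * C.dV z) ∧ C.l j z ≤ c * C.dV z := by
  obtain ⟨M, hM, hfar⟩ := C.far
  refine ⟨min (1/8) (1/(2 * M * 10)), by positivity, min_le_left _ _, fun z hz hzV => ?_⟩
  set c := min (1/8) (1/(2 * M * 10)) with hc
  have hc0 : 0 < c := by positivity
  have hcM : c * (2 * M * 10) ≤ 1 := by
    rw [← le_div_iff₀ (by positivity)]; exact min_le_right _ _
  have hd := C.dV_pos.2 hzV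
  by_cases hA : ∀ j, c * C.dV z ≤ C.l j z
  · left
    intro y hy j
    rw [Metric.mem_ball, dist_eq_norm] at hy
    have := C.l_le j z y
    rw [norm_sub_rev] at this
    linarith [hA j]
  · right
    push Not at hA
    obtain ⟨j, hj⟩ := hA
    refine ⟨j, ⟨?_, fun k hk y hy => ?_⟩, hj.le⟩
    · have := C.l_add j z (-(C.l j z) • C.ν j)
      rw [dot_smul, C.hν, neg_smul, ← sub_eq_add_neg] at this
      rw [this]; ring
    · obtain ⟨i, hij, hki⟩ : ∃ i : Fin 3, i ≠ j ∧ i ≠ k := by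
        fin_cases j <;> fin_cases k <;> simp at hk ⊢ <;> decide
      have h1 := hfar z hz j k i hk.symm hki.symm hij
      have h2 := C.dV_le z i
      have h3 := C.l_le k z y
      rw [Metric.mem_ball, dist_eq_norm] at hy
      have h4 : ‖z - y‖ ≤ ‖y - (z - C.l j z • C.ν j)‖ + C.l j z := by
        have := norm_add_le (y - (z - C.l j z • C.ν j)) (- (C.l j z • C.ν j))
        rw [norm_neg, norm_smul, C.nν, mul_one, Real.norm_of_nonneg (hz j)] at this
        rw [norm_sub_rev]
        convert this using 2; ring
      have h5 : C.dV z ≤ M * (C.l j z + C.l k z) := h2.trans h1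
      have h6 : c * (2 * M * 10) * C.dV z ≤ C.dV z := by nlinarith
      have h7 : M * (20 * c * C.dV z) ≤ M * (C.l j z + C.l k z) := by nlinarith
      have h8 := le_of_mul_le_mul_left h7 hM
      nlinarith [mul_pos hc0 hd]
end Cfg
end HS
end

noncomputable section
namespace HS
open Complex Filter Topology MeasureTheory
open scoped ContDiff Convolution

def th (x : ℝ) : ℝ := Real.smoothTransition x
lemma th_cd : ContDiff ℝ ∞ th := Real.smoothTransition.contDiff
lemma th_nonneg (x : ℝ) : 0 ≤ th x := Real.smoothTransition.nonneg x
lemma th_le (x : ℝ) : th x ≤ 1 := Real.smoothTransition.le_one x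
lemma th_abs (x : ℝ) : |th x| ≤ 1 := by rw [abs_of_nonneg (th_nonneg x)]; exact th_le x
lemma th_zero {x : ℝ} (h : x ≤ 0) : th x = 0 := Real.smoothTransition.zero_of_nonpos h
lemma th_one {x : ℝ} (h : 1 ≤ x) : th x = 1 := Real.smoothTransition.one_of_one_le h
lemma th_hd (x : ℝ) : HasDerivAt th (deriv th x) x :=
  (th_cd.differentiable (by simp) x).hasDerivAt
lemma th_deriv_neg {x : ℝ} (h : x < 0) : deriv th x = 0 := by
  have : th =ᶠ[𝓝 x] fun _ => 0 := by
    filter_upwards [Iio_mem_nhds h] with y hy; exact th_zero (le_of_lt hy)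
  rw [this.deriv_eq]; simp
lemma th_deriv_gt {x : ℝ} (h : 1 < x) : deriv th x = 0 := by
  have : th =ᶠ[𝓝 x] fun _ => 1 := by
    filter_upwards [Ioi_mem_nhds h] with y hy; exact th_one (le_of_lt hy)
  rw [this.deriv_eq]; simp
lemma th_deriv_bound : ∃ M : ℝ, 0 < M ∧ ∀ x, |deriv th x| ≤ M := by
  have hc : Continuous (deriv th) := th_cd.continuous_deriv (by simp)
  obtain ⟨M, hM⟩ := isCompact_Icc.exists_bound_of_continuousOn (s := Icc (0:ℝ) 1) hc.continuousOn
  refine ⟨max M 1, by positivity, fun x => ?_⟩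
  by_cases h : x ∈ Icc (0:ℝ) 1
  · exact (hM x h).trans (le_max_left _ _)
  · have : deriv th x = 0 := by
      rw [mem_Icc, not_and_or, not_le, not_le] at h
      rcases h with h | h
      · exact th_deriv_neg h
      · exact th_deriv_gt h
    rw [this, abs_zero]; positivity

lemma dd_th {g : ℂ → ℝ} {z : ℂ} (hg : DifferentiableAt ℝ g z) (v : ℂ) :
    dd v (fun y => th (g y)) z = deriv th (g z) * dd v g z := by
  unfold dd
  have := (th_hd (g z)).comp_hasFDerivAt z hg.hasFDerivAt
  have e := this.fderiv
  change fderiv ℝ (fun y => th (g y)) z = _ at e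
  rw [e]; simp

lemma lip_lineDeriv {K : NNReal} {F : ℂ → ℝ} (h : LipschitzWith K F) (v : ℂ) :
    ∀ᵐ z, lineDeriv ℝ F z v = dd v F z := by
  filter_upwards [h.ae_differentiableAt (μ := volume)] with z hz
  exact hz.lineDeriv_eq_fderiv

lemma dd_lip_bound {K : NNReal} {F : ℂ → ℝ} (h : LipschitzWith K F) (v z : ℂ) : |dd v F z| ≤ K * ‖v‖ := by
  unfold dd
  exact ((fderiv ℝ F z).le_opNorm v).trans (mul_le_mul_of_nonneg_right (norm_fderiv_le_of_lipschitz ℝ h) (norm_nonneg v))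

lemma dd_meas (F : ℂ → ℝ) (v : ℂ) : Measurable (dd v F) := measurable_fderiv_apply_const ℝ F v

namespace Cfg
variable (C : Cfg)

def eta (N : ℝ) (z : ℂ) : ℝ := th (N * C.l 0 z) * th (N * C.l 1 z) * th (N * C.l 2 z)

lemma eta_cd (N : ℝ) : ContDiff ℝ ∞ (C.eta N) := by
  have h (j : Fin 3) : ContDiff ℝ ∞ (fun z => th (N * C.l j z)) :=
    th_cd.comp (contDiff_const.mul (C.l_contDiff j))
  exact ((h 0).mul (h 1)).mul (h 2)

lemma eta_supp {N : ℝ} (hN : 0 < N) {z : ℂ} (hz : z ∉ C.T) : C.eta N z = 0 := by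
  have : ∃ j, C.l j z < 0 := by
    by_contra h; push Not at h; exact hz h
  obtain ⟨j, hj⟩ := this
  have h0 : th (N * C.l j z) = 0 := th_zero (by nlinarith)
  unfold eta
  fin_cases j <;> simp at h0 <;> simp [h0]

lemma eta_compact {N : ℝ} (hN : 0 < N) : HasCompactSupport (C.eta N) :=
  HasCompactSupport.intro C.T_compact fun _ hz => C.eta_supp hN hz

lemma dd_eta (N : ℝ) (v z : ℂ) : dd v (C.eta N) z =
    N * deriv th (N * C.l 0 z) * dot (C.ν 0) v * (th (N * C.l 1 z) * th (N * C.l 2 z)) +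
    N * deriv th (N * C.l 1 z) * dot (C.ν 1) v * (th (N * C.l 0 z) * th (N * C.l 2 z)) +
    N * deriv th (N * C.l 2 z) * dot (C.ν 2) v * (th (N * C.l 0 z) * th (N * C.l 1 z)) := by
  have h0 (j : Fin 3) : DifferentiableAt ℝ (fun z => N * C.l j z) z :=
    cdd (contDiff_const.mul (C.l_contDiff j)) z
  have h (j : Fin 3) : DifferentiableAt ℝ (fun z => th (N * C.l j z)) z :=
    cdd (th_cd.comp (contDiff_const.mul (C.l_contDiff j))) z
  have e (j : Fin 3) : dd v (fun z => th (N * C.l j z)) z = N * deriv th (N * C.l j z) * dot (C.ν j) v := by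
    rw [dd_th (h0 j), dd_const_mul (cdd (C.l_contDiff j) z), dd_l]; ring
  have e1 : dd v (C.eta N) z = dd v (fun z => (th (N * C.l 0 z) * th (N * C.l 1 z)) * th (N * C.l 2 z)) z := rfl
  rw [e1, dd_mul ((h 0).fun_mul (h 1)) (h 2), dd_mul (h 0) (h 1), e, e, e]
  ring

lemma eta_lim {z : ℂ} (hz : z ∈ C.T0) : ∀ᶠ n : ℕ in atTop, (∀ j, 1 < ((n : ℝ) + 1) * C.l j z) := by
  have h (j : Fin 3) : ∀ᶠ n : ℕ in atTop, 1 < ((n : ℝ) + 1) * C.l j z := by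
    have := tendsto_natCast_atTop_atTop (R := ℝ)
    have h1 : Tendsto (fun n : ℕ => ((n : ℝ) + 1) * C.l j z) atTop atTop :=
      Tendsto.atTop_mul_const (hz j) (tendsto_atTop_add_const_right _ _ this)
    exact h1.eventually_gt_atTop 1
  rw [eventually_all]; exact h

lemma ibp {K : NNReal} {F : ℂ → ℝ} (h : LipschitzWith K F) {η : ℂ → ℝ} (hη : ContDiff ℝ ∞ η)
    (hc : HasCompactSupport η) (v : ℂ) : ∫ z, η z * dd v F z = - ∫ z, dd v η z * F z := by
  obtain ⟨D, hD⟩ := hη.lipschitzWith_of_hasCompactSupport hc (by simp)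
  have e1 := h.integral_lineDeriv_mul_eq hD hc v (μ := volume)
  have e2 : ∫ z, η z * dd v F z = ∫ x, lineDeriv ℝ F x v * η x := by
    apply integral_congr_ae
    filter_upwards [lip_lineDeriv h v] with z hz
    rw [hz, mul_comm]
  rw [e2, e1, ← integral_neg]
  apply integral_congr_ae
  filter_upwards with z
  rw [(cdd hη z).lineDeriv_eq_fderiv, map_neg]
  simp [dd]

theorem div_lemma {K1 K2 : NNReal} {F1 F2 : ℂ → ℝ} (h1 : LipschitzWith K1 F1) (h2 : LipschitzWith K2 F2)
    (hn : ∀ j, ∀ z ∈ C.T, C.l j z = 0 → dot (C.ν j) ⟨F1 z, F2 z⟩ = 0) :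
    ∫ z in C.T, (dd 1 F1 z + dd I F2 z) = 0 := by
  obtain ⟨Kf, hKf, hfoot⟩ := C.foot
  obtain ⟨M, hM, hth⟩ := th_deriv_bound
  have hb : ∀ j, ∀ z ∈ C.T, |dot (C.ν j) ⟨F1 z, F2 z⟩| ≤ (K1 + K2) * Kf * C.l j z := by
    intro j z hz
    obtain ⟨y, hy, hly, hzy⟩ := hfoot j z hz
    have e : dot (C.ν j) ⟨F1 z, F2 z⟩ = (C.ν j).re * (F1 z - F1 y) + (C.ν j).im * (F2 z - F2 y) := by
      have := hn j y hy hly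
      simp only [dot] at this ⊢
      linarith
    have n1 : |(C.ν j).re| ≤ 1 := (Complex.abs_re_le_norm _).trans (C.nν j).le
    have n2 : |(C.ν j).im| ≤ 1 := (Complex.abs_im_le_norm _).trans (C.nν j).le
    have l1 : |F1 z - F1 y| ≤ K1 * ‖z - y‖ := by
      have := h1.dist_le_mul z y; rwa [Real.dist_eq, dist_eq_norm] at this
    have l2 : |F2 z - F2 y| ≤ K2 * ‖z - y‖ := by
      have := h2.dist_le_mul z y; rwa [Real.dist_eq, dist_eq_norm] at this
    rw [e]
    calc _ ≤ |(C.ν j).re| * |F1 z - F1 y| + |(C.ν j).im| * |F2 z - F2 y| := by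
            rw [← abs_mul, ← abs_mul]; exact abs_add_le _ _
      _ ≤ 1 * (K1 * ‖z - y‖) + 1 * (K2 * ‖z - y‖) := by gcongr
      _ = (K1 + K2) * ‖z - y‖ := by ring
      _ ≤ (K1 + K2) * (Kf * C.l j z) := by gcongr
      _ = _ := by ring
  let B : ℂ → ℝ := fun z => dd 1 F1 z + dd I F2 z
  have hB : Measurable B := (dd_meas F1 1).add (dd_meas F2 I)
  have hBb : ∀ z, |B z| ≤ K1 + K2 := fun z => by
    have a := dd_lip_bound h1 1 z
    have b := dd_lip_bound h2 I z
    simp at a b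
    exact (abs_add_le _ _).trans (add_le_add a b)
  let D : ℕ → ℂ → ℝ := fun n z => dd 1 (C.eta (n + 1)) z * F1 z + dd I (C.eta (n + 1)) z * F2 z
  have hDc (n : ℕ) : Continuous (D n) := by
    have a := (contDiff_dd (C.eta_cd (n + 1)) 1).continuous
    have b := (contDiff_dd (C.eta_cd (n + 1)) I).continuous
    have := h1.continuous
    have := h2.continuous
    fun_prop
  have key : ∀ n : ℕ, ∫ z in C.T, C.eta (n + 1) z * B z = - ∫ z in C.T, D n z := by
    intro n
    have hp : (0 : ℝ) < n + 1 := by positivity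
    have hs := C.eta_compact hp
    have i1 := ibp h1 (C.eta_cd (n + 1)) hs 1
    have i2 := ibp h2 (C.eta_cd (n + 1)) hs I
    have hbnd0 (G : ℂ → ℝ) (hG : Measurable G) (c : ℝ) (hGb : ∀ z, |G z| ≤ c) :
        Integrable (fun z => C.eta (n + 1) z * G z) := by
      have := ((C.eta_cd (n + 1)).continuous.integrable_of_hasCompactSupport hs (μ := volume))
      exact this.mul_bdd (c := c) hG.aestronglyMeasurable (Eventually.of_forall hGb)
    have j1 := hbnd0 _ (dd_meas F1 1) _ (dd_lip_bound h1 1)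
    have j2 := hbnd0 _ (dd_meas F2 I) _ (dd_lip_bound h2 I)
    have k1 : Integrable (fun z => dd 1 (C.eta (n + 1)) z * F1 z) :=
      Continuous.integrable_of_hasCompactSupport
        ((contDiff_dd (C.eta_cd (n + 1)) 1).continuous.mul h1.continuous) (dd_compact hs 1).mul_right
    have k2 : Integrable (fun z => dd I (C.eta (n + 1)) z * F2 z) :=
      Continuous.integrable_of_hasCompactSupport
        ((contDiff_dd (C.eta_cd (n + 1)) I).continuous.mul h2.continuous) (dd_compact hs I).mul_right
    have a1 : ∫ z in C.T, C.eta (n + 1) z * B z = ∫ z, (C.eta (n + 1) z * dd 1 F1 z + C.eta (n + 1) z * dd I F2 z) := by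
      rw [setIntegral_eq_integral_of_forall_compl_eq_zero]
      · congr 1; ext z; simp only [B]; ring
      · intro z hz; rw [C.eta_supp hp hz, zero_mul]
    have a2 : ∫ z in C.T, D n z = ∫ z, (dd 1 (C.eta (n + 1)) z * F1 z + dd I (C.eta (n + 1)) z * F2 z) := by
      rw [setIntegral_eq_integral_of_forall_compl_eq_zero]
      intro z hz
      have : C.eta (n + 1) =ᶠ[𝓝 z] fun _ => 0 := by
        filter_upwards [C.T_closed.isOpen_compl.mem_nhds hz] with y hy
        exact C.eta_supp hp hy
      simp only [D]
      rw [dd_congr this, dd_congr this, dd_const, dd_const]; ring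
    rw [a1, a2, integral_add j1 j2, integral_add k1 k2, i1, i2]; ring
  have lim1 : Tendsto (fun n : ℕ => ∫ z in C.T, C.eta (n + 1) z * B z) atTop (𝓝 (∫ z in C.T, B z)) := by
    apply tendsto_integral_of_dominated_convergence (fun _ => (K1 : ℝ) + K2)
    · intro n; exact ((C.eta_cd (n + 1)).continuous.measurable.mul hB).aestronglyMeasurable
    · exact integrable_const _
    · intro n; filter_upwards with z
      rw [Real.norm_eq_abs, abs_mul]
      have e1 : |C.eta (n + 1) z| ≤ 1 := by
        unfold eta; rw [abs_mul, abs_mul]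
        exact mul_le_one₀ (mul_le_one₀ (th_abs _) (abs_nonneg _) (th_abs _)) (abs_nonneg _) (th_abs _)
      have := hBb z
      calc _ ≤ 1 * |B z| := by gcongr
        _ ≤ _ := by linarith
    · filter_upwards [C.T_ae] with z hz
      apply tendsto_const_nhds.congr'
      filter_upwards [C.eta_lim hz] with n hn
      unfold eta
      rw [th_one (hn 0).le, th_one (hn 1).le, th_one (hn 2).le]; ring
  have lim2 : Tendsto (fun n : ℕ => ∫ z in C.T, D n z) atTop (𝓝 (∫ z in C.T, (0:ℝ))) := by
    have hDe : ∀ n z, D n z = (n + 1) * deriv th ((n + 1) * C.l 0 z) * dot (C.ν 0) ⟨F1 z, F2 z⟩ * (th ((n + 1) * C.l 1 z) * th ((n + 1) * C.l 2 z)) +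
      (n + 1) * deriv th ((n + 1) * C.l 1 z) * dot (C.ν 1) ⟨F1 z, F2 z⟩ * (th ((n + 1) * C.l 0 z) * th ((n + 1) * C.l 2 z)) +
      (n + 1) * deriv th ((n + 1) * C.l 2 z) * dot (C.ν 2) ⟨F1 z, F2 z⟩ * (th ((n + 1) * C.l 0 z) * th ((n + 1) * C.l 1 z)) := by
      intro n z
      simp only [D]
      rw [dd_eta, dd_eta]
      simp only [dot, one_re, one_im, I_re, I_im]
      ring
    apply tendsto_integral_of_dominated_convergence (fun _ => 3 * (M * ((K1 + K2) * Kf)))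
    · intro n; exact (hDc n).aestronglyMeasurable
    · exact integrable_const _
    · intro n
      rw [ae_restrict_iff' C.T_meas]
      filter_upwards with z hz
      have hp : (0 : ℝ) < n + 1 := by positivity
      have t (j a b : Fin 3) : |(n + 1) * deriv th ((n + 1) * C.l j z) * dot (C.ν j) ⟨F1 z, F2 z⟩ * (th ((n + 1) * C.l a z) * th ((n + 1) * C.l b z))| ≤ M * ((K1 + K2) * Kf) := by
        by_cases h : 1 < (n + 1) * C.l j z
        · rw [th_deriv_gt h]; simp; positivity
        · push Not at h
          rw [abs_mul]
          have e1 : |th ((n + 1) * C.l a z) * th ((n + 1) * C.l b z)| ≤ 1 := by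
            rw [abs_mul]; exact mul_le_one₀ (th_abs _) (abs_nonneg _) (th_abs _)
          calc _ ≤ |(n + 1) * deriv th ((n + 1) * C.l j z) * dot (C.ν j) ⟨F1 z, F2 z⟩| * 1 := by gcongr
            _ = (n + 1) * |deriv th ((n + 1) * C.l j z)| * |dot (C.ν j) ⟨F1 z, F2 z⟩| := by
              rw [mul_one, abs_mul, abs_mul, abs_of_pos hp]
            _ ≤ (n + 1) * M * ((K1 + K2) * Kf * C.l j z) := by
              gcongr
              · exact hth _
              · exact hb j z hz
            _ = M * ((K1 + K2) * Kf) * ((n + 1) * C.l j z) := by ring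
            _ ≤ M * ((K1 + K2) * Kf) * 1 := by gcongr
            _ = _ := by ring
      rw [Real.norm_eq_abs, hDe]
      refine (abs_add_le _ _).trans ?_
      have := abs_add_le ((n + 1) * deriv th ((n + 1) * C.l 0 z) * dot (C.ν 0) ⟨F1 z, F2 z⟩ * (th ((n + 1) * C.l 1 z) * th ((n + 1) * C.l 2 z)))
        ((n + 1) * deriv th ((n + 1) * C.l 1 z) * dot (C.ν 1) ⟨F1 z, F2 z⟩ * (th ((n + 1) * C.l 0 z) * th ((n + 1) * C.l 2 z)))
      have := t 0 1 2
      have := t 1 0 2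
      have := t 2 0 1
      linarith
    · filter_upwards [C.T_ae] with z hz
      apply tendsto_const_nhds.congr'
      filter_upwards [C.eta_lim hz] with n hn
      rw [hDe, th_deriv_gt (hn 0), th_deriv_gt (hn 1), th_deriv_gt (hn 2)]; ring
  have lim3 : Tendsto (fun n : ℕ => ∫ z in C.T, C.eta (n + 1) z * B z) atTop (𝓝 (- ∫ z in C.T, (0:ℝ))) := by
    simp_rw [key]; exact lim2.neg
  have := tendsto_nhds_unique lim1 lim3
  simpa using this

theorem div_lemma_on {K1 K2 : NNReal} {F1 F2 : ℂ → ℝ} (h1 : LipschitzOnWith K1 F1 C.T) (h2 : LipschitzOnWith K2 F2 C.T)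
    (hn : ∀ j, ∀ z ∈ C.T, C.l j z = 0 → dot (C.ν j) ⟨F1 z, F2 z⟩ = 0) :
    ∫ z in C.T, (dd 1 F1 z + dd I F2 z) = 0 := by
  obtain ⟨G1, g1, e1⟩ := h1.extend_real
  obtain ⟨G2, g2, e2⟩ := h2.extend_real
  have := C.div_lemma g1 g2 (fun j z hz hl => by rw [← e1 hz, ← e2 hz]; exact hn j z hz hl)
  rw [← this]
  apply integral_congr_ae
  filter_upwards [C.T_ae] with z hz
  have hT := C.T0_open.mem_nhds hz
  rw [dd_congr (f := F1) (g := G1) (by filter_upwards [hT] with y hy using e1 (C.T0_sub hy)),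
    dd_congr (f := F2) (g := G2) (by filter_upwards [hT] with y hy using e2 (C.T0_sub hy))]
end Cfg
end HS
end

noncomputable section
namespace HS
open Complex Filter Topology MeasureTheory
open scoped ContDiff Convolution

namespace Cfg
variable (C : Cfg)

lemma Lap_const (c : ℝ) (z : ℂ) : Lap (fun _ => c) z = 0 := by
  have (v : ℂ) : dd v (fun _ => c) = fun _ => 0 := by ext y; exact dd_const c v y
  unfold Lap; rw [this, this, dd_const, dd_const]; ring

def S (j : Fin 3) (z : ℂ) : ℂ := z - (2 * C.l j z) • C.ν j
def Sl (j : Fin 3) (v : ℂ) : ℂ := v - (2 * dot (C.ν j) v) • C.ν j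

lemma l_S (j : Fin 3) (z : ℂ) : C.l j (C.S j z) = - C.l j z := by
  unfold S
  rw [sub_eq_add_neg, ← neg_smul, l_add, dot_smul, C.hν]; ring
lemma S_S (j : Fin 3) (z : ℂ) : C.S j (C.S j z) = z := by
  have := C.l_S j z
  conv_lhs => unfold S
  rw [show z - (2 * C.l j z) • C.ν j = C.S j z from rfl, this]; unfold S; module
lemma S_sub (j : Fin 3) (x y : ℂ) : C.S j x - C.S j y = C.Sl j (x - y) := by
  unfold S Sl
  rw [← l_sub_l]; module
lemma Sl_norm (j : Fin 3) (v : ℂ) : ‖C.Sl j v‖ = ‖v‖ := by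
  have : ‖C.Sl j v‖ ^ 2 = ‖v‖ ^ 2 := by
    rw [← dot_self, ← dot_self]
    have := C.hν j
    unfold Sl
    simp only [dot, Complex.sub_re, Complex.sub_im, Complex.smul_re, Complex.smul_im, smul_eq_mul] at this ⊢
    linear_combination 4 * ((C.ν j).re * v.re + (C.ν j).im * v.im) ^ 2 * this
  exact (pow_left_inj₀ (norm_nonneg _) (norm_nonneg _) two_ne_zero).1 this
lemma S_norm (j : Fin 3) (x y : ℂ) : ‖C.S j x - C.S j y‖ = ‖x - y‖ := by rw [S_sub, Sl_norm]
lemma S_fix {j : Fin 3} {p : ℂ} (h : C.l j p = 0) : C.S j p = p := by simp [S, h]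
lemma S_ball {j : Fin 3} {p : ℂ} (h : C.l j p = 0) {z : ℂ} {ρ : ℝ} (hz : z ∈ Metric.ball p ρ) :
    C.S j z ∈ Metric.ball p ρ := by
  rw [Metric.mem_ball, dist_eq_norm] at *
  rwa [← C.S_fix h, S_norm, ]
lemma S_isom (j : Fin 3) : Isometry (C.S j) := Isometry.of_dist_eq fun x y => by
  rw [dist_eq_norm, dist_eq_norm, S_norm]
def Se (j : Fin 3) : ℂ ≃ₜ ℂ where
  toFun := C.S j
  invFun := C.S j
  left_inv := C.S_S j
  right_inv := C.S_S j
  continuous_toFun := (C.S_isom j).continuous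
  continuous_invFun := (C.S_isom j).continuous
lemma S_emb (j : Fin 3) : MeasurableEmbedding (C.S j) := (C.Se j).measurableEmbedding
lemma S_mp (j : Fin 3) : MeasurePreserving (C.S j) := by
  have e : C.S j = fun z => (-(2 * C.c j) • C.ν j) + (-(C.ν j) ^ 2) * (Complex.conjLIE z) := by
    ext z
    unfold S l
    have := C.hν j
    apply Complex.ext
    · simp [dot, pow_two] at this ⊢; linear_combination (-z.re) * this
    · simp [dot, pow_two] at this ⊢; linear_combination (-z.im) * this
  have h1 : MeasurePreserving (fun z : ℂ => Complex.conjLIE z) := Complex.conjLIE.measurePreserving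
  have hn : ‖-(C.ν j) ^ 2‖ = 1 := by rw [norm_neg, norm_pow, C.nν, one_pow]
  have h2 : MeasurePreserving (fun z : ℂ => (-(C.ν j) ^ 2) * z) := by
    have := (rotation (⟨-(C.ν j) ^ 2, mem_sphere_zero_iff_norm.2 hn⟩ : Circle)).measurePreserving
    exact this
  have h3 := measurePreserving_add_left (volume : Measure ℂ) (-(2 * C.c j) • C.ν j)
  rw [e]
  exact h3.comp (h2.comp h1)
lemma int_S (j : Fin 3) (f : ℂ → ℝ) : ∫ z, f (C.S j z) = ∫ z, f z :=
  (C.S_mp j).integral_comp (C.S_emb j) f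

lemma S_cd (j : Fin 3) : ContDiff ℝ ∞ (C.S j) := by
  unfold S
  have := C.l_contDiff j
  fun_prop
lemma S_hasF (j : Fin 3) (z v : ℂ) : fderiv ℝ (C.S j) z v = C.Sl j v := by
  have h := (cdd (C.l_contDiff j) z).hasFDerivAt
  have h2 := (hasFDerivAt_id z).fun_sub ((h.const_mul 2).smul_const (C.ν j))
  have e := h2.fderiv
  change fderiv ℝ (C.S j) z = _ at e
  rw [e]
  have := C.dd_l j v z
  unfold dd at this
  simp [Sl, this]
lemma dd_S {f : ℂ → ℝ} (j : Fin 3) {z : ℂ} (hf : DifferentiableAt ℝ f (C.S j z)) (v : ℂ) :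
    dd v (fun y => f (C.S j y)) z = dd (C.Sl j v) f (C.S j z) := by
  unfold dd
  have hS : DifferentiableAt ℝ (C.S j) z := (C.S_cd j).differentiable (by simp) z
  have := (hf.hasFDerivAt.comp z hS.hasFDerivAt).fderiv
  change fderiv ℝ (fun y => f (C.S j y)) z = _ at this
  rw [this]; simp [S_hasF]
lemma Sl_τ (j : Fin 3) : C.Sl j (C.τ j) = C.τ j := by unfold Sl; rw [dot_comm, C.hτν]; simp
lemma Sl_ν (j : Fin 3) : C.Sl j (C.ν j) = - C.ν j := by unfold Sl; rw [C.hν]; module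
lemma dd_neg (v : ℂ) (f : ℂ → ℝ) (z : ℂ) : dd (-v) f z = - dd v f z := by simp [dd]
lemma Lap_S {f : ℂ → ℝ} (hf : ContDiff ℝ ∞ f) (j : Fin 3) (z : ℂ) :
    Lap (fun y => f (C.S j y)) z = Lap f (C.S j z) := by
  have hfs : ContDiff ℝ ∞ (fun y => f (C.S j y)) := hf.comp (C.S_cd j)
  rw [Lap_rot hfs.contDiffAt (C.hτ j) (C.hν j) (C.hτν j), Lap_rot hf.contDiffAt (C.hτ j) (C.hν j) (C.hτν j)]
  have e1 : dd (C.τ j) (fun y => f (C.S j y)) = fun y => dd (C.τ j) f (C.S j y) := by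
    ext y; rw [dd_S C j (cdd hf _), Sl_τ]
  have e2 : dd (C.ν j) (fun y => f (C.S j y)) = fun y => - dd (C.ν j) f (C.S j y) := by
    ext y; rw [dd_S C j (cdd hf _), Sl_ν, dd_neg]
  have e3 : dd (C.ν j) (fun y => - dd (C.ν j) f (C.S j y)) z = - dd (C.ν j) (fun y => dd (C.ν j) f (C.S j y)) z := by
    unfold dd; rw [fderiv_fun_neg]; simp
  rw [e1, e2, e3, dd_S C j (cdd (contDiff_dd hf _) _), dd_S C j (cdd (contDiff_dd hf _) _), Sl_τ, Sl_ν, dd_neg]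
  ring

def Pat (lam : ℝ) (g : ℂ → ℝ) (p : ℂ) (ρ : ℝ) (G : ℂ → ℝ) : Prop :=
  ContDiff ℝ ∞ G ∧ (∀ z ∈ Metric.ball p ρ, Lap G z = - lam * G z) ∧
    ∀ z ∈ C.T, z ∈ Metric.ball p ρ → G z = g z
def PatA (lam : ℝ) (g : ℂ → ℝ) (p : ℂ) (ρ : ℝ) (G : ℂ → ℝ) : Prop :=
  ContDiff ℝ ∞ G ∧ (∀ z ∈ Metric.ball p ρ, Lap G z = - lam * G z) ∧
    ∀ᵐ z, z ∈ C.T → z ∈ Metric.ball p ρ → G z = g z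

lemma side_mem {j : Fin 3} {p : ℂ} {R : ℝ} (h : C.SideBall j p R) {z : ℂ} (hz : z ∈ Metric.ball p R)
    (hl : 0 ≤ C.l j z) : z ∈ C.T := by
  intro k
  by_cases hk : k = j
  · rw [hk]; exact hl
  · exact (h.2 k hk z hz).le

lemma weak_int {lam R : ℝ} {g : ℂ → ℝ} {p : ℂ} (hl : 0 ≤ lam) (hR : 0 < R) (hlR : lam * R ^ 2 ≤ 1)
    (hb : Metric.ball p R ⊆ C.T) (hg : IntegrableOn g C.T)
    (h : ∀ φ : ℂ → ℝ, ContDiff ℝ ∞ φ → tsupport φ ⊆ Metric.ball p R →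
      ∫ y in C.T, g y * (Lap φ y + lam * φ y) = 0) : ∃ G, C.PatA lam g p (R / 2) G := by
  have hg' : Integrable (C.T.indicator g) := (integrable_indicator_iff C.T_meas).2 hg
  obtain ⟨a, b, c⟩ := weyl hg' hl hR hlR (p := p) (fun φ hφ hs => by
    rw [← h φ hφ hs, ← integral_indicator C.T_meas]
    congr 1; ext y
    by_cases hy : y ∈ C.T <;> simp [hy])
  refine ⟨_, a, b, ?_⟩
  filter_upwards [c] with z hz hzT hzb
  rw [hz hzb, indicator_of_mem hzT]

lemma weak_side {lam R s : ℝ} {g : ℂ → ℝ} {p : ℂ} {j : Fin 3} (hl : 0 ≤ lam) (hR : 0 < R) (hlR : lam * R ^ 2 ≤ 1)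
    (hs : s ^ 2 = 1) (hb : C.SideBall j p R) (hg : IntegrableOn g C.T)
    (h : ∀ φ : ℂ → ℝ, ContDiff ℝ ∞ φ → tsupport φ ⊆ Metric.ball p R → (∀ z, φ (C.S j z) = s * φ z) →
      ∫ y in C.T, g y * (Lap φ y + lam * φ y) = 0) :
    ∃ G, C.PatA lam g p (R / 2) G ∧ ∀ z, G (C.S j z) = s * G z := by
  set g0 : ℂ → ℝ := (C.T ∩ Metric.ball p R).indicator g with hg0
  have mTb : MeasurableSet (C.T ∩ Metric.ball p R) := C.T_meas.inter measurableSet_ball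
  have ig0 : Integrable g0 := (integrable_indicator_iff mTb).2 (hg.mono_set inter_subset_left)
  have igS : Integrable (fun z => g0 (C.S j z)) := ((C.S_mp j).integrable_comp_emb (C.S_emb j)).2 ig0
  set gh : ℂ → ℝ := fun z => g0 z + s * g0 (C.S j z) with hgh
  have igh : Integrable gh := ig0.add (igS.const_mul s)
  have ghS : ∀ z, gh (C.S j z) = s * gh z := by
    intro z; simp only [hgh]; rw [S_S]; linear_combination (- g0 (C.S j z)) * hs
  have hw : ∀ φ : ℂ → ℝ, ContDiff ℝ ∞ φ → tsupport φ ⊆ Metric.ball p R →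
      ∫ y, gh y * (Lap φ y + lam * φ y) = 0 := by
    intro φ hφ hsup
    have hφc : HasCompactSupport φ :=
      HasCompactSupport.of_support_subset_isCompact (isCompact_closedBall p R)
        ((subset_tsupport φ).trans (hsup.trans Metric.ball_subset_closedBall))
    set ψ : ℂ → ℝ := fun y => Lap φ y + lam * φ y with hψ
    have cψ : Continuous ψ := by
      have a := (contDiff_dd (contDiff_dd hφ 1) 1).continuous
      have b := (contDiff_dd (contDiff_dd hφ I) I).continuous
      have c := hφ.continuous
      exact (a.add b).add (continuous_const.mul c)
    have sψ : ∀ y, y ∉ Metric.ball p R → ψ y = 0 := by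
      intro y hy
      have : φ =ᶠ[𝓝 y] fun _ => 0 := by
        have := (isClosed_tsupport φ).isOpen_compl.mem_nhds (fun h' => hy (hsup h'))
        filter_upwards [this] with x hx
        exact image_eq_zero_of_notMem_tsupport hx
      simp only [hψ]
      rw [Lap_congr this, this.eq_of_nhds, Lap_const]; ring
    have hbd : ∃ c, ∀ y, ‖ψ y‖ ≤ c := by
      have : HasCompactSupport ψ := HasCompactSupport.intro (isCompact_closedBall p R)
        (fun y hy => sψ y (fun h' => hy (Metric.ball_subset_closedBall h')))
      exact this.exists_bound_of_continuous cψ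
    obtain ⟨cb, hcb⟩ := hbd
    have i1 : Integrable (fun y => g0 y * ψ y) := ig0.mul_bdd cψ.aestronglyMeasurable (Eventually.of_forall hcb)
    have i2 : Integrable (fun y => s * g0 (C.S j y) * ψ y) :=
      (igS.const_mul s).mul_bdd cψ.aestronglyMeasurable (Eventually.of_forall hcb)
    have i3 : Integrable (fun y => g0 y * (s * ψ (C.S j y))) :=
      ig0.mul_bdd (c := |s| * cb) (continuous_const.mul (cψ.comp (C.S_isom j).continuous)).aestronglyMeasurable
        (Eventually.of_forall fun y => by
          rw [norm_mul, Real.norm_eq_abs s]; exact mul_le_mul_of_nonneg_left (hcb _) (abs_nonneg _))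
    have e1 : ∫ y, gh y * ψ y = ∫ y, g0 y * (ψ y + s * ψ (C.S j y)) := by
      have a1 : ∫ y, gh y * ψ y = ∫ y, (g0 y * ψ y + s * g0 (C.S j y) * ψ y) := by
        congr 1; ext y; simp only [hgh]; ring
      have a2 : ∫ y, g0 y * (ψ y + s * ψ (C.S j y)) = ∫ y, (g0 y * ψ y + g0 y * (s * ψ (C.S j y))) := by
        congr 1; ext y; ring
      rw [a1, a2, integral_add i1 i2, integral_add i1 i3]
      congr 1
      rw [← C.int_S j]
      congr 1; ext y; rw [S_S]; ring
    set Φ : ℂ → ℝ := fun y => φ y + s * φ (C.S j y) with hΦ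
    have hφS : ContDiff ℝ ∞ (fun y => φ (C.S j y)) := hφ.comp (C.S_cd j)
    have hΦc : ContDiff ℝ ∞ Φ := hφ.add (contDiff_const.mul hφS)
    have hΦL : ∀ y, Lap Φ y + lam * Φ y = ψ y + s * ψ (C.S j y) := by
      intro y
      have : Lap Φ y = Lap φ y + s * Lap φ (C.S j y) := by
        have := Lap_comb (z := y) hφ.contDiffAt hφS.contDiffAt 1 s
        rw [Lap_S C hφ] at this
        rw [one_mul] at this
        rw [← this]; congr 1; ext y; simp [hΦ]
      rw [this]; simp only [hΦ, hψ]; ring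
    have hΦs : tsupport Φ ⊆ Metric.ball p R := by
      have k1 : IsCompact (tsupport φ ∪ (C.S j) ⁻¹' (tsupport φ)) := by
        apply IsCompact.union hφc
        exact (C.Se j).isCompact_preimage.2 hφc
      refine (closure_minimal ?_ k1.isClosed).trans (union_subset hsup ?_)
      · intro y hy
        by_contra hn
        rw [mem_union, not_or] at hn
        apply hy
        simp only [hΦ]
        rw [image_eq_zero_of_notMem_tsupport hn.1, image_eq_zero_of_notMem_tsupport (x := C.S j y) hn.2]; ring
      · intro y hy
        have := C.S_ball hb.1 (hsup hy)
        rwa [S_S] at this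
    have hfin := h Φ hΦc hΦs (fun z => by simp only [hΦ]; rw [S_S]; linear_combination (-φ (C.S j z)) * hs)
    change ∫ y, gh y * ψ y = 0
    rw [e1, ← hfin, ← integral_indicator C.T_meas]
    congr 1; ext y
    rw [← hΦL]
    by_cases hy : y ∈ C.T
    · by_cases hyb : y ∈ Metric.ball p R
      · simp [hg0, hy, hyb]
      · rw [indicator_of_mem hy, hΦL, sψ y hyb, sψ _ (fun h' => hyb (by have := C.S_ball hb.1 h'; rwa [S_S] at this))]
        ring
    · simp [hg0, hy]
  obtain ⟨a, b, c⟩ := weyl igh hl hR hlR hw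
  refine ⟨_, ⟨a, b, ?_⟩, ?_⟩
  · have hT := C.T_ae
    rw [ae_restrict_iff' C.T_meas] at hT
    filter_upwards [c, hT] with z hz hzT0 hzT hzb
    rw [hz hzb]
    have hzb' : z ∈ Metric.ball p R := Metric.ball_subset_ball (by linarith) hzb
    have h0 := hzT0 hzT j
    have : C.S j z ∉ C.T := fun h' => by
      have := h' j; rw [l_S] at this; linarith
    simp [hgh, hg0, hzT, hzb', this]
  · intro z
    have : cv (ker (R / 4)) gh (C.S j z) = s * cv (ker (R / 4)) gh z := by
      unfold cv
      rw [← C.int_S j, ← integral_const_mul]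
      congr 1; ext y
      rw [ghS, ker_norm (C.S_norm j z y)]; ring
    simp only [this]; ring

/-- continuous functions agreeing a.e. on T near p agree there -/
lemma ae_eq_on {G G' : ℂ → ℝ} (hG : Continuous G) (hG' : Continuous G') {p : ℂ} {ρ : ℝ}
    (h : ∀ᵐ z, z ∈ C.T → z ∈ Metric.ball p ρ → G z = G' z) :
    ∀ z ∈ C.T, z ∈ Metric.ball p ρ → G z = G' z := by
  have hcl : IsClosed {z | G z = G' z} := isClosed_eq hG hG'
  have h1 : C.T0 ∩ Metric.ball p ρ ⊆ {z | G z = G' z} := by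
    intro z hz
    by_contra hne
    have ho : IsOpen (C.T0 ∩ Metric.ball p ρ ∩ {z | G z = G' z}ᶜ) :=
      (C.T0_open.inter Metric.isOpen_ball).inter hcl.isOpen_compl
    have hpos := ho.measure_pos volume ⟨z, hz, hne⟩
    have h0 : volume (C.T0 ∩ Metric.ball p ρ ∩ {z | G z = G' z}ᶜ) = 0 := by
      refine measure_mono_null ?_ (ae_iff.1 h)
      rintro y ⟨⟨y1, y2⟩, y3⟩ hy
      exact y3 (hy (C.T0_sub y1) y2)
    rw [h0] at hpos; exact lt_irrefl _ hpos
  have h2 : C.T ⊆ closure C.T0 := by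
    rw [← interior_T, C.T_convex.closure_interior_eq_closure_of_nonempty_interior
      (by rw [interior_T]; exact C.T0_nonempty)]
    exact subset_closure
  intro z hz hzb
  have : z ∈ closure (C.T0 ∩ Metric.ball p ρ) := by
    rw [inter_comm]
    exact Metric.isOpen_ball.inter_closure ⟨hzb, h2 hz⟩
  exact closure_minimal h1 hcl this

end Cfg
end HS
end

noncomputable section
namespace HS
open Complex Filter Topology MeasureTheory
open scoped ContDiff Convolution

namespace Cfg
variable (C : Cfg)

def gr (v : ℂ) (g : ℂ → ℝ) (z : ℂ) : ℝ := fderivWithin ℝ g C.T z v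

variable {C}

lemma gr_lin (v : ℂ) (g : ℂ → ℝ) (z : ℂ) : C.gr v g z = v.re * C.gr 1 g z + v.im * C.gr I g z :=
  lin_apply _ v

lemma Pat.mono {lam : ℝ} {g G : ℂ → ℝ} {p q : ℂ} {ρ r : ℝ} (h : C.Pat lam g p ρ G)
    (hs : Metric.ball q r ⊆ Metric.ball p ρ) : C.Pat lam g q r G :=
  ⟨h.1, fun z hz => h.2.1 z (hs hz), fun z hz hz' => h.2.2 z hz (hs hz')⟩

lemma Pat.gr_eq {lam : ℝ} {g G : ℂ → ℝ} {p : ℂ} {ρ : ℝ} (h : C.Pat lam g p ρ G) {z : ℂ} (hz : z ∈ C.T)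
    (hzb : z ∈ Metric.ball p ρ) : HasFDerivWithinAt g (fderiv ℝ G z) C.T z ∧ ∀ v, C.gr v g z = dd v G z := by
  have h1 : HasFDerivWithinAt G (fderiv ℝ G z) C.T z := (cdd h.1 z).hasFDerivAt.hasFDerivWithinAt
  have h2 : HasFDerivWithinAt g (fderiv ℝ G z) C.T z := by
    apply h1.congr_of_eventuallyEq _ (h.2.2 z hz hzb).symm
    filter_upwards [self_mem_nhdsWithin, mem_nhdsWithin_of_mem_nhds (Metric.isOpen_ball.mem_nhds hzb)] with y hy hyb
    exact (h.2.2 y hy hyb).symm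
  exact ⟨h2, fun v => by unfold gr dd; rw [h2.fderivWithin (C.T_uniq z hz)]⟩

lemma gr_eq_dd {z : ℂ} (hz : z ∈ C.T0) (v : ℂ) (g : ℂ → ℝ) : C.gr v g z = dd v g z := by
  unfold gr dd
  rw [fderivWithin_of_mem_nhds (mem_of_superset (C.T0_open.mem_nhds hz) C.T0_sub)]

lemma helm_dd_at {G : ℂ → ℝ} (hG : ContDiff ℝ ∞ G) {lam ρ : ℝ} {p : ℂ}
    (h : ∀ z ∈ Metric.ball p ρ, Lap G z = - lam * G z) (v : ℂ) :
    ∀ z ∈ Metric.ball p ρ, Lap (dd v G) z = - lam * dd v G z := by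
  intro z hz
  rw [Lap_dd hG.contDiffAt]
  have : Lap G =ᶠ[𝓝 z] fun y => - lam * G y := by
    filter_upwards [Metric.isOpen_ball.mem_nhds hz] with y hy using h y hy
  rw [dd_congr this, dd_const_mul (cdd hG z)]

lemma Pat.gr {lam : ℝ} {g G : ℂ → ℝ} {p : ℂ} {ρ : ℝ} (h : C.Pat lam g p ρ G) (v : ℂ) :
    C.Pat lam (C.gr v g) p ρ (dd v G) :=
  ⟨contDiff_dd h.1 v, helm_dd_at h.1 h.2.1 v, fun _ hz hzb => ((h.gr_eq hz hzb).2 v).symm⟩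

lemma Pat.comb {lam : ℝ} {g G g' G' : ℂ → ℝ} {p : ℂ} {ρ : ℝ} (h : C.Pat lam g p ρ G) (h' : C.Pat lam g' p ρ G') (a b : ℝ) :
    C.Pat lam (fun z => a * g z + b * g' z) p ρ (fun z => a * G z + b * G' z) := by
  refine ⟨(contDiff_const.mul h.1).add (contDiff_const.mul h'.1), fun z hz => ?_, fun z hz hzb => ?_⟩
  · rw [Lap_comb h.1.contDiffAt h'.1.contDiffAt, h.2.1 z hz, h'.2.1 z hz]; ring
  · simp only; rw [h.2.2 z hz hzb, h'.2.2 z hz hzb]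

lemma Pat.congr {lam : ℝ} {g g' G : ℂ → ℝ} {p : ℂ} {ρ : ℝ} (h : C.Pat lam g p ρ G)
    (hg : ∀ z ∈ C.T, z ∈ Metric.ball p ρ → g z = g' z) : C.Pat lam g' p ρ G :=
  ⟨h.1, h.2.1, fun z hz hzb => (h.2.2 z hz hzb).trans (hg z hz hzb)⟩

variable (C)
def ISol (lam : ℝ) (g : ℂ → ℝ) : Prop := ∀ p R, 0 < R → lam * R ^ 2 ≤ 1 → Metric.ball p R ⊆ C.T →
  ∃ G, C.Pat lam g p (R / 2) G
def SSol (lam : ℝ) (j : Fin 3) (s : ℝ) (g : ℂ → ℝ) : Prop := ∀ p R, 0 < R → lam * R ^ 2 ≤ 1 → C.SideBall j p R →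
  ∃ G, C.Pat lam g p (R / 2) G ∧ ∀ z, G (C.S j z) = s * G z
def Reg (lam : ℝ) (g : ℂ → ℝ) : Prop := ∀ z ∈ C.T, z ∉ C.V → ∃ ρ > 0, ∃ G, C.Pat lam g z ρ G
variable {C}

lemma ISol.gr {lam : ℝ} {g : ℂ → ℝ} (h : C.ISol lam g) (v : ℂ) : C.ISol lam (C.gr v g) := by
  intro p R hR hl hb
  obtain ⟨G, hG⟩ := h p R hR hl hb
  exact ⟨_, hG.gr v⟩
lemma ISol.comb {lam : ℝ} {g g' : ℂ → ℝ} (h : C.ISol lam g) (h' : C.ISol lam g') (a b : ℝ) :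
    C.ISol lam (fun z => a * g z + b * g' z) := by
  intro p R hR hl hb
  obtain ⟨G, hG⟩ := h p R hR hl hb
  obtain ⟨G', hG'⟩ := h' p R hR hl hb
  exact ⟨_, hG.comb hG' a b⟩
lemma Reg.gr {lam : ℝ} {g : ℂ → ℝ} (h : C.Reg lam g) (v : ℂ) : C.Reg lam (C.gr v g) := by
  intro z hz hzV
  obtain ⟨ρ, hρ, G, hG⟩ := h z hz hzV
  exact ⟨ρ, hρ, _, hG.gr v⟩
lemma Reg.comb {lam : ℝ} {g g' : ℂ → ℝ} (h : C.Reg lam g) (h' : C.Reg lam g') (a b : ℝ) :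
    C.Reg lam (fun z => a * g z + b * g' z) := by
  intro z hz hzV
  obtain ⟨ρ, hρ, G, hG⟩ := h z hz hzV
  obtain ⟨ρ', hρ', G', hG'⟩ := h' z hz hzV
  exact ⟨min ρ ρ', lt_min hρ hρ', _, (hG.mono (Metric.ball_subset_ball (min_le_left _ _))).comb
    (hG'.mono (Metric.ball_subset_ball (min_le_right _ _))) a b⟩

lemma SSol.gr_τ {lam s : ℝ} {j : Fin 3} {g : ℂ → ℝ} (h : C.SSol lam j s g) : C.SSol lam j s (C.gr (C.τ j) g) := by
  intro p R hR hl hb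
  obtain ⟨G, hG, hs⟩ := h p R hR hl hb
  refine ⟨_, hG.gr _, fun z => ?_⟩
  have e : (fun y => G (C.S j y)) = fun y => s * G y := funext hs
  have := C.dd_S j (cdd hG.1 (C.S j z)) (C.τ j)
  rw [e, dd_const_mul (cdd hG.1 z), Sl_τ] at this
  exact this.symm
lemma SSol.gr_ν {lam s : ℝ} {j : Fin 3} {g : ℂ → ℝ} (h : C.SSol lam j s g) : C.SSol lam j (-s) (C.gr (C.ν j) g) := by
  intro p R hR hl hb
  obtain ⟨G, hG, hs⟩ := h p R hR hl hb
  refine ⟨_, hG.gr _, fun z => ?_⟩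
  have e : (fun y => G (C.S j y)) = fun y => s * G y := funext hs
  have := C.dd_S j (cdd hG.1 (C.S j z)) (C.ν j)
  rw [e, dd_const_mul (cdd hG.1 z), Sl_ν, dd_neg] at this
  linarith
lemma SSol.comb {lam s : ℝ} {j : Fin 3} {g g' : ℂ → ℝ} (h : C.SSol lam j s g) (h' : C.SSol lam j s g') (a b : ℝ) :
    C.SSol lam j s (fun z => a * g z + b * g' z) := by
  intro p R hR hl hb
  obtain ⟨G, hG, hs⟩ := h p R hR hl hb
  obtain ⟨G', hG', hs'⟩ := h' p R hR hl hb
  refine ⟨_, hG.comb hG' a b, fun z => ?_⟩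
  rw [hs, hs']; ring

lemma exists_R (lam : ℝ) {r : ℝ} (hr : 0 < r) : ∃ R, 0 < R ∧ R ≤ r ∧ lam * R ^ 2 ≤ 1 := by
  refine ⟨min (min r 1) (1 / (|lam| + 1)), by positivity, (min_le_left _ _).trans (min_le_left _ _), ?_⟩
  set R := min (min r 1) (1 / (|lam| + 1))
  have h0 : 0 < R := by positivity
  have h1 : R ≤ 1 := (min_le_left _ _).trans (min_le_right _ _)
  have h2 : R * (|lam| + 1) ≤ 1 := by
    rw [← le_div_iff₀ (by positivity)]; exact min_le_right _ _
  have := le_abs_self lam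
  have h3 : lam * R ^ 2 ≤ |lam| * R ^ 2 := by gcongr
  nlinarith [abs_nonneg lam]

lemma SideBall.mono {j : Fin 3} {p : ℂ} {ρ r : ℝ} (h : C.SideBall j p ρ) (hr : r ≤ ρ) : C.SideBall j p r :=
  ⟨h.1, fun k hk y hy => h.2 k hk y (Metric.ball_subset_ball hr hy)⟩

lemma SideBall.T_mem {j : Fin 3} {p : ℂ} {ρ : ℝ} (h : C.SideBall j p ρ) (hρ : 0 < ρ) : p ∈ C.T :=
  C.side_mem h (Metric.mem_ball_self hρ) h.1.ge

/-- at most one l vanishes off the vertices -/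
lemma not_two {z : ℂ} (hz : z ∉ C.V) {i j : Fin 3} (hij : i ≠ j) (hi : C.l i z = 0) : C.l j z ≠ 0 := by
  intro hj
  apply hz
  obtain ⟨k, hki, hkj⟩ : ∃ k : Fin 3, k ≠ i ∧ k ≠ j := by
    fin_cases i <;> fin_cases j <;> simp at hij ⊢ <;> decide
  have h3 (f : Fin 3 → ℂ) : ∑ m, f m = f i + f j + f k := by
    fin_cases i <;> fin_cases j <;> fin_cases k <;> simp [Fin.sum_univ_three] at hij hki hkj ⊢ <;> ring
  have h3' (f : Fin 3 → ℝ) : ∑ m, f m = f i + f j + f k := by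
    fin_cases i <;> fin_cases j <;> fin_cases k <;> simp [Fin.sum_univ_three] at hij hki hkj ⊢ <;> ring
  have e1 := C.sP z
  have e2 := C.s1 z
  rw [h3, hi, hj] at e1; rw [h3', hi, hj] at e2
  simp only [zero_div, zero_add] at e2
  rw [e2] at e1
  exact ⟨k, by simpa using e1⟩

lemma exists_sideBall {z : ℂ} (hz : z ∈ C.T) (hzV : z ∉ C.V) {j : Fin 3} (hj : C.l j z = 0) :
    ∃ ρ > 0, C.SideBall j z ρ := by
  have hp : ∀ k, k ≠ j → 0 < C.l k z := fun k hk => (hz k).lt_of_ne' (not_two hzV hk.symm hj)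
  have : ∀ᶠ y in 𝓝 z, ∀ k, k ≠ j → 0 < C.l k y := by
    rw [eventually_all]; intro k
    by_cases hk : k = j
    · simp [hk]
    · filter_upwards [(C.l_cont k).continuousAt.eventually (lt_mem_nhds (hp k hk))] with y hy _ using hy
  obtain ⟨ρ, hρ, h⟩ := Metric.eventually_nhds_iff_ball.1 this
  exact ⟨ρ, hρ, hj, fun k hk y hy => h y hy k hk⟩

lemma T0_or_side {z : ℂ} (hz : z ∈ C.T) : z ∈ C.T0 ∨ ∃ j, C.l j z = 0 := by
  by_cases h : ∃ j, C.l j z = 0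
  · exact Or.inr h
  · push Not at h
    exact Or.inl fun j => (hz j).lt_of_ne' (h j)

lemma T0_notV {z : ℂ} (hz : z ∈ C.T0) : z ∉ C.V := by
  rintro ⟨k, rfl⟩
  obtain ⟨j, hj⟩ := exists_ne k
  have := hz j; rw [l_P_ne C hj] at this; exact lt_irrefl _ this

lemma sideBall_notV {z p : ℂ} {j : Fin 3} {ρ : ℝ} (h : C.SideBall j p ρ) (hz : z ∈ Metric.ball p ρ) : z ∉ C.V := by
  rintro ⟨k, rfl⟩
  obtain ⟨m, hm, hmk⟩ : ∃ m : Fin 3, m ≠ j ∧ m ≠ k := by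
    fin_cases j <;> fin_cases k <;> simp <;> decide
  have := h.2 m hm _ hz
  rw [l_P_ne C hmk] at this; exact lt_irrefl _ this

/-- Regularity from local solvability, with side data given in the form of local patches. -/
lemma Reg_of {lam : ℝ} {g : ℂ → ℝ} (h : C.ISol lam g)
    (hs : ∀ j p R, 0 < R → lam * R ^ 2 ≤ 1 → C.SideBall j p R → ∃ G, C.Pat lam g p (R / 2) G) : C.Reg lam g := by
  intro z hz hzV
  rcases T0_or_side hz with h0 | ⟨j, hj⟩
  · obtain ⟨r, hr, hb⟩ := Metric.isOpen_iff.1 C.T0_open z h0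
    obtain ⟨R, hR, hRr, hl⟩ := exists_R lam hr
    obtain ⟨G, hG⟩ := h z R hR hl (((Metric.ball_subset_ball hRr).trans hb).trans C.T0_sub)
    exact ⟨R / 2, by positivity, G, hG⟩
  · obtain ⟨r, hr, hb⟩ := exists_sideBall hz hzV hj
    obtain ⟨R, hR, hRr, hl⟩ := exists_R lam hr
    obtain ⟨G, hG⟩ := hs j z R hR hl (hb.mono hRr)
    exact ⟨R / 2, by positivity, G, hG⟩

/-- scalar solution with parity s on every side -/
structure PSol (C : Cfg) (lam s : ℝ) (g : ℂ → ℝ) : Prop where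
  int : C.ISol lam g
  side : ∀ j, C.SSol lam j s g

/-- tangential field solution -/
structure TSol (C : Cfg) (lam : ℝ) (w1 w2 : ℂ → ℝ) : Prop where
  int1 : C.ISol lam w1
  int2 : C.ISol lam w2
  ev : ∀ j, C.SSol lam j 1 (fun z => (C.τ j).re * w1 z + (C.τ j).im * w2 z)
  od : ∀ j, C.SSol lam j (-1) (fun z => (C.ν j).re * w1 z + (C.ν j).im * w2 z)

lemma PSol.reg {lam s : ℝ} {g : ℂ → ℝ} (h : PSol C lam s g) : C.Reg lam g :=
  Reg_of h.int fun j p R hR hl hb => by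
    obtain ⟨G, hG, _⟩ := h.side j p R hR hl hb
    exact ⟨G, hG⟩

/-- relation of the frames -/
lemma frame (j : Fin 3) : ∃ κ : ℝ, κ ^ 2 = 1 ∧ (C.ν j).re = - κ * (C.τ j).im ∧ (C.ν j).im = κ * (C.τ j).re := by
  have h1 := C.hτ j
  have h2 := C.hν j
  have h3 := C.hτν j
  unfold dot at h1 h2 h3
  refine ⟨(C.τ j).re * (C.ν j).im - (C.τ j).im * (C.ν j).re, ?_, ?_, ?_⟩
  · have : ((C.τ j).re * (C.ν j).im - (C.τ j).im * (C.ν j).re) ^ 2 = ((C.τ j).re * (C.τ j).re + (C.τ j).im * (C.τ j).im) * ((C.ν j).re * (C.ν j).re + (C.ν j).im * (C.ν j).im)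
        - ((C.τ j).re * (C.ν j).re + (C.τ j).im * (C.ν j).im) ^ 2 := by ring
    rw [this, h1, h2, h3]; norm_num
  · linear_combination (-(C.ν j).re) * h1 + (C.τ j).re * h3
  · linear_combination (-(C.ν j).im) * h1 + (C.τ j).im * h3

lemma frame_id (j : Fin 3) : (C.τ j).re ^ 2 + (C.ν j).re ^ 2 = 1 ∧ (C.τ j).im ^ 2 + (C.ν j).im ^ 2 = 1 ∧
    (C.τ j).re * (C.τ j).im + (C.ν j).re * (C.ν j).im = 0 := by
  obtain ⟨κ, hκ, h1, h2⟩ := C.frame j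
  have h3 := C.hτ j
  unfold dot at h3
  rw [h1, h2]
  refine ⟨?_, ?_, ?_⟩
  · linear_combination h3 + (C.τ j).im ^ 2 * hκ
  · linear_combination h3 + (C.τ j).re ^ 2 * hκ
  · linear_combination - (C.τ j).re * (C.τ j).im * hκ

lemma TSol.side {lam : ℝ} {w1 w2 : ℂ → ℝ} (h : TSol C lam w1 w2) {j : Fin 3} {p : ℂ} {R : ℝ} (hR : 0 < R)
    (hl : lam * R ^ 2 ≤ 1) (hb : C.SideBall j p R) : ∃ A B : ℂ → ℝ, ContDiff ℝ ∞ A ∧ ContDiff ℝ ∞ B ∧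
    (∀ z, A (C.S j z) = A z) ∧ (∀ z, B (C.S j z) = - B z) ∧
    C.Pat lam w1 p (R / 2) (fun z => (C.τ j).re * A z + (C.ν j).re * B z) ∧
    C.Pat lam w2 p (R / 2) (fun z => (C.τ j).im * A z + (C.ν j).im * B z) := by
  obtain ⟨A, hA, hAs⟩ := h.ev j p R hR hl hb
  obtain ⟨B, hB, hBs⟩ := h.od j p R hR hl hb
  obtain ⟨i1, i2, i3⟩ := C.frame_id j
  refine ⟨A, B, hA.1, hB.1, fun z => by rw [hAs, one_mul], fun z => by rw [hBs]; ring, (hA.comb hB _ _).congr ?_, (hA.comb hB _ _).congr ?_⟩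
  · intro z _ _
    linear_combination w1 z * i1 + w2 z * i3
  · intro z _ _
    linear_combination w2 z * i2 + w1 z * i3

lemma TSol.reg1 {lam : ℝ} {w1 w2 : ℂ → ℝ} (h : TSol C lam w1 w2) : C.Reg lam w1 :=
  Reg_of h.int1 fun j p R hR hl hb => by
    obtain ⟨A, B, _, _, _, _, h1, _⟩ := h.side hR hl hb
    exact ⟨_, h1⟩
lemma TSol.reg2 {lam : ℝ} {w1 w2 : ℂ → ℝ} (h : TSol C lam w1 w2) : C.Reg lam w2 :=
  Reg_of h.int2 fun j p R hR hl hb => by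
    obtain ⟨A, B, _, _, _, _, _, h2⟩ := h.side hR hl hb
    exact ⟨_, h2⟩

lemma PSol.grad {lam : ℝ} {f : ℂ → ℝ} (h : PSol C lam 1 f) : TSol C lam (C.gr 1 f) (C.gr I f) := by
  refine ⟨h.int.gr 1, h.int.gr I, fun j => ?_, fun j => ?_⟩
  · have e : (fun z => (C.τ j).re * C.gr 1 f z + (C.τ j).im * C.gr I f z) = C.gr (C.τ j) f := by
      ext z; exact (gr_lin _ f z).symm
    rw [e]; exact (h.side j).gr_τ
  · have e : (fun z => (C.ν j).re * C.gr 1 f z + (C.ν j).im * C.gr I f z) = C.gr (C.ν j) f := by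
      ext z; exact (gr_lin _ f z).symm
    rw [e]; exact (h.side j).gr_ν

variable (C)
def dv (w1 w2 : ℂ → ℝ) (z : ℂ) : ℝ := 1 * C.gr 1 w1 z + 1 * C.gr I w2 z
def cl (w1 w2 : ℂ → ℝ) (z : ℂ) : ℝ := 1 * C.gr 1 w2 z + (-1) * C.gr I w1 z
variable {C}

lemma dd_par {G : ℂ → ℝ} (hG : ContDiff ℝ ∞ G) {s : ℝ} {j : Fin 3} (h : ∀ z, G (C.S j z) = s * G z) (z : ℂ) :
    dd (C.τ j) G (C.S j z) = s * dd (C.τ j) G z ∧ dd (C.ν j) G (C.S j z) = - s * dd (C.ν j) G z := by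
  have e : (fun y => G (C.S j y)) = fun y => s * G y := funext h
  have h1 := C.dd_S j (cdd hG (C.S j z)) (C.τ j)
  have h2 := C.dd_S j (cdd hG (C.S j z)) (C.ν j)
  rw [e, dd_const_mul (cdd hG z), Sl_τ] at h1
  rw [e, dd_const_mul (cdd hG z), Sl_ν, dd_neg] at h2
  exact ⟨h1.symm, by linarith⟩

lemma TSol.div {lam : ℝ} {w1 w2 : ℂ → ℝ} (h : TSol C lam w1 w2) : PSol C lam 1 (C.dv w1 w2) := by
  refine ⟨(h.int1.gr 1).comb (h.int2.gr I) 1 1, fun j p R hR hl hb => ?_⟩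
  obtain ⟨A, B, hA, hB, hAs, hBs, h1, h2⟩ := h.side hR hl hb
  refine ⟨_, (h1.gr 1).comb (h2.gr I) 1 1, fun z => ?_⟩
  have e (z : ℂ) : 1 * dd 1 (fun z => (C.τ j).re * A z + (C.ν j).re * B z) z + 1 * dd I (fun z => (C.τ j).im * A z + (C.ν j).im * B z) z
      = dd (C.τ j) A z + dd (C.ν j) B z := by
    rw [dd_comb (cdd hA z) (cdd hB z), dd_comb (cdd hA z) (cdd hB z), dd_lin (C.τ j), dd_lin (C.ν j)]; ring
  rw [e, e]
  have a := dd_par hA (s := 1) (fun z => by rw [hAs, one_mul]) z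
  have b := dd_par hB (s := -1) (fun z => by rw [hBs]; ring) z
  rw [a.1, b.2]; ring

lemma TSol.curl {lam : ℝ} {w1 w2 : ℂ → ℝ} (h : TSol C lam w1 w2) : PSol C lam (-1) (C.cl w1 w2) := by
  refine ⟨(h.int2.gr 1).comb (h.int1.gr I) 1 (-1), fun j p R hR hl hb => ?_⟩
  obtain ⟨A, B, hA, hB, hAs, hBs, h1, h2⟩ := h.side hR hl hb
  refine ⟨_, (h2.gr 1).comb (h1.gr I) 1 (-1), fun z => ?_⟩
  obtain ⟨κ, hκ, k1, k2⟩ := C.frame j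
  have e (z : ℂ) : 1 * dd 1 (fun z => (C.τ j).im * A z + (C.ν j).im * B z) z + (-1) * dd I (fun z => (C.τ j).re * A z + (C.ν j).re * B z) z
      = - κ * dd (C.ν j) A z + κ * dd (C.τ j) B z := by
    rw [dd_comb (cdd hA z) (cdd hB z), dd_comb (cdd hA z) (cdd hB z), dd_lin (C.τ j), dd_lin (C.ν j), k1, k2]
    linear_combination (-((C.τ j).im * dd 1 A z) + (C.τ j).re * dd I A z) * hκ
  rw [e, e]
  have a := dd_par hA (s := 1) (fun z => by rw [hAs, one_mul]) z
  have b := dd_par hB (s := -1) (fun z => by rw [hBs]; ring) z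
  rw [a.2, b.1]; ring

end Cfg
end HS
end

noncomputable section
namespace HS
open Complex Filter Topology MeasureTheory
open scoped ContDiff Convolution

namespace Cfg
variable {C : Cfg}

lemma lip_of_loc {F : ℂ → ℝ} (h : ∀ z ∈ C.T, (F =ᶠ[𝓝 z] fun _ => 0) ∨ ContDiffWithinAt ℝ 1 F C.T z) :
    ∃ K, LipschitzOnWith K F C.T := by
  apply LocallyLipschitzOn.exists_lipschitzOnWith_of_compact C.T_compact
  intro z hz
  rcases h z hz with h | h
  · refine ⟨0, _, mem_nhdsWithin_of_mem_nhds h, ?_⟩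
    intro x hx y hy
    simp only [mem_setOf_eq] at hx hy
    rw [hx, hy]; simp
  · exact h.exists_lipschitzOnWith C.T_convex

/-- classical Neumann solution -/
structure Cls (C : Cfg) (mu : ℝ) (u : ℂ → ℝ) : Prop where
  cont : ContinuousOn u C.T
  sm : ∀ q ∈ C.T, q ∉ C.V → ContDiffWithinAt ℝ ∞ u C.T q
  eq : ∀ z ∈ C.T0, Lap u z = - mu * u z
  neu : ∀ j, ∀ z ∈ C.T, C.l j z = 0 → z ∉ C.V → C.gr (C.ν j) u z = 0

lemma Cls.gr_sm {mu : ℝ} {u : ℂ → ℝ} (h : Cls C mu u) (v : ℂ) {q : ℂ} (hq : q ∈ C.T) (hV : q ∉ C.V) :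
    ContDiffWithinAt ℝ 1 (C.gr v u) C.T q := by
  have h1 : ContDiffWithinAt ℝ 1 (fderivWithin ℝ u C.T) C.T q :=
    (h.sm q hq hV).fderivWithin_right C.T_uniq (by norm_cast) hq
  exact h1.clm_apply contDiffWithinAt_const

lemma ev_zero {φ : ℂ → ℝ} {z : ℂ} (h : z ∉ tsupport φ) : φ =ᶠ[𝓝 z] fun _ => 0 :=
  notMem_tsupport_iff_eventuallyEq.1 h

lemma dd_ev_zero {φ : ℂ → ℝ} {z : ℂ} (h : φ =ᶠ[𝓝 z] fun _ => 0) (v : ℂ) : dd v φ =ᶠ[𝓝 z] fun _ => 0 :=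
  (dd_congr' h v).trans (Eventually.of_forall fun y => dd_const 0 v y)

lemma Cls.weak {mu : ℝ} {u : ℂ → ℝ} (h : Cls C mu u) {φ : ℂ → ℝ} (hφ : ContDiff ℝ ∞ φ)
    (hV : ∀ z ∈ C.V, z ∉ tsupport φ) (hn : ∀ j, ∀ z ∈ C.T, C.l j z = 0 → dd (C.ν j) φ z = 0) :
    ∫ y in C.T, u y * (Lap φ y + mu * φ y) = 0 := by
  have hL (v : ℂ) : ∃ K, LipschitzOnWith K (fun y => u y * dd v φ y - φ y * C.gr v u y) C.T := by
    apply lip_of_loc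
    intro z hz
    by_cases hs : z ∈ tsupport φ
    · right
      have hzV : z ∉ C.V := fun hv => hV z hv hs
      have h1 : ContDiffWithinAt ℝ 1 u C.T z := (h.sm z hz hzV).of_le (by norm_cast)
      have h2 : ContDiffWithinAt ℝ 1 (dd v φ) C.T z := ((contDiff_dd hφ v).of_le (by norm_cast)).contDiffWithinAt
      have h3 : ContDiffWithinAt ℝ 1 φ C.T z := (hφ.of_le (by norm_cast)).contDiffWithinAt
      exact (h1.mul h2).sub (h3.mul (h.gr_sm v hz hzV))
    · left
      filter_upwards [ev_zero hs, dd_ev_zero (ev_zero hs) v] with y h1 h2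
      rw [h1, h2]; ring
  obtain ⟨K1, hK1⟩ := hL 1
  obtain ⟨K2, hK2⟩ := hL I
  have key := C.div_lemma_on hK1 hK2 (by
    intro j z hz hl
    have e : dot (C.ν j) ⟨u z * dd 1 φ z - φ z * C.gr 1 u z, u z * dd I φ z - φ z * C.gr I u z⟩
        = u z * dd (C.ν j) φ z - φ z * C.gr (C.ν j) u z := by
      rw [dd_lin (C.ν j), gr_lin (C.ν j)]; simp only [dot]; ring
    rw [e, hn j z hz hl]
    by_cases hs : z ∈ tsupport φ
    · rw [h.neu j z hz hl (fun hv => hV z hv hs)]; ring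
    · rw [(ev_zero hs).self_of_nhds]; ring)
  rw [← key]
  apply integral_congr_ae
  filter_upwards [C.T_ae] with z hz
  have hT := C.T0_open.mem_nhds hz
  have hu : ContDiffAt ℝ ∞ u z := (h.sm z (C.T0_sub hz) (T0_notV hz)).contDiffAt (mem_of_superset hT C.T0_sub)
  have ev (v : ℂ) : (fun y => u y * dd v φ y - φ y * C.gr v u y) =ᶠ[𝓝 z] fun y => u y * dd v φ y - φ y * dd v u y := by
    filter_upwards [hT] with y hy
    rw [gr_eq_dd hy]
  have hd (v : ℂ) := cdda (contDiffAt_dd hu v)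
  have hd' (v : ℂ) := cdd (contDiff_dd hφ v) z
  rw [dd_congr (ev 1), dd_congr (ev I), dd_sub ((cdda hu).fun_mul (hd' 1)) ((cdd hφ z).fun_mul (hd 1)),
    dd_sub ((cdda hu).fun_mul (hd' I)) ((cdd hφ z).fun_mul (hd I)), dd_mul (cdda hu) (hd' 1), dd_mul (cdda hu) (hd' I),
    dd_mul (cdd hφ z) (hd 1), dd_mul (cdd hφ z) (hd I)]
  have := h.eq z hz
  unfold Lap at this ⊢
  linear_combination φ z * this

lemma PatA.toPat {lam : ℝ} {g G : ℂ → ℝ} {p : ℂ} {ρ : ℝ} (h : C.PatA lam g p ρ G) (hg : ContinuousOn g C.T) :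
    C.Pat lam g p ρ G := by
  obtain ⟨g', hg'⟩ := ContinuousMap.exists_restrict_eq C.T_closed ⟨C.T.restrict g, continuousOn_iff_continuous_restrict.1 hg⟩
  have e : ∀ z ∈ C.T, g' z = g z := fun z hz => congrArg (fun f => f ⟨z, hz⟩) hg'
  refine ⟨h.1, h.2.1, fun z hz hzb => ?_⟩
  rw [← e z hz]
  refine C.ae_eq_on h.1.continuous g'.continuous ?_ z hz hzb
  filter_upwards [h.2.2] with y hy h1 h2
  rw [hy h1 h2, e y h1]

lemma ball_l_pos {p : ℂ} {R : ℝ} (hb : Metric.ball p R ⊆ C.T) {z : ℂ} (hz : z ∈ Metric.ball p R) : z ∈ C.T0 := by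
  rw [← interior_T]
  exact interior_maximal hb Metric.isOpen_ball hz

lemma side_ts {j : Fin 3} {p : ℂ} {R : ℝ} (hb : C.SideBall j p R) {φ : ℂ → ℝ} (hs : tsupport φ ⊆ Metric.ball p R)
    {k : Fin 3} (hk : k ≠ j) {z : ℂ} (hz : C.l k z = 0) : z ∉ tsupport φ := fun h =>
  (hb.2 k hk z (hs h)).ne' hz

theorem Cls.psol {mu : ℝ} {u : ℂ → ℝ} (hmu : 0 ≤ mu) (h : Cls C mu u) : PSol C mu 1 u := by
  have hi : IntegrableOn u C.T := h.cont.integrableOn_compact C.T_compact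
  refine ⟨fun p R hR hl hb => ?_, fun j p R hR hl hb => ?_⟩
  · obtain ⟨G, hG⟩ := C.weak_int hmu hR hl hb hi (fun φ hφ hs => h.weak hφ
      (fun z hz h' => T0_notV (ball_l_pos hb (hs h')) hz) (fun j z hz hlz => by
        have : z ∉ tsupport φ := fun h' => ((ball_l_pos hb (hs h')) j).ne' hlz
        exact (dd_ev_zero (ev_zero this) _).self_of_nhds))
    exact ⟨G, hG.toPat h.cont⟩
  · obtain ⟨G, hG, hGs⟩ := C.weak_side hmu hR hl (s := 1) (by norm_num) hb hi (fun φ hφ hs hse => h.weak hφ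
      (fun z hz h' => sideBall_notV hb (hs h') hz) (fun k z hz hlz => by
        by_cases hk : k = j
        · subst hk
          have := (dd_par hφ hse z).2
          rw [C.S_fix hlz] at this; linarith
        · exact (dd_ev_zero (ev_zero (side_ts hb hs hk hlz)) _).self_of_nhds))
    exact ⟨G, hG.toPat h.cont, hGs⟩

end Cfg
end HS
end

noncomputable section
namespace HS
open Complex Filter Topology MeasureTheory
open scoped ContDiff Convolution

namespace Cfg
variable {C : Cfg}

lemma dV_bdd : ∃ D : ℝ, 0 < D ∧ ∀ z ∈ C.T, C.dV z ≤ D := by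
  obtain ⟨D, hD⟩ := C.T_bounded.exists_norm_le
  refine ⟨D + ‖C.P 0‖ + 1, ?_, fun z hz => ?_⟩
  · have := (norm_nonneg _).trans (hD _ (C.P_mem 0)); positivity
  · have h1 := C.dV_le z 0
    have h2 := hD z hz
    have h3 := norm_sub_le z (C.P 0)
    linarith

lemma cases_ball2 (lam : ℝ) : ∃ c : ℝ, 0 < c ∧ c ≤ 1 / 8 ∧ (∀ z ∈ C.T, lam * (4 * c * C.dV z) ^ 2 ≤ 1) ∧ ∀ z ∈ C.T, z ∉ C.V →
    (Metric.ball z (c * C.dV z) ⊆ C.T) ∨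
    ∃ j, C.SideBall j (z - C.l j z • C.ν j) (8 * c * C.dV z) ∧ C.l j z ≤ c * C.dV z := by
  obtain ⟨c, hc, hc8, h⟩ := C.cases_ball
  obtain ⟨D, hD, hdV⟩ := C.dV_bdd
  obtain ⟨R, hR, hRc, hl⟩ := exists_R lam (show 0 < 4 * c * D by positivity)
  have hR0 : 0 < R / (4 * D) := by positivity
  have hc' : R / (4 * D) ≤ c := by rw [div_le_iff₀ (by positivity)]; linarith
  refine ⟨R / (4 * D), hR0, hc'.trans hc8, fun z hz => ?_, fun z hz hzV => ?_⟩
  · have h0 := C.dV_nonneg z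
    have h1 : 4 * (R / (4 * D)) * C.dV z ≤ R := by
      have : 4 * (R / (4 * D)) * C.dV z = R * (C.dV z / D) := by field_simp
      rw [this]
      have : C.dV z / D ≤ 1 := by rw [div_le_one hD]; exact hdV z hz
      nlinarith
    have h2 : (4 * (R / (4 * D)) * C.dV z) ^ 2 ≤ R ^ 2 := by gcongr
    rcases le_total 0 lam with hlam | hlam
    · nlinarith
    · nlinarith [sq_nonneg (4 * (R / (4 * D)) * C.dV z)]
  · set c' := R / (4 * D)
    have hd := C.dV_pos.2 hzV
    have hcc : c' * C.dV z ≤ c * C.dV z := by gcongr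
    rcases h z hz hzV with h1 | ⟨j, h1, h2⟩
    · left; exact (Metric.ball_subset_ball hcc).trans h1
    · by_cases h3 : C.l j z ≤ c' * C.dV z
      · right; exact ⟨j, h1.mono (by linarith), h3⟩
      · left
        push Not at h3
        intro y hy
        rw [Metric.mem_ball, dist_eq_norm] at hy
        have hyb : y ∈ Metric.ball (z - C.l j z • C.ν j) (8 * c * C.dV z) := by
          rw [Metric.mem_ball, dist_eq_norm]
          have e : y - (z - C.l j z • C.ν j) = (y - z) + C.l j z • C.ν j := by module
          have e2 : ‖C.l j z • C.ν j‖ = C.l j z := by rw [norm_smul, C.nν, mul_one, Real.norm_of_nonneg (hz j)]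
          have := norm_add_le (y - z) (C.l j z • C.ν j)
          rw [e]; nlinarith
        apply C.side_mem h1 hyb
        have := C.l_lip j y z
        have h5 := (abs_le.1 this).1
        linarith

variable (C) in
def Good (lam : ℝ) (z : ℂ) (ρ r : ℝ) (g : ℂ → ℝ) (s : ℝ) : Prop :=
  ∃ G, C.Pat lam g z ρ G ∧ (∀ y ∈ Metric.ball z ρ, ∃ y' ∈ C.T, ‖y' - z‖ < r ∧ (G y = g y' ∨ G y = s * g y')) ∧
    ∃ A ⊆ C.T ∩ Metric.ball z r, MeasurableSet A ∧ IntegrableOn (fun y => g y ^ 2) A ∧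
      ∫ y in Metric.ball z ρ, G y ^ 2 ≤ 2 * ∫ y in A, g y ^ 2

lemma good_int {lam : ℝ} {z : ℂ} {ρ r : ℝ} {g : ℂ → ℝ} {G : ℂ → ℝ} (h : C.Pat lam g z ρ G) (hb : Metric.ball z ρ ⊆ C.T) (hr : ρ ≤ r)
    (s : ℝ) : C.Good lam z ρ r g s := by
  have hG : IntegrableOn (fun y => G y ^ 2) (Metric.ball z ρ) :=
    ((h.1.continuous.pow 2).continuousOn.integrableOn_compact (isCompact_closedBall z ρ)).mono_set Metric.ball_subset_closedBall
  have e : ∀ y ∈ Metric.ball z ρ, G y ^ 2 = g y ^ 2 := fun y hy => by rw [h.2.2 y (hb hy) hy]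
  refine ⟨G, h, fun y hy => ⟨y, hb hy, ?_, Or.inl (h.2.2 y (hb hy) hy)⟩, Metric.ball z ρ, subset_inter hb (Metric.ball_subset_ball hr),
    measurableSet_ball, hG.congr_fun e measurableSet_ball, ?_⟩
  · rw [← dist_eq_norm]; exact (Metric.mem_ball.1 hy).trans_le hr
  · have h0 : 0 ≤ ∫ y in Metric.ball z ρ, G y ^ 2 := integral_nonneg fun y => sq_nonneg _
    rw [← setIntegral_congr_fun measurableSet_ball e]; linarith

lemma good_side {lam : ℝ} {z p : ℂ} {ρ ρ' r s : ℝ} {j : Fin 3} {g : ℂ → ℝ} {G : ℂ → ℝ} (h : C.Pat lam g p ρ G)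
    (hs : s ^ 2 = 1) (hG : ∀ z, G (C.S j z) = s * G z) (hb : C.SideBall j p ρ)
    (h1 : Metric.ball z ρ' ⊆ Metric.ball p ρ) (h2 : Metric.ball p ρ ⊆ Metric.ball z r) : C.Good lam z ρ' r g s := by
  have hGi : IntegrableOn (fun y => G y ^ 2) (Metric.ball p ρ) :=
    ((h.1.continuous.pow 2).continuousOn.integrableOn_compact (isCompact_closedBall p ρ)).mono_set Metric.ball_subset_closedBall
  have hAm : MeasurableSet (C.T ∩ Metric.ball p ρ) := C.T_meas.inter measurableSet_ball
  have e : ∀ y ∈ C.T ∩ Metric.ball p ρ, G y ^ 2 = g y ^ 2 := fun y hy => by rw [h.2.2 y hy.1 hy.2]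
  have hGA : IntegrableOn (fun y => G y ^ 2) (C.T ∩ Metric.ball p ρ) := hGi.mono_set inter_subset_right
  have hor : ∀ y ∈ Metric.ball p ρ, y ∈ C.T ∨ C.S j y ∈ C.T := by
    intro y hy
    rcases le_total 0 (C.l j y) with h0 | h0
    · exact Or.inl (C.side_mem hb hy h0)
    · exact Or.inr (C.side_mem hb (C.S_ball hb.1 hy) (by rw [C.l_S]; linarith))
  refine ⟨G, h.mono h1, fun y hy => ?_, C.T ∩ Metric.ball p ρ, inter_subset_inter_right _ h2, hAm, hGA.congr_fun e hAm, ?_⟩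
  · rcases hor y (h1 hy) with h0 | h0
    · exact ⟨y, h0, by rw [← dist_eq_norm]; exact h2 (h1 hy), Or.inl (h.2.2 y h0 (h1 hy))⟩
    · refine ⟨C.S j y, h0, by rw [← dist_eq_norm]; exact h2 (C.S_ball hb.1 (h1 hy)), Or.inr ?_⟩
      rw [← h.2.2 _ h0 (C.S_ball hb.1 (h1 hy)), hG, ← mul_assoc, ← pow_two, hs, one_mul]
  · rw [← setIntegral_congr_fun hAm e]
    set F := (C.T ∩ Metric.ball p ρ).indicator (fun y => G y ^ 2) with hF
    have hFi : Integrable F := (integrable_indicator_iff hAm).2 hGA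
    have hFn : ∀ y, 0 ≤ F y := fun y => indicator_nonneg (fun y _ => sq_nonneg _) y
    have hFS : Integrable (fun y => F (C.S j y)) := (C.S_mp j).integrable_comp_of_integrable hFi
    rw [← integral_indicator hAm, ← integral_indicator measurableSet_ball]
    have : 2 * ∫ y, F y = ∫ y, (F y + F (C.S j y)) := by
      rw [integral_add hFi hFS, C.int_S]; ring
    rw [this]
    apply integral_mono ((integrable_indicator_iff measurableSet_ball).2 (hGi.mono_set h1)) (hFi.add hFS)
    intro y
    change _ ≤ F y + F (C.S j y)
    by_cases hy : y ∈ Metric.ball z ρ'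
    · rw [indicator_of_mem hy]
      rcases hor y (h1 hy) with h0 | h0
      · have : F y = G y ^ 2 := indicator_of_mem (show y ∈ C.T ∩ _ from ⟨h0, h1 hy⟩) _
        have := hFn (C.S j y); linarith
      · have : F (C.S j y) = G y ^ 2 := by
          rw [hF, indicator_of_mem (show C.S j y ∈ C.T ∩ _ from ⟨h0, C.S_ball hb.1 (h1 hy)⟩), hG, mul_pow, hs, one_mul]
        have := hFn y; linarith
    · rw [indicator_of_notMem hy]
      exact add_nonneg (hFn _) (hFn _)

lemma patch (lam : ℝ) : ∃ c : ℝ, 0 < c ∧ c ≤ 1 / 8 ∧ (∀ z ∈ C.T, lam * (c * C.dV z) ^ 2 ≤ 1) ∧ ∀ z ∈ C.T, z ∉ C.V →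
    (∀ g s, C.ISol lam g → C.Good lam z (c * C.dV z) (C.dV z / 2) g s) ∨
    ∃ j, C.l j z ≤ C.dV z / 8 ∧ ∀ g s, s ^ 2 = 1 → C.SSol lam j s g → C.Good lam z (c * C.dV z) (C.dV z / 2) g s := by
  obtain ⟨c, hc, hc8, hl, h⟩ := C.cases_ball2 lam
  refine ⟨c / 2, by positivity, by linarith, fun z hz => ?_, fun z hz hzV => ?_⟩
  · have := hl z hz
    rcases le_total 0 lam with hlam | hlam
    · have : lam * (c / 2 * C.dV z) ^ 2 ≤ lam * (4 * c * C.dV z) ^ 2 := by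
        have := C.dV_nonneg z
        gcongr; linarith
      linarith
    · nlinarith [sq_nonneg (c / 2 * C.dV z)]
  · have hd := C.dV_pos.2 hzV
    have hl' := hl z hz
    have hcd : 0 < c * C.dV z := by positivity
    rcases h z hz hzV with h1 | ⟨j, h1, h2⟩
    · left
      intro g s hg
      obtain ⟨G, hG⟩ := hg z (c * C.dV z) hcd (by
        rcases le_total 0 lam with hlam | hlam
        · nlinarith [mul_nonneg hlam (sq_nonneg (c * C.dV z))]
        · nlinarith [sq_nonneg (c * C.dV z)]) h1
      rw [show c * C.dV z / 2 = c / 2 * C.dV z by ring] at hG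
      exact good_int hG ((Metric.ball_subset_ball (by nlinarith)).trans h1) (by nlinarith) s
    · right
      refine ⟨j, by nlinarith, fun g s hs hg => ?_⟩
      set p := z - C.l j z • C.ν j with hp
      have hzp : ‖z - p‖ ≤ c * C.dV z := by
        rw [hp, sub_sub_cancel, norm_smul, C.nν, mul_one, Real.norm_of_nonneg (hz j)]; exact h2
      obtain ⟨G, hG, hGs⟩ := hg p (4 * c * C.dV z) (by positivity) hl' (h1.mono (by nlinarith))
      refine good_side hG hs hGs (h1.mono (by nlinarith)) ?_ ?_
      · apply Metric.ball_subset_ball'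
        rw [dist_eq_norm]; nlinarith
      · apply Metric.ball_subset_ball'
        rw [dist_comm, dist_eq_norm]; nlinarith

lemma good_grad (lam : ℝ) (hlam : 0 ≤ lam) : ∃ K : ℝ, 0 < K ∧ ∀ z ρ r g s c M, 0 < ρ → lam * ρ ^ 2 ≤ 1 → C.Good lam z ρ r g s → z ∈ C.T →
    (s = 1 ∨ (s = -1 ∧ c = 0)) → (∀ y ∈ C.T, ‖y - z‖ < r → |g y - c| ≤ M) → ∀ v, ‖v‖ ≤ 1 → |C.gr v g z| ≤ K / ρ * M := by
  obtain ⟨K, hK, h⟩ := grad_est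
  refine ⟨K, hK, fun z ρ r g s c M hρ hl ⟨G, hG, hv, _⟩ hz hs hM v hv1 => ?_⟩
  rw [(hG.gr_eq hz (Metric.mem_ball_self hρ)).2 v]
  refine h lam ρ G z c M hlam hρ hl hG.1 (fun y hy => hG.2.1 y (by rwa [Metric.mem_ball, dist_eq_norm])) (fun y hy => ?_) v hv1
  obtain ⟨y', hy', hyr, h1⟩ := hv y (by rwa [Metric.mem_ball, dist_eq_norm])
  have h2 := hM y' hy' hyr
  rcases h1 with h1 | h1
  · rwa [h1]
  · rw [h1]
    rcases hs with hs | ⟨hs, hc⟩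
    · rwa [hs, one_mul]
    · subst hs hc
      simpa using h2

lemma good_l2 (lam : ℝ) (hlam : 0 ≤ lam) : ∃ K : ℝ, 0 < K ∧ ∀ z ρ r g s, 0 < ρ → lam * ρ ^ 2 ≤ 1 → C.Good lam z ρ r g s → z ∈ C.T →
    ∀ Q : ℂ → ℝ, IntegrableOn Q C.T → (∀ y ∈ C.T, g y ^ 2 ≤ Q y) → g z ^ 2 * ρ ^ 2 ≤ K * ∫ y in C.T ∩ Metric.ball z r, Q y := by
  refine ⟨8 / c0, by have := c0_pos; positivity, fun z ρ r g s hρ hl ⟨G, hG, _, A, hA, hAm, hAi, hle⟩ hz Q hQ hgQ => ?_⟩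
  have h1 := l2_est hlam hρ hl hG.1 (x := z) (fun y hy => hG.2.1 y (by rwa [Metric.mem_ball, dist_eq_norm]))
  rw [hG.2.2 z hz (Metric.mem_ball_self hρ)] at h1
  have h2 : ∫ y in A, g y ^ 2 ≤ ∫ y in A, Q y :=
    setIntegral_mono_on hAi (hQ.mono_set (hA.trans inter_subset_left)) hAm (fun y hy => hgQ y (hA hy).1)
  have hQ2 := hQ.mono_set (inter_subset_left : C.T ∩ Metric.ball z r ⊆ C.T)
  have h3 : ∫ y in A, Q y ≤ ∫ y in C.T ∩ Metric.ball z r, Q y :=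
    setIntegral_mono_set hQ2 (by
      filter_upwards [ae_restrict_mem (C.T_meas.inter measurableSet_ball)] with y hy
      exact (sq_nonneg _).trans (hgQ y hy.1)) (Eventually.of_forall hA)
  have hc0 := c0_pos
  calc g z ^ 2 * ρ ^ 2 ≤ 4 / c0 * ∫ y in Metric.ball z ρ, G y ^ 2 := h1
    _ ≤ 4 / c0 * (2 * ∫ y in C.T ∩ Metric.ball z r, Q y) := by gcongr; linarith
    _ = _ := by ring

lemma small_near {Q : ℂ → ℝ} (hQ : IntegrableOn Q C.T) {ε : ℝ} (hε : 0 < ε) :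
    ∃ δ > 0, ∀ A ⊆ C.T ∩ {z | C.dV z < δ}, MeasurableSet A → ∫ y in A, |Q y| < ε := by
  have h0 : Tendsto (fun n : ℕ => ∫ y in C.T ∩ {z | C.dV z < 1 / ((n : ℝ) + 1)}, |Q y|) atTop
      (𝓝 (∫ y in ⋂ n : ℕ, C.T ∩ {z | C.dV z < 1 / ((n : ℝ) + 1)}, |Q y|)) := by
    apply tendsto_setIntegral_of_antitone
    · intro n
      exact C.T_meas.inter (isOpen_lt (Metric.continuous_infDist_pt _) continuous_const).measurableSet
    · intro m n hmn z hz
      refine ⟨hz.1, ?_⟩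
      have h2 : C.dV z < 1 / ((n : ℝ) + 1) := hz.2
      refine lt_of_lt_of_le h2 ?_
      gcongr
    · exact ⟨0, (hQ.mono_set inter_subset_left).abs⟩
  have h1 : ∫ y in ⋂ n : ℕ, C.T ∩ {z | C.dV z < 1 / ((n : ℝ) + 1)}, |Q y| = 0 := by
    apply setIntegral_measure_zero
    refine measure_mono_null (t := C.V) (fun z hz => ?_) (C.V_fin.measure_zero _)
    by_contra hV
    obtain ⟨n, hn⟩ := exists_nat_one_div_lt (C.dV_pos.2 hV)
    have := (mem_iInter.1 hz n).2
    exact lt_irrefl _ (this.trans hn)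
  rw [h1] at h0
  obtain ⟨n, hn⟩ := (h0.eventually (gt_mem_nhds hε)).exists
  refine ⟨1 / ((n : ℝ) + 1), by positivity, fun A hA hAm => lt_of_le_of_lt ?_ hn⟩
  exact setIntegral_mono_set (hQ.mono_set inter_subset_left).abs (Eventually.of_forall fun y => abs_nonneg _) (Eventually.of_forall hA)

/-- if g is locally good with respect to the square integrable bound then d |g| tends to 0 -/
lemma l2_small {lam : ℝ} (hlam : 0 ≤ lam) {g : ℂ → ℝ} {s : ℝ} (hs : s ^ 2 = 1) (h : PSol C lam s g)
    (hg : IntegrableOn (fun y => g y ^ 2) C.T) {ε : ℝ} (hε : 0 < ε) :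
    ∃ δ > 0, ∀ z ∈ C.T, z ∉ C.V → C.dV z < δ → C.dV z * |g z| ≤ ε := by
  obtain ⟨c, hc, hc8, hl, hp⟩ := C.patch lam
  obtain ⟨K, hK, hk⟩ := C.good_l2 lam hlam
  obtain ⟨δ, hδ, hsm⟩ := C.small_near hg (ε := ε ^ 2 * c ^ 2 / K) (by positivity)
  refine ⟨δ / 2, by positivity, fun z hz hzV hd => ?_⟩
  have hd0 := C.dV_pos.2 hzV
  have hgood : C.Good lam z (c * C.dV z) (C.dV z / 2) g s := by
    rcases hp z hz hzV with h1 | ⟨j, _, h1⟩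
    · exact h1 g s h.int
    · exact h1 g s hs (h.side j)
  have h1 := hk z _ _ g s (by positivity) (hl z hz) hgood hz _ hg (fun y _ => le_rfl)
  have h2 := hsm (C.T ∩ Metric.ball z (C.dV z / 2)) (inter_subset_inter_right _ (fun y hy => by
    rw [Metric.mem_ball, dist_eq_norm] at hy
    have := C.dV_lip y z
    simp only [mem_setOf_eq]; linarith)) (C.T_meas.inter measurableSet_ball)
  simp only [abs_sq] at h2
  have h3 : (C.dV z * |g z|) ^ 2 ≤ ε ^ 2 := by
    have : g z ^ 2 * (c * C.dV z) ^ 2 ≤ ε ^ 2 * c ^ 2 := by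
      refine h1.trans ?_
      calc K * _ ≤ K * (ε ^ 2 * c ^ 2 / K) := by gcongr
        _ = _ := by field_simp
    have h4 : (C.dV z * |g z|) ^ 2 * c ^ 2 ≤ ε ^ 2 * c ^ 2 := by
      rw [mul_pow, sq_abs]; nlinarith
    exact le_of_mul_le_mul_right h4 (by positivity)
  exact (abs_le_of_sq_le_sq' h3 hε.le).2

lemma ab_bd {d ε a b x y : ℝ} (hd : 0 ≤ d) (hx : |x| ≤ 1) (hy : |y| ≤ 1) (ha : d * |a| ≤ ε / 2) (hb : d * |b| ≤ ε / 2) :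
    d * |x * a + y * b| ≤ ε := by
  have h1 : |x * a + y * b| ≤ |a| + |b| := by
    refine (abs_add_le _ _).trans ?_
    rw [abs_mul, abs_mul]
    exact add_le_add (mul_le_of_le_one_left (abs_nonneg _) hx) (mul_le_of_le_one_left (abs_nonneg _) hy)
  have := mul_le_mul_of_nonneg_left h1 hd
  linarith
lemma ab_unit {x y : ℝ} (h : x * x + y * y = 1) : |x| ≤ 1 ∧ |y| ≤ 1 := by
  rw [← sq_le_one_iff_abs_le_one, ← sq_le_one_iff_abs_le_one]
  constructor <;> nlinarith [sq_nonneg x, sq_nonneg y]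

lemma l2_small_T {lam : ℝ} (hlam : 0 ≤ lam) {w1 w2 : ℂ → ℝ} (h : TSol C lam w1 w2)
    (hg : IntegrableOn (fun y => w1 y ^ 2 + w2 y ^ 2) C.T) {ε : ℝ} (hε : 0 < ε) :
    ∃ δ > 0, ∀ z ∈ C.T, z ∉ C.V → C.dV z < δ → C.dV z * |w1 z| ≤ ε ∧ C.dV z * |w2 z| ≤ ε := by
  obtain ⟨c, hc, hc8, hl, hp⟩ := C.patch lam
  obtain ⟨K, hK, hk⟩ := C.good_l2 lam hlam
  obtain ⟨δ, hδ, hsm⟩ := C.small_near hg (ε := (ε / 2) ^ 2 * c ^ 2 / K) (by positivity)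
  refine ⟨δ / 2, by positivity, fun z hz hzV hd => ?_⟩
  have hd0 := C.dV_pos.2 hzV
  have h2 := hsm (C.T ∩ Metric.ball z (C.dV z / 2)) (inter_subset_inter_right _ (fun y hy => by
    rw [Metric.mem_ball, dist_eq_norm] at hy
    have := C.dV_lip y z
    simp only [mem_setOf_eq]; linarith)) (C.T_meas.inter measurableSet_ball)
  have hab : ∀ y, |w1 y ^ 2 + w2 y ^ 2| = w1 y ^ 2 + w2 y ^ 2 := fun y => abs_of_nonneg (by positivity)
  simp only [hab] at h2
  have key (g : ℂ → ℝ) (s : ℝ) (hgood : C.Good lam z (c * C.dV z) (C.dV z / 2) g s) (hgQ : ∀ y ∈ C.T, g y ^ 2 ≤ w1 y ^ 2 + w2 y ^ 2) :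
      C.dV z * |g z| ≤ ε / 2 := by
    have h1 := hk z _ _ g s (by positivity) (hl z hz) hgood hz _ hg hgQ
    have h3 : (C.dV z * |g z|) ^ 2 ≤ (ε / 2) ^ 2 := by
      have : g z ^ 2 * (c * C.dV z) ^ 2 ≤ (ε / 2) ^ 2 * c ^ 2 := by
        refine h1.trans ?_
        calc K * _ ≤ K * ((ε / 2) ^ 2 * c ^ 2 / K) := by gcongr
          _ = _ := by field_simp
      have h4 : (C.dV z * |g z|) ^ 2 * c ^ 2 ≤ (ε / 2) ^ 2 * c ^ 2 := by
        rw [mul_pow, sq_abs]; nlinarith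
      exact le_of_mul_le_mul_right h4 (by positivity)
    exact (abs_le_of_sq_le_sq' h3 (by positivity)).2
  rcases hp z hz hzV with h1 | ⟨j, _, h1⟩
  · have k1 := key w1 1 (h1 w1 1 h.int1) (fun y _ => by nlinarith [sq_nonneg (w2 y)])
    have k2 := key w2 1 (h1 w2 1 h.int2) (fun y _ => by nlinarith [sq_nonneg (w1 y)])
    constructor <;> linarith
  · obtain ⟨i1, i2, i3⟩ := C.frame_id j
    have ht := C.hτ j
    have hn := C.hν j
    unfold dot at ht hn
    have k1 := key _ 1 (h1 _ 1 (by norm_num) (h.ev j)) (fun y _ => by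
      nlinarith [sq_nonneg ((C.τ j).re * w2 y - (C.τ j).im * w1 y)])
    have k2 := key _ (-1) (h1 _ (-1) (by norm_num) (h.od j)) (fun y _ => by
      nlinarith [sq_nonneg ((C.ν j).re * w2 y - (C.ν j).im * w1 y)])
    set a := (C.τ j).re * w1 z + (C.τ j).im * w2 z with ha
    set b := (C.ν j).re * w1 z + (C.ν j).im * w2 z with hb
    have e1 : w1 z = (C.τ j).re * a + (C.ν j).re * b := by rw [ha, hb]; linear_combination (- w1 z) * i1 - w2 z * i3
    have e2 : w2 z = (C.τ j).im * a + (C.ν j).im * b := by rw [ha, hb]; linear_combination (- w2 z) * i2 - w1 z * i3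
    obtain ⟨t1, t2⟩ := ab_unit ht
    obtain ⟨n1, n2⟩ := ab_unit hn
    exact ⟨by rw [e1]; exact ab_bd hd0.le t1 n1 k1 k2, by rw [e2]; exact ab_bd hd0.le t2 n2 k1 k2⟩

end Cfg
end HS
end

noncomputable section
namespace HS
open Complex Filter Topology MeasureTheory
open scoped ContDiff Convolution

def qq (P z : ℂ) : ℝ := (z.re - P.re) ^ 2 + (z.im - P.im) ^ 2

lemma qq_eq (P z : ℂ) : qq P z = ‖z - P‖ ^ 2 := by
  rw [← dot_self]; unfold qq dot; simp; ring

lemma qq_cd (P : ℂ) : ContDiff ℝ ∞ (qq P) := by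
  have e1 : ContDiff ℝ ∞ (fun z : ℂ => z.re) := reCLM.contDiff
  have e2 : ContDiff ℝ ∞ (fun z : ℂ => z.im) := imCLM.contDiff
  exact ((e1.sub contDiff_const).pow 2).add ((e2.sub contDiff_const).pow 2)

lemma dd_re (v z : ℂ) (c : ℝ) : dd v (fun z : ℂ => z.re - c) z = v.re := by
  have : HasFDerivAt (fun z : ℂ => z.re - c) reCLM z := reCLM.hasFDerivAt.sub_const c
  unfold dd; rw [this.fderiv]; rfl
lemma dd_im (v z : ℂ) (c : ℝ) : dd v (fun z : ℂ => z.im - c) z = v.im := by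
  have : HasFDerivAt (fun z : ℂ => z.im - c) imCLM z := imCLM.hasFDerivAt.sub_const c
  unfold dd; rw [this.fderiv]; rfl
lemma re_cd (c : ℝ) : ContDiff ℝ ∞ (fun z : ℂ => z.re - c) := reCLM.contDiff.sub contDiff_const
lemma im_cd (c : ℝ) : ContDiff ℝ ∞ (fun z : ℂ => z.im - c) := imCLM.contDiff.sub contDiff_const

lemma dd_qq (P v z : ℂ) : dd v (qq P) z = 2 * (v.re * (z.re - P.re) + v.im * (z.im - P.im)) := by
  have e : qq P = fun z => (z.re - P.re) * (z.re - P.re) + (z.im - P.im) * (z.im - P.im) := by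
    ext z; unfold qq; ring
  have h1 := cdd (re_cd P.re) z
  have h2 := cdd (im_cd P.im) z
  rw [e, dd_add (h1.fun_mul h1) (h2.fun_mul h2), dd_mul h1 h1, dd_mul h2 h2, dd_re, dd_im]
  ring

lemma dd_dd_qq (P v z : ℂ) : dd v (dd v (qq P)) z = 2 * (v.re ^ 2 + v.im ^ 2) := by
  have e : dd v (qq P) = fun z => (2 * v.re) * (z.re - P.re) + (2 * v.im) * (z.im - P.im) := by
    ext z; rw [dd_qq]; ring
  rw [e, dd_comb (cdd (re_cd P.re) z) (cdd (im_cd P.im) z), dd_re, dd_im]; ring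

lemma dd_chain {φ : ℝ → ℝ} {φ' : ℝ} {q : ℂ → ℝ} {z : ℂ} (h : HasDerivAt φ φ' (q z)) (hq : DifferentiableAt ℝ q z) (v : ℂ) :
    dd v (fun y => φ (q y)) z = φ' * dd v q z := by
  have : HasFDerivAt (fun y => φ (q y)) (φ' • fderiv ℝ q z) z := h.comp_hasFDerivAt z hq.hasFDerivAt
  unfold dd; rw [this.fderiv]; rfl

lemma Lap_radial {φ φ1 : ℝ → ℝ} {φ2 : ℝ} {P z : ℂ} (h1 : ∀ s > 0, HasDerivAt φ (φ1 s) s)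
    (h2 : HasDerivAt φ1 φ2 (qq P z)) (hz : 0 < qq P z) :
    Lap (fun y => φ (qq P y)) z = 4 * φ1 (qq P z) + 4 * qq P z * φ2 := by
  have ev (v : ℂ) : dd v (fun y => φ (qq P y)) =ᶠ[𝓝 z] fun y => φ1 (qq P y) * dd v (qq P) y := by
    filter_upwards [(qq_cd P).continuous.continuousAt.eventually (lt_mem_nhds hz)] with y hy
    exact dd_chain (h1 _ hy) (cdd (qq_cd P) y) v
  have hd : DifferentiableAt ℝ (fun y => φ1 (qq P y)) z := (h2.comp_hasFDerivAt z (cdd (qq_cd P) z).hasFDerivAt).differentiableAt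
  unfold Lap
  rw [dd_congr (ev 1), dd_congr (ev I), dd_mul hd (cdd (contDiff_dd (qq_cd P) 1) z), dd_mul hd (cdd (contDiff_dd (qq_cd P) I) z),
    dd_dd_qq, dd_dd_qq, dd_chain h2 (cdd (qq_cd P) z), dd_chain h2 (cdd (qq_cd P) z), dd_qq, dd_qq]
  simp [qq]; ring

lemma Lap_bphi {b : ℂ → ℝ} {φ φ1 : ℝ → ℝ} {φ2 : ℝ} {P z : ℂ} (hb : ContDiff ℝ ∞ b) (hLb : Lap b z = 0)
    (hbz : b z = (z.re - P.re) * dd 1 b z + (z.im - P.im) * dd I b z) (hφ : ∀ s > 0, ContDiffAt ℝ ∞ φ s)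
    (h1 : ∀ s > 0, HasDerivAt φ (φ1 s) s) (h2 : HasDerivAt φ1 φ2 (qq P z)) (hz : 0 < qq P z) :
    Lap (fun y => b y * φ (qq P y)) z = 4 * b z * (2 * φ1 (qq P z) + qq P z * φ2) := by
  have hc : ContDiffAt ℝ ∞ (fun y => φ (qq P y)) z := (hφ _ hz).comp z (qq_cd P).contDiffAt
  rw [Lap_mul hb.contDiffAt hc, Lap_radial h1 h2 hz, hLb, dd_chain (h1 _ hz) (cdd (qq_cd P) z), dd_chain (h1 _ hz) (cdd (qq_cd P) z),
    dd_qq, dd_qq]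
  simp
  linear_combination (- 4 * φ1 (qq P z)) * hbz

def bar (A K ε s : ℝ) : ℝ := A * (1 - K * s) + ε * (s⁻¹ + (√s)⁻¹)
def bar1 (A K ε s : ℝ) : ℝ := - A * K + ε * (-(s ^ 2)⁻¹ - (2 * s * √s)⁻¹)

lemma bar_cd (A K ε : ℝ) {s : ℝ} (hs : 0 < s) : ContDiffAt ℝ ∞ (bar A K ε) s := by
  have h1 : ContDiffAt ℝ ∞ (fun s : ℝ => s⁻¹) s := contDiffAt_inv ℝ hs.ne'
  have h2 : ContDiffAt ℝ ∞ (fun s : ℝ => (√s)⁻¹) s := (Real.contDiffAt_sqrt hs.ne').inv (by positivity)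
  exact (contDiffAt_const.mul (contDiffAt_const.sub (contDiffAt_const.mul contDiffAt_id))).add (contDiffAt_const.mul (h1.add h2))

lemma bar_hd (A K ε : ℝ) {s : ℝ} (hs : 0 < s) : HasDerivAt (bar A K ε) (bar1 A K ε s) s := by
  have h1 := hasDerivAt_inv hs.ne'
  have hq : HasDerivAt (fun s => √s) (1 / (2 * √s)) s := Real.hasDerivAt_sqrt hs.ne'
  have hq0 : √s ≠ 0 := by positivity
  have h2 := hq.fun_inv hq0
  have h3 := ((hasDerivAt_id s).const_mul K).const_sub 1 |>.const_mul A
  have h4 := h3.add ((h1.fun_add h2).const_mul ε)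
  refine HasDerivAt.congr_deriv (h4.congr_of_eventuallyEq (Eventually.of_forall fun y => ?_)) ?_
  · simp [bar]
  · unfold bar1
    have hsq : √s ^ 2 = s := Real.sq_sqrt hs.le
    rw [hsq]
    field_simp
    ring

lemma bar_hd1 (A K ε : ℝ) {s : ℝ} (hs : 0 < s) :
    HasDerivAt (bar1 A K ε) (ε * (2 * (s ^ 3)⁻¹ + (3 / 4) * (s ^ 2 * √s)⁻¹)) s := by
  have hq : HasDerivAt (fun s => √s) (1 / (2 * √s)) s := Real.hasDerivAt_sqrt hs.ne'
  have hq0 : √s ≠ 0 := by positivity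
  have h1 := (hasDerivAt_pow 2 s).fun_inv (by positivity)
  have h2 := (((hasDerivAt_id' s).const_mul 2).fun_mul hq).fun_inv (by positivity)
  have h4 := ((h1.neg.sub h2).const_mul ε).const_add (- A * K)
  refine HasDerivAt.congr_deriv (h4.congr_of_eventuallyEq (Eventually.of_forall fun y => ?_)) ?_
  · simp [bar1]
  · have hsq : √s ^ 2 = s := Real.sq_sqrt hs.le
    obtain ⟨t, ht, rfl⟩ : ∃ t, 0 < t ∧ s = t ^ 2 := ⟨√s, by positivity, hsq.symm⟩
    rw [Real.sqrt_sq ht.le]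
    field_simp
    norm_num
    field_simp
    ring

/-- strict supersolution inequality -/
lemma bar_super {A K ε lam s : ℝ} (hA : 0 < A) (hε : 0 < ε) (hl : 0 ≤ lam) (hK : lam < 8 * K) (hs : 0 < s) (hs1 : s ≤ 1)
    (hs2 : 4 * lam ^ 2 * s < 1) :
    4 * (2 * bar1 A K ε s + s * (ε * (2 * (s ^ 3)⁻¹ + (3 / 4) * (s ^ 2 * √s)⁻¹))) + lam * bar A K ε s < 0 := by
  obtain ⟨t, ht, rfl⟩ : ∃ t, 0 < t ∧ s = t ^ 2 := ⟨√s, by positivity, (Real.sq_sqrt hs.le).symm⟩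
  unfold bar1 bar
  rw [Real.sqrt_sq ht.le]
  have ht1 : t ≤ 1 := by nlinarith
  have hlt : 2 * lam * t < 1 := by nlinarith
  have e : 4 * (2 * (-A * K + ε * (-((t ^ 2) ^ 2)⁻¹ - (2 * t ^ 2 * t)⁻¹)) + t ^ 2 * (ε * (2 * ((t ^ 2) ^ 3)⁻¹ + 3 / 4 * ((t ^ 2) ^ 2 * t)⁻¹)))
      + lam * (A * (1 - K * t ^ 2) + ε * ((t ^ 2)⁻¹ + t⁻¹)) = - A * (8 * K - lam + lam * K * t ^ 2) - ε * (t ^ 3)⁻¹ * (1 - lam * t - lam * t ^ 2) := by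
    field_simp; ring
  rw [e]
  have hK0 : 0 < K := by linarith
  have h1 : 0 < A * (8 * K - lam + lam * K * t ^ 2) := by
    have : 0 ≤ lam * K * t ^ 2 := by positivity
    apply mul_pos hA; linarith
  have h2 : 0 < ε * (t ^ 3)⁻¹ * (1 - lam * t - lam * t ^ 2) := by
    have : 0 < 1 - lam * t - lam * t ^ 2 := by nlinarith [mul_nonneg hl ht.le]
    positivity
  linarith

namespace Cfg
variable {C : Cfg}

lemma others (k : Fin 3) : ∃ i j : Fin 3, i ≠ j ∧ j ≠ k ∧ k ≠ i ∧ ∀ m, m ≠ k → m = i ∨ m = j := by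
  fin_cases k
  · exact ⟨1, 2, by decide⟩
  · exact ⟨2, 0, by decide⟩
  · exact ⟨0, 1, by decide⟩

lemma near_dV {k : Fin 3} {z : ℂ} (h : ‖z - C.P k‖ ≤ C.h k / 2) : C.dV z = ‖z - C.P k‖ := by
  apply le_antisymm (C.dV_le z k)
  obtain ⟨m, hm⟩ := C.dV_exists z
  rw [hm]
  by_cases hmk : m = k
  · rw [hmk]
  · have h1 := (abs_le.1 (C.l_lip k z (C.P k))).1
    have h2 := (abs_le.1 (C.l_lip k z (C.P m))).2
    rw [C.l_P_self] at h1
    rw [C.l_P_ne (Ne.symm hmk)] at h2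
    linarith

lemma near_side {k j : Fin 3} {z : ℂ} (h : ‖z - C.P k‖ ≤ C.h k / 2) (hj : C.l j z ≤ C.dV z / 8) : j ≠ k := by
  rintro rfl
  have h1 := (abs_le.1 (C.l_lip j z (C.P j))).1
  rw [C.l_P_self] at h1
  have h2 := C.dV_le z j
  have h3 := C.hpos j
  linarith

lemma near_notV {k : Fin 3} {z : ℂ} (h : ‖z - C.P k‖ ≤ C.h k / 2) (h0 : 0 < ‖z - C.P k‖) : z ∉ C.V := by
  rw [← C.dV_pos, near_dV h]; exact h0

lemma Pat.contAt {lam : ℝ} {g G : ℂ → ℝ} {p : ℂ} {ρ : ℝ} (h : C.Pat lam g p ρ G) {z : ℂ} (hz : z ∈ C.T)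
    (hzb : z ∈ Metric.ball p ρ) : ContinuousWithinAt g C.T z := (h.gr_eq hz hzb).1.continuousWithinAt

lemma Reg.cont {lam : ℝ} {g : ℂ → ℝ} (h : C.Reg lam g) : ContinuousOn g (C.T \ C.V) := by
  intro z hz
  obtain ⟨ρ, hρ, G, hG⟩ := h z hz.1 hz.2
  exact (hG.contAt hz.1 (Metric.mem_ball_self hρ)).mono diff_subset

lemma Reg.T0 {lam : ℝ} {g : ℂ → ℝ} (h : C.Reg lam g) {z : ℂ} (hz : z ∈ C.T0) :
    ContDiffAt ℝ ∞ g z ∧ Lap g z = - lam * g z := by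
  obtain ⟨ρ, hρ, G, hG⟩ := h z (C.T0_sub hz) (T0_notV hz)
  have ev : g =ᶠ[𝓝 z] G := by
    filter_upwards [C.T0_open.mem_nhds hz, Metric.ball_mem_nhds z hρ] with y h1 h2
    exact (hG.2.2 y (C.T0_sub h1) h2).symm
  refine ⟨hG.1.contDiffAt.congr_of_eventuallyEq ev, ?_⟩
  rw [Lap_congr ev, hG.2.1 z (Metric.mem_ball_self hρ), ev.self_of_nhds]

set_option maxHeartbeats 1000000 in
lemma barrier_half {lam : ℝ} (hlam : 0 ≤ lam) {k : Fin 3} {U : ℂ → ℝ} (hU : C.Reg lam U)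
    (hz : ∀ z ∈ C.T, z ∉ C.V → ∀ j, j ≠ k → C.l j z = 0 → U z = 0)
    (hsm : ∀ ε > 0, ∃ δ > 0, ∀ z ∈ C.T, z ∉ C.V → ‖z - C.P k‖ < δ → ‖z - C.P k‖ * |U z| ≤ ε) :
    ∃ A δ, 0 < A ∧ 0 < δ ∧ ∀ z ∈ C.T, z ∉ C.V → ‖z - C.P k‖ ≤ δ → U z ≤ A * ‖z - C.P k‖ := by
  obtain ⟨i, j, hij, hjk, hki, hor⟩ := others k
  obtain ⟨M, hM, hfar⟩ := C.far
  set P := C.P k with hP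
  set b : ℂ → ℝ := fun z => 1 * C.l i z + 1 * C.l j z with hb
  set K := lam + 1 with hK
  have hbcd : ContDiff ℝ ∞ b := (contDiff_const.mul (C.l_contDiff i)).add (contDiff_const.mul (C.l_contDiff j))
  have hddb (v z : ℂ) : dd v b z = dot (C.ν i) v + dot (C.ν j) v := by
    rw [hb, dd_comb (cdd (C.l_contDiff i) z) (cdd (C.l_contDiff j) z), C.dd_l, C.dd_l]; ring
  have hLb (z : ℂ) : Lap b z = 0 := by
    have e (v : ℂ) : dd v b = fun _ => dot (C.ν i) v + dot (C.ν j) v := funext (hddb v)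
    unfold Lap; rw [e, e, dd_const, dd_const]; ring
  have li (z : ℂ) : C.l i z = dot (C.ν i) (z - P) := by
    have := C.l_sub_l i z P
    rw [C.l_P_ne hki.symm] at this; linarith
  have lj (z : ℂ) : C.l j z = dot (C.ν j) (z - P) := by
    have := C.l_sub_l j z P
    rw [C.l_P_ne hjk] at this; linarith
  have hbz (z : ℂ) : b z = (z.re - P.re) * dd 1 b z + (z.im - P.im) * dd I b z := by
    rw [hddb, hddb]; simp only [hb]; rw [li, lj]; simp [dot]; ring
  have hblow : ∀ z ∈ C.T, ‖z - P‖ ≤ M * b z := fun z hz => by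
    have := hfar z hz i j k hij hjk hki
    simp only [hb, one_mul]; exact this
  have hbup : ∀ z, b z ≤ 2 * ‖z - P‖ := fun z => by
    have h1 := abs_dot_le (C.ν i) (z - P)
    have h2 := abs_dot_le (C.ν j) (z - P)
    rw [C.nν, one_mul] at h1 h2
    simp only [hb, one_mul]; rw [li, lj]
    linarith [le_abs_self (dot (C.ν i) (z - P)), le_abs_self (dot (C.ν j) (z - P))]
  obtain ⟨δ, hδ, hδ1, hδ2, hδ3, hδ4⟩ : ∃ δ > 0, δ ≤ 1 ∧ δ ≤ C.h k / 2 ∧ 4 * lam ^ 2 * δ ^ 2 < 1 ∧ K * δ ^ 2 ≤ 1 / 2 := by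
    refine ⟨min (min 1 (C.h k / 2)) (1 / (2 * K)), ?_, (min_le_left _ _).trans (min_le_left _ _), (min_le_left _ _).trans (min_le_right _ _), ?_, ?_⟩
    · have := C.hpos k; positivity
    all_goals
      set d := min (min 1 (C.h k / 2)) (1 / (2 * K)) with hd
      have h0 : 0 < d := by have := C.hpos k; positivity
      have h1 : d ≤ 1 := (min_le_left _ _).trans (min_le_left _ _)
      have h2 : d * (2 * K) ≤ 1 := by rw [← le_div_iff₀ (by positivity)]; exact min_le_right _ _
    · have h3 : 2 * lam * d < 1 := by nlinarith
      nlinarith [mul_nonneg hlam h0.le]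
    · nlinarith
  have hnV : ∀ z, z ∈ C.T → 0 < ‖z - P‖ → ‖z - P‖ ≤ δ → z ∉ C.V := fun z hz h0 h1 => near_notV (h1.trans hδ2) h0
  obtain ⟨B, hB⟩ : ∃ B, ∀ z ∈ C.T, ‖z - P‖ = δ → U z ≤ B := by
    have hc : IsCompact (C.T ∩ Metric.sphere P δ) := C.T_compact.inter_right Metric.isClosed_sphere
    have hco : ContinuousOn U (C.T ∩ Metric.sphere P δ) := hU.cont.mono fun z hz => ⟨hz.1, by
      have : ‖z - P‖ = δ := by rw [← dist_eq_norm]; exact hz.2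
      exact hnV z hz.1 (by rw [this]; exact hδ) this.le⟩
    obtain ⟨B, hB⟩ := hc.bddAbove_image hco
    exact ⟨B, fun z hz hzd => hB ⟨z, ⟨hz, by rw [Metric.mem_sphere, dist_eq_norm]; exact hzd⟩, rfl⟩⟩
  set A := 2 * M * (|B| + 1) / δ with hA
  have hA0 : 0 < A := by positivity
  have key : ∀ ε > 0, ∀ z ∈ C.T, 0 < ‖z - P‖ → ‖z - P‖ ≤ δ → U z ≤ b z * bar A K ε (qq P z) := by
    intro ε hε z0 hz0 hz0p hz0δ
    by_contra hcon
    push Not at hcon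
    obtain ⟨δ', hδ', hU'⟩ := hsm (ε / (2 * M)) (by positivity)
    set r0 := min (δ' / 2) ‖z0 - P‖ with hr0
    have hr0p : 0 < r0 := by positivity
    have bpos : ∀ z ∈ C.T, 0 < ‖z - P‖ → 0 < b z := fun z hz h0 => by
      have := hblow z hz
      by_contra hc; push Not at hc
      nlinarith
    have qpos : ∀ z, 0 < ‖z - P‖ → 0 < qq P z := fun z h => by rw [qq_eq]; positivity
    have barpos : ∀ z, 0 < ‖z - P‖ → ‖z - P‖ ≤ δ → A / 2 + ε * (qq P z)⁻¹ < bar A K ε (qq P z) := by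
      intro z h0 h1
      have := qpos z h0
      have h2 : qq P z ≤ δ ^ 2 := by rw [qq_eq]; gcongr
      unfold bar
      have h3 : 1 / 2 ≤ 1 - K * qq P z := by nlinarith
      have h4 : 0 < ε * (√(qq P z))⁻¹ := by positivity
      nlinarith
    have spos : ∀ z ∈ C.T, 0 < ‖z - P‖ → ‖z - P‖ ≤ δ → 0 < b z * bar A K ε (qq P z) := by
      intro z hz h0 h1
      have h2 := barpos z h0 h1
      have h3 : 0 < ε * (qq P z)⁻¹ := by have := qpos z h0; positivity
      exact mul_pos (bpos z hz h0) (by linarith)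
    set Ω := C.T ∩ {z | r0 ≤ ‖z - P‖ ∧ ‖z - P‖ ≤ δ} with hΩ
    have hΩc : IsCompact Ω := by
      apply C.T_compact.inter_right
      have hcn : Continuous fun z : ℂ => ‖z - P‖ := by fun_prop
      exact (isClosed_le continuous_const hcn).inter (isClosed_le hcn continuous_const)
    have hscd : ∀ z, 0 < ‖z - P‖ → ContDiffAt ℝ ∞ (fun z => b z * bar A K ε (qq P z)) z := fun z h0 =>
      hbcd.contDiffAt.mul ((bar_cd A K ε (qpos z h0)).comp z (qq_cd P).contDiffAt)
    have hΩco : ContinuousOn (fun z => U z / (b z * bar A K ε (qq P z))) Ω := by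
      apply ContinuousOn.div
      · exact hU.cont.mono fun z hz => ⟨hz.1, hnV z hz.1 (hr0p.trans_le hz.2.1) hz.2.2⟩
      · intro z hz
        exact (hscd z (hr0p.trans_le hz.2.1)).continuousAt.continuousWithinAt
      · intro z hz
        exact (spos z hz.1 (hr0p.trans_le hz.2.1) hz.2.2).ne'
    obtain ⟨z1, hz1, hmax⟩ := hΩc.exists_isMaxOn ⟨z0, hz0, min_le_right _ _, hz0δ⟩ hΩco
    set κ := U z1 / (b z1 * bar A K ε (qq P z1)) with hκ
    have h1p := hr0p.trans_le hz1.2.1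
    have hS1 := spos z1 hz1.1 h1p hz1.2.2
    have hκ1 : 1 < κ := by
      have h1 : U z0 / (b z0 * bar A K ε (qq P z0)) ≤ κ := hmax ⟨hz0, min_le_right _ _, hz0δ⟩
      refine lt_of_lt_of_le ?_ h1
      rw [one_lt_div (spos z0 hz0 hz0p hz0δ)]; exact hcon
    have hUk : U z1 = κ * (b z1 * bar A K ε (qq P z1)) := (div_mul_cancel₀ _ hS1.ne').symm
    have hU1 : b z1 * bar A K ε (qq P z1) < U z1 := by rw [hUk]; nlinarith
    have hb1 := bpos z1 hz1.1 h1p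
    have hbl1 := hblow z1 hz1.1
    have hbr := barpos z1 h1p hz1.2.2
    -- not on the outer arc
    have c1 : ‖z1 - P‖ < δ := by
      refine lt_of_le_of_ne hz1.2.2 fun he => ?_
      have h2 := hB z1 hz1.1 he
      have h3 : 0 < ε * (qq P z1)⁻¹ := by have := qpos z1 h1p; positivity
      have h4 : b z1 * (A / 2) < U z1 := by nlinarith
      have h5 : |B| + 1 ≤ b z1 * (A / 2) := by
        have : (|B| + 1) = (δ / M) * (A / 2) := by rw [hA]; field_simp
        rw [this]
        have : δ / M ≤ b z1 := by rw [div_le_iff₀ hM, ← he]; linarith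
        gcongr
      linarith [le_abs_self B]
    -- not on the inner arc
    have c2 : r0 < ‖z1 - P‖ := by
      by_contra hle
      push Not at hle
      have h2 := hU' z1 hz1.1 (hnV z1 hz1.1 h1p hz1.2.2) (by
        have : r0 ≤ δ' / 2 := min_le_left _ _
        linarith)
      have h4 : b z1 * (ε * (qq P z1)⁻¹) < U z1 := by nlinarith
      rw [qq_eq] at h4
      set r := ‖z1 - P‖
      have h5 : r * U z1 ≤ ε / (2 * M) := (mul_le_mul_of_nonneg_left (le_abs_self _) h1p.le).trans h2
      have h6 : ε / M ≤ r * (b z1 * (ε * (r ^ 2)⁻¹)) := by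
        have : r * (b z1 * (ε * (r ^ 2)⁻¹)) = ε * (b z1 / r) := by field_simp
        rw [this, div_eq_mul_inv]
        have : M⁻¹ ≤ b z1 / r := by rw [le_div_iff₀ h1p, inv_mul_le_iff₀ hM]; exact hbl1
        gcongr
      have h7 : r * (b z1 * (ε * (r ^ 2)⁻¹)) < r * U z1 := by gcongr
      have h8 : ε / (2 * M) = ε / M / 2 := by field_simp
      have h9 : 0 < ε / M := by positivity
      linarith
    have c3 : z1 ∈ C.T0 := by
      rcases T0_or_side hz1.1 with h | ⟨m, hm⟩
      · exact h
      · exfalso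
        by_cases hmk : m = k
        · rw [hmk] at hm
          have h1 := (abs_le.1 (C.l_lip k z1 (C.P k))).1
          rw [C.l_P_self, hm] at h1
          have := C.hpos k
          linarith
        · have := hz z1 hz1.1 (hnV z1 hz1.1 h1p hz1.2.2) m hmk hm
          linarith
    obtain ⟨hUcd, hUL⟩ := hU.T0 c3
    have hsc := hscd z1 h1p
    have hloc : IsLocalMax (fun z => 1 * U z + (-κ) * (b z * bar A K ε (qq P z))) z1 := by
      have hcn : Continuous fun z : ℂ => ‖z - P‖ := by fun_prop
      have e1 := hcn.continuousAt.eventually (lt_mem_nhds c2)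
      have e2 := hcn.continuousAt.eventually (gt_mem_nhds c1)
      filter_upwards [e1, e2, C.T0_open.mem_nhds c3] with y y1 y2 y3
      have h1 : U y / (b y * bar A K ε (qq P y)) ≤ κ := hmax ⟨C.T0_sub y3, y1.le, y2.le⟩
      rw [div_le_iff₀ (spos y (C.T0_sub y3) (hr0p.trans y1) y2.le)] at h1
      rw [hUk]; linarith
    have hL := Lap_nonpos_of_isLocalMax ((contDiffAt_const.mul hUcd).add (contDiffAt_const.mul hsc)) hloc
    rw [Lap_comb hUcd hsc, hUL, Lap_bphi hbcd (hLb z1) (hbz z1) (fun s hs => bar_cd A K ε hs) (fun s hs => bar_hd A K ε hs)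
      (bar_hd1 A K ε (qpos z1 h1p)) (qpos z1 h1p)] at hL
    have hq2 : qq P z1 ≤ δ ^ 2 := by rw [qq_eq]; gcongr
    have hsup := bar_super (A := A) (K := K) (ε := ε) (lam := lam) hA0 hε hlam (by rw [hK]; linarith) (qpos z1 h1p)
      (hq2.trans (pow_le_one₀ hδ.le hδ1)) (lt_of_le_of_lt (mul_le_mul_of_nonneg_left hq2 (by positivity)) hδ3)
    rw [hUk] at hL
    have hfin := mul_neg_of_pos_of_neg (mul_pos (show 0 < κ by linarith) hb1) hsup
    linarith
  refine ⟨2 * A, δ, by positivity, hδ, fun z hzT hzV hzδ => ?_⟩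
  have h0 : 0 < ‖z - P‖ := (C.dV_pos.2 hzV).trans_le (C.dV_le z k)
  have hb0 : 0 ≤ b z := by
    have h1 := hzT i; have h2 := hzT j
    simp only [hb]; linarith
  have hle : U z ≤ b z * (A * (1 - K * qq P z)) := by
    refine le_of_forall_pos_le_add fun η hη => ?_
    have hX : 0 ≤ b z * ((qq P z)⁻¹ + (√(qq P z))⁻¹) := by rw [qq_eq]; positivity
    set X := b z * ((qq P z)⁻¹ + (√(qq P z))⁻¹) with hXd
    have h1 := key (η / (X + 1)) (by positivity) z hzT h0 hzδ
    have h2 : η / (X + 1) * X ≤ η := by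
      rw [div_mul_eq_mul_div, div_le_iff₀ (by positivity)]; nlinarith
    refine h1.trans ?_
    unfold bar
    have : b z * (A * (1 - K * qq P z) + η / (X + 1) * ((qq P z)⁻¹ + (√(qq P z))⁻¹)) = b z * (A * (1 - K * qq P z)) + η / (X + 1) * X := by
      rw [hXd]; ring
    rw [this]; linarith
  have h3 : A * (1 - K * qq P z) ≤ A := by
    have : 0 ≤ K * qq P z := by rw [qq_eq]; positivity
    nlinarith
  have := hbup z
  nlinarith

lemma barrier {lam : ℝ} (hlam : 0 ≤ lam) {k : Fin 3} {U : ℂ → ℝ} (hU : C.Reg lam U)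
    (hz : ∀ z ∈ C.T, z ∉ C.V → ∀ j, j ≠ k → C.l j z = 0 → U z = 0)
    (hsm : ∀ ε > 0, ∃ δ > 0, ∀ z ∈ C.T, z ∉ C.V → ‖z - C.P k‖ < δ → ‖z - C.P k‖ * |U z| ≤ ε) :
    ∃ A δ, 0 < A ∧ 0 < δ ∧ ∀ z ∈ C.T, z ∉ C.V → ‖z - C.P k‖ ≤ δ → |U z| ≤ A * ‖z - C.P k‖ := by
  obtain ⟨A, δ, hA, hδ, h⟩ := barrier_half hlam hU hz hsm
  have e : (fun z => (-1) * U z + 0 * U z) = fun z => - U z := by ext z; ring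
  have hU2 := hU.comb hU (-1) 0
  rw [e] at hU2
  obtain ⟨A', δ', hA', hδ', h'⟩ := barrier_half hlam hU2 (fun z hz' hV j hj hl => by rw [hz z hz' hV j hj hl, neg_zero])
    (fun ε hε => by simpa only [abs_neg] using hsm ε hε)
  refine ⟨max A A', min δ δ', by positivity, by positivity, fun z hz hV hd => ?_⟩
  have h1 := h z hz hV (hd.trans (min_le_left _ _))
  have h2 := h' z hz hV (hd.trans (min_le_right _ _))
  have h3 : A * ‖z - C.P k‖ ≤ max A A' * ‖z - C.P k‖ := by gcongr; exact le_max_left _ _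
  have h4 : A' * ‖z - C.P k‖ ≤ max A A' * ‖z - C.P k‖ := by gcongr; exact le_max_right _ _
  rw [abs_le]; constructor <;> linarith

end Cfg
end HS
end

noncomputable section
namespace HS
open Complex Filter Topology MeasureTheory
open scoped ContDiff Convolution

def rt (P : ℂ) (g1 g2 : ℂ → ℝ) (z : ℂ) : ℝ := (z.re - P.re) * g2 z - (z.im - P.im) * g1 z

lemma Lap_re (c : ℝ) (z : ℂ) : Lap (fun z : ℂ => z.re - c) z = 0 := by
  have e (v : ℂ) : dd v (fun z : ℂ => z.re - c) = fun _ => v.re := funext fun z => dd_re v z c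
  unfold Lap; rw [e, e, dd_const, dd_const]; ring
lemma Lap_im (c : ℝ) (z : ℂ) : Lap (fun z : ℂ => z.im - c) z = 0 := by
  have e (v : ℂ) : dd v (fun z : ℂ => z.im - c) = fun _ => v.im := funext fun z => dd_im v z c
  unfold Lap; rw [e, e, dd_const, dd_const]; ring

lemma rt_cd {P : ℂ} {G : ℂ → ℝ} (hG : ContDiff ℝ ∞ G) : ContDiff ℝ ∞ (rt P (dd 1 G) (dd I G)) :=
  ((re_cd P.re).mul (contDiff_dd hG I)).sub ((im_cd P.im).mul (contDiff_dd hG 1))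

lemma dd_rt {P : ℂ} {G : ℂ → ℝ} (hG : ContDiff ℝ ∞ G) (v z : ℂ) : dd v (rt P (dd 1 G) (dd I G)) z =
    (z.re - P.re) * dd v (dd I G) z + v.re * dd I G z - ((z.im - P.im) * dd v (dd 1 G) z + v.im * dd 1 G z) := by
  have a1 := cdd (re_cd P.re) z
  have a2 := cdd (im_cd P.im) z
  have b1 := cdd (contDiff_dd hG 1) z
  have b2 := cdd (contDiff_dd hG I) z
  have : dd v (rt P (dd 1 G) (dd I G)) z = dd v (fun z => (z.re - P.re) * dd I G z - (z.im - P.im) * dd 1 G z) z := rfl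
  rw [this, dd_sub (a1.fun_mul b2) (a2.fun_mul b1), dd_mul a1 b2, dd_mul a2 b1, dd_re, dd_im]; ring

lemma Lap_rt {P : ℂ} {G : ℂ → ℝ} (hG : ContDiff ℝ ∞ G) (z : ℂ) : Lap (rt P (dd 1 G) (dd I G)) z =
    (z.re - P.re) * Lap (dd I G) z - (z.im - P.im) * Lap (dd 1 G) z := by
  have a1 := (re_cd P.re).contDiffAt (x := z)
  have a2 := (im_cd P.im).contDiffAt (x := z)
  have b1 := (contDiff_dd hG 1).contDiffAt (x := z)
  have b2 := (contDiff_dd hG I).contDiffAt (x := z)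
  have e : rt P (dd 1 G) (dd I G) = fun z => 1 * ((z.re - P.re) * dd I G z) + (-1) * ((z.im - P.im) * dd 1 G z) := by
    ext z; unfold rt; ring
  rw [e, Lap_comb (a1.mul b2) (a2.mul b1), Lap_mul a1 b2, Lap_mul a2 b1, Lap_re, Lap_im, dd_re, dd_re, dd_im, dd_im,
    dd_comm hG.contDiffAt 1 I]
  simp; ring

namespace Cfg
variable {C : Cfg}

lemma Pat.rt {lam : ℝ} {f G : ℂ → ℝ} {p : ℂ} {ρ : ℝ} (h : C.Pat lam f p ρ G) (P : ℂ) :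
    C.Pat lam (rt P (C.gr 1 f) (C.gr I f)) p ρ (rt P (dd 1 G) (dd I G)) := by
  refine ⟨rt_cd h.1, fun z hz => ?_, fun z hz hzb => ?_⟩
  · rw [Lap_rt h.1, (h.gr I).2.1 z hz, (h.gr 1).2.1 z hz]; unfold HS.rt; ring
  · unfold HS.rt; rw [(h.gr I).2.2 z hz hzb, (h.gr 1).2.2 z hz hzb]

lemma ISol.rt {lam : ℝ} {f : ℂ → ℝ} (h : C.ISol lam f) (P : ℂ) : C.ISol lam (rt P (C.gr 1 f) (C.gr I f)) := by
  intro p R hR hl hb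
  obtain ⟨G, hG⟩ := h p R hR hl hb
  exact ⟨_, hG.rt P⟩
lemma Reg.rt {lam : ℝ} {f : ℂ → ℝ} (h : C.Reg lam f) (P : ℂ) : C.Reg lam (rt P (C.gr 1 f) (C.gr I f)) := by
  intro z hz hzV
  obtain ⟨ρ, hρ, G, hG⟩ := h z hz hzV
  exact ⟨ρ, hρ, _, hG.rt P⟩

lemma rt_frame (j : Fin 3) : ∃ κ : ℝ, ∀ (P z : ℂ) (G : ℂ → ℝ), rt P (dd 1 G) (dd I G) z =
    κ * (dot (C.τ j) (z - P) * dd (C.ν j) G z - dot (C.ν j) (z - P) * dd (C.τ j) G z) := by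
  obtain ⟨κ, hκ, k1, k2⟩ := C.frame j
  refine ⟨κ, fun P z G => ?_⟩
  have h := C.hτ j
  rw [dd_lin (C.τ j), dd_lin (C.ν j)]
  unfold rt
  unfold dot at h ⊢
  rw [k1, k2, sub_re, sub_im]
  set x := z.re - P.re
  set y := z.im - P.im
  set a := (C.τ j).re
  set b := (C.τ j).im
  linear_combination (-(x * dd I G z - y * dd 1 G z)) * ((a * a + b * b) * hκ + h)

lemma SSol.rt {lam : ℝ} {j : Fin 3} {f : ℂ → ℝ} (h : C.SSol lam j 1 f) {P : ℂ} (hP : C.l j P = 0) :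
    C.SSol lam j (-1) (rt P (C.gr 1 f) (C.gr I f)) := by
  intro p R hR hl hb
  obtain ⟨G, hG, hs⟩ := h p R hR hl hb
  refine ⟨_, hG.rt P, fun z => ?_⟩
  obtain ⟨κ, hκ⟩ := C.rt_frame j
  have h1 := dd_par hG.1 hs z
  have e : C.S j z - P = C.Sl j (z - P) := by rw [← C.S_sub, C.S_fix hP]
  have e1 : dot (C.τ j) (C.Sl j (z - P)) = dot (C.τ j) (z - P) := by
    unfold Sl; rw [dot_sub, dot_smul, C.hτν]; ring
  have e2 : dot (C.ν j) (C.Sl j (z - P)) = - dot (C.ν j) (z - P) := by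
    unfold Sl; rw [dot_sub, dot_smul, C.hν]; ring
  rw [hκ, hκ, e, e1, e2, h1.1, h1.2]; ring

/-- an odd solution vanishes on its side -/
lemma SSol.zero {lam : ℝ} {j : Fin 3} {g : ℂ → ℝ} (h : C.SSol lam j (-1) g) {z : ℂ} (hz : z ∈ C.T) (hV : z ∉ C.V) (hl : C.l j z = 0) :
    g z = 0 := by
  obtain ⟨r, hr, hb⟩ := exists_sideBall hz hV hl
  obtain ⟨R, hR, hRr, hlR⟩ := exists_R lam hr
  obtain ⟨G, hG, hs⟩ := h z R hR hlR (hb.mono hRr)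
  have := hs z
  rw [C.S_fix hl, hG.2.2 z hz (Metric.mem_ball_self (by positivity))] at this
  linarith

lemma pat_at {lam : ℝ} {f : ℂ → ℝ} (h : C.Reg lam f) {z : ℂ} (hz : z ∈ C.T) (hV : z ∉ C.V) :
    ∃ ρ > 0, ∃ G, C.Pat lam f z ρ G := h z hz hV

/-- gradient bound near a vertex for functions bounded by a multiple of the distance and odd on the adjacent sides -/
lemma odd_grad {lam : ℝ} (hlam : 0 ≤ lam) {k : Fin 3} {U : ℂ → ℝ} (hi : C.ISol lam U) (hs : ∀ j, j ≠ k → C.SSol lam j (-1) U)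
    {A δ : ℝ} (hA : 0 < A) (hδ : 0 < δ) (hU : ∀ z ∈ C.T, z ∉ C.V → ‖z - C.P k‖ ≤ δ → |U z| ≤ A * ‖z - C.P k‖) :
    ∃ B δ', 0 < B ∧ 0 < δ' ∧ ∀ z ∈ C.T, z ∉ C.V → ‖z - C.P k‖ ≤ δ' → ∀ v, ‖v‖ ≤ 1 → |C.gr v U z| ≤ B := by
  obtain ⟨c, hc, hc8, hl, hp⟩ := C.patch lam
  obtain ⟨K, hK, hk⟩ := C.good_grad lam hlam
  have hh := C.hpos k
  refine ⟨K / c * (A * 2), min (δ / 2) (C.h k / 4), by positivity, by positivity, fun z hz hV hd v hv => ?_⟩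
  have hd1 : ‖z - C.P k‖ ≤ δ / 2 := hd.trans (min_le_left _ _)
  have hd2 : ‖z - C.P k‖ ≤ C.h k / 4 := hd.trans (min_le_right _ _)
  have hdV := C.near_dV (k := k) (z := z) (by linarith)
  have hd0 := C.dV_pos.2 hV
  have hgood : C.Good lam z (c * C.dV z) (C.dV z / 2) U (-1) := by
    rcases hp z hz hV with h1 | ⟨j, hj, h1⟩
    · exact h1 U (-1) hi
    · exact h1 U (-1) (by norm_num) (hs j (near_side (by linarith) hj))
  have h1 := hk z _ _ U (-1) 0 (A * (2 * C.dV z)) (by positivity) (hl z hz) hgood hz (Or.inr ⟨rfl, rfl⟩) (fun y hy hyz => by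
    rw [sub_zero]
    have e1 : ‖y - C.P k‖ ≤ ‖y - z‖ + ‖z - C.P k‖ := by
      have := norm_add_le (y - z) (z - C.P k); rwa [sub_add_sub_cancel] at this
    have e2 : ‖z - C.P k‖ ≤ ‖y - z‖ + ‖y - C.P k‖ := by
      have := norm_sub_le (y - C.P k) (y - z); rw [sub_sub_sub_cancel_left] at this; linarith
    have h2 := hU y hy (near_notV (k := k) (by linarith) (by linarith)) (by linarith)
    refine h2.trans ?_
    gcongr; linarith) v hv
  refine h1.trans (le_of_eq ?_)
  field_simp

lemma vertex {lam : ℝ} (hlam : 0 ≤ lam) {f : ℂ → ℝ} (h : PSol C lam 1 f) (k : Fin 3)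
    (h1 : ∀ ε > 0, ∃ δ > 0, ∀ z ∈ C.T, z ∉ C.V → ‖z - C.P k‖ < δ →
      ‖z - C.P k‖ * |C.gr 1 f z| ≤ ε ∧ ‖z - C.P k‖ * |C.gr I f z| ≤ ε)
    (h2 : ∃ B δ : ℝ, 0 < δ ∧ ∀ z ∈ C.T, z ∉ C.V → ‖z - C.P k‖ < δ → ‖z - C.P k‖ * |f z| ≤ B) :
    ∃ B δ : ℝ, 0 < δ ∧ ∀ z ∈ C.T, z ∉ C.V → ‖z - C.P k‖ < δ → |C.gr 1 f z| ≤ B ∧ |C.gr I f z| ≤ B := by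
  set P := C.P k with hP
  set U := rt P (C.gr 1 f) (C.gr I f) with hU
  have hUi : C.ISol lam U := h.int.rt P
  have hUs : ∀ j, j ≠ k → C.SSol lam j (-1) U := fun j hj => (h.side j).rt (C.l_P_ne hj)
  have hreim (z : ℂ) : |z.re - P.re| ≤ ‖z - P‖ ∧ |z.im - P.im| ≤ ‖z - P‖ :=
    ⟨by rw [← sub_re]; exact abs_re_le_norm _, by rw [← sub_im]; exact abs_im_le_norm _⟩
  obtain ⟨A, δ0, hA, hδ0, hUb⟩ := C.barrier hlam (k := k) (h.reg.rt P) (fun z hz hV j hj hl => (hUs j hj).zero hz hV hl) (by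
    intro ε hε
    obtain ⟨δ, hδ, h3⟩ := h1 (ε / 2) (by positivity)
    refine ⟨min δ 1, by positivity, fun z hz hV hd => ?_⟩
    obtain ⟨a, b⟩ := h3 z hz hV (hd.trans_le (min_le_left _ _))
    have hd1 := hd.trans_le (min_le_right _ _)
    obtain ⟨r1, r2⟩ := hreim z
    have : |rt P (C.gr 1 f) (C.gr I f) z| ≤ ‖z - P‖ * |C.gr I f z| + ‖z - P‖ * |C.gr 1 f z| := by
      unfold HS.rt
      refine (abs_sub _ _).trans ?_
      rw [abs_mul, abs_mul]; gcongr
    have h4 : |rt P (C.gr 1 f) (C.gr I f) z| ≤ ε := by linarith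
    nlinarith [norm_nonneg (z - P), abs_nonneg (rt P (C.gr 1 f) (C.gr I f) z)])
  obtain ⟨B1, δ1, hB1, hδ1, hgU⟩ := C.odd_grad hlam hUi hUs hA hδ0 hUb
  obtain ⟨B2, δ2, hδ2, hf⟩ := h2
  have hh := C.hpos k
  set δ := min (min δ0 δ1) (min δ2 (C.h k / 2)) with hδd
  have hδ : 0 < δ := by positivity
  set L := lam * |B2| + B1 with hL
  refine ⟨L + A, δ, hδ, fun z hz hV hd => ?_⟩
  have hd0 : ‖z - P‖ ≤ δ0 := hd.le.trans ((min_le_left _ _).trans (min_le_left _ _))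
  have hd1 : ‖z - P‖ ≤ δ1 := hd.le.trans ((min_le_left _ _).trans (min_le_right _ _))
  have hd2 : ‖z - P‖ < δ2 := hd.trans_le ((min_le_right _ _).trans (min_le_left _ _))
  have hd3 : ‖z - P‖ ≤ C.h k / 2 := hd.le.trans ((min_le_right _ _).trans (min_le_right _ _))
  set t1 := ‖z - P‖ with ht1
  have ht1p : 0 < t1 := (C.dV_pos.2 hV).trans_le (C.dV_le z k)
  set e : ℂ := t1⁻¹ • (z - P) with he
  have hen : ‖e‖ = 1 := by rw [he, norm_smul, Real.norm_of_nonneg (by positivity), ← ht1]; field_simp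
  have hze : z = P + t1 • e := by rw [he, smul_smul, mul_inv_cancel₀ ht1p.ne']; simp
  set n : ℂ := I * e with hn
  have hnn : ‖n‖ = 1 := by rw [hn, norm_mul, hen]; simp
  have hee : dot e e = 1 := by rw [dot_self, hen]; norm_num
  have hnn' : dot n n = 1 := by rw [dot_self, hnn]; norm_num
  have hen' : dot e n = 0 := by rw [hn]; simp [dot]; ring
  have hline : ∀ t ∈ Ioc 0 t1, P + t • e ∈ C.T ∧ ‖P + t • e - P‖ = t := by
    intro t ht
    refine ⟨?_, by rw [add_sub_cancel_left, norm_smul, hen, mul_one, Real.norm_of_nonneg ht.1.le]⟩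
    have := C.T_convex (C.P_mem k) hz (a := 1 - t / t1) (b := t / t1)
      (by rw [sub_nonneg, div_le_one ht1p]; exact ht.2) (by have := ht.1; positivity) (by ring)
    convert this using 1
    rw [← hP]
    have : (t / t1) • z = (t / t1) • P + t • e := by
      conv_lhs => rw [hze]
      rw [smul_add, smul_smul, div_mul_cancel₀ _ ht1p.ne']
    rw [this]; module
  have hlV : ∀ t ∈ Ioc 0 t1, P + t • e ∉ C.V := fun t ht => by
    have := (hline t ht).2
    exact near_notV (k := k) (by rw [← hP, this]; exact ht.2.trans hd3) (by rw [← hP, this]; exact ht.1)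
  set φ : ℝ → ℝ := fun t => t * C.gr e f (P + t • e) with hφ
  have hder : ∀ t ∈ Ioc 0 t1, ∃ φ', HasDerivWithinAt φ φ' (Ioc 0 t1) t ∧ |φ'| ≤ L := by
    intro t ht
    obtain ⟨hyT, hyn⟩ := hline t ht
    have hyV := hlV t ht
    obtain ⟨ρ, hρ, G, hG⟩ := h.reg _ hyT hyV
    set y := P + t • e with hy
    have hyb : y ∈ Metric.ball y ρ := Metric.mem_ball_self hρ
    have hlc : Continuous fun s : ℝ => P + s • e := by fun_prop
    have hl1 : HasDerivAt (fun s : ℝ => dd e G (P + s • e)) (dd e (dd e G) y) t :=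
      hasDerivAt_line (cdd (contDiff_dd hG.1 e) _)
    have hd := (hasDerivAt_id' t).fun_mul hl1
    have hL1 := hG.2.1 y hyb
    rw [Lap_rot hG.1.contDiffAt hee hnn' hen', hG.2.2 y hyT hyb] at hL1
    have hu : C.gr n U y = t * dd n (dd n G) y - dd e G y := by
      rw [((hG.rt P).gr_eq hyT hyb).2 n, dd_rt hG.1, dd_dd_lin hG.1.contDiffAt n n, dd_lin e, dd_lin n (dd I G),
        dd_lin n (dd 1 G), dd_comm hG.1.contDiffAt I 1]
      have r1 : y.re - P.re = t * e.re := by rw [hy]; simp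
      have r2 : y.im - P.im = t * e.im := by rw [hy]; simp
      have n1 : n.re = - e.im := by rw [hn]; simp
      have n2 : n.im = e.re := by rw [hn]; simp
      rw [r1, r2, n1, n2]; ring
    refine ⟨1 * dd e G (P + t • e) + t * dd e (dd e G) y, ?_, ?_⟩
    · apply hd.hasDerivWithinAt.congr_of_eventuallyEq
      · filter_upwards [self_mem_nhdsWithin, mem_nhdsWithin_of_mem_nhds (hlc.continuousAt.preimage_mem_nhds (Metric.isOpen_ball.mem_nhds hyb))] with s hs hsb
        simp only [hφ]
        rw [(hG.gr_eq (hline s hs).1 hsb).2 e]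
      · simp only [hφ]
        rw [(hG.gr_eq hyT hyb).2 e]
    · have e1 : 1 * dd e G (P + t • e) + t * dd e (dd e G) y = - lam * (t * f y) - C.gr n U y := by
        rw [hu, ← hy]; linear_combination t * hL1
      rw [e1]
      have b1 := hgU y hyT hyV (by rw [← hP, hyn]; exact ht.2.trans hd1) n hnn.le
      have b2 := hf y hyT hyV (by rw [hyn]; exact ht.2.trans_lt hd2)
      rw [hyn] at b2
      refine (abs_sub _ _).trans ?_
      rw [abs_mul, abs_neg, abs_of_nonneg hlam, abs_mul, abs_of_pos ht.1]
      have : t * |f y| ≤ |B2| := b2.trans (le_abs_self _)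
      have := mul_le_mul_of_nonneg_left this hlam
      linarith
  choose! φ' hφ' hφb using hder
  have hL0 : 0 ≤ L := by positivity
  have hgre : |C.gr e f z| ≤ L := by
    have main : |φ t1| ≤ L * t1 := by
      refine le_of_forall_pos_le_add fun ε hε => ?_
      obtain ⟨δ', hδ', h3⟩ := h1 (ε / 2) (by positivity)
      set t0 := min (δ' / 2) t1 with ht0
      have ht0p : 0 < t0 := by positivity
      have ht0m : t0 ∈ Ioc 0 t1 := ⟨ht0p, min_le_right _ _⟩
      have hsub : Icc t0 t1 ⊆ Ioc 0 t1 := fun t ht => ⟨ht0p.trans_le ht.1, ht.2⟩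
      have mv := (convex_Icc t0 t1).norm_image_sub_le_of_norm_hasDerivWithin_le (f := φ) (f' := φ') (C := L) (x := t0) (y := t1)
        (fun t ht => (hφ' t (hsub ht)).mono hsub) (fun t ht => hφb t (hsub ht)) ⟨le_rfl, ht0m.2⟩ ⟨ht0m.2, le_rfl⟩
      have h4 := h3 _ (hline t0 ht0m).1 (hlV t0 ht0m) (by
        rw [(hline t0 ht0m).2]
        have : t0 ≤ δ' / 2 := min_le_left _ _
        linarith)
      rw [(hline t0 ht0m).2] at h4
      have h5 : |φ t0| ≤ ε := by
        simp only [hφ]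
        rw [gr_lin, abs_mul, abs_of_pos ht0p]
        obtain ⟨a1, a2⟩ := ab_unit (show e.re * e.re + e.im * e.im = 1 from hee)
        exact ab_bd ht0p.le a1 a2 h4.1 h4.2
      rw [Real.norm_eq_abs, Real.norm_eq_abs, abs_of_nonneg (sub_nonneg.2 ht0m.2)] at mv
      have h6 : |φ t1| ≤ |φ t1 - φ t0| + |φ t0| := by
        have := abs_add_le (φ t1 - φ t0) (φ t0); rwa [sub_add_cancel] at this
      nlinarith
    simp only [hφ] at main
    rw [← hze, abs_mul, abs_of_pos ht1p] at main
    nlinarith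
  have hgrn : |C.gr n f z| ≤ A := by
    have h3 := hUb z hz hV (by rw [← hP, ← ht1]; exact hd0)
    rw [← hP, ← ht1] at h3
    have e1 : rt P (C.gr 1 f) (C.gr I f) z = t1 * C.gr n f z := by
      rw [gr_lin n]
      unfold HS.rt
      have r1 : z.re - P.re = t1 * e.re := by conv_lhs => rw [hze]
                                              simp
      have r2 : z.im - P.im = t1 * e.im := by conv_lhs => rw [hze]
                                              simp
      have n1 : n.re = - e.im := by rw [hn]; simp
      have n2 : n.im = e.re := by rw [hn]; simp
      rw [r1, r2, n1, n2]; ring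
    rw [e1, abs_mul, abs_of_pos ht1p] at h3
    nlinarith
  have hA' := (abs_nonneg _).trans hgrn
  obtain ⟨a1, a2⟩ := ab_unit (show e.re * e.re + e.im * e.im = 1 from hee)
  have n1 : n.re = - e.im := by rw [hn]; simp
  have n2 : n.im = e.re := by rw [hn]; simp
  have x1 : C.gr 1 f z = e.re * C.gr e f z + (- e.im) * C.gr n f z := by
    rw [gr_lin e, gr_lin n, n1, n2]; unfold dot at hee; linear_combination (- C.gr 1 f z) * hee
  have x2 : C.gr I f z = e.im * C.gr e f z + e.re * C.gr n f z := by
    rw [gr_lin e, gr_lin n, n1, n2]; unfold dot at hee; linear_combination (- C.gr I f z) * hee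
  have fin (a b x y : ℝ) (ha : |a| ≤ 1) (hb : |b| ≤ 1) (hx : |x| ≤ L) (hy : |y| ≤ A) : |a * x + b * y| ≤ L + A := by
    refine (abs_add_le _ _).trans ?_
    rw [abs_mul, abs_mul]
    exact add_le_add ((mul_le_of_le_one_left (abs_nonneg _) ha).trans hx) ((mul_le_of_le_one_left (abs_nonneg _) hb).trans hy)
  exact ⟨by rw [x1]; exact fin _ _ _ _ a1 (by rwa [abs_neg]) hgre hgrn, by rw [x2]; exact fin _ _ _ _ a2 a1 hgre hgrn⟩

end Cfg
end HS
end

noncomputable section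
namespace HS
open Complex Filter Topology MeasureTheory
open scoped ContDiff Convolution

/-- radial cutoff -/
def ct (P : ℂ) (δ : ℝ) (z : ℂ) : ℝ := th (qq P z / δ ^ 2 - 1)

lemma ct_arg_cd (P : ℂ) (δ : ℝ) : ContDiff ℝ ∞ (fun z => qq P z / δ ^ 2 - 1) :=
  ((qq_cd P).div_const _).sub contDiff_const

lemma ct_cd (P : ℂ) (δ : ℝ) : ContDiff ℝ ∞ (ct P δ) := th_cd.comp (ct_arg_cd P δ)

lemma ct_zero {P z : ℂ} {δ : ℝ} (hδ : 0 < δ) (h : ‖z - P‖ ≤ δ) : ct P δ z = 0 := by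
  apply th_zero
  rw [qq_eq, sub_nonpos, div_le_one (by positivity)]
  exact pow_le_pow_left₀ (norm_nonneg _) h 2

lemma ct_one {P z : ℂ} {δ : ℝ} (hδ : 0 < δ) (h : 2 * δ ^ 2 ≤ ‖z - P‖ ^ 2) : ct P δ z = 1 := by
  apply th_one
  rw [qq_eq, le_sub_iff_add_le, le_div_iff₀ (by positivity)]
  linarith

lemma dd_ct {P z v : ℂ} {δ : ℝ} : dd v (ct P δ) z = deriv th (qq P z / δ ^ 2 - 1) * (dd v (qq P) z / δ ^ 2) := by
  have := dd_th (g := fun z => qq P z / δ ^ 2 - 1) (cdd (ct_arg_cd P δ) z) v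
  have e : dd v (fun z => qq P z / δ ^ 2 - 1) z = dd v (qq P) z / δ ^ 2 := by
    rw [dd_sub (cdd ((qq_cd P).div_const _) z) (by fun_prop), dd_const]
    have : (fun y => qq P y / δ ^ 2) = fun y => (δ ^ 2)⁻¹ * qq P y := by ext y; ring
    rw [this, dd_const_mul (cdd (qq_cd P) z)]; ring
  rw [e] at this
  exact this

lemma dd_ct_zero {P z v : ℂ} {δ : ℝ} (hδ : 0 < δ) (h : ‖z - P‖ < δ ∨ 2 * δ ^ 2 < ‖z - P‖ ^ 2) : dd v (ct P δ) z = 0 := by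
  rw [dd_ct]
  rcases h with h | h
  · rw [th_deriv_neg, zero_mul]
    rw [qq_eq, sub_neg, div_lt_one (by positivity)]
    exact pow_lt_pow_left₀ h (norm_nonneg _) (by norm_num)
  · rw [th_deriv_gt, zero_mul]
    rw [qq_eq, lt_sub_iff_add_lt, lt_div_iff₀ (by positivity)]
    linarith

lemma dd_ct_bound {M : ℝ} (hM : ∀ x, |deriv th x| ≤ M) {P z v : ℂ} {δ : ℝ} (hδ : 0 < δ) (hv : ‖v‖ ≤ 1) :
    |dd v (ct P δ) z| ≤ 4 * M / δ := by
  have hM0 : 0 ≤ M := (abs_nonneg _).trans (hM 0)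
  by_cases h : 2 * δ ^ 2 < ‖z - P‖ ^ 2
  · rw [dd_ct_zero hδ (Or.inr h)]; simp; positivity
  · have h1 : ‖z - P‖ ≤ 2 * δ := by nlinarith [norm_nonneg (z - P)]
    have h2 : |dd v (qq P) z| ≤ 4 * δ := by
      rw [dd_qq]
      have := abs_dot_le v (z - P)
      unfold dot at this
      simp only [sub_re, sub_im] at this
      rw [abs_mul, abs_two]
      have h3 : ‖v‖ * ‖z - P‖ ≤ 1 * (2 * δ) := mul_le_mul hv h1 (norm_nonneg _) zero_le_one
      linarith
    rw [dd_ct, abs_mul, abs_div, abs_of_pos (show (0:ℝ) < δ ^ 2 by positivity)]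
    calc _ ≤ M * (4 * δ / δ ^ 2) := by
          apply mul_le_mul (hM _) _ (by positivity) hM0
          gcongr
      _ = _ := by field_simp

lemma ct_int {M : ℝ} (hM : ∀ x, |deriv th x| ≤ M) {P v : ℂ} {δ : ℝ} (hδ : 0 < δ) (hv : ‖v‖ ≤ 1) {S : Set ℂ} (hS : IsCompact S) :
    ∫ z in S, dd v (ct P δ) z ^ 2 ≤ 64 * M ^ 2 * Real.pi := by
  have hM0 : 0 ≤ M := (abs_nonneg _).trans (hM 0)
  have hle : ∀ z, dd v (ct P δ) z ^ 2 ≤ (Metric.closedBall P (2 * δ)).indicator (fun _ => (4 * M / δ) ^ 2) z := by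
    intro z
    by_cases h : z ∈ Metric.closedBall P (2 * δ)
    · rw [indicator_of_mem h, ← sq_abs]
      exact pow_le_pow_left₀ (abs_nonneg _) (dd_ct_bound hM hδ hv) 2
    · rw [indicator_of_notMem h, dd_ct_zero hδ]
      · simp
      · right
        rw [mem_closedBall_iff_norm, not_le] at h
        nlinarith
  have hi : Integrable ((Metric.closedBall P (2 * δ)).indicator (fun _ => (4 * M / δ) ^ 2)) :=
    (integrable_indicator_iff measurableSet_closedBall).2 (integrableOn_const (measure_closedBall_lt_top.ne))
  have hc : Continuous fun z => dd v (ct P δ) z ^ 2 := ((contDiff_dd (ct_cd P δ) v).continuous).pow 2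
  calc _ ≤ ∫ z in S, (Metric.closedBall P (2 * δ)).indicator (fun _ => (4 * M / δ) ^ 2) z :=
        integral_mono (hc.continuousOn.integrableOn_compact hS) hi.integrableOn hle
    _ ≤ ∫ z, (Metric.closedBall P (2 * δ)).indicator (fun _ => (4 * M / δ) ^ 2) z := by
        apply setIntegral_le_integral hi
        exact Eventually.of_forall fun z => indicator_nonneg (fun _ _ => by positivity) z
    _ = _ := by
        rw [integral_indicator measurableSet_closedBall, setIntegral_const, measureReal_def, Complex.volume_closedBall]
        simp [ENNReal.toReal_ofReal hδ.le]
        field_simp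
        ring

namespace Cfg
variable {C : Cfg}

lemma cut_exists (C : Cfg) : ∃ K : ℝ, 0 < K ∧ ∀ δ > 0, ∃ X : ℂ → ℝ, ContDiff ℝ ∞ X ∧ (∀ z, 0 ≤ X z) ∧
    (∀ z, C.dV z < δ → X z = 0) ∧ (∀ z, 2 * δ ≤ C.dV z → X z = 1) ∧
    (∀ v z, dd v X z ≠ 0 → δ ≤ C.dV z ∧ C.dV z ^ 2 ≤ 2 * δ ^ 2) ∧
    ∀ v, ‖v‖ ≤ 1 → ∫ z in C.T, dd v X z ^ 2 ≤ K := by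
  obtain ⟨M, hM0, hM⟩ := th_deriv_bound
  refine ⟨3 * (3 * (64 * M ^ 2 * Real.pi)), by positivity, fun δ hδ => ?_⟩
  have hd (v z : ℂ) : dd v (fun z => ct (C.P 0) δ z * (ct (C.P 1) δ z * ct (C.P 2) δ z)) z =
      ct (C.P 0) δ z * (ct (C.P 1) δ z * dd v (ct (C.P 2) δ) z + ct (C.P 2) δ z * dd v (ct (C.P 1) δ) z)
        + ct (C.P 1) δ z * ct (C.P 2) δ z * dd v (ct (C.P 0) δ) z := by
    rw [dd_mul (cdd (ct_cd _ δ) z) ((cdd (ct_cd _ δ) z).fun_mul (cdd (ct_cd _ δ) z)), dd_mul (cdd (ct_cd _ δ) z) (cdd (ct_cd _ δ) z)]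
  have hz (z : ℂ) (h : C.dV z < δ) : ct (C.P 0) δ z * (ct (C.P 1) δ z * ct (C.P 2) δ z) = 0 := by
    obtain ⟨k, hk⟩ := C.dV_exists z
    have := ct_zero (P := C.P k) hδ (by rw [← hk]; exact h.le)
    fin_cases k <;> simp at this <;> simp [this]
  refine ⟨fun z => ct (C.P 0) δ z * (ct (C.P 1) δ z * ct (C.P 2) δ z),
    (ct_cd _ δ).mul ((ct_cd _ δ).mul (ct_cd _ δ)),
    fun z => mul_nonneg (th_nonneg _) (mul_nonneg (th_nonneg _) (th_nonneg _)), hz, ?_, ?_, ?_⟩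
  · intro z h
    have : ∀ k, ct (C.P k) δ z = 1 := fun k => ct_one hδ (by nlinarith [C.dV_le z k])
    simp [this]
  · intro v z h
    by_contra hc
    apply h
    by_cases h1 : C.dV z < δ
    · have ev : (fun z => ct (C.P 0) δ z * (ct (C.P 1) δ z * ct (C.P 2) δ z)) =ᶠ[𝓝 z] fun _ => 0 := by
        have : Continuous C.dV := Metric.continuous_infDist_pt _
        filter_upwards [this.continuousAt.eventually_lt_const h1] with y hy using hz y hy
      rw [dd_congr ev, dd_const]
    · have h2 : 2 * δ ^ 2 < C.dV z ^ 2 := by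
        by_contra h3; exact hc ⟨not_lt.1 h1, not_lt.1 h3⟩
      have h3 (k) : dd v (ct (C.P k) δ) z = 0 := dd_ct_zero hδ (Or.inr (h2.trans_le
        (pow_le_pow_left₀ (C.dV_nonneg z) (C.dV_le z k) 2)))
      rw [hd, h3, h3, h3]; ring
  · intro v hv
    have hi (k) : IntegrableOn (fun z => dd v (ct (C.P k) δ) z ^ 2) C.T :=
      (((contDiff_dd (ct_cd _ δ) v).continuous).pow 2).continuousOn.integrableOn_compact C.T_compact
    have hc : Continuous (fun z => dd v (fun z => ct (C.P 0) δ z * (ct (C.P 1) δ z * ct (C.P 2) δ z)) z ^ 2) :=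
      ((contDiff_dd ((ct_cd _ δ).mul ((ct_cd _ δ).mul (ct_cd _ δ))) v).continuous).pow 2
    have hs : Integrable (fun z => 3 * (dd v (ct (C.P 0) δ) z ^ 2 + dd v (ct (C.P 1) δ) z ^ 2 + dd v (ct (C.P 2) δ) z ^ 2))
      (volume.restrict C.T) := (((hi 0).add (hi 1)).add (hi 2)).const_mul 3
    calc _ ≤ ∫ z in C.T, 3 * (dd v (ct (C.P 0) δ) z ^ 2 + dd v (ct (C.P 1) δ) z ^ 2 + dd v (ct (C.P 2) δ) z ^ 2) := by
          apply integral_mono (hc.continuousOn.integrableOn_compact C.T_compact) hs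
          intro z
          simp only [hd]
          have b (k) : 0 ≤ ct (C.P k) δ z ∧ ct (C.P k) δ z ≤ 1 := ⟨th_nonneg _, th_le _⟩
          have b0 := b 0
          have b1 := b 1
          have b2 := b 2
          generalize ct (C.P 0) δ z = a0 at *
          generalize ct (C.P 1) δ z = a1 at *
          generalize ct (C.P 2) δ z = a2 at *
          generalize dd v (ct (C.P 0) δ) z = d0
          generalize dd v (ct (C.P 1) δ) z = d1
          generalize dd v (ct (C.P 2) δ) z = d2
          have aux : ∀ a b x : ℝ, 0 ≤ a ∧ a ≤ 1 → 0 ≤ b ∧ b ≤ 1 → (a * b * x) ^ 2 ≤ x ^ 2 := by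
            intro a b x ha hb
            rw [mul_pow]
            have : (a * b) ^ 2 ≤ 1 := pow_le_one₀ (mul_nonneg ha.1 hb.1) (mul_le_one₀ ha.2 hb.1 hb.2)
            nlinarith [sq_nonneg x]
          have e1 := aux a0 a1 d2 b0 b1
          have e2 := aux a0 a2 d1 b0 b2
          have e3 := aux a1 a2 d0 b1 b2
          have e4 : a0 * (a1 * d2 + a2 * d1) + a1 * a2 * d0 = a0 * a1 * d2 + a0 * a2 * d1 + a1 * a2 * d0 := by ring
          rw [e4]
          generalize a0 * a1 * d2 = x at *
          generalize a0 * a2 * d1 = y at *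
          generalize a1 * a2 * d0 = t at *
          nlinarith [sq_nonneg (x - y), sq_nonneg (y - t), sq_nonneg (x - t)]
      _ = 3 * (∫ z in C.T, dd v (ct (C.P 0) δ) z ^ 2) + 3 * (∫ z in C.T, dd v (ct (C.P 1) δ) z ^ 2) + 3 * (∫ z in C.T, dd v (ct (C.P 2) δ) z ^ 2) := by
          have := integral_add ((hi 0).add (hi 1)) (hi 2)
          have h2 := integral_add (hi 0) (hi 1)
          simp only [Pi.add_apply] at this
          rw [integral_const_mul, this, h2]; ring
      _ ≤ _ := by
          have := fun k => ct_int hM (P := C.P k) hδ hv C.T_compact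
          linarith [this 0, this 1, this 2]

lemma cutN (C : Cfg) : ∃ K : ℝ, 0 < K ∧ ∀ δ > 0, ∀ N : ℕ, 0 < N → ∃ X : ℂ → ℝ, ContDiff ℝ ∞ X ∧
    (∃ δ' > 0, ∀ z, C.dV z < δ' → X z = 0) ∧ (∀ z, 2 * δ ≤ C.dV z → X z = 1) ∧
    ∀ v, ‖v‖ ≤ 1 → ∫ z in C.T, dd v X z ^ 2 ≤ K / N := by
  obtain ⟨K, hK, h⟩ := C.cut_exists
  refine ⟨K, hK, fun δ hδ N hN => ?_⟩
  have hp (n : ℕ) : 0 < δ / 2 ^ n := by positivity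
  choose Y h1 h2 h3 h4 h5 h6 using fun n : ℕ => h (δ / 2 ^ n) (hp n)
  have hmono : ∀ n m : ℕ, n ≤ m → δ / 2 ^ m ≤ δ / 2 ^ n := fun n m hnm => by
    apply div_le_div_of_nonneg_left hδ.le (by positivity)
    exact pow_le_pow_right₀ (by norm_num) hnm
  have hN0 : (N : ℝ) ≠ 0 := by positivity
  have hcd : ContDiff ℝ ∞ (fun z => ∑ n ∈ Finset.range N, Y n z) := ContDiff.sum fun n _ => h1 n
  have hdd (v z : ℂ) : dd v (fun z => (N : ℝ)⁻¹ * ∑ n ∈ Finset.range N, Y n z) z = (N : ℝ)⁻¹ * ∑ n ∈ Finset.range N, dd v (Y n) z := by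
    rw [dd_const_mul (cdd hcd z)]
    congr 1
    unfold dd
    rw [fderiv_fun_sum fun n _ => cdd (h1 n) z]
    simp
  have hdisj (n m : ℕ) (v z : ℂ) (hnm : n < m) (hn : dd v (Y n) z ≠ 0) (hm : dd v (Y m) z ≠ 0) : False := by
    have a1 := (h5 n v z hn).1
    have a2 := (h5 m v z hm).2
    have a3 := hmono (n + 1) m hnm
    have a4 : δ / 2 ^ (n + 1) = (δ / 2 ^ n) / 2 := by rw [pow_succ]; field_simp
    have p1 := hp n
    have p2 := hp m
    generalize δ / 2 ^ n = x at *
    generalize δ / 2 ^ m = y at *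
    rw [a4] at a3
    nlinarith
  have hsq (v z : ℂ) : (∑ n ∈ Finset.range N, dd v (Y n) z) ^ 2 = ∑ n ∈ Finset.range N, dd v (Y n) z ^ 2 := by
    by_cases hex : ∃ n ∈ Finset.range N, dd v (Y n) z ≠ 0
    · obtain ⟨n, hn, hne⟩ := hex
      have hz : ∀ m, m ≠ n → dd v (Y m) z = 0 := by
        intro m hm
        by_contra hc
        rcases lt_or_gt_of_ne hm with h | h
        · exact hdisj m n v z h hc hne
        · exact hdisj n m v z h hne hc
      rw [Finset.sum_eq_single_of_mem n hn fun m _ hm => hz m hm, Finset.sum_eq_single_of_mem n hn fun m _ hm => by rw [hz m hm]; simp]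
    · push Not at hex
      rw [Finset.sum_eq_zero hex, Finset.sum_eq_zero fun m hm => by rw [hex m hm]; simp]; simp
  refine ⟨fun z => (N : ℝ)⁻¹ * ∑ n ∈ Finset.range N, Y n z, contDiff_const.mul hcd, ⟨δ / 2 ^ N, hp N, ?_⟩, ?_, ?_⟩
  · intro z hz
    simp only
    rw [Finset.sum_eq_zero fun n hn => h3 n z (hz.trans_le (hmono n N (Finset.mem_range.1 hn).le))]; simp
  · intro z hz
    simp only
    rw [Finset.sum_congr rfl fun n _ => h4 n z (by have := hmono 0 n (Nat.zero_le _); simp at this; linarith)]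
    simp [hN0]
  · intro v hv
    simp only [hdd, mul_pow, hsq]
    rw [integral_const_mul, integral_finset_sum]
    · calc _ ≤ ((N : ℝ)⁻¹) ^ 2 * ∑ n ∈ Finset.range N, K := by
            gcongr with n; exact h6 n v hv
        _ = _ := by simp; field_simp
    · intro n _
      exact (((contDiff_dd (h1 n) v).continuous).pow 2).continuousOn.integrableOn_compact C.T_compact

end Cfg
end HS
end

noncomputable section
namespace HS
open Complex Filter Topology MeasureTheory
open scoped ContDiff Convolution

lemma pic_one {G H X : ℂ → ℝ} {z : ℂ} (hG : ContDiffAt ℝ ∞ G z) (hH : ContDiffAt ℝ ∞ H z) (hX : ContDiffAt ℝ ∞ X z) (h0 : H z ≠ 0) (v : ℂ) :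
    dd v (fun y => X y ^ 2 * (G y * dd v G y - G y ^ 2 / H y * dd v H y)) z =
      X z ^ 2 * (dd v G z ^ 2 + G z * dd v (dd v G) z - 2 * (G z / H z) * dd v G z * dd v H z + (G z / H z) ^ 2 * dd v H z ^ 2
        - G z ^ 2 / H z * dd v (dd v H) z) + 2 * X z * dd v X z * (G z * (dd v G z - G z / H z * dd v H z)) := by
  have dG := cdda hG
  have dH := cdda hH
  have dX := cdda hX
  have dG' := cdda (contDiffAt_dd hG v)
  have dH' := cdda (contDiffAt_dd hH v)
  have e : (fun y => X y ^ 2 * (G y * dd v G y - G y ^ 2 / H y * dd v H y)) =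
      fun y => (X y * X y) * (G y * dd v G y - (G y * G y * (H y)⁻¹) * dd v H y) := by ext y; ring
  have dI : DifferentiableAt ℝ (fun y => (H y)⁻¹) z := dH.fun_inv h0
  have eI : dd v (fun y => (H y)⁻¹) z = - (H z ^ 2)⁻¹ * dd v H z := dd_chain (φ := fun s => s⁻¹) (hasDerivAt_inv h0) dH v
  rw [e, dd_mul (dX.fun_mul dX) ((dG.fun_mul dG').fun_sub (((dG.fun_mul dG).fun_mul dI).fun_mul dH')), dd_mul dX dX,
    dd_sub (dG.fun_mul dG') (((dG.fun_mul dG).fun_mul dI).fun_mul dH'), dd_mul dG dG', dd_mul ((dG.fun_mul dG).fun_mul dI) dH',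
    dd_mul (dG.fun_mul dG) dI, dd_mul dG dG, eI]
  field_simp
  ring

lemma pic_ineq (x d1 d2 g b1 b2 : ℝ) : 2⁻¹ * x ^ 2 * (b1 ^ 2 + b2 ^ 2) - 2 * g ^ 2 * (d1 ^ 2 + d2 ^ 2) ≤
    x ^ 2 * (b1 ^ 2 + b2 ^ 2) + 2 * x * d1 * (g * b1) + 2 * x * d2 * (g * b2) := by
  nlinarith [sq_nonneg (x * b1 + 2 * g * d1), sq_nonneg (x * b2 + 2 * g * d2)]

namespace Cfg
variable {C : Cfg}

lemma Reg.cdw {lam : ℝ} {g : ℂ → ℝ} (h : C.Reg lam g) {z : ℂ} (hz : z ∈ C.T) (hV : z ∉ C.V) : ContDiffWithinAt ℝ ∞ g C.T z := by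
  obtain ⟨ρ, hρ, G, hG⟩ := h z hz hV
  apply hG.1.contDiffWithinAt.congr_of_eventuallyEq
  · filter_upwards [self_mem_nhdsWithin, mem_nhdsWithin_of_mem_nhds (Metric.ball_mem_nhds z hρ)] with y h1 h2
    exact (hG.2.2 y h1 h2).symm
  · exact (hG.2.2 z hz (Metric.mem_ball_self hρ)).symm

/-- flux -/
def pf (C : Cfg) (a b : ℂ → ℝ) (v z : ℂ) : ℝ := a z * C.gr v a z - a z ^ 2 / b z * C.gr v b z
/-- defect -/
def pb (C : Cfg) (a b : ℂ → ℝ) (v z : ℂ) : ℝ := C.gr v a z - a z / b z * C.gr v b z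

lemma pf_dd {a b X : ℂ → ℝ} {mu lam : ℝ} (ha : C.Reg mu a) (hb : C.Reg lam b) (hX : ContDiff ℝ ∞ X) {z : ℂ} (hz : z ∈ C.T0) (h0 : b z ≠ 0) :
    dd 1 (fun y => X y ^ 2 * C.pf a b 1 y) z + dd I (fun y => X y ^ 2 * C.pf a b I y) z =
      X z ^ 2 * (C.pb a b 1 z ^ 2 + C.pb a b I z ^ 2 + (lam - mu) * a z ^ 2) + 2 * X z * dd 1 X z * (a z * C.pb a b 1 z)
       + 2 * X z * dd I X z * (a z * C.pb a b I z) := by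
  have ev (v : ℂ) : (fun y => X y ^ 2 * C.pf a b v y) =ᶠ[𝓝 z] fun y => X y ^ 2 * (a y * dd v a y - a y ^ 2 / b y * dd v b y) := by
    filter_upwards [C.T0_open.mem_nhds hz] with y hy
    unfold pf
    rw [gr_eq_dd hy, gr_eq_dd hy]
  obtain ⟨ca, la⟩ := ha.T0 hz
  obtain ⟨cb, lb⟩ := hb.T0 hz
  rw [dd_congr (ev 1), dd_congr (ev I), pic_one ca cb hX.contDiffAt h0, pic_one ca cb hX.contDiffAt h0]
  unfold pb
  simp only [gr_eq_dd hz]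
  unfold Lap at la lb
  have l1 : dd I (dd I a) z = - mu * a z - dd 1 (dd 1 a) z := by linarith
  have l2 : dd I (dd I b) z = - lam * b z - dd 1 (dd 1 b) z := by linarith
  rw [l1, l2]
  field_simp
  ring

lemma cut_cont {F : ℂ → ℝ} {δ : ℝ} (hδ : 0 < δ) (h0 : ∀ z, C.dV z < δ → F z = 0) (hF : ContinuousOn F (C.T \ C.V)) : ContinuousOn F C.T := by
  intro z hz
  by_cases hV : z ∈ C.V
  · have hd : C.dV z < δ := by
      have : ¬ 0 < C.dV z := fun h => C.dV_pos.1 h hV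
      linarith
    have ev : F =ᶠ[𝓝 z] fun _ => 0 := by
      have : Continuous C.dV := Metric.continuous_infDist_pt _
      filter_upwards [this.continuousAt.eventually_lt_const hd] with y hy using h0 y hy
    exact (continuousAt_const.congr ev.symm).continuousWithinAt
  · apply (hF z ⟨hz, hV⟩).mono_of_mem_nhdsWithin
    exact inter_mem self_mem_nhdsWithin (mem_nhdsWithin_of_mem_nhds (C.V_fin.isClosed.isOpen_compl.mem_nhds hV))

lemma cut_lip {F X : ℂ → ℝ} {δ : ℝ} (hδ : 0 < δ) (h0 : ∀ z, C.dV z < δ → X z = 0)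
    (hX : ContDiff ℝ ∞ X) (hF : ∀ z ∈ C.T, z ∉ C.V → ContDiffWithinAt ℝ ∞ F C.T z) :
    ∃ K, LipschitzOnWith K (fun y => X y ^ 2 * F y) C.T := by
  apply lip_of_loc
  intro z hz
  by_cases hV : z ∈ C.V
  · left
    have hd : C.dV z < δ := by
      have : ¬ 0 < C.dV z := fun h => C.dV_pos.1 h hV
      linarith
    have : Continuous C.dV := Metric.continuous_infDist_pt _
    filter_upwards [this.continuousAt.eventually_lt_const hd] with y hy
    rw [h0 y hy]; simp
  · right
    exact (((hX.pow 2).contDiffWithinAt).mul (hF z hz hV)).of_le (by norm_cast)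

lemma TSol.bdry {lam : ℝ} {w1 w2 : ℂ → ℝ} (h : TSol C lam w1 w2) {j : Fin 3} {z : ℂ} (hz : z ∈ C.T) (hV : z ∉ C.V) (hl : C.l j z = 0) :
    (C.ν j).re * w1 z + (C.ν j).im * w2 z = 0 ∧ (C.τ j).re * C.gr (C.ν j) w1 z + (C.τ j).im * C.gr (C.ν j) w2 z = 0 := by
  refine ⟨(h.od j).zero hz hV hl, ?_⟩
  have h1 := (h.ev j).gr_ν.zero hz hV hl
  rw [← h1]
  have d1 := (h.reg1.cdw hz hV).differentiableWithinAt (by simp)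
  have d2 := (h.reg2.cdw hz hV).differentiableWithinAt (by simp)
  unfold gr
  rw [fderivWithin_fun_add (C.T_uniq z hz) (d1.const_mul _) (d2.const_mul _), fderivWithin_const_mul (C.T_uniq z hz) d1,
    fderivWithin_const_mul (C.T_uniq z hz) d2]
  rfl

lemma pf_bdry {mu lam : ℝ} {v1 v2 w1 w2 : ℂ → ℝ} (hv : TSol C mu v1 v2) (hw : TSol C lam w1 w2) {j : Fin 3} {z : ℂ}
    (hz : z ∈ C.T) (hV : z ∉ C.V) (hl : C.l j z = 0) (p1 : 0 < w1 z) (p2 : 0 < w2 z) :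
    dot (C.ν j) ⟨C.pf v1 w1 1 z + C.pf v2 w2 1 z, C.pf v1 w1 I z + C.pf v2 w2 I z⟩ = 0 := by
  obtain ⟨a1, a2⟩ := hv.bdry hz hV hl
  obtain ⟨b1, b2⟩ := hw.bdry hz hV hl
  have e : dot (C.ν j) ⟨C.pf v1 w1 1 z + C.pf v2 w2 1 z, C.pf v1 w1 I z + C.pf v2 w2 I z⟩ =
    (v1 z * C.gr (C.ν j) v1 z + v2 z * C.gr (C.ν j) v2 z) - (v1 z ^ 2 / w1 z * C.gr (C.ν j) w1 z + v2 z ^ 2 / w2 z * C.gr (C.ν j) w2 z) := by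
    unfold dot pf
    rw [C.gr_lin (C.ν j) v1, C.gr_lin (C.ν j) v2, C.gr_lin (C.ν j) w1, C.gr_lin (C.ν j) w2]
    simp only
    ring
  rw [e]
  obtain ⟨κ, hκ, n1, n2⟩ := C.frame j
  have t1 := C.τre j
  have t2 := C.τim j
  rw [n1, n2] at a1 b1
  have hκ0 : κ ≠ 0 := by rintro rfl; norm_num at hκ
  have a1' : v2 z * (C.τ j).re = v1 z * (C.τ j).im := by
    apply mul_left_cancel₀ hκ0; linarith
  have b1' : w2 z * (C.τ j).re = w1 z * (C.τ j).im := by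
    apply mul_left_cancel₀ hκ0; linarith
  have ev1 : v2 z = v1 z / (C.τ j).re * (C.τ j).im := by field_simp; linarith
  have ew1 : w2 z = w1 z / (C.τ j).re * (C.τ j).im := by field_simp; linarith
  generalize C.gr (C.ν j) v1 z = x1 at *
  generalize C.gr (C.ν j) v2 z = x2 at *
  generalize C.gr (C.ν j) w1 z = y1 at *
  generalize C.gr (C.ν j) w2 z = y2 at *
  rw [ev1, ew1]
  have f1 : v1 z * x1 + v1 z / (C.τ j).re * (C.τ j).im * x2 = v1 z / (C.τ j).re * ((C.τ j).re * x1 + (C.τ j).im * x2) := by field_simp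
  have f2 : v1 z ^ 2 / w1 z * y1 + (v1 z / (C.τ j).re * (C.τ j).im) ^ 2 / (w1 z / (C.τ j).re * (C.τ j).im) * y2 =
    v1 z ^ 2 / (w1 z * (C.τ j).re) * ((C.τ j).re * y1 + (C.τ j).im * y2) := by field_simp
  rw [f1, f2, a2, b2]; ring

lemma pf_cdw {mu lam : ℝ} {a b : ℂ → ℝ} (ha : C.Reg mu a) (hb : C.Reg lam b) {z : ℂ} (hz : z ∈ C.T) (hV : z ∉ C.V) (p : 0 < b z) (v : ℂ) :
    ContDiffWithinAt ℝ ∞ (C.pf a b v) C.T z :=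
  ((ha.cdw hz hV).mul ((ha.gr v).cdw hz hV)).sub ((((ha.cdw hz hV).pow 2).div (hb.cdw hz hV) p.ne').mul ((hb.gr v).cdw hz hV))

lemma pb_cont {mu lam : ℝ} {a b : ℂ → ℝ} (ha : C.Reg mu a) (hb : C.Reg lam b) (p : ∀ z ∈ C.T, z ∉ C.V → 0 < b z) (v : ℂ) :
    ContinuousOn (C.pb a b v) (C.T \ C.V) :=
  (ha.gr v).cont.sub ((ha.cont.div hb.cont fun z hz => (p z hz.1 hz.2).ne').mul (hb.gr v).cont)

/-- Picone bound -/
lemma picone {mu lam M : ℝ} {v1 v2 w1 w2 : ℂ → ℝ} (hv : TSol C mu v1 v2) (hw : TSol C lam w1 w2)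
    (p1 : ∀ z ∈ C.T, z ∉ C.V → 0 < w1 z) (p2 : ∀ z ∈ C.T, z ∉ C.V → 0 < w2 z)
    (b1 : ∀ z ∈ C.T, z ∉ C.V → v1 z ^ 2 ≤ M) (b2 : ∀ z ∈ C.T, z ∉ C.V → v2 z ^ 2 ≤ M)
    {X : ℂ → ℝ} (hX : ContDiff ℝ ∞ X) {δ : ℝ} (hδ : 0 < δ) (h0 : ∀ z, C.dV z < δ → X z = 0) :
    ∫ z in C.T, X z ^ 2 * (2⁻¹ * (C.pb v1 w1 1 z ^ 2 + C.pb v1 w1 I z ^ 2 + C.pb v2 w2 1 z ^ 2 + C.pb v2 w2 I z ^ 2)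
      + (lam - mu) * (v1 z ^ 2 + v2 z ^ 2)) ≤ 4 * M * ((∫ z in C.T, dd 1 X z ^ 2) + ∫ z in C.T, dd I X z ^ 2) := by
  have r1 := hv.reg1
  have r2 := hv.reg2
  have s1 := hw.reg1
  have s2 := hw.reg2
  have hL (v : ℂ) : ∃ K, LipschitzOnWith K (fun y => X y ^ 2 * (C.pf v1 w1 v y + C.pf v2 w2 v y)) C.T :=
    cut_lip hδ h0 hX fun z hz hV => (pf_cdw r1 s1 hz hV (p1 z hz hV) v).add (pf_cdw r2 s2 hz hV (p2 z hz hV) v)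
  obtain ⟨K1, hK1⟩ := hL 1
  obtain ⟨K2, hK2⟩ := hL I
  have key := C.div_lemma_on hK1 hK2 (by
    intro j z hz hl
    by_cases hV : z ∈ C.V
    · have hd : C.dV z < δ := by
        have : ¬ 0 < C.dV z := fun h => C.dV_pos.1 h hV
        linarith
      rw [h0 z hd]; unfold dot; simp
    · have := pf_bdry hv hw hz hV hl (p1 z hz hV) (p2 z hz hV)
      unfold dot at this ⊢
      simp only at this ⊢
      linear_combination X z ^ 2 * this)
  set E : ℂ → ℝ := fun z => (X z ^ 2 * (C.pb v1 w1 1 z ^ 2 + C.pb v1 w1 I z ^ 2 + (lam - mu) * v1 z ^ 2) + 2 * X z * dd 1 X z * (v1 z * C.pb v1 w1 1 z)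
       + 2 * X z * dd I X z * (v1 z * C.pb v1 w1 I z)) + (X z ^ 2 * (C.pb v2 w2 1 z ^ 2 + C.pb v2 w2 I z ^ 2 + (lam - mu) * v2 z ^ 2) + 2 * X z * dd 1 X z * (v2 z * C.pb v2 w2 1 z)
       + 2 * X z * dd I X z * (v2 z * C.pb v2 w2 I z)) with hE
  have hEeq : ∫ z in C.T, E z = 0 := by
    rw [← key]
    apply integral_congr_ae
    filter_upwards [C.T_ae] with z hz
    have hzV := T0_notV hz
    have hzT := C.T0_sub hz
    have q1 := (p1 z hzT hzV).ne'
    have q2 := (p2 z hzT hzV).ne'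
    have A1 := pf_dd r1 s1 hX hz q1
    have A2 := pf_dd r2 s2 hX hz q2
    have dif {a b : ℂ → ℝ} {m l : ℝ} (ha : C.Reg m a) (hb : C.Reg l b) (p : 0 < b z) (v : ℂ) :
        DifferentiableAt ℝ (fun y => X y ^ 2 * C.pf a b v y) z := by
      have := ((hX.pow 2).contDiffWithinAt (s := C.T)).mul (pf_cdw ha hb hzT hzV p v)
      exact cdda (this.contDiffAt (mem_of_superset (C.T0_open.mem_nhds hz) C.T0_sub))
    have sp (v : ℂ) : dd v (fun y => X y ^ 2 * (C.pf v1 w1 v y + C.pf v2 w2 v y)) z =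
        dd v (fun y => X y ^ 2 * C.pf v1 w1 v y) z + dd v (fun y => X y ^ 2 * C.pf v2 w2 v y) z := by
      rw [← dd_add (dif r1 s1 (p1 z hzT hzV) v) (dif r2 s2 (p2 z hzT hzV) v)]
      congr 1; ext y; ring
    rw [sp, sp]
    simp only [hE]
    rw [← A1, ← A2]; ring
  have cX := hX.continuous
  have c1 := (contDiff_dd hX 1).continuous
  have c2 := (contDiff_dd hX I).continuous
  have cc1 := pb_cont r1 s1 p1 1
  have cc2 := pb_cont r1 s1 p1 I
  have cc3 := pb_cont r2 s2 p2 1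
  have cc4 := pb_cont r2 s2 p2 I
  have cv1 := r1.cont
  have cv2 := r2.cont
  have cXo := cX.continuousOn (s := C.T \ C.V)
  have c1o := c1.continuousOn (s := C.T \ C.V)
  have c2o := c2.continuousOn (s := C.T \ C.V)
  have iE : IntegrableOn E C.T := by
    apply (cut_cont hδ _ _).integrableOn_compact C.T_compact
    · intro z hz; simp only [hE]; rw [h0 z hz]; ring
    · exact (((cXo.pow 2).mul (((cc1.pow 2).add (cc2.pow 2)).add (continuousOn_const.mul (cv1.pow 2)))).add
        (((continuousOn_const.mul cXo).mul c1o).mul (cv1.mul cc1))).add (((continuousOn_const.mul cXo).mul c2o).mul (cv1.mul cc2)) |>.add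
        ((((cXo.pow 2).mul (((cc3.pow 2).add (cc4.pow 2)).add (continuousOn_const.mul (cv2.pow 2)))).add
        (((continuousOn_const.mul cXo).mul c1o).mul (cv2.mul cc3))).add (((continuousOn_const.mul cXo).mul c2o).mul (cv2.mul cc4)))
  have iR : IntegrableOn (fun z => 4 * M * (dd 1 X z ^ 2 + dd I X z ^ 2)) C.T :=
    (continuous_const.mul ((c1.pow 2).add (c2.pow 2))).continuousOn.integrableOn_compact C.T_compact
  set L : ℂ → ℝ := fun z => X z ^ 2 * (2⁻¹ * (C.pb v1 w1 1 z ^ 2 + C.pb v1 w1 I z ^ 2 + C.pb v2 w2 1 z ^ 2 + C.pb v2 w2 I z ^ 2)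
      + (lam - mu) * (v1 z ^ 2 + v2 z ^ 2)) with hL'
  have iL : IntegrableOn L C.T := by
    apply (cut_cont hδ _ _).integrableOn_compact C.T_compact
    · intro z hz; simp only [hL']; rw [h0 z hz]; ring
    · exact (cXo.pow 2).mul ((continuousOn_const.mul ((((cc1.pow 2).add (cc2.pow 2)).add (cc3.pow 2)).add (cc4.pow 2))).add
        (continuousOn_const.mul ((cv1.pow 2).add (cv2.pow 2))))
  have mono : ∫ z in C.T, (L z - 4 * M * (dd 1 X z ^ 2 + dd I X z ^ 2)) ≤ ∫ z in C.T, E z := by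
    apply integral_mono_ae (iL.sub iR) iE
    filter_upwards [C.T_ae] with z hz
    have hzV := T0_notV hz
    have hzT := C.T0_sub hz
    have B1 := b1 z hzT hzV
    have B2 := b2 z hzT hzV
    have I1 := pic_ineq (X z) (dd 1 X z) (dd I X z) (v1 z) (C.pb v1 w1 1 z) (C.pb v1 w1 I z)
    have I2 := pic_ineq (X z) (dd 1 X z) (dd I X z) (v2 z) (C.pb v2 w2 1 z) (C.pb v2 w2 I z)
    have J1 := mul_le_mul_of_nonneg_right B1 (show 0 ≤ dd 1 X z ^ 2 + dd I X z ^ 2 by positivity)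
    have J2 := mul_le_mul_of_nonneg_right B2 (show 0 ≤ dd 1 X z ^ 2 + dd I X z ^ 2 by positivity)
    change L z - 4 * M * (dd 1 X z ^ 2 + dd I X z ^ 2) ≤ E z
    simp only [hE, hL']
    linarith
  have i1 : IntegrableOn (fun z => dd 1 X z ^ 2) C.T := (c1.pow 2).continuousOn.integrableOn_compact C.T_compact
  have i2 : IntegrableOn (fun z => dd I X z ^ 2) C.T := (c2.pow 2).continuousOn.integrableOn_compact C.T_compact
  rw [hEeq, integral_sub iL iR, integral_const_mul, integral_add i1 i2] at mono
  linarith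

/-- conclusion of the Picone argument -/
lemma gs {mu lam M : ℝ} (hml : mu ≤ lam) {v1 v2 w1 w2 : ℂ → ℝ} (hv : TSol C mu v1 v2) (hw : TSol C lam w1 w2)
    (p1 : ∀ z ∈ C.T, z ∉ C.V → 0 < w1 z) (p2 : ∀ z ∈ C.T, z ∉ C.V → 0 < w2 z)
    (b1 : ∀ z ∈ C.T, z ∉ C.V → v1 z ^ 2 ≤ M) (b2 : ∀ z ∈ C.T, z ∉ C.V → v2 z ^ 2 ≤ M) {z : ℂ} (hz : z ∈ C.T0) :
    2⁻¹ * (C.pb v1 w1 1 z ^ 2 + C.pb v1 w1 I z ^ 2 + C.pb v2 w2 1 z ^ 2 + C.pb v2 w2 I z ^ 2)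
      + (lam - mu) * (v1 z ^ 2 + v2 z ^ 2) = 0 := by
  set Q : ℂ → ℝ := fun z => 2⁻¹ * (C.pb v1 w1 1 z ^ 2 + C.pb v1 w1 I z ^ 2 + C.pb v2 w2 1 z ^ 2 + C.pb v2 w2 I z ^ 2)
      + (lam - mu) * (v1 z ^ 2 + v2 z ^ 2) with hQ
  have hQ0 : ∀ y, 0 ≤ Q y := fun y => by
    have := sub_nonneg.2 hml
    simp only [hQ]; positivity
  have hQc : ContinuousOn Q (C.T \ C.V) :=
    (continuousOn_const.mul (((((pb_cont hv.reg1 hw.reg1 p1 1).pow 2).add ((pb_cont hv.reg1 hw.reg1 p1 I).pow 2)).add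
      ((pb_cont hv.reg2 hw.reg2 p2 1).pow 2)).add ((pb_cont hv.reg2 hw.reg2 p2 I).pow 2))).add
        (continuousOn_const.mul ((hv.reg1.cont.pow 2).add (hv.reg2.cont.pow 2)))
  change Q z = 0
  by_contra hne
  have hpos : 0 < Q z := lt_of_le_of_ne (hQ0 z) (Ne.symm hne)
  have hzV := T0_notV hz
  have hd := C.dV_pos.2 hzV
  have hcz : ContinuousAt Q z := by
    apply (hQc z ⟨C.T0_sub hz, hzV⟩).continuousAt
    exact mem_of_superset (C.T0_open.mem_nhds hz) fun y hy => ⟨C.T0_sub hy, T0_notV hy⟩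
  have hcd : Continuous C.dV := Metric.continuous_infDist_pt _
  obtain ⟨r, hr, hb⟩ := Metric.mem_nhds_iff.1 (inter_mem (inter_mem (C.T0_open.mem_nhds hz)
    (hcz.eventually_const_lt (half_lt_self hpos))) (hcd.continuousAt.eventually_const_lt (half_lt_self hd)))
  obtain ⟨K, hK, hcut⟩ := C.cutN
  have hM : 0 ≤ M := (sq_nonneg _).trans (b1 z (C.T0_sub hz) hzV)
  have main (N : ℕ) (hN : 0 < N) : Q z / 2 * volume.real (Metric.ball z r) ≤ 8 * M * K / N := by
    obtain ⟨X, hX, ⟨δ', hδ', h0⟩, h1, hI⟩ := hcut (C.dV z / 4) (by positivity) N hN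
    have P := picone hv hw p1 p2 b1 b2 hX hδ' h0
    have hI1 := hI 1 (by simp)
    have hI2 := hI I (by simp)
    have iL : IntegrableOn (fun y => X y ^ 2 * Q y) C.T := by
      apply (cut_cont hδ' _ _).integrableOn_compact C.T_compact
      · intro y hy; rw [h0 y hy]; ring
      · exact (hX.continuous.continuousOn.pow 2).mul hQc
    have hsub : Metric.ball z r ⊆ C.T := fun y hy => C.T0_sub (hb hy).1.1
    calc Q z / 2 * volume.real (Metric.ball z r) = ∫ y in Metric.ball z r, Q z / 2 := by
          rw [setIntegral_const]; simp; ring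
      _ ≤ ∫ y in Metric.ball z r, X y ^ 2 * Q y := by
          apply setIntegral_mono_on (integrableOn_const measure_ball_lt_top.ne) (iL.mono_set hsub) measurableSet_ball
          intro y hy
          have h2 : C.dV z / 2 < C.dV y := (hb hy).2
          have h3 : Q z / 2 < Q y := (hb hy).1.2
          rw [h1 y (by linarith)]; linarith
      _ ≤ ∫ y in C.T, X y ^ 2 * Q y := by
          apply setIntegral_mono_set iL (Eventually.of_forall fun y => mul_nonneg (sq_nonneg _) (hQ0 y))
          exact HasSubset.Subset.eventuallyLE hsub
      _ ≤ _ := P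
      _ ≤ 4 * M * (K / N + K / N) := by gcongr
      _ = _ := by ring
  have hvol : 0 < volume.real (Metric.ball z r) := by
    rw [measureReal_def]
    exact ENNReal.toReal_pos (Metric.measure_ball_pos volume z hr).ne' measure_ball_lt_top.ne
  obtain ⟨N, hN⟩ := exists_nat_gt (8 * M * K / (Q z / 2 * volume.real (Metric.ball z r)))
  have hq : 0 < Q z / 2 * volume.real (Metric.ball z r) := by positivity
  have hN0 : (0 : ℝ) < N := lt_of_le_of_lt (by positivity) hN
  have := main N (by exact_mod_cast hN0)
  rw [div_lt_iff₀ hq] at hN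
  rw [le_div_iff₀ hN0] at this
  linarith

end Cfg
end HS
end

noncomputable section
namespace HS
open Complex Filter Topology MeasureTheory
open scoped ContDiff Convolution

/-- squared gradient -/
def sg (f : ℂ → ℝ) (z : ℂ) : ℝ := dd 1 f z ^ 2 + dd I f z ^ 2

lemma sg_nonneg (f : ℂ → ℝ) (z : ℂ) : 0 ≤ sg f z := by unfold sg; positivity
lemma sg_meas (f : ℂ → ℝ) : Measurable (sg f) := ((dd_meas f 1).pow_const 2).add ((dd_meas f I).pow_const 2)

lemma dd_sq_le (f : ℂ → ℝ) (v z : ℂ) : dd v f z ^ 2 ≤ ‖v‖ ^ 2 * sg f z := by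
  rw [dd_lin, ← dot_self]; unfold sg dot
  nlinarith [sq_nonneg (v.re * dd I f z - v.im * dd 1 f z)]

lemma line_est {K : NNReal} {f : ℂ → ℝ} (hf : LipschitzWith K f) {x v : ℂ}
    (hd : ∀ᵐ t ∂(volume.restrict (Ioc (0:ℝ) 1)), DifferentiableAt ℝ f (x + t • v)) :
    ENNReal.ofReal ((f (x + v) - f x) ^ 2) ≤ ∫⁻ t in Ioc (0:ℝ) 1, ENNReal.ofReal (‖v‖ ^ 2 * sg f (x + t • v)) := by
  set h : ℝ → ℝ := fun t => f (x + t • v) with hh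
  have hL : LipschitzWith (K * ‖v‖₊) h := by
    have : LipschitzWith ‖v‖₊ (fun t : ℝ => x + t • v) := by
      apply LipschitzWith.of_dist_le_mul
      intro s t
      rw [dist_add_left, dist_eq_norm, ← sub_smul, norm_smul, dist_eq_norm, mul_comm]; rfl
    exact hf.comp this
  have ftc := (hL.lipschitzOnWith (s := uIcc 0 1)).absolutelyContinuousOnInterval.integral_deriv_eq_sub
  have hb : ∀ t, |deriv h t| ≤ K * ‖v‖ := fun t => by
    have := norm_deriv_le_of_lipschitz (x₀ := t) hL
    simpa using this
  have hm : Measurable (deriv h) := measurable_deriv h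
  have i1 : IntegrableOn (deriv h) (Ioc 0 1) :=
    Measure.integrableOn_of_bounded (M := K * ‖v‖) (by simp) hm.aestronglyMeasurable (Eventually.of_forall hb)
  have i2 : IntegrableOn (fun t => deriv h t ^ 2) (Ioc 0 1) :=
    Measure.integrableOn_of_bounded (M := (K * ‖v‖) ^ 2) (by simp) (hm.pow_const 2).aestronglyMeasurable
      (Eventually.of_forall fun t => by
        rw [Real.norm_eq_abs, abs_of_nonneg (sq_nonneg _), ← sq_abs]
        exact pow_le_pow_left₀ (abs_nonneg _) (hb t) 2)
  rw [intervalIntegral.integral_of_le zero_le_one] at ftc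
  have e1 : h 1 - h 0 = f (x + v) - f x := by simp [hh]
  rw [e1] at ftc
  set c := f (x + v) - f x
  have jen : c ^ 2 ≤ ∫ t in Ioc (0:ℝ) 1, deriv h t ^ 2 := by
    have h0 : 0 ≤ ∫ t in Ioc (0:ℝ) 1, (deriv h t - c) ^ 2 := integral_nonneg fun t => sq_nonneg _
    have e : ∫ t in Ioc (0:ℝ) 1, (deriv h t - c) ^ 2 = (∫ t in Ioc (0:ℝ) 1, deriv h t ^ 2) - 2 * c * c + c ^ 2 := by
      have j1 : IntegrableOn (fun t => 2 * c * deriv h t) (Ioc 0 1) := i1.const_mul _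
      have j2 : IntegrableOn (fun t : ℝ => c ^ 2) (Ioc 0 1) := integrableOn_const (by simp)
      have : (fun t => (deriv h t - c) ^ 2) = fun t => (deriv h t ^ 2 - 2 * c * deriv h t) + c ^ 2 := by ext t; ring
      have j3 : IntegrableOn (fun t => deriv h t ^ 2 - 2 * c * deriv h t) (Ioc 0 1) := i2.sub j1
      rw [this, integral_add j3 j2, integral_sub i2 j1, integral_const_mul, ftc]
      simp
    rw [e] at h0
    nlinarith
  calc ENNReal.ofReal (c ^ 2) ≤ ENNReal.ofReal (∫ t in Ioc (0:ℝ) 1, deriv h t ^ 2) := ENNReal.ofReal_le_ofReal jen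
    _ = ∫⁻ t in Ioc (0:ℝ) 1, ENNReal.ofReal (deriv h t ^ 2) :=
        ofReal_integral_eq_lintegral_ofReal i2 (Eventually.of_forall fun t => sq_nonneg _)
    _ ≤ _ := by
        apply lintegral_mono_ae
        filter_upwards [hd] with t ht
        apply ENNReal.ofReal_le_ofReal
        rw [(hasDerivAt_line ht).deriv]
        exact dd_sq_le f v _

/-- gradient density, infinite at bad points -/
def gG (f : ℂ → ℝ) (z : ℂ) : ENNReal := {z | ¬ DifferentiableAt ℝ f z}.indicator (fun _ => ⊤) z + ENNReal.ofReal (sg f z)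

lemma gG_meas (f : ℂ → ℝ) : Measurable (gG f) :=
  (measurable_const.indicator (measurableSet_of_differentiableAt ℝ f).compl).add (sg_meas f).ennreal_ofReal

lemma line_est2 {K : NNReal} {f : ℂ → ℝ} (hf : LipschitzWith K f) {d : ℝ} {x y : ℂ} (hv : ‖y - x‖ ≤ d) :
    ENNReal.ofReal ((f y - f x) ^ 2) ≤ ENNReal.ofReal (d ^ 2) * ∫⁻ t in Ioc (0:ℝ) 1, gG f (x + t • (y - x)) := by
  by_cases hd0 : d = 0
  · subst hd0
    have : y = x := by
      have := norm_le_zero_iff.1 hv; exact sub_eq_zero.1 this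
    simp [this]
  have hmap : Measurable fun t : ℝ => x + t • (y - x) := by fun_prop
  by_cases h : ∫⁻ t in Ioc (0:ℝ) 1, gG f (x + t • (y - x)) = ⊤
  · rw [h, ENNReal.mul_top]
    · exact le_top
    · simpa using hd0
  · have hlt := ae_lt_top ((gG_meas f).comp hmap) h
    have hd : ∀ᵐ t ∂(volume.restrict (Ioc (0:ℝ) 1)), DifferentiableAt ℝ f (x + t • (y - x)) := by
      filter_upwards [hlt] with t ht
      by_contra hc
      simp only [Function.comp, gG] at ht
      rw [indicator_of_mem (by exact hc)] at ht
      simp at ht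
    have := line_est hf hd
    rw [add_sub_cancel] at this
    refine this.trans ?_
    have hm2 : Measurable fun t : ℝ => gG f (x + t • (y - x)) := (gG_meas f).comp hmap
    rw [← lintegral_const_mul _ hm2]
    apply lintegral_mono
    intro t
    show ENNReal.ofReal _ ≤ _ * _
    refine le_trans (ENNReal.ofReal_le_ofReal (mul_le_mul_of_nonneg_right (pow_le_pow_left₀ (norm_nonneg _) hv 2) (sg_nonneg f _))) ?_
    rw [ENNReal.ofReal_mul (by positivity)]
    gcongr
    unfold gG
    exact le_add_self

lemma gG_int {K : NNReal} {f : ℂ → ℝ} (hf : LipschitzWith K f) (Ω : Set ℂ) : ∫⁻ z in Ω, gG f z = ∫⁻ z in Ω, ENNReal.ofReal (sg f z) := by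
  apply lintegral_congr_ae
  apply ae_restrict_of_ae
  filter_upwards [hf.ae_differentiableAt] with z hz
  unfold gG
  rw [indicator_of_notMem (by simpa using hz), zero_add]

lemma conv_half {Ω : Set ℂ} (hc : Convex ℝ Ω) (hm : MeasurableSet Ω) {G : ℂ → ENNReal} (hG : Measurable G) {t : ℝ} (ht : 1 / 2 ≤ t) (ht1 : t ≤ 1)
    {x : ℂ} (hx : x ∈ Ω) : ∫⁻ y in Ω, G (x + t • (y - x)) ≤ 4 * ∫⁻ y in Ω, G y := by
  have ht0 : t ≠ 0 := by linarith
  calc ∫⁻ y in Ω, G (x + t • (y - x)) ≤ ∫⁻ y in Ω, Ω.indicator G ((x - t • x) + t • y) := by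
        apply setLIntegral_mono' hm
        intro y hy
        have e : x + t • (y - x) = (x - t • x) + t • y := by rw [smul_sub]; abel
        have : x + t • (y - x) ∈ Ω := hc.add_smul_sub_mem hx hy ⟨by linarith, ht1⟩
        rw [← e, indicator_of_mem this]
    _ ≤ ∫⁻ y, Ω.indicator G ((x - t • x) + t • y) := setLIntegral_le_lintegral _ _
    _ = ∫⁻ y, Ω.indicator G ((x - t • x) + y) ∂(Measure.map (t • ·) volume) := by
        have hm2 : Measurable fun y => Ω.indicator G ((x - t • x) + y) := (hG.indicator hm).comp (measurable_const_add _)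
        rw [lintegral_map hm2 (measurable_const_smul t)]
    _ = ENNReal.ofReal |(t ^ Module.finrank ℝ ℂ)⁻¹| * ∫⁻ y, Ω.indicator G ((x - t • x) + y) := by
        rw [Measure.map_addHaar_smul volume ht0, lintegral_smul_measure]; rfl
    _ = ENNReal.ofReal |(t ^ Module.finrank ℝ ℂ)⁻¹| * ∫⁻ y in Ω, G y := by
        rw [lintegral_add_left_eq_self, lintegral_indicator hm]
    _ ≤ 4 * ∫⁻ y in Ω, G y := by
        gcongr
        rw [Complex.finrank_real_complex]
        rw [show (4 : ENNReal) = ENNReal.ofReal 4 by norm_num]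
        apply ENNReal.ofReal_le_ofReal
        rw [abs_of_pos (by positivity)]
        apply inv_le_of_inv_le₀ (by norm_num)
        nlinarith

lemma conv_all {Ω : Set ℂ} (hc : Convex ℝ Ω) (hm : MeasurableSet Ω) {G : ℂ → ENNReal} (hG : Measurable G) {t : ℝ} (ht : 0 ≤ t) (ht1 : t ≤ 1) :
    ∫⁻ x in Ω, ∫⁻ y in Ω, G (x + t • (y - x)) ≤ volume Ω * (4 * ∫⁻ y in Ω, G y) := by
  by_cases h : 1 / 2 ≤ t
  · calc _ ≤ ∫⁻ x in Ω, (4 * ∫⁻ y in Ω, G y) := by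
          apply setLIntegral_mono' hm
          intro x hx; exact conv_half hc hm hG h ht1 hx
      _ = _ := by rw [setLIntegral_const, mul_comm]
  · rw [lintegral_lintegral_swap]
    · calc _ ≤ ∫⁻ x in Ω, (4 * ∫⁻ y in Ω, G y) := by
            apply setLIntegral_mono' hm
            intro x hx
            have := conv_half hc hm hG (t := 1 - t) (by linarith) (by linarith) hx
            refine le_trans (le_of_eq ?_) this
            congr 1; ext y
            congr 1
            simp only [real_smul]; push_cast; ring
        _ = _ := by rw [setLIntegral_const, mul_comm]
    · apply Measurable.aemeasurable
      apply hG.comp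
      fun_prop

lemma poin0 {K : NNReal} {f : ℂ → ℝ} (hf : LipschitzWith K f) {Ω : Set ℂ} (hc : Convex ℝ Ω) (hm : MeasurableSet Ω) {d : ℝ}
    (hd : ∀ x ∈ Ω, ∀ y ∈ Ω, ‖y - x‖ ≤ d) :
    ∫⁻ x in Ω, ∫⁻ y in Ω, ENNReal.ofReal ((f y - f x) ^ 2) ≤
      ENNReal.ofReal (d ^ 2) * (volume Ω * (4 * ∫⁻ y in Ω, ENNReal.ofReal (sg f y))) := by
  have hG := gG_meas f
  calc _ ≤ ∫⁻ x in Ω, ∫⁻ y in Ω, ENNReal.ofReal (d ^ 2) * ∫⁻ t in Ioc (0:ℝ) 1, gG f (x + t • (y - x)) := by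
        apply setLIntegral_mono' hm
        intro x hx
        apply setLIntegral_mono' hm
        intro y hy
        exact line_est2 hf (hd x hx y hy)
    _ = ENNReal.ofReal (d ^ 2) * ∫⁻ x in Ω, ∫⁻ y in Ω, ∫⁻ t in Ioc (0:ℝ) 1, gG f (x + t • (y - x)) := by
        simp_rw [lintegral_const_mul' _ _ ENNReal.ofReal_ne_top]
    _ = ENNReal.ofReal (d ^ 2) * ∫⁻ t in Ioc (0:ℝ) 1, ∫⁻ x in Ω, ∫⁻ y in Ω, gG f (x + t • (y - x)) := by
        congr 1
        have e (x : ℂ) : ∫⁻ y in Ω, ∫⁻ t in Ioc (0:ℝ) 1, gG f (x + t • (y - x)) = ∫⁻ t in Ioc (0:ℝ) 1, ∫⁻ y in Ω, gG f (x + t • (y - x)) := by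
          apply lintegral_lintegral_swap
          apply Measurable.aemeasurable
          apply hG.comp; fun_prop
        simp_rw [e]
        apply lintegral_lintegral_swap
        apply Measurable.aemeasurable
        have : Measurable fun p : (ℂ × ℝ) × ℂ => gG f (p.1.1 + p.1.2 • (p.2 - p.1.1)) := by apply hG.comp; fun_prop
        exact this.lintegral_prod_right'
    _ ≤ ENNReal.ofReal (d ^ 2) * ∫⁻ t in Ioc (0:ℝ) 1, (volume Ω * (4 * ∫⁻ y in Ω, gG f y)) := by
        gcongr 1
        apply setLIntegral_mono' measurableSet_Ioc
        intro t ht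
        exact conv_all hc hm hG ht.1.le ht.2
    _ = _ := by rw [setLIntegral_const, gG_int hf]; simp

lemma sg_le {K : NNReal} {f : ℂ → ℝ} (hf : LipschitzWith K f) (z : ℂ) : sg f z ≤ 2 * K ^ 2 := by
  have h1 := dd_lip_bound hf 1 z
  have h2 := dd_lip_bound hf I z
  simp only [norm_one, mul_one, norm_I] at h1 h2
  have h3 := pow_le_pow_left₀ (abs_nonneg _) h1 2
  have h4 := pow_le_pow_left₀ (abs_nonneg _) h2 2
  rw [sq_abs] at h3 h4
  unfold sg; linarith

lemma poin {K : NNReal} {f : ℂ → ℝ} (hf : LipschitzWith K f) {Ω : Set ℂ} (hc : Convex ℝ Ω) (hm : MeasurableSet Ω) {d : ℝ}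
    (hd : ∀ x ∈ Ω, ∀ y ∈ Ω, ‖y - x‖ ≤ d) (hfin : volume Ω ≠ ⊤) (hi1 : IntegrableOn f Ω) (hi2 : IntegrableOn (fun z => f z ^ 2) Ω) :
    volume.real Ω * ∫ x in Ω, f x ^ 2 ≤ (∫ x in Ω, f x) ^ 2 + 2 * d ^ 2 * volume.real Ω * ∫ x in Ω, sg f x := by
  haveI : IsFiniteMeasure (volume.restrict Ω) := ⟨by simpa using hfin.lt_top⟩
  have isg : IntegrableOn (sg f) Ω :=
    Measure.integrableOn_of_bounded (M := 2 * K ^ 2) hfin (sg_meas f).aestronglyMeasurable (Eventually.of_forall fun z => by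
      rw [Real.norm_eq_abs, abs_of_nonneg (sg_nonneg f z)]; exact sg_le hf z)
  have P := poin0 hf hc hm hd
  set m := volume.real Ω with hmm
  set A := ∫ x in Ω, f x ^ 2 with hA
  set B := ∫ x in Ω, f x with hB
  have ein (x : ℂ) : Integrable (fun y => (f y - f x) ^ 2) (volume.restrict Ω) ∧ ∫ y in Ω, (f y - f x) ^ 2 = A - 2 * f x * B + m * f x ^ 2 := by
    have j1 : IntegrableOn (fun y => 2 * f x * f y) Ω := hi1.const_mul _
    have j2 : IntegrableOn (fun y : ℂ => f x ^ 2) Ω := integrableOn_const hfin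
    have j3 : IntegrableOn (fun y => f y ^ 2 - 2 * f x * f y) Ω := hi2.sub j1
    have e : (fun y => (f y - f x) ^ 2) = fun y => (f y ^ 2 - 2 * f x * f y) + f x ^ 2 := by ext t; ring
    rw [e]
    refine ⟨j3.add j2, ?_⟩
    rw [integral_add j3 j2, integral_sub hi2 j1, integral_const_mul, setIntegral_const, ← hA, ← hB]; simp [hmm]
  have eo : Integrable (fun x => A - 2 * f x * B + m * f x ^ 2) (volume.restrict Ω) ∧
      ∫ x in Ω, (A - 2 * f x * B + m * f x ^ 2) = 2 * m * A - 2 * B ^ 2 := by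
    have j1 : IntegrableOn (fun x => 2 * B * f x) Ω := hi1.const_mul _
    have j2 : IntegrableOn (fun y : ℂ => A) Ω := integrableOn_const hfin
    have j3 : IntegrableOn (fun x => A - 2 * B * f x) Ω := j2.sub j1
    have j4 : IntegrableOn (fun x => m * f x ^ 2) Ω := hi2.const_mul _
    have e : (fun x => A - 2 * f x * B + m * f x ^ 2) = fun x => (A - 2 * B * f x) + m * f x ^ 2 := by ext t; ring
    rw [e]
    refine ⟨j3.add j4, ?_⟩
    rw [integral_add j3 j4, integral_sub j2 j1, integral_const_mul, integral_const_mul, setIntegral_const, ← hB, ← hA]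
    simp only [smul_eq_mul, ← hmm]; ring
  have e1 (x : ℂ) : ∫⁻ y in Ω, ENNReal.ofReal ((f y - f x) ^ 2) = ENNReal.ofReal (A - 2 * f x * B + m * f x ^ 2) := by
    rw [← (ein x).2, ofReal_integral_eq_lintegral_ofReal (ein x).1 (Eventually.of_forall fun y => sq_nonneg _)]
  simp_rw [e1] at P
  rw [← ofReal_integral_eq_lintegral_ofReal eo.1 (Eventually.of_forall fun x => by
      simp only [Pi.zero_apply]; rw [← (ein x).2]; exact integral_nonneg fun y => sq_nonneg _), eo.2,
    ← ofReal_integral_eq_lintegral_ofReal isg (Eventually.of_forall fun x => sg_nonneg f x)] at P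
  have hv : volume Ω = ENNReal.ofReal m := (ENNReal.ofReal_toReal hfin).symm
  have hS : 0 ≤ ∫ x in Ω, sg f x := integral_nonneg fun x => sg_nonneg f x
  have hm0 : 0 ≤ m := measureReal_nonneg
  rw [hv, show (4 : ENNReal) = ENNReal.ofReal 4 by norm_num, ← ENNReal.ofReal_mul (by norm_num), ← ENNReal.ofReal_mul hm0,
    ← ENNReal.ofReal_mul (by positivity), ENNReal.ofReal_le_ofReal_iff (by positivity)] at P
  linarith

end HS
end

noncomputable section
namespace HS
open Complex Filter Topology MeasureTheory
open scoped ContDiff Convolution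

lemma l2_norm {μ : Measure ℂ} {f : ℂ → ℝ} (hf : MemLp f 2 μ) : ‖hf.toLp f‖ ^ 2 = ∫ z, f z ^ 2 ∂μ := by
  rw [← real_inner_self_eq_norm_sq, L2.inner_def]
  apply integral_congr_ae
  filter_upwards [hf.coeFn_toLp] with z hz
  rw [hz]; simp [sq]

lemma l2_complete {μ : Measure ℂ} {f : ℕ → ℂ → ℝ} (hf : ∀ n, MemLp (f n) 2 μ)
    (hc : ∀ ε > 0, ∃ n0, ∀ n ≥ n0, ∀ m ≥ n0, ∫ z, (f n z - f m z) ^ 2 ∂μ ≤ ε) :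
    ∃ g, MemLp g 2 μ ∧ Tendsto (fun n => ∫ z, (f n z - g z) ^ 2 ∂μ) atTop (𝓝 0) := by
  have hcs : CauchySeq fun n => (hf n).toLp (f n) := by
    rw [Metric.cauchySeq_iff]
    intro ε hε
    obtain ⟨n0, h0⟩ := hc ((ε / 2) ^ 2) (by positivity)
    refine ⟨n0, fun n hn m hm => ?_⟩
    have h1 := h0 n hn m hm
    have e := l2_norm ((hf n).sub (hf m))
    rw [MemLp.toLp_sub (hf n) (hf m)] at e
    simp only [Pi.sub_apply] at e
    rw [← e] at h1
    rw [dist_eq_norm]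
    have := abs_le_of_sq_le_sq h1 (by positivity)
    rw [abs_norm] at this
    exact this.trans_lt (by linarith)
  obtain ⟨g, hg⟩ := cauchySeq_tendsto_of_complete hcs
  refine ⟨g, Lp.memLp g, ?_⟩
  have h1 : Tendsto (fun n => ‖(hf n).toLp (f n) - g‖ ^ 2) atTop (𝓝 0) := by
    have := (tendsto_iff_norm_sub_tendsto_zero.1 hg).pow 2
    simpa using this
  refine h1.congr fun n => ?_
  have e := l2_norm ((hf n).sub (Lp.memLp g))
  rw [MemLp.toLp_sub (hf n) (Lp.memLp g), Lp.toLp_coeFn] at e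
  rw [e]; rfl

namespace Cfg
variable {C : Cfg}

def cell (C : Cfg) (N : ℕ) (k : ℤ × ℤ) : Set ℂ := C.T ∩ {z | ⌊(N:ℝ) * z.re⌋ = k.1 ∧ ⌊(N:ℝ) * z.im⌋ = k.2}

lemma cell_meas (C : Cfg) (N : ℕ) (k : ℤ × ℤ) : MeasurableSet (C.cell N k) := by
  apply C.T_meas.inter
  have h1 : Measurable fun z : ℂ => ⌊(N:ℝ) * z.re⌋ := Int.measurable_floor.comp (measurable_re.const_mul _)
  have h2 : Measurable fun z : ℂ => ⌊(N:ℝ) * z.im⌋ := Int.measurable_floor.comp (measurable_im.const_mul _)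
  exact (h1 (measurableSet_singleton k.1)).inter (h2 (measurableSet_singleton k.2))

lemma cell_convex (C : Cfg) (N : ℕ) (k : ℤ × ℤ) : Convex ℝ (C.cell N k) := by
  apply C.T_convex.inter
  have e : {z : ℂ | ⌊(N:ℝ) * z.re⌋ = k.1 ∧ ⌊(N:ℝ) * z.im⌋ = k.2} =
      ((N:ℝ) • reLm) ⁻¹' Ico (k.1:ℝ) (k.1 + 1) ∩ ((N:ℝ) • imLm) ⁻¹' Ico (k.2:ℝ) (k.2 + 1) := by
    ext z; simp [Int.floor_eq_iff]
  rw [e]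
  exact ((convex_Ico _ _).linear_preimage _).inter ((convex_Ico _ _).linear_preimage _)

lemma cell_diam {N : ℕ} (hN : 0 < N) {k : ℤ × ℤ} {x y : ℂ} (hx : x ∈ C.cell N k) (hy : y ∈ C.cell N k) : ‖y - x‖ ≤ 2 / N := by
  have hN' : (0:ℝ) < N := by exact_mod_cast hN
  obtain ⟨-, h1, h2⟩ := hx
  obtain ⟨-, h3, h4⟩ := hy
  rw [Int.floor_eq_iff] at h1 h2 h3 h4
  refine (norm_le_abs_re_add_abs_im _).trans ?_
  rw [le_div_iff₀ hN', sub_re, sub_im]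
  have a1 : (N:ℝ) * |y.re - x.re| ≤ 1 := by
    rw [← abs_of_pos hN', ← abs_mul, abs_le]; constructor <;> nlinarith
  have a2 : (N:ℝ) * |y.im - x.im| ≤ 1 := by
    rw [← abs_of_pos hN', ← abs_mul, abs_le]; constructor <;> nlinarith
  linarith

lemma cell_cover (C : Cfg) (N : ℕ) : ∃ F : Finset (ℤ × ℤ), C.T = ⋃ k ∈ F, C.cell N k := by
  obtain ⟨R, hR⟩ := C.T_bounded.exists_norm_le
  have key (z : ℂ) (hz : z ∈ C.T) (x : ℝ) (hx : |x| ≤ ‖z‖) : ⌊(N:ℝ) * x⌋ ∈ Finset.Icc ⌊-((N:ℝ) * R)⌋ ⌊(N:ℝ) * R⌋ := by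
    have h := abs_le.1 (hx.trans (hR z hz))
    have hN : (0:ℝ) ≤ N := by positivity
    rw [Finset.mem_Icc]
    exact ⟨Int.floor_le_floor (by nlinarith), Int.floor_le_floor (by nlinarith)⟩
  refine ⟨Finset.Icc ⌊-((N:ℝ) * R)⌋ ⌊(N:ℝ) * R⌋ ×ˢ Finset.Icc ⌊-((N:ℝ) * R)⌋ ⌊(N:ℝ) * R⌋, ?_⟩
  ext z
  simp only [mem_iUnion, exists_prop]
  constructor
  · intro hz
    exact ⟨(⌊(N:ℝ) * z.re⌋, ⌊(N:ℝ) * z.im⌋), Finset.mem_product.2 ⟨key z hz _ (abs_re_le_norm z), key z hz _ (abs_im_le_norm z)⟩, hz, rfl, rfl⟩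
  · rintro ⟨k, -, hz⟩; exact hz.1

lemma cell_sum {N : ℕ} {F : Finset (ℤ × ℤ)} (hF : C.T = ⋃ k ∈ F, C.cell N k) {g : ℂ → ℝ} (hg : IntegrableOn g C.T) :
    ∫ z in C.T, g z = ∑ k ∈ F, ∫ z in C.cell N k, g z := by
  conv_lhs => rw [hF]
  apply integral_biUnion_finset
  · intro k _; exact C.cell_meas N k
  · intro k _ k' _ hkk
    rw [Function.onFun, Set.disjoint_left]
    rintro z ⟨-, h1, h2⟩ ⟨-, h3, h4⟩
    exact hkk (Prod.ext (h1.symm.trans h3) (h2.symm.trans h4))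
  · intro k _; exact hg.mono_set inter_subset_left

lemma T_fin (C : Cfg) : volume C.T ≠ ⊤ := C.T_compact.measure_lt_top.ne

lemma sg_int {K : NNReal} {f : ℂ → ℝ} (hf : LipschitzWith K f) : IntegrableOn (sg f) C.T :=
  Measure.integrableOn_of_bounded (M := 2 * K ^ 2) C.T_fin (sg_meas f).aestronglyMeasurable (Eventually.of_forall fun z => by
      rw [Real.norm_eq_abs, abs_of_nonneg (sg_nonneg f z)]; exact sg_le hf z)

lemma cont_int {f : ℂ → ℝ} (hf : Continuous f) : IntegrableOn f C.T := hf.continuousOn.integrableOn_compact C.T_compact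

lemma rel_est (C : Cfg) {ε : ℝ} (hε : 0 < ε) : ∃ (N : ℕ) (F : Finset (ℤ × ℤ)) (m : ℤ × ℤ → ℝ), (∀ k, 0 ≤ m k) ∧
    ∀ (K : NNReal) (f : ℂ → ℝ), LipschitzWith K f →
      ∫ z in C.T, f z ^ 2 ≤ (∑ k ∈ F, m k * (∫ z in C.cell N k, f z) ^ 2) + ε * ∫ z in C.T, sg f z := by
  obtain ⟨N, hN⟩ := exists_nat_gt (8 / ε + 1)
  have hN0 : (0:ℝ) < N := lt_trans (by positivity) hN
  have hN1 : (1:ℝ) ≤ N := by have : 0 < 8 / ε := by positivity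
                             linarith
  have hN' : 0 < N := by exact_mod_cast hN0
  have hd : 2 * (2 / (N:ℝ)) ^ 2 ≤ ε := by
    have h8 : 8 ≤ ε * N := by
      have : 8 / ε < N := by linarith
      rw [div_lt_iff₀ hε] at this; linarith
    have : 2 * (2 / (N:ℝ)) ^ 2 = 8 / (N * N) := by field_simp; norm_num
    rw [this, div_le_iff₀ (by positivity)]
    nlinarith
  obtain ⟨F, hF⟩ := C.cell_cover N
  refine ⟨N, F, fun k => (volume.real (C.cell N k))⁻¹, fun k => inv_nonneg.2 measureReal_nonneg, fun K f hf => ?_⟩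
  have hf2 : IntegrableOn (fun z => f z ^ 2) C.T := C.cont_int (hf.continuous.pow 2)
  have isg := C.sg_int hf
  rw [C.cell_sum hF hf2, C.cell_sum hF isg, Finset.mul_sum, ← Finset.sum_add_distrib]
  apply Finset.sum_le_sum
  intro k _
  have hsub : C.cell N k ⊆ C.T := inter_subset_left
  have hfin : volume (C.cell N k) ≠ ⊤ := ((measure_mono hsub).trans_lt C.T_compact.measure_lt_top).ne
  have P := poin hf (C.cell_convex N k) (C.cell_meas N k) (fun x hx y hy => C.cell_diam hN' hx hy) hfin
    ((C.cont_int hf.continuous).mono_set hsub) (hf2.mono_set hsub)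
  have hS : 0 ≤ ∫ x in C.cell N k, sg f x := integral_nonneg fun x => sg_nonneg f x
  rcases (measureReal_nonneg (μ := volume) (s := C.cell N k)).eq_or_lt with h0 | h0
  · have hz : volume (C.cell N k) = 0 := (measureReal_eq_zero_iff hfin).1 h0.symm
    rw [Measure.restrict_eq_zero.2 hz]; simp
  · set m := volume.real (C.cell N k)
    have h2 : ∫ x in C.cell N k, f x ^ 2 ≤ m⁻¹ * (∫ x in C.cell N k, f x) ^ 2 + 2 * (2 / (N:ℝ)) ^ 2 * ∫ x in C.cell N k, sg f x := by
      have : m⁻¹ * (∫ x in C.cell N k, f x) ^ 2 + 2 * (2 / (N:ℝ)) ^ 2 * ∫ x in C.cell N k, sg f x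
        = m⁻¹ * ((∫ x in C.cell N k, f x) ^ 2 + 2 * (2 / (N:ℝ)) ^ 2 * m * ∫ x in C.cell N k, sg f x) := by
        rw [mul_add]; congr 1; field_simp
      rw [this, ← div_eq_inv_mul, le_div_iff₀ h0, mul_comm]
      exact P
    refine h2.trans ?_
    gcongr

lemma sg_sub {K L : NNReal} {f g : ℂ → ℝ} (hf : LipschitzWith K f) (hg : LipschitzWith L g) :
    ∀ᵐ z, sg (fun z => f z - g z) z ≤ 2 * (sg f z + sg g z) := by
  filter_upwards [hf.ae_differentiableAt, hg.ae_differentiableAt] with z h1 h2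
  unfold sg
  rw [dd_sub h1 h2, dd_sub h1 h2]
  nlinarith [sq_nonneg (dd 1 f z + dd 1 g z), sq_nonneg (dd I f z + dd I g z)]

lemma rellich (C : Cfg) {f : ℕ → ℂ → ℝ} (hL : ∀ n, ∃ K : NNReal, LipschitzWith K (f n)) {B : ℝ}
    (h1 : ∀ n, ∫ z in C.T, f n z ^ 2 ≤ B) (h2 : ∀ n, ∫ z in C.T, sg (f n) z ≤ B) :
    ∃ φ : ℕ → ℕ, StrictMono φ ∧ ∀ ε > 0, ∃ n0, ∀ n ≥ n0, ∀ m ≥ n0, ∫ z in C.T, (f (φ n) z - f (φ m) z) ^ 2 ≤ ε := by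
  have hco n : Continuous (f n) := (hL n).choose_spec.continuous
  set M := (B + volume.real C.T) / 2
  let Φ : ℕ → (ℕ × (ℤ × ℤ) → ℝ) := fun n k => ∫ z in C.cell k.1 k.2, f n z
  have hΦ n : Φ n ∈ Set.pi univ fun _ : ℕ × (ℤ × ℤ) => Icc (-M) M := by
    intro k _
    refine abs_le.1 ?_
    have hs : C.cell k.1 k.2 ⊆ C.T := inter_subset_left
    calc |Φ n k| ≤ ∫ z in C.cell k.1 k.2, |f n z| := abs_integral_le_integral_abs
      _ ≤ ∫ z in C.T, |f n z| := setIntegral_mono_set (C.cont_int (hco n).abs) (Eventually.of_forall fun z => abs_nonneg _) hs.eventuallyLE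
      _ ≤ ∫ z in C.T, (f n z ^ 2 + 1) / 2 := by
          apply integral_mono (C.cont_int (hco n).abs) (C.cont_int (by have := hco n; fun_prop))
          intro z
          show |f n z| ≤ (f n z ^ 2 + 1) / 2
          nlinarith [sq_nonneg (|f n z| - 1), sq_abs (f n z)]
      _ = ((∫ z in C.T, f n z ^ 2) + volume.real C.T) / 2 := by
          have j1 : IntegrableOn (fun z => f n z ^ 2) C.T := C.cont_int ((hco n).pow 2)
          rw [integral_div, integral_add j1 (C.cont_int continuous_const)]; simp
      _ ≤ M := by have := h1 n; simp only [M]; linarith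
  obtain ⟨a, -, φ, hφ, hlim⟩ := (isCompact_univ_pi fun _ : ℕ × (ℤ × ℤ) => isCompact_Icc (a := -M) (b := M)).tendsto_subseq hΦ
  refine ⟨φ, hφ, fun ε hε => ?_⟩
  have hB : 0 ≤ B := (integral_nonneg fun z => sg_nonneg (f 0) z).trans (h2 0)
  obtain ⟨N, F, m, hm, hest⟩ := C.rel_est (ε := ε / (2 * (4 * B + 1))) (by positivity)
  have ht : Tendsto (fun p : ℕ × ℕ => ∑ k ∈ F, m k * (Φ (φ p.1) (N, k) - Φ (φ p.2) (N, k)) ^ 2) (atTop ×ˢ atTop) (𝓝 0) := by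
    have : (0:ℝ) = ∑ k ∈ F, m k * (a (N, k) - a (N, k)) ^ 2 := by simp
    rw [this]
    apply tendsto_finset_sum
    intro k _
    have hk := (tendsto_pi_nhds.1 hlim (N, k))
    exact (((hk.comp tendsto_fst).sub (hk.comp tendsto_snd)).pow 2).const_mul _
  rw [prod_atTop_atTop_eq] at ht
  have hev := ht.eventually_lt_const (half_pos hε)
  rw [eventually_atTop] at hev
  obtain ⟨⟨n1, n2⟩, hn⟩ := hev
  refine ⟨max n1 n2, fun p hp q hq => ?_⟩
  have hn' := hn (p, q) ⟨(le_max_left _ _).trans hp, (le_max_right _ _).trans hq⟩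
  obtain ⟨K, hK⟩ := hL (φ p)
  obtain ⟨L, hLL⟩ := hL (φ q)
  have hsub := hK.sub hLL
  have e := hest _ _ hsub
  have hsg : ∫ z in C.T, sg (fun z => f (φ p) z - f (φ q) z) z ≤ 4 * B := by
    calc _ ≤ ∫ z in C.T, 2 * (sg (f (φ p)) z + sg (f (φ q)) z) :=
          integral_mono_ae (C.sg_int hsub) (((C.sg_int hK).add (C.sg_int hLL)).const_mul 2) (ae_restrict_of_ae (sg_sub hK hLL))
      _ = 2 * ((∫ z in C.T, sg (f (φ p)) z) + ∫ z in C.T, sg (f (φ q)) z) := by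
          rw [integral_const_mul, integral_add (C.sg_int hK) (C.sg_int hLL)]
      _ ≤ 4 * B := by linarith [h2 (φ p), h2 (φ q)]
  have hcell : ∀ k, ∫ z in C.cell N k, (f (φ p) z - f (φ q) z) = Φ (φ p) (N, k) - Φ (φ q) (N, k) := fun k =>
    integral_sub ((C.cont_int (hco _)).mono_set inter_subset_left) ((C.cont_int (hco _)).mono_set inter_subset_left)
  simp_rw [hcell] at e
  have h3 : ε / (2 * (4 * B + 1)) * ∫ z in C.T, sg (fun z => f (φ p) z - f (φ q) z) z ≤ ε / 2 := by
    calc _ ≤ ε / (2 * (4 * B + 1)) * (4 * B + 1) := by gcongr; linarith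
      _ = ε / 2 := by field_simp
  linarith

end Cfg
end HS
end

noncomputable section
namespace HS
open Complex Filter Topology MeasureTheory
open scoped ContDiff Convolution
namespace Cfg
variable {C : Cfg}

/-- Lipschitz tangential fields -/
structure Fld (C : Cfg) (a b : ℂ → ℝ) : Prop where
  la : ∃ K : NNReal, LipschitzWith K a
  lb : ∃ K : NNReal, LipschitzWith K b
  tan : ∀ j, ∀ z ∈ C.T, C.l j z = 0 → dot (C.ν j) ⟨a z, b z⟩ = 0

def nn (C : Cfg) (a b : ℂ → ℝ) : ℝ := ∫ z in C.T, (a z ^ 2 + b z ^ 2)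
def en (C : Cfg) (a b : ℂ → ℝ) : ℝ := ∫ z in C.T, (sg a z + sg b z)
def ip (a c : ℂ → ℝ) (z : ℂ) : ℝ := dd 1 a z * dd 1 c z + dd I a z * dd I c z
def bl (C : Cfg) (lam : ℝ) (a b c d : ℂ → ℝ) : ℝ := ∫ z in C.T, (ip a c z + ip b d z - lam * (a z * c z + b z * d z))

lemma ip_int {K L : NNReal} {a c : ℂ → ℝ} (ha : LipschitzWith K a) (hc : LipschitzWith L c) : IntegrableOn (ip a c) C.T := by
  have key (v : ℂ) : IntegrableOn (fun z => dd v a z * dd v c z) C.T := by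
    refine Measure.integrableOn_of_bounded (M := K * ‖v‖ * (L * ‖v‖)) C.T_fin ((dd_meas a v).mul (dd_meas c v)).aestronglyMeasurable
      (Eventually.of_forall fun z => ?_)
    rw [Real.norm_eq_abs, abs_mul]
    exact mul_le_mul (dd_lip_bound ha v z) (dd_lip_bound hc v z) (abs_nonneg _) (by positivity)
  exact (key 1).add (key I)

lemma bl_int {a b c d : ℂ → ℝ} (ha : ∃ K : NNReal, LipschitzWith K a) (hb : ∃ K : NNReal, LipschitzWith K b)
    (hc : ∃ K : NNReal, LipschitzWith K c) (hd : ∃ K : NNReal, LipschitzWith K d) (lam : ℝ) :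
    IntegrableOn (fun z => ip a c z + ip b d z - lam * (a z * c z + b z * d z)) C.T := by
  obtain ⟨K1, ha⟩ := ha
  obtain ⟨K2, hb⟩ := hb
  obtain ⟨K3, hc⟩ := hc
  obtain ⟨K4, hd⟩ := hd
  have j1 : IntegrableOn (fun z => lam * (a z * c z + b z * d z)) C.T := by
    apply C.cont_int
    have := ha.continuous; have := hb.continuous; have := hc.continuous; have := hd.continuous
    fun_prop
  exact ((ip_int ha hc).add (ip_int hb hd)).sub j1

lemma en_int {a b : ℂ → ℝ} (ha : ∃ K : NNReal, LipschitzWith K a) (hb : ∃ K : NNReal, LipschitzWith K b) :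
    IntegrableOn (fun z => sg a z + sg b z) C.T := by
  obtain ⟨K1, ha⟩ := ha
  obtain ⟨K2, hb⟩ := hb
  exact (C.sg_int ha).add (C.sg_int hb)

lemma nn_int {a b : ℂ → ℝ} (ha : ∃ K : NNReal, LipschitzWith K a) (hb : ∃ K : NNReal, LipschitzWith K b) :
    IntegrableOn (fun z => a z ^ 2 + b z ^ 2) C.T := by
  obtain ⟨K1, ha⟩ := ha
  obtain ⟨K2, hb⟩ := hb
  exact C.cont_int ((ha.continuous.pow 2).add (hb.continuous.pow 2))

lemma bl_self {a b : ℂ → ℝ} (ha : ∃ K : NNReal, LipschitzWith K a) (hb : ∃ K : NNReal, LipschitzWith K b) (lam : ℝ) :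
    C.bl lam a b a b = C.en a b - lam * C.nn a b := by
  have h : C.en a b - lam * C.nn a b = ∫ z in C.T, (sg a z + sg b z - lam * (a z ^ 2 + b z ^ 2)) := by
    rw [integral_sub (en_int ha hb) ((nn_int ha hb).const_mul lam), integral_const_mul]; rfl
  rw [h]
  unfold bl ip sg
  congr 1; ext z; ring

lemma Lip_comb {a c : ℂ → ℝ} (ha : ∃ K : NNReal, LipschitzWith K a) (hc : ∃ K : NNReal, LipschitzWith K c) (t : ℝ) :
    ∃ K : NNReal, LipschitzWith K (fun z => a z + t * c z) := by
  obtain ⟨K1, ha⟩ := ha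
  obtain ⟨K2, hc⟩ := hc
  have h : LipschitzWith (‖t‖₊ * K2) (fun z => t * c z) := by
    have := (lipschitzWith_smul (α := ℝ) (β := ℝ) t).comp hc
    exact this
  exact ⟨_, ha.add h⟩

lemma ip_comb {a c : ℂ → ℝ} (ha : ∃ K : NNReal, LipschitzWith K a) (hc : ∃ K : NNReal, LipschitzWith K c) (t : ℝ) :
    ∀ᵐ z, ip (fun z => a z + t * c z) (fun z => a z + t * c z) z = ip a a z + 2 * t * ip a c z + t ^ 2 * ip c c z := by
  obtain ⟨K1, ha⟩ := ha
  obtain ⟨K2, hc⟩ := hc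
  filter_upwards [ha.ae_differentiableAt, hc.ae_differentiableAt] with z h1 h2
  have e (v : ℂ) : dd v (fun z => a z + t * c z) z = dd v a z + t * dd v c z := by
    rw [dd_add h1 (h2.const_mul t), dd_const_mul h2]
  simp only [ip, e]; ring

lemma bl_expand {a b c d : ℂ → ℝ} (ha : ∃ K : NNReal, LipschitzWith K a) (hb : ∃ K : NNReal, LipschitzWith K b)
    (hc : ∃ K : NNReal, LipschitzWith K c) (hd : ∃ K : NNReal, LipschitzWith K d) (lam t : ℝ) :
    C.bl lam (fun z => a z + t * c z) (fun z => b z + t * d z) (fun z => a z + t * c z) (fun z => b z + t * d z) =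
      C.bl lam a b a b + 2 * t * C.bl lam a b c d + t ^ 2 * C.bl lam c d c d := by
  have j1 := bl_int (C := C) ha hb ha hb lam
  have j2 := (bl_int (C := C) ha hb hc hd lam).const_mul (2 * t)
  have j3 := (bl_int (C := C) hc hd hc hd lam).const_mul (t ^ 2)
  unfold bl
  rw [← integral_const_mul, ← integral_const_mul, ← integral_add j1 j2]
  refine Eq.trans ?_ (integral_add (j1.add j2) j3)
  apply integral_congr_ae
  apply ae_restrict_of_ae
  filter_upwards [ip_comb ha hc t, ip_comb hb hd t] with z h1 h2
  rw [h1, h2]; ring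

lemma Fld.comb {a b c d : ℂ → ℝ} (h : Fld C a b) (h' : Fld C c d) (t : ℝ) : Fld C (fun z => a z + t * c z) (fun z => b z + t * d z) :=
  ⟨Lip_comb h.la h'.la t, Lip_comb h.lb h'.lb t, fun j z hz hl => by
    have e1 := h.tan j z hz hl
    have e2 := h'.tan j z hz hl
    unfold dot at *; simp only at *
    linear_combination e1 + t * e2⟩

lemma Fld.zero : Fld C (fun _ => 0) (fun _ => 0) :=
  ⟨⟨0, LipschitzWith.const 0⟩, ⟨0, LipschitzWith.const 0⟩, fun j z _ _ => by simp [dot]⟩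

lemma ip_zero (a : ℂ → ℝ) (z : ℂ) : ip (fun _ => 0) a z = 0 := by simp [ip, dd_const]

lemma bl_zero (lam : ℝ) (c d : ℂ → ℝ) : C.bl lam (fun _ => 0) (fun _ => 0) c d = 0 := by
  simp [bl, ip_zero]

lemma Fld.smul {a b : ℂ → ℝ} (h : Fld C a b) (t : ℝ) : Fld C (fun z => t * a z) (fun z => t * b z) := by
  have := Fld.zero.comb h t
  simpa using this

lemma bl_smul {a b : ℂ → ℝ} (h : Fld C a b) (lam t : ℝ) :
    C.bl lam (fun z => t * a z) (fun z => t * b z) (fun z => t * a z) (fun z => t * b z) = t ^ 2 * C.bl lam a b a b := by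
  have := bl_expand (C := C) (Fld.zero (C := C)).la (Fld.zero (C := C)).lb h.la h.lb lam t
  simpa [bl_zero] using this

lemma nn_bl {a b : ℂ → ℝ} (ha : ∃ K : NNReal, LipschitzWith K a) (hb : ∃ K : NNReal, LipschitzWith K b) :
    C.nn a b = C.bl 0 a b a b - C.bl 1 a b a b := by
  rw [bl_self ha hb, bl_self ha hb]; ring

lemma en_bl {a b : ℂ → ℝ} (ha : ∃ K : NNReal, LipschitzWith K a) (hb : ∃ K : NNReal, LipschitzWith K b) :
    C.en a b = C.bl 0 a b a b := by
  rw [bl_self ha hb]; ring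

lemma nn_smul {a b : ℂ → ℝ} (h : Fld C a b) (t : ℝ) : C.nn (fun z => t * a z) (fun z => t * b z) = t ^ 2 * C.nn a b := by
  rw [nn_bl (h.smul t).la (h.smul t).lb, bl_smul h, bl_smul h, nn_bl h.la h.lb]; ring

lemma en_smul {a b : ℂ → ℝ} (h : Fld C a b) (t : ℝ) : C.en (fun z => t * a z) (fun z => t * b z) = t ^ 2 * C.en a b := by
  rw [en_bl (h.smul t).la (h.smul t).lb, bl_smul h, en_bl h.la h.lb]

lemma nn_nonneg (a b : ℂ → ℝ) : 0 ≤ C.nn a b := integral_nonneg fun z => add_nonneg (sq_nonneg _) (sq_nonneg _)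
lemma en_nonneg (a b : ℂ → ℝ) : 0 ≤ C.en a b := integral_nonneg fun z => add_nonneg (sg_nonneg _ _) (sg_nonneg _ _)

/-- the set of energies of normalized fields -/
def Es (C : Cfg) : Set ℝ := {e | ∃ a b, Fld C a b ∧ C.nn a b = 1 ∧ C.en a b = e}
def lm (C : Cfg) : ℝ := sInf C.Es

lemma exists_fld (C : Cfg) : ∃ a b, Fld C a b ∧ 0 < C.nn a b := by
  have hl (j : Fin 3) : LipschitzWith 1 (C.l j) := LipschitzWith.of_dist_le_mul fun x y => by
    rw [Real.dist_eq, dist_eq_norm, NNReal.coe_one, one_mul]; exact C.l_lip j x y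
  set a : ℂ → ℝ := fun z => min (C.l 0 z) (min (C.l 1 z) (C.l 2 z)) with ha
  have hLa : LipschitzWith (max 1 (max 1 1)) a := (hl 0).min ((hl 1).min (hl 2))
  have F : Fld C a (fun _ => 0) := by
    refine ⟨⟨_, hLa⟩, ⟨0, LipschitzWith.const 0⟩, fun j z hz hj => ?_⟩
    have : a z = 0 := by
      have h0 := hz 0
      have h1 := hz 1
      have h2 := hz 2
      have hge : 0 ≤ a z := le_min h0 (le_min h1 h2)
      have hle : a z ≤ C.l j z := by
        fin_cases j
        · exact min_le_left _ _
        · exact (min_le_right _ _).trans (min_le_left _ _)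
        · exact (min_le_right _ _).trans (min_le_right _ _)
      linarith
    rw [this]; simp [dot]
  refine ⟨a, _, F, lt_of_le_of_ne (nn_nonneg _ _) fun h => ?_⟩
  unfold nn at h
  have h0 := (integral_eq_zero_iff_of_nonneg (fun z => add_nonneg (sq_nonneg _) (sq_nonneg _)) (nn_int F.la F.lb)).1 h.symm
  have h1 : ∀ᵐ z ∂(volume.restrict C.T), False := by
    filter_upwards [h0, C.T_ae] with z hz hz0
    have : 0 < a z := lt_min (hz0 0) (lt_min (hz0 1) (hz0 2))
    simp at hz
    linarith
  have h2 : volume C.T0 = 0 := by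
    rw [ae_restrict_iff' C.T_meas] at h1
    refine measure_mono_null C.T0_sub ?_
    rw [← compl_mem_ae_iff]
    filter_upwards [h1] with z hz h; exact hz h
  exact (C.T0_open.measure_pos volume C.T0_nonempty).ne' h2

lemma Es_ne (C : Cfg) : C.Es.Nonempty := by
  obtain ⟨a, b, F, h⟩ := C.exists_fld
  refine ⟨_, _, _, F.smul (√(C.nn a b))⁻¹, ?_, rfl⟩
  rw [nn_smul F, inv_pow, Real.sq_sqrt h.le, inv_mul_cancel₀ h.ne']

lemma Es_bdd (C : Cfg) : BddBelow C.Es := ⟨0, by rintro e ⟨a, b, -, -, rfl⟩; exact en_nonneg a b⟩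

lemma lm_nonneg (C : Cfg) : 0 ≤ C.lm := le_csInf C.Es_ne (by rintro e ⟨a, b, -, -, rfl⟩; exact en_nonneg a b)

lemma lm_le {a b : ℂ → ℝ} (F : Fld C a b) : 0 ≤ C.bl C.lm a b a b := by
  rw [bl_self F.la F.lb, sub_nonneg]
  rcases (nn_nonneg (C := C) a b).eq_or_lt with h | h
  · rw [← h, mul_zero]; exact en_nonneg a b
  · have := csInf_le C.Es_bdd ⟨_, _, F.smul (√(C.nn a b))⁻¹, by
      rw [nn_smul F, inv_pow, Real.sq_sqrt h.le, inv_mul_cancel₀ h.ne'], rfl⟩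
    rw [en_smul F, inv_pow, Real.sq_sqrt h.le, ← div_eq_inv_mul, le_div_iff₀ h] at this
    exact this

lemma sg_abs {a : ℂ → ℝ} (ha : ∃ K : NNReal, LipschitzWith K a) : (∃ K : NNReal, LipschitzWith K fun z => |a z|) ∧ ∀ᵐ z, sg (fun z => |a z|) z ≤ sg a z := by
  obtain ⟨K, ha⟩ := ha
  refine ⟨⟨K, LipschitzWith.of_dist_le_mul fun x y => ?_⟩, Eventually.of_forall fun z => ?_⟩
  · refine le_trans ?_ (ha.dist_le_mul x y)
    rw [Real.dist_eq, Real.dist_eq]; exact abs_abs_sub_abs_le _ _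
  · rcases lt_trichotomy (a z) 0 with h | h | h
    · have e : (fun z => |a z|) =ᶠ[𝓝 z] fun z => - a z := by
        filter_upwards [ha.continuous.continuousAt.eventually_lt_const h] with y hy
        exact abs_of_neg hy
      unfold sg
      rw [dd_congr e, dd_congr e]
      have e2 (v : ℂ) : dd v (fun z => - a z) z = - dd v a z := by
        unfold dd; rw [fderiv_fun_neg]; rfl
      rw [e2, e2, neg_sq, neg_sq]
    · have : IsLocalMin (fun z => |a z|) z := Eventually.of_forall fun y => by simp [h]
      have h0 : sg (fun z => |a z|) z = 0 := by
        unfold sg dd; rw [this.fderiv_eq_zero]; simp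
      rw [h0]; exact sg_nonneg _ _
    · have e : (fun z => |a z|) =ᶠ[𝓝 z] a := by
        filter_upwards [ha.continuous.continuousAt.eventually_const_lt h] with y hy
        exact abs_of_pos hy
      unfold sg
      rw [dd_congr e, dd_congr e]

lemma tang_abs {j : Fin 3} {x y : ℝ} (h : dot (C.ν j) ⟨x, y⟩ = 0) : dot (C.ν j) ⟨|x|, |y|⟩ = 0 := by
  have h1 := C.hτν j
  have h2 := C.τre j
  have h3 := C.τim j
  have h4 := C.hν j
  unfold dot at *
  simp only at *
  have hxy : x * (C.τ j).im = y * (C.τ j).re := by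
    by_cases hr : (C.ν j).re = 0
    · rw [hr] at h h1
      have hi : (C.ν j).im ≠ 0 := by
        intro hi
        have : C.ν j = 0 := Complex.ext hr hi
        rw [this] at h4; simp at h4
      have a1 : (C.τ j).im = 0 := by
        have : (C.τ j).im * (C.ν j).im = 0 := by linarith
        exact (mul_eq_zero.1 this).resolve_right hi
      linarith
    · apply mul_left_cancel₀ hr
      linear_combination (C.τ j).im * h - y * h1
  have hab : |x| * (C.τ j).im = |y| * (C.τ j).re := by
    rw [← abs_of_pos h3, ← abs_mul, hxy, abs_mul, abs_of_pos h2]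
  apply mul_left_cancel₀ h3.ne'
  linear_combination (C.ν j).re * hab + |y| * h1

lemma Fld.abs {a b : ℂ → ℝ} (F : Fld C a b) : Fld C (fun z => |a z|) (fun z => |b z|) ∧ C.nn (fun z => |a z|) (fun z => |b z|) = C.nn a b ∧
    C.en (fun z => |a z|) (fun z => |b z|) ≤ C.en a b := by
  obtain ⟨l1, s1⟩ := sg_abs F.la
  obtain ⟨l2, s2⟩ := sg_abs F.lb
  refine ⟨⟨l1, l2, fun j z hz hl => tang_abs (F.tan j z hz hl)⟩, ?_, ?_⟩
  · unfold nn; simp only [sq_abs]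
  · apply integral_mono_ae (en_int l1 l2) (en_int F.la F.lb)
    apply ae_restrict_of_ae
    filter_upwards [s1, s2] with z h1 h2
    exact add_le_add h1 h2

lemma min_seq (C : Cfg) : ∃ a b : ℕ → ℂ → ℝ, ∀ n, Fld C (a n) (b n) ∧ (∀ z, 0 ≤ a n z) ∧ (∀ z, 0 ≤ b n z) ∧ C.nn (a n) (b n) = 1 ∧
    C.bl C.lm (a n) (b n) (a n) (b n) ≤ 1 / ((n:ℝ) + 1) := by
  have (n : ℕ) : ∃ a b : ℂ → ℝ, Fld C a b ∧ (∀ z, 0 ≤ a z) ∧ (∀ z, 0 ≤ b z) ∧ C.nn a b = 1 ∧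
    C.bl C.lm a b a b ≤ 1 / ((n:ℝ) + 1) := by
    obtain ⟨e, ⟨a, b, F, h1, rfl⟩, he⟩ := exists_lt_of_csInf_lt C.Es_ne (show sInf C.Es < C.lm + 1 / ((n:ℝ) + 1) by
      have : 0 < 1 / ((n:ℝ) + 1) := by positivity
      unfold lm; linarith)
    obtain ⟨F', g1, g2⟩ := F.abs
    refine ⟨_, _, F', fun z => abs_nonneg _, fun z => abs_nonneg _, g1.trans h1, ?_⟩
    rw [bl_self F'.la F'.lb, g1, h1]; linarith
  choose a b h using this
  exact ⟨a, b, h⟩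

/-- Cauchy-Schwarz for the nonnegative form -/
lemma bl_cs {a b c d : ℂ → ℝ} (F : Fld C a b) (G : Fld C c d) : C.bl C.lm a b c d ^ 2 ≤ C.bl C.lm a b a b * C.bl C.lm c d c d := by
  have h (t : ℝ) : 0 ≤ C.bl C.lm c d c d * (t * t) + 2 * C.bl C.lm a b c d * t + C.bl C.lm a b a b := by
    have := lm_le (F.comb G t)
    rw [bl_expand F.la F.lb G.la G.lb] at this
    linarith
  have := discrim_le_zero h
  unfold discrim at this
  nlinarith

lemma bl_par {a b c d : ℂ → ℝ} (F : Fld C a b) (G : Fld C c d) :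
    C.bl C.lm (fun z => a z - c z) (fun z => b z - d z) (fun z => a z - c z) (fun z => b z - d z) ≤ 2 * C.bl C.lm a b a b + 2 * C.bl C.lm c d c d := by
  have h1 := bl_expand (C := C) F.la F.lb G.la G.lb C.lm 1
  have h2 := bl_expand (C := C) F.la F.lb G.la G.lb C.lm (-1)
  have h3 := lm_le (F.comb G 1)
  have e (f g : ℂ → ℝ) : (fun z => f z + -1 * g z) = fun z => f z - g z := by ext z; ring
  rw [e, e] at h2
  linarith

end Cfg
end HS
end

noncomputable section
namespace HS
open Complex Filter Topology MeasureTheory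
open scoped ContDiff Convolution

lemma l2_cs {μ : Measure ℂ} {f g : ℂ → ℝ} (hf : MemLp f 2 μ) (hg : MemLp g 2 μ) :
    (∫ z, f z * g z ∂μ) ^ 2 ≤ (∫ z, f z ^ 2 ∂μ) * ∫ z, g z ^ 2 ∂μ := by
  rw [← l2_norm hf, ← l2_norm hg]
  have h := abs_real_inner_le_norm (hf.toLp f) (hg.toLp g)
  have e : ∫ z, f z * g z ∂μ = inner ℝ (hf.toLp f) (hg.toLp g) := by
    rw [L2.inner_def]
    apply integral_congr_ae
    filter_upwards [hf.coeFn_toLp, hg.coeFn_toLp] with z h1 h2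
    rw [h1, h2]; simp [mul_comm]
  rw [e, ← mul_pow, ← sq_abs]
  exact pow_le_pow_left₀ (abs_nonneg _) h 2

lemma l2_int {μ : Measure ℂ} {f g : ℂ → ℝ} (hf : MemLp f 2 μ) (hg : MemLp g 2 μ) : Integrable (fun z => f z * g z) μ :=
  hf.integrable_mul hg

lemma l2_lim {μ : Measure ℂ} {f : ℕ → ℂ → ℝ} {g φ : ℂ → ℝ} (hf : ∀ n, MemLp (f n) 2 μ) (hg : MemLp g 2 μ) (hφ : MemLp φ 2 μ)
    (h : Tendsto (fun n => ∫ z, (f n z - g z) ^ 2 ∂μ) atTop (𝓝 0)) :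
    Tendsto (fun n => ∫ z, f n z * φ z ∂μ) atTop (𝓝 (∫ z, g z * φ z ∂μ)) := by
  rw [tendsto_iff_dist_tendsto_zero]
  have h2 : Tendsto (fun n => √((∫ z, (f n z - g z) ^ 2 ∂μ) * ∫ z, φ z ^ 2 ∂μ)) atTop (𝓝 0) := by
    have := (h.mul_const (∫ z, φ z ^ 2 ∂μ)).sqrt
    simpa using this
  refine squeeze_zero (fun n => dist_nonneg) (fun n => ?_) h2
  apply Real.le_sqrt_of_sq_le
  rw [Real.dist_eq, sq_abs, ← integral_sub (l2_int (hf n) hφ) (l2_int hg hφ)]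
  have e : (fun z => f n z * φ z - g z * φ z) = fun z => (f n z - g z) * φ z := by ext z; ring
  rw [e]
  exact l2_cs ((hf n).sub hg) hφ

lemma l2_lim_sq {μ : Measure ℂ} {f : ℕ → ℂ → ℝ} {g : ℂ → ℝ} (hf : ∀ n, MemLp (f n) 2 μ) (hg : MemLp g 2 μ)
    (h : Tendsto (fun n => ∫ z, (f n z - g z) ^ 2 ∂μ) atTop (𝓝 0)) :
    Tendsto (fun n => ∫ z, f n z ^ 2 ∂μ) atTop (𝓝 (∫ z, g z ^ 2 ∂μ)) := by
  have h1 := l2_lim hf hg hg h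
  have e : (∫ z, g z ^ 2 ∂μ) = 0 + 2 * (∫ z, g z * g z ∂μ) - ∫ z, g z ^ 2 ∂μ := by
    have : ∫ z, g z * g z ∂μ = ∫ z, g z ^ 2 ∂μ := by congr 1; ext z; ring
    rw [this]; ring
  rw [e]
  refine ((h.add (h1.const_mul 2)).sub_const _).congr fun n => ?_
  have j0 : Integrable (fun z => (f n z - g z) ^ 2) μ := ((hf n).sub hg).integrable_sq
  have j1 : Integrable (fun z => 2 * (f n z * g z)) μ := (l2_int (hf n) hg).const_mul 2
  have j2 : Integrable (fun z => g z ^ 2) μ := hg.integrable_sq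
  have j3 : Integrable (fun z => (f n z - g z) ^ 2 + 2 * (f n z * g z)) μ := j0.add j1
  rw [← integral_const_mul, ← integral_add j0 j1, ← integral_sub j3 j2]
  congr 1; ext z; ring

lemma l2_nonneg {μ : Measure ℂ} {f : ℕ → ℂ → ℝ} {g : ℂ → ℝ} (hf : ∀ n, MemLp (f n) 2 μ) (hg : MemLp g 2 μ)
    (h : Tendsto (fun n => ∫ z, (f n z - g z) ^ 2 ∂μ) atTop (𝓝 0)) (h0 : ∀ n z, 0 ≤ f n z) : ∀ᵐ z ∂μ, 0 ≤ g z := by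
  have hm : AEStronglyMeasurable (fun z => (min (g z) 0) ^ 2) μ :=
    (hg.1.inf aestronglyMeasurable_const).pow 2
  have hi : Integrable (fun z => (min (g z) 0) ^ 2) μ := by
    refine hg.integrable_sq.mono' hm (Eventually.of_forall fun z => ?_)
    rw [Real.norm_eq_abs, abs_of_nonneg (sq_nonneg _)]
    rcases le_total (g z) 0 with h | h
    · rw [min_eq_left h]
    · rw [min_eq_right h]; nlinarith [sq_nonneg (g z)]
  have hle (n : ℕ) : ∫ z, (min (g z) 0) ^ 2 ∂μ ≤ ∫ z, (f n z - g z) ^ 2 ∂μ := by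
    refine integral_mono hi ((hf n).sub hg).integrable_sq fun z => ?_
    show (min (g z) 0) ^ 2 ≤ (f n z - g z) ^ 2
    have := h0 n z
    rcases le_total (g z) 0 with h | h
    · rw [min_eq_left h]; nlinarith
    · rw [min_eq_right h]; nlinarith [sq_nonneg (f n z - g z)]
  have hz : ∫ z, (min (g z) 0) ^ 2 ∂μ = 0 :=
    le_antisymm (ge_of_tendsto' h hle) (integral_nonneg fun z => sq_nonneg _)
  filter_upwards [(integral_eq_zero_iff_of_nonneg (fun z => sq_nonneg _) hi).1 hz] with z hz
  simp only [Pi.zero_apply] at hz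
  have := pow_eq_zero_iff (two_ne_zero) |>.1 hz
  by_contra hc
  rw [min_eq_left (by linarith)] at this
  linarith

namespace Cfg
variable {C : Cfg}

lemma cont_l2 {f : ℂ → ℝ} (hf : Continuous f) : MemLp f 2 (volume.restrict C.T) := by
  rw [memLp_two_iff_integrable_sq hf.aestronglyMeasurable]
  exact C.cont_int (hf.pow 2)

lemma dd_l2 {K : NNReal} {f : ℂ → ℝ} (hf : LipschitzWith K f) (v : ℂ) : MemLp (dd v f) 2 (volume.restrict C.T) :=
  MemLp.of_bound (dd_meas f v).aestronglyMeasurable (K * ‖v‖) (Eventually.of_forall fun z => dd_lip_bound hf v z)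

lemma Fld.sub {a b c d : ℂ → ℝ} (F : Fld C a b) (G : Fld C c d) : Fld C (fun z => a z - c z) (fun z => b z - d z) := by
  have := F.comb G (-1)
  have e (f g : ℂ → ℝ) : (fun z => f z + -1 * g z) = fun z => f z - g z := by ext z; ring
  rwa [e, e] at this

lemma split_sq {a b : ℂ → ℝ} (F : Fld C a b) : C.nn a b = (∫ z in C.T, a z ^ 2) + ∫ z in C.T, b z ^ 2 := by
  obtain ⟨K, h1⟩ := F.la
  obtain ⟨L, h2⟩ := F.lb
  have j1 : IntegrableOn (fun z => a z ^ 2) C.T := C.cont_int (h1.continuous.pow 2)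
  have j2 : IntegrableOn (fun z => b z ^ 2) C.T := C.cont_int (h2.continuous.pow 2)
  exact integral_add j1 j2

lemma split_sg {a b : ℂ → ℝ} (F : Fld C a b) : C.en a b = (∫ z in C.T, sg a z) + ∫ z in C.T, sg b z := by
  obtain ⟨K, h1⟩ := F.la
  obtain ⟨L, h2⟩ := F.lb
  exact integral_add (C.sg_int h1) (C.sg_int h2)

lemma dd_le_sg {K : NNReal} {f : ℂ → ℝ} (hf : LipschitzWith K f) {v : ℂ} (hv : ‖v‖ ≤ 1) :
    ∫ z in C.T, dd v f z ^ 2 ≤ ∫ z in C.T, sg f z := by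
  refine integral_mono (dd_l2 hf v).integrable_sq (C.sg_int hf) fun z => ?_
  have := dd_sq_le f v z
  refine this.trans ?_
  have h := sg_nonneg f z
  have : ‖v‖ ^ 2 ≤ 1 := pow_le_one₀ (norm_nonneg _) hv
  nlinarith

/-- limit of the minimizing sequence -/
structure LimD (C : Cfg) (a b : ℕ → ℂ → ℝ) (w1 w2 : ℂ → ℝ) : Prop where
  fld : ∀ n, Fld C (a n) (b n)
  q : Tendsto (fun n => C.bl C.lm (a n) (b n) (a n) (b n)) atTop (𝓝 0)
  m1 : MemLp w1 2 (volume.restrict C.T)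
  m2 : MemLp w2 2 (volume.restrict C.T)
  t1 : Tendsto (fun n => ∫ z in C.T, (a n z - w1 z) ^ 2) atTop (𝓝 0)
  t2 : Tendsto (fun n => ∫ z in C.T, (b n z - w2 z) ^ 2) atTop (𝓝 0)
  p1 : ∀ᵐ z ∂(volume.restrict C.T), 0 ≤ w1 z
  p2 : ∀ᵐ z ∂(volume.restrict C.T), 0 ≤ w2 z
  one : (∫ z in C.T, w1 z ^ 2) + ∫ z in C.T, w2 z ^ 2 = 1
  d1 : ∀ v, ‖v‖ ≤ 1 → ∃ W, MemLp W 2 (volume.restrict C.T) ∧ Tendsto (fun n => ∫ z in C.T, (dd v (a n) z - W z) ^ 2) atTop (𝓝 0)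
  d2 : ∀ v, ‖v‖ ≤ 1 → ∃ W, MemLp W 2 (volume.restrict C.T) ∧ Tendsto (fun n => ∫ z in C.T, (dd v (b n) z - W z) ^ 2) atTop (𝓝 0)

lemma exists_lim (C : Cfg) : ∃ a b w1 w2, LimD C a b w1 w2 := by
  obtain ⟨a, b, hab⟩ := C.min_seq
  have F n := (hab n).1
  have hN n := (hab n).2.2.2.1
  have hQ n := (hab n).2.2.2.2
  have hE n : C.en (a n) (b n) ≤ C.lm + 1 := by
    have h1 := hQ n
    rw [bl_self (F n).la (F n).lb, hN n] at h1
    have : 1 / ((n:ℝ) + 1) ≤ 1 := by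
      rw [div_le_one (by positivity)]; linarith [Nat.cast_nonneg (α := ℝ) n]
    linarith
  have hl0 := C.lm_nonneg
  have na n : ∫ z in C.T, a n z ^ 2 ≤ C.lm + 1 := by
    have h1 := split_sq (F n)
    have h2 : 0 ≤ ∫ z in C.T, b n z ^ 2 := integral_nonneg fun z => sq_nonneg _
    linarith [hN n]
  have nb n : ∫ z in C.T, b n z ^ 2 ≤ C.lm + 1 := by
    have h1 := split_sq (F n)
    have h2 : 0 ≤ ∫ z in C.T, a n z ^ 2 := integral_nonneg fun z => sq_nonneg _
    linarith [hN n]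
  have ea n : ∫ z in C.T, sg (a n) z ≤ C.lm + 1 := by
    have h1 := split_sg (F n)
    have h2 : 0 ≤ ∫ z in C.T, sg (b n) z := integral_nonneg fun z => sg_nonneg _ _
    linarith [hE n]
  have eb n : ∫ z in C.T, sg (b n) z ≤ C.lm + 1 := by
    have h1 := split_sg (F n)
    have h2 : 0 ≤ ∫ z in C.T, sg (a n) z := integral_nonneg fun z => sg_nonneg _ _
    linarith [hE n]
  obtain ⟨φ, hφ, ca⟩ := C.rellich (fun n => (F n).la) na ea
  obtain ⟨ψ, hψ, cb⟩ := C.rellich (f := fun n => b (φ n)) (fun n => (F _).lb) (fun n => nb _) (fun n => eb _)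
  set A : ℕ → ℂ → ℝ := fun n => a (φ (ψ n)) with hA
  set B : ℕ → ℂ → ℝ := fun n => b (φ (ψ n)) with hB
  have FA n : Fld C (A n) (B n) := F _
  have cA : ∀ ε > 0, ∃ n0, ∀ n ≥ n0, ∀ m ≥ n0, ∫ z in C.T, (A n z - A m z) ^ 2 ≤ ε := fun ε hε => by
    obtain ⟨n0, h⟩ := ca ε hε
    exact ⟨n0, fun n hn m hm => h _ (hn.le.trans (hψ.id_le n)) _ (hm.le.trans (hψ.id_le m))⟩
  have q : Tendsto (fun n => C.bl C.lm (A n) (B n) (A n) (B n)) atTop (𝓝 0) := by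
    refine squeeze_zero (fun n => lm_le (FA n)) (fun n => hQ _) ?_
    exact tendsto_one_div_add_atTop_nhds_zero_nat.comp (hφ.comp hψ).tendsto_atTop
  have mA n : MemLp (A n) 2 (volume.restrict C.T) := cont_l2 (FA n).la.choose_spec.continuous
  have mB n : MemLp (B n) 2 (volume.restrict C.T) := cont_l2 (FA n).lb.choose_spec.continuous
  obtain ⟨w1, m1, t1⟩ := l2_complete mA cA
  obtain ⟨w2, m2, t2⟩ := l2_complete mB cb
  have cE : ∀ ε > 0, ∃ n0, ∀ n ≥ n0, ∀ m ≥ n0, C.en (fun z => A n z - A m z) (fun z => B n z - B m z) ≤ ε := by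
    intro ε hε
    have hε' : 0 < ε / (4 * (C.lm + 1)) := by positivity
    obtain ⟨n1, h1⟩ := cA _ hε'
    obtain ⟨n2, h2⟩ := cb _ hε'
    obtain ⟨n3, h3⟩ := eventually_atTop.1 (q.eventually_lt_const (show (0:ℝ) < ε / 8 by positivity))
    refine ⟨max n1 (max n2 n3), fun n hn m hm => ?_⟩
    have e1 := h1 n (le_of_max_le_left hn) m (le_of_max_le_left hm)
    have e2 := h2 n (le_of_max_le_left (le_of_max_le_right hn)) m (le_of_max_le_left (le_of_max_le_right hm))
    have e3 := h3 n (le_of_max_le_right (le_of_max_le_right hn))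
    have e4 := h3 m (le_of_max_le_right (le_of_max_le_right hm))
    have e5 := bl_par (FA n) (FA m)
    have FS := (FA n).sub (FA m)
    rw [bl_self FS.la FS.lb, split_sq FS] at e5
    have e6 : C.lm * ((∫ z in C.T, (A n z - A m z) ^ 2) + ∫ z in C.T, (B n z - B m z) ^ 2) ≤ (C.lm + 1) * (ε / (4 * (C.lm + 1)) + ε / (4 * (C.lm + 1))) := by
      apply mul_le_mul (by linarith) (add_le_add e1 e2) _ (by linarith)
      exact add_nonneg (integral_nonneg fun z => sq_nonneg _) (integral_nonneg fun z => sq_nonneg _)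
    have e7 : (C.lm + 1) * (ε / (4 * (C.lm + 1)) + ε / (4 * (C.lm + 1))) = ε / 2 := by field_simp; norm_num
    linarith
  have sub_dd {f g : ℂ → ℝ} (hf : ∃ K : NNReal, LipschitzWith K f) (hg : ∃ K : NNReal, LipschitzWith K g) (v : ℂ) (hv : ‖v‖ ≤ 1) :
      ∫ z in C.T, (dd v f z - dd v g z) ^ 2 ≤ ∫ z in C.T, sg (fun z => f z - g z) z := by
    obtain ⟨K, hf⟩ := hf
    obtain ⟨L, hg⟩ := hg
    refine le_trans (le_of_eq ?_) (dd_le_sg (hf.sub hg) hv)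
    apply integral_congr_ae
    apply ae_restrict_of_ae
    filter_upwards [hf.ae_differentiableAt, hg.ae_differentiableAt] with z h1 h2
    rw [dd_sub h1 h2]
  refine ⟨A, B, w1, w2, FA, q, m1, m2, t1, t2, l2_nonneg mA m1 t1 (fun n z => (hab _).2.1 z), l2_nonneg mB m2 t2 (fun n z => (hab _).2.2.1 z), ?_, ?_, ?_⟩
  · have h1 := (l2_lim_sq mA m1 t1).add (l2_lim_sq mB m2 t2)
    refine tendsto_nhds_unique h1 ?_
    have : ∀ n, (∫ z in C.T, A n z ^ 2) + ∫ z in C.T, B n z ^ 2 = 1 := fun n => by rw [← split_sq (FA n)]; exact hN _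
    simp_rw [this]
    exact tendsto_const_nhds
  · intro v hv
    refine l2_complete (fun n => dd_l2 (FA n).la.choose_spec v) fun ε hε => ?_
    obtain ⟨n0, h⟩ := cE ε hε
    refine ⟨n0, fun n hn m hm => (sub_dd (FA n).la (FA m).la v hv).trans (le_trans ?_ (h n hn m hm))⟩
    rw [split_sg ((FA n).sub (FA m))]
    have : 0 ≤ ∫ z in C.T, sg (fun z => B n z - B m z) z := integral_nonneg fun z => sg_nonneg _ _
    linarith
  · intro v hv
    refine l2_complete (fun n => dd_l2 (FA n).lb.choose_spec v) fun ε hε => ?_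
    obtain ⟨n0, h⟩ := cE ε hε
    refine ⟨n0, fun n hn m hm => (sub_dd (FA n).lb (FA m).lb v hv).trans (le_trans ?_ (h n hn m hm))⟩
    rw [split_sg ((FA n).sub (FA m))]
    have : 0 ≤ ∫ z in C.T, sg (fun z => A n z - A m z) z := integral_nonneg fun z => sg_nonneg _ _
    linarith

lemma LimD.pair {a b : ℕ → ℂ → ℝ} {w1 w2 : ℂ → ℝ} (L : LimD C a b w1 w2) {c d : ℂ → ℝ} (G : Fld C c d) :
    Tendsto (fun n => C.bl C.lm (a n) (b n) c d) atTop (𝓝 0) := by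
  have h1 : Tendsto (fun n => √(C.bl C.lm (a n) (b n) (a n) (b n) * C.bl C.lm c d c d)) atTop (𝓝 0) := by
    have := (L.q.mul_const (C.bl C.lm c d c d)).sqrt
    simpa using this
  rw [tendsto_zero_iff_abs_tendsto_zero]
  refine squeeze_zero (fun n => abs_nonneg _) (fun n => ?_) h1
  apply Real.le_sqrt_of_sq_le
  simp only [Function.comp, sq_abs]
  exact bl_cs (L.fld n) G

lemma lip_mul {K L : NNReal} {f g : ℂ → ℝ} (hf : LipschitzWith K f) (hg : LipschitzWith L g) : ∃ M, LipschitzOnWith M (fun z => f z * g z) C.T := by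
  obtain ⟨A, hA⟩ := C.T_compact.exists_bound_of_continuousOn hf.continuous.continuousOn
  obtain ⟨B, hB⟩ := C.T_compact.exists_bound_of_continuousOn hg.continuous.continuousOn
  refine ⟨⟨|A| * L + |B| * K, by positivity⟩, LipschitzOnWith.of_dist_le_mul fun x hx y hy => ?_⟩
  show dist _ _ ≤ (|A| * L + |B| * K) * dist x y
  have h1 := hf.dist_le_mul x y
  have h2 := hg.dist_le_mul x y
  rw [Real.dist_eq] at *
  have e : f x * g x - f y * g y = f x * (g x - g y) + g y * (f x - f y) := by ring
  have a1 : |f x| ≤ |A| := (hA x hx).trans (le_abs_self A)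
  have a2 : |g y| ≤ |B| := (hB y hy).trans (le_abs_self B)
  rw [e]
  refine (abs_add_le _ _).trans ?_
  rw [abs_mul, abs_mul, add_mul]
  have b1 := mul_le_mul a1 h2 (abs_nonneg _) (abs_nonneg _)
  have b2 := mul_le_mul a2 h1 (abs_nonneg _) (abs_nonneg _)
  linarith

lemma lip_smooth {φ : ℂ → ℝ} (hφ : ContDiff ℝ ∞ φ) (hc : HasCompactSupport φ) : ∃ K, LipschitzWith K φ :=
  (hφ.of_le (by norm_cast)).lipschitzWith_of_hasCompactSupport hc one_ne_zero

lemma green {g φ : ℂ → ℝ} (hg : ∃ K : NNReal, LipschitzWith K g) (hφ : ContDiff ℝ ∞ φ) (hc : HasCompactSupport φ)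
    (hn : ∀ j, ∀ z ∈ C.T, C.l j z = 0 → g z * dd (C.ν j) φ z = 0) : ∫ z in C.T, ip g φ z = - ∫ z in C.T, g z * Lap φ z := by
  obtain ⟨K, hg⟩ := hg
  have hd v := contDiff_dd hφ v
  obtain ⟨L1, hL1⟩ := lip_smooth (hd 1) (dd_compact hc 1)
  obtain ⟨L2, hL2⟩ := lip_smooth (hd I) (dd_compact hc I)
  obtain ⟨L, hL⟩ := lip_smooth hφ hc
  obtain ⟨M1, hM1⟩ := C.lip_mul hg hL1
  obtain ⟨M2, hM2⟩ := C.lip_mul hg hL2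
  have key := C.div_lemma_on hM1 hM2 (by
    intro j z hz hl
    have := hn j z hz hl
    rw [dd_lin] at this
    simp only [dot]; linear_combination this)
  have j2 : IntegrableOn (fun z => g z * Lap φ z) C.T := by
    apply C.cont_int
    have h1 := hg.continuous
    have h2 := (contDiff_dd (hd 1) 1).continuous
    have h3 := (contDiff_dd (hd I) I).continuous
    unfold Lap; fun_prop
  rw [← sub_eq_zero, sub_neg_eq_add, ← integral_add (ip_int hg hL) j2, ← key]
  apply integral_congr_ae
  apply ae_restrict_of_ae
  filter_upwards [hg.ae_differentiableAt] with z hz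
  rw [dd_mul hz (cdd (hd 1) z), dd_mul hz (cdd (hd I) z)]
  simp only [ip, Lap]; ring

lemma tang_id {j : Fin 3} {x y : ℝ} (h : dot (C.ν j) ⟨x, y⟩ = 0) : x * (C.τ j).im = y * (C.τ j).re := by
  obtain ⟨κ, hκ, h1, h2⟩ := C.frame j
  unfold dot at h
  simp only at h
  rw [h1, h2] at h
  have hk : κ ≠ 0 := by rintro rfl; norm_num at hκ
  apply mul_left_cancel₀ hk
  linear_combination -h

lemma LimD.weak {a b : ℕ → ℂ → ℝ} {w1 w2 : ℂ → ℝ} (L : LimD C a b w1 w2) {φ : ℂ → ℝ} (hφ : ContDiff ℝ ∞ φ) (hc : HasCompactSupport φ) (α β : ℝ)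
    (h1 : ∀ j, ∀ z ∈ C.T, C.l j z = 0 → dot (C.ν j) ⟨α, β⟩ * φ z = 0)
    (h2 : ∀ j, ∀ z ∈ C.T, C.l j z = 0 → dot (C.τ j) ⟨α, β⟩ * dd (C.ν j) φ z = 0) :
    ∫ z in C.T, (α * w1 z + β * w2 z) * (Lap φ z + C.lm * φ z) = 0 := by
  obtain ⟨K, hK⟩ := lip_smooth hφ hc
  have G : Fld C (fun z => α * φ z) (fun z => β * φ z) := by
    refine ⟨?_, ?_, fun j z hz hl => ?_⟩
    · simpa using Lip_comb ⟨0, LipschitzWith.const (0:ℝ)⟩ ⟨K, hK⟩ α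
    · simpa using Lip_comb ⟨0, LipschitzWith.const (0:ℝ)⟩ ⟨K, hK⟩ β
    · have := h1 j z hz hl
      unfold dot at *; simp only at *; linear_combination this
  have hP := L.pair G
  have cL : Continuous (fun z => Lap φ z + C.lm * φ z) := by
    have h2 := (contDiff_dd (contDiff_dd hφ 1) 1).continuous
    have h3 := (contDiff_dd (contDiff_dd hφ I) I).continuous
    have := hφ.continuous
    unfold Lap; fun_prop
  have mA n : MemLp (a n) 2 (volume.restrict C.T) := cont_l2 (L.fld n).la.choose_spec.continuous
  have mB n : MemLp (b n) 2 (volume.restrict C.T) := cont_l2 (L.fld n).lb.choose_spec.continuous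
  have l1 := l2_lim mA L.m1 (cont_l2 cL) L.t1
  have l2 := l2_lim mB L.m2 (cont_l2 cL) L.t2
  have e n : C.bl C.lm (a n) (b n) (fun z => α * φ z) (fun z => β * φ z) =
      - (α * (∫ z in C.T, a n z * (Lap φ z + C.lm * φ z)) + β * ∫ z in C.T, b n z * (Lap φ z + C.lm * φ z)) := by
    obtain ⟨K1, la⟩ := (L.fld n).la
    obtain ⟨K2, lb⟩ := (L.fld n).lb
    set g : ℂ → ℝ := fun z => α * a n z + β * b n z with hg
    have lg : ∃ K : NNReal, LipschitzWith K g := by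
      have h0 : ∃ K : NNReal, LipschitzWith K fun z => (0:ℝ) + α * a n z := Lip_comb ⟨0, LipschitzWith.const (0:ℝ)⟩ ⟨_, la⟩ α
      simpa [hg] using Lip_comb h0 ⟨_, lb⟩ β
    have gr := green lg hφ hc (fun j z hz hl => by
      have t := tang_id ((L.fld n).tan j z hz hl)
      have h := h2 j z hz hl
      apply mul_left_cancel₀ (C.τre j).ne'
      unfold dot at h
      simp only [hg] at h ⊢
      linear_combination a n z * h - dd (C.ν j) φ z * β * t)
    have i0 : IntegrableOn (fun z => g z * (C.lm * φ z)) C.T := C.cont_int (lg.choose_spec.continuous.mul (continuous_const.mul hφ.continuous))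
    have i1 : IntegrableOn (fun z => a n z * (Lap φ z + C.lm * φ z)) C.T := C.cont_int (la.continuous.mul cL)
    have i2 : IntegrableOn (fun z => b n z * (Lap φ z + C.lm * φ z)) C.T := C.cont_int (lb.continuous.mul cL)
    have i3 : IntegrableOn (fun z => g z * (Lap φ z + C.lm * φ z)) C.T := C.cont_int (lg.choose_spec.continuous.mul cL)
    have r1 : α * (∫ z in C.T, a n z * (Lap φ z + C.lm * φ z)) + β * (∫ z in C.T, b n z * (Lap φ z + C.lm * φ z))
        = (∫ z in C.T, g z * Lap φ z) + ∫ z in C.T, g z * (C.lm * φ z) := by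
      have i4 : IntegrableOn (fun z => g z * Lap φ z) C.T := by
        refine (i3.sub i0).congr_fun (fun z _ => ?_) C.T_meas
        simp only [Pi.sub_apply]; ring
      rw [← integral_const_mul, ← integral_const_mul, ← integral_add (i1.const_mul α) (i2.const_mul β), ← integral_add i4 i0]
      congr 1; ext z; simp only [hg]; ring
    rw [r1, neg_add, ← gr, ← sub_eq_add_neg, ← integral_sub (ip_int lg.choose_spec hK) i0]
    apply integral_congr_ae
    apply ae_restrict_of_ae
    filter_upwards [la.ae_differentiableAt, lb.ae_differentiableAt] with z d1 d2
    simp only [ip, hg]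
    rw [dd_comb d1 d2, dd_comb d1 d2, dd_const_mul (cdd hφ z), dd_const_mul (cdd hφ z), dd_const_mul (cdd hφ z), dd_const_mul (cdd hφ z)]
    ring
  simp_rw [e] at hP
  have u := tendsto_nhds_unique hP ((l1.const_mul α).add (l2.const_mul β)).neg
  have j1 := (l2_int L.m1 (cont_l2 cL)).const_mul α
  have j2 := (l2_int L.m2 (cont_l2 cL)).const_mul β
  rw [← integral_const_mul, ← integral_const_mul, ← integral_add j1 j2] at u
  have : ∫ z in C.T, (α * w1 z + β * w2 z) * (Lap φ z + C.lm * φ z) =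
      ∫ z in C.T, (α * (w1 z * (Lap φ z + C.lm * φ z)) + β * (w2 z * (Lap φ z + C.lm * φ z))) := by
    congr 1; ext z; ring
  rw [this]; linarith

end Cfg
end HS
end

noncomputable section
namespace HS
open Complex Filter Topology MeasureTheory
open scoped ContDiff Convolution
namespace Cfg
variable {C : Cfg}

open Classical in
/-- continuous representative -/
def rep (C : Cfg) (g : ℂ → ℝ) (z : ℂ) : ℝ :=
  if h : ∃ G : ℂ → ℝ, Continuous G ∧ ∃ ρ > 0, ∀ᵐ y, y ∈ C.T → y ∈ Metric.ball z ρ → G y = g y then h.choose z else 0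

lemma rep_eq {g G : ℂ → ℝ} (hG : Continuous G) {p : ℂ} {ρ : ℝ} (h : ∀ᵐ y, y ∈ C.T → y ∈ Metric.ball p ρ → G y = g y)
    {z : ℂ} (hz : z ∈ C.T) (hzb : z ∈ Metric.ball p ρ) : G z = C.rep g z := by
  obtain ⟨r, hr, hb⟩ := Metric.isOpen_iff.1 Metric.isOpen_ball z hzb
  have hex : ∃ G : ℂ → ℝ, Continuous G ∧ ∃ ρ > 0, ∀ᵐ y, y ∈ C.T → y ∈ Metric.ball z ρ → G y = g y :=
    ⟨G, hG, r, hr, by filter_upwards [h] with y hy h1 h2; exact hy h1 (hb h2)⟩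
  unfold rep
  rw [dif_pos hex]
  obtain ⟨h1, r', hr', h2⟩ := hex.choose_spec
  refine C.ae_eq_on (p := z) (ρ := min r r') hG h1 ?_ z hz (Metric.mem_ball_self (lt_min hr hr'))
  filter_upwards [h, h2] with y a1 a2 hy hyb
  rw [a1 hy (hb (Metric.ball_subset_ball (min_le_left _ _) hyb)), a2 hy (Metric.ball_subset_ball (min_le_right _ _) hyb)]

lemma PatA.rep {lam : ℝ} {g G : ℂ → ℝ} {p : ℂ} {ρ : ℝ} (h : C.PatA lam g p ρ G) : C.Pat lam (C.rep g) p ρ G :=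
  ⟨h.1, h.2.1, fun _ hz hzb => rep_eq h.1.continuous h.2.2 hz hzb⟩

lemma PatA.comb {lam : ℝ} {g G g' G' : ℂ → ℝ} {p : ℂ} {ρ : ℝ} (h : C.PatA lam g p ρ G) (h' : C.PatA lam g' p ρ G') (a b : ℝ) :
    C.PatA lam (fun z => a * g z + b * g' z) p ρ (fun z => a * G z + b * G' z) := by
  refine ⟨(contDiff_const.mul h.1).add (contDiff_const.mul h'.1), fun z hz => ?_, ?_⟩
  · rw [Lap_comb h.1.contDiffAt h'.1.contDiffAt, h.2.1 z hz, h'.2.1 z hz]; ring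
  · filter_upwards [h.2.2, h'.2.2] with z a1 a2 hz hzb
    rw [a1 hz hzb, a2 hz hzb]

lemma cpt_of_ball {φ : ℂ → ℝ} {p : ℂ} {R : ℝ} (hs : tsupport φ ⊆ Metric.ball p R) : HasCompactSupport φ :=
  (isCompact_closedBall p R).of_isClosed_subset (isClosed_tsupport φ) (hs.trans Metric.ball_subset_closedBall)

lemma LimD.int {a b : ℕ → ℂ → ℝ} {w1 w2 : ℂ → ℝ} (L : LimD C a b w1 w2) (α β : ℝ) {p : ℂ} {R : ℝ} (hR : 0 < R) (hl : C.lm * R ^ 2 ≤ 1)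
    (hb : Metric.ball p R ⊆ C.T) : ∃ G, C.PatA C.lm (fun z => α * w1 z + β * w2 z) p (R / 2) G := by
  have i1 : IntegrableOn w1 C.T := L.m1.integrable (by norm_num)
  have i2 : IntegrableOn w2 C.T := L.m2.integrable (by norm_num)
  refine C.weak_int C.lm_nonneg hR hl hb ((i1.const_mul α).add (i2.const_mul β)) fun φ hφ hs => ?_
  have hz : ∀ j, ∀ z, C.l j z = 0 → z ∉ tsupport φ := fun j z hlz h' => ((ball_l_pos hb (hs h')) j).ne' hlz
  refine L.weak hφ (cpt_of_ball hs) α β (fun j z _ hlz => ?_) fun j z _ hlz => ?_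
  · rw [(ev_zero (hz j z hlz)).self_of_nhds, mul_zero]
  · rw [(dd_ev_zero (ev_zero (hz j z hlz)) _).self_of_nhds, mul_zero]

lemma LimD.side_ev {a b : ℕ → ℂ → ℝ} {w1 w2 : ℂ → ℝ} (L : LimD C a b w1 w2) {j : Fin 3} {p : ℂ} {R : ℝ} (hR : 0 < R) (hl : C.lm * R ^ 2 ≤ 1)
    (hb : C.SideBall j p R) : (∃ G, C.PatA C.lm (fun z => (C.τ j).re * w1 z + (C.τ j).im * w2 z) p (R / 2) G ∧ ∀ z, G (C.S j z) = 1 * G z) ∧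
    ∃ G, C.PatA C.lm (fun z => (C.ν j).re * w1 z + (C.ν j).im * w2 z) p (R / 2) G ∧ ∀ z, G (C.S j z) = -1 * G z := by
  have i1 : IntegrableOn w1 C.T := L.m1.integrable (by norm_num)
  have i2 : IntegrableOn w2 C.T := L.m2.integrable (by norm_num)
  have hτν := C.hτν j
  constructor
  · refine C.weak_side C.lm_nonneg hR hl (by norm_num) hb ((i1.const_mul _).add (i2.const_mul _)) fun φ hφ hs hse => ?_
    refine L.weak hφ (cpt_of_ball hs) _ _ (fun k z _ hlz => ?_) fun k z _ hlz => ?_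
    · by_cases hk : k = j
      · subst hk
        unfold dot at hτν ⊢
        simp only
        linear_combination φ z * hτν
      · rw [(ev_zero (side_ts hb hs hk hlz)).self_of_nhds, mul_zero]
    · by_cases hk : k = j
      · subst hk
        have := (dd_par hφ hse z).2
        rw [C.S_fix hlz] at this
        have : dd (C.ν k) φ z = 0 := by linarith
        rw [this, mul_zero]
      · rw [(dd_ev_zero (ev_zero (side_ts hb hs hk hlz)) _).self_of_nhds, mul_zero]
  · refine C.weak_side C.lm_nonneg hR hl (by norm_num) hb ((i1.const_mul _).add (i2.const_mul _)) fun φ hφ hs hse => ?_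
    refine L.weak hφ (cpt_of_ball hs) _ _ (fun k z _ hlz => ?_) fun k z _ hlz => ?_
    · by_cases hk : k = j
      · subst hk
        have := hse z
        rw [C.S_fix hlz] at this
        have : φ z = 0 := by linarith
        rw [this, mul_zero]
      · rw [(ev_zero (side_ts hb hs hk hlz)).self_of_nhds, mul_zero]
    · by_cases hk : k = j
      · subst hk
        unfold dot at hτν ⊢
        simp only
        linear_combination dd (C.ν k) φ z * hτν
      · rw [(dd_ev_zero (ev_zero (side_ts hb hs hk hlz)) _).self_of_nhds, mul_zero]

lemma LimD.side {a b : ℕ → ℂ → ℝ} {w1 w2 : ℂ → ℝ} (L : LimD C a b w1 w2) {j : Fin 3} {p : ℂ} {R : ℝ} (hR : 0 < R) (hl : C.lm * R ^ 2 ≤ 1)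
    (hb : C.SideBall j p R) : (∃ G, C.Pat C.lm (fun z => (C.τ j).re * C.rep w1 z + (C.τ j).im * C.rep w2 z) p (R / 2) G ∧ ∀ z, G (C.S j z) = 1 * G z) ∧
    (∃ G, C.Pat C.lm (fun z => (C.ν j).re * C.rep w1 z + (C.ν j).im * C.rep w2 z) p (R / 2) G ∧ ∀ z, G (C.S j z) = -1 * G z) ∧
    (∃ G, C.PatA C.lm w1 p (R / 2) G) ∧ ∃ G, C.PatA C.lm w2 p (R / 2) G := by
  obtain ⟨⟨A, hA, sA⟩, B, hB, sB⟩ := L.side_ev hR hl hb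
  obtain ⟨f1, f2, f3⟩ := C.frame_id j
  have e1 := hA.comb hB (C.τ j).re (C.ν j).re
  have e2 := hA.comb hB (C.τ j).im (C.ν j).im
  have g1 : (fun z => (C.τ j).re * ((C.τ j).re * w1 z + (C.τ j).im * w2 z) + (C.ν j).re * ((C.ν j).re * w1 z + (C.ν j).im * w2 z)) = w1 := by
    ext z; linear_combination w1 z * f1 + w2 z * f3
  have g2 : (fun z => (C.τ j).im * ((C.τ j).re * w1 z + (C.τ j).im * w2 z) + (C.ν j).im * ((C.ν j).re * w1 z + (C.ν j).im * w2 z)) = w2 := by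
    ext z; linear_combination w2 z * f2 + w1 z * f3
  rw [g1] at e1
  rw [g2] at e2
  have h1 := C.hτ j
  have h2 := C.hν j
  have h3 := C.hτν j
  unfold dot at h1 h2 h3
  have r1 := e1.rep
  have r2 := e2.rep
  refine ⟨⟨A, ⟨hA.1, hA.2.1, fun z hz hzb => ?_⟩, sA⟩, ⟨B, ⟨hB.1, hB.2.1, fun z hz hzb => ?_⟩, sB⟩, ⟨_, e1⟩, ⟨_, e2⟩⟩
  · beta_reduce; rw [← r1.2.2 z hz hzb, ← r2.2.2 z hz hzb]
    linear_combination -B z * h3 - A z * h1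
  · beta_reduce; rw [← r1.2.2 z hz hzb, ← r2.2.2 z hz hzb]
    linear_combination -A z * h3 - B z * h2

lemma LimD.int1 {a b : ℕ → ℂ → ℝ} {w1 w2 : ℂ → ℝ} (L : LimD C a b w1 w2) {p : ℂ} {R : ℝ} (hR : 0 < R) (hl : C.lm * R ^ 2 ≤ 1)
    (hb : Metric.ball p R ⊆ C.T) : (∃ G, C.PatA C.lm w1 p (R / 2) G) ∧ ∃ G, C.PatA C.lm w2 p (R / 2) G := by
  have h1 := L.int 1 0 hR hl hb
  have h2 := L.int 0 1 hR hl hb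
  simp only [one_mul, zero_mul, add_zero, zero_add] at h1 h2
  exact ⟨h1, h2⟩

lemma LimD.tsol {a b : ℕ → ℂ → ℝ} {w1 w2 : ℂ → ℝ} (L : LimD C a b w1 w2) : TSol C C.lm (C.rep w1) (C.rep w2) :=
  ⟨fun _ _ hR hl hb => (L.int1 hR hl hb).1.imp fun _ h => h.rep, fun _ _ hR hl hb => (L.int1 hR hl hb).2.imp fun _ h => h.rep,
    fun _ _ _ hR hl hb => (L.side hR hl hb).1, fun _ _ _ hR hl hb => (L.side hR hl hb).2.1⟩

lemma LimD.loc {a b : ℕ → ℂ → ℝ} {w1 w2 : ℂ → ℝ} (L : LimD C a b w1 w2) {z : ℂ} (hz : z ∈ C.T) (hV : z ∉ C.V) :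
    ∃ ρ > 0, (∃ G, C.PatA C.lm w1 z ρ G) ∧ ∃ G, C.PatA C.lm w2 z ρ G := by
  rcases T0_or_side hz with h0 | ⟨j, hj⟩
  · obtain ⟨r, hr, hb⟩ := Metric.isOpen_iff.1 C.T0_open z h0
    obtain ⟨R, hR, hRr, hl⟩ := exists_R C.lm hr
    exact ⟨R / 2, by positivity, L.int1 hR hl (((Metric.ball_subset_ball hRr).trans hb).trans C.T0_sub)⟩
  · obtain ⟨r, hr, hb⟩ := exists_sideBall hz hV hj
    obtain ⟨R, hR, hRr, hl⟩ := exists_R C.lm hr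
    exact ⟨R / 2, by positivity, (L.side hR hl (hb.mono hRr)).2.2⟩

lemma rep_ae {g : ℂ → ℝ} (h : ∀ z ∈ C.T, z ∉ C.V → ∃ ρ > 0, ∃ G, C.PatA C.lm g z ρ G) : ∀ᵐ z ∂(volume.restrict C.T), C.rep g z = g z := by
  have key : volume {z | z ∈ C.T0 ∧ C.rep g z ≠ g z} = 0 := by
    apply measure_null_of_locally_null
    rintro z ⟨hz, -⟩
    obtain ⟨ρ, hρ, G, hG⟩ := h z (C.T0_sub hz) (T0_notV hz)
    refine ⟨{y | y ∈ C.T0 ∧ C.rep g y ≠ g y} ∩ Metric.ball z ρ, inter_mem_nhdsWithin _ (Metric.ball_mem_nhds z hρ), ?_⟩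
    refine measure_mono_null (t := {y | ¬ (y ∈ C.T → y ∈ Metric.ball z ρ → G y = g y)}) ?_ hG.2.2
    rintro y ⟨⟨h1, h2⟩, h3⟩ hc
    exact h2 (by rw [← hG.rep.2.2 y (C.T0_sub h1) h3]; exact hc (C.T0_sub h1) h3)
  have k2 : ∀ᵐ z, ¬ (z ∈ C.T0 ∧ C.rep g z ≠ g z) := by
    rw [ae_iff]; simpa using key
  filter_upwards [C.T_ae, ae_restrict_of_ae k2] with z h1 h2
  by_contra hc
  exact h2 ⟨h1, hc⟩

lemma rep_nonneg {g : ℂ → ℝ} (h : ∀ z ∈ C.T, z ∉ C.V → ∃ ρ > 0, ∃ G, C.PatA C.lm g z ρ G) (h0 : ∀ᵐ z ∂(volume.restrict C.T), 0 ≤ g z)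
    {z : ℂ} (hz : z ∈ C.T) (hV : z ∉ C.V) : 0 ≤ C.rep g z := by
  obtain ⟨ρ, hρ, G, hG⟩ := h z hz hV
  have hzb := Metric.mem_ball_self (x := z) hρ
  rw [← hG.rep.2.2 z hz hzb]
  have : G z = |G z| := by
    refine C.ae_eq_on (G' := fun z => |G z|) (p := z) (ρ := ρ) hG.1.continuous hG.1.continuous.abs ?_ z hz hzb
    rw [ae_restrict_iff' C.T_meas] at h0
    filter_upwards [hG.2.2, h0] with y h1 h2 h3 h4
    rw [h1 h3 h4, abs_of_nonneg (h2 h3)]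
  rw [this]; exact abs_nonneg _

lemma ibp0 {F : ℂ → ℝ} {K : NNReal} (hF : LipschitzOnWith K F C.T) (h0 : ∀ j, ∀ z ∈ C.T, C.l j z = 0 → F z = 0) :
    (∫ z in C.T, dd 1 F z = 0) ∧ ∫ z in C.T, dd I F z = 0 := by
  have hz : LipschitzOnWith 0 (fun _ : ℂ => (0:ℝ)) C.T := (LipschitzWith.const 0).lipschitzOnWith
  constructor
  · have := C.div_lemma_on hF hz (fun j z hz hl => by rw [h0 j z hz hl]; simp [dot])
    simpa [dd_const] using this
  · have := C.div_lemma_on hz hF (fun j z hz hl => by rw [h0 j z hz hl]; simp [dot])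
    simpa [dd_const] using this

lemma gr_l2 {a : ℕ → ℂ → ℝ} {w g W : ℂ → ℝ} {v : ℂ} (hv : v = 1 ∨ v = I) (ha : ∀ n, ∃ K : NNReal, LipschitzWith K (a n))
    (mw : MemLp w 2 (volume.restrict C.T)) (t : Tendsto (fun n => ∫ z in C.T, (a n z - w z) ^ 2) atTop (𝓝 0))
    (mW : MemLp W 2 (volume.restrict C.T)) (tW : Tendsto (fun n => ∫ z in C.T, (dd v (a n) z - W z) ^ 2) atTop (𝓝 0))
    {lam : ℝ} (hg : C.Reg lam g) (hgw : ∀ᵐ z ∂(volume.restrict C.T), g z = w z) :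
    IntegrableOn (fun z => C.gr v g z ^ 2) C.T ∧
      (Tendsto (fun n => ∫ z in C.T, dd v (a n) z ^ 2) atTop (𝓝 0) → ∫ z in C.T, C.gr v g z ^ 2 = 0) := by
  have hgr := hg.gr v
  have ibp {F : ℂ → ℝ} (hF : ∃ K, LipschitzOnWith K F C.T) (h0 : ∀ j, ∀ z ∈ C.T, C.l j z = 0 → F z = 0) : ∫ z in C.T, dd v F z = 0 := by
    obtain ⟨K, hF⟩ := hF
    rcases hv with rfl | rfl
    · exact (ibp0 hF h0).1
    · exact (ibp0 hF h0).2
  have main : ∀ᵐ z ∂(volume.restrict C.T), z ∈ C.T0 → W z - C.gr v g z = 0 := by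
    apply C.T0_open.ae_eq_zero_of_integral_contDiff_smul_eq_zero
    · have h1 : LocallyIntegrableOn W C.T0 (volume.restrict C.T) := by
        have : Integrable W (volume.restrict C.T) := mW.integrable (by norm_num)
        exact this.integrableOn.locallyIntegrableOn
      have h2 : LocallyIntegrableOn (C.gr v g) C.T0 (volume.restrict C.T) := by
        refine ContinuousOn.locallyIntegrableOn (hgr.cont.mono fun z hz => ⟨C.T0_sub hz, T0_notV hz⟩) C.T0_open.measurableSet
      exact h1.sub h2
    · intro φ hφ hc hs
      have hb : ∀ j, ∀ z ∈ C.T, C.l j z = 0 → φ z = 0 := fun j z _ hl => by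
        have : z ∉ tsupport φ := fun h => (hs h j).ne' hl
        exact (ev_zero this).self_of_nhds
      obtain ⟨L, hL⟩ := lip_smooth hφ hc
      have lip {f : ℂ → ℝ} (hf : C.Reg lam f) : ∃ K, LipschitzOnWith K (fun z => φ z * f z) C.T := by
        apply lip_of_loc
        intro z hz
        by_cases h : z ∈ tsupport φ
        · right
          exact (hφ.contDiffWithinAt.mul (hf.cdw hz (T0_notV (hs h)))).of_le (by norm_cast)
        · left
          filter_upwards [ev_zero h] with y hy
          rw [hy, zero_mul]
      have int {f : ℂ → ℝ} (hf : C.Reg lam f) : IntegrableOn (fun z => φ z * f z) C.T :=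
        (lip hf).choose_spec.continuousOn.integrableOn_compact C.T_compact
      have mφ : MemLp φ 2 (volume.restrict C.T) := cont_l2 hφ.continuous
      have mdφ : MemLp (dd v φ) 2 (volume.restrict C.T) := cont_l2 (contDiff_dd hφ v).continuous
      have mA n : MemLp (a n) 2 (volume.restrict C.T) := cont_l2 (ha n).choose_spec.continuous
      have mD n : MemLp (dd v (a n)) 2 (volume.restrict C.T) := dd_l2 (ha n).choose_spec v
      have e1 : ∫ z in C.T, W z * φ z = - ∫ z in C.T, w z * dd v φ z := by
        refine tendsto_nhds_unique (l2_lim mD mW mφ tW) ?_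
        refine (l2_lim mA mw mdφ t).neg.congr fun n => ?_
        obtain ⟨K, hK⟩ := ha n
        have h := ibp (C.lip_mul hK hL) (fun j z hz hl => by rw [hb j z hz hl, mul_zero])
        have : ∫ z in C.T, dd v (fun z => a n z * φ z) z = ∫ z in C.T, (a n z * dd v φ z + dd v (a n) z * φ z) := by
          apply integral_congr_ae
          apply ae_restrict_of_ae
          filter_upwards [hK.ae_differentiableAt] with z hz
          rw [dd_mul hz (cdd hφ z)]; ring
        rw [this, integral_add (l2_int (mA n) mdφ) (l2_int (mD n) mφ)] at h
        linarith
      have e2 : ∫ z in C.T, φ z * C.gr v g z = - ∫ z in C.T, w z * dd v φ z := by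
        have h := ibp (lip hg) (fun j z hz hl => by rw [hb j z hz hl, zero_mul])
        have : ∫ z in C.T, dd v (fun z => φ z * g z) z = ∫ z in C.T, (φ z * C.gr v g z + w z * dd v φ z) := by
          apply integral_congr_ae
          filter_upwards [C.T_ae, hgw] with z hz hgz
          rw [dd_mul (cdd hφ z) (cdda (hg.T0 hz).1), gr_eq_dd hz, hgz]
        rw [this, integral_add (int hgr) (l2_int mw mdφ)] at h
        linarith
      have e3 : ∫ z in C.T, φ z • (W z - C.gr v g z) = ∫ z in C.T, (W z * φ z - φ z * C.gr v g z) := by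
        congr 1; ext z; simp only [smul_eq_mul]; ring
      rw [e3, integral_sub (l2_int mW mφ) (int hgr), e1, e2, sub_self]
  have ea : (fun z => W z ^ 2) =ᵐ[volume.restrict C.T] fun z => C.gr v g z ^ 2 := by
    filter_upwards [main, C.T_ae] with z h1 h2
    have := h1 h2
    rw [show C.gr v g z = W z by linarith]
  refine ⟨mW.integrable_sq.congr ea, fun h => ?_⟩
  rw [← integral_congr_ae ea]
  exact tendsto_nhds_unique (l2_lim_sq (fun n => dd_l2 (ha n).choose_spec v) mW tW) h

lemma LimD.zero {a b : ℕ → ℂ → ℝ} {w1 w2 : ℂ → ℝ} (L : LimD C a b w1 w2) (h0 : C.lm = 0) {v : ℂ} (hv : v = 1 ∨ v = I) :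
    Tendsto (fun n => ∫ z in C.T, dd v (a n) z ^ 2) atTop (𝓝 0) ∧ Tendsto (fun n => ∫ z in C.T, dd v (b n) z ^ 2) atTop (𝓝 0) := by
  have q := L.q
  have e n : C.bl C.lm (a n) (b n) (a n) (b n) = ∫ z in C.T, (sg (a n) z + sg (b n) z) := by
    rw [bl_self (L.fld n).la (L.fld n).lb, h0, zero_mul, sub_zero]; rfl
  simp only [e] at q
  have i n : IntegrableOn (fun z => sg (a n) z + sg (b n) z) C.T := (sg_int (L.fld n).la.choose_spec).add (sg_int (L.fld n).lb.choose_spec)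
  have k (f : ℂ → ℝ) (z : ℂ) : dd v f z ^ 2 ≤ sg f z := by
    unfold sg; rcases hv with rfl | rfl <;> nlinarith [sq_nonneg (dd 1 f z), sq_nonneg (dd I f z)]
  constructor
  · refine tendsto_of_tendsto_of_tendsto_of_le_of_le tendsto_const_nhds q (fun n => integral_nonneg fun z => sq_nonneg _) fun n => ?_
    exact integral_mono (dd_l2 (L.fld n).la.choose_spec v).integrable_sq (i n) fun z => by
      linarith [k (a n) z, sg_nonneg (b n) z]
  · refine tendsto_of_tendsto_of_tendsto_of_le_of_le tendsto_const_nhds q (fun n => integral_nonneg fun z => sq_nonneg _) fun n => ?_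
    exact integral_mono (dd_l2 (L.fld n).lb.choose_spec v).integrable_sq (i n) fun z => by
      linarith [k (b n) z, sg_nonneg (a n) z]

/-- the first tangential field -/
structure WSol (C : Cfg) (w1 w2 : ℂ → ℝ) : Prop where
  ts : TSol C C.lm w1 w2
  n1 : ∀ z ∈ C.T, z ∉ C.V → 0 ≤ w1 z
  n2 : ∀ z ∈ C.T, z ∉ C.V → 0 ≤ w2 z
  s1 : MemLp w1 2 (volume.restrict C.T)
  s2 : MemLp w2 2 (volume.restrict C.T)
  one : (∫ z in C.T, w1 z ^ 2) + ∫ z in C.T, w2 z ^ 2 = 1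
  d1 : ∀ v, v = 1 ∨ v = I → IntegrableOn (fun z => C.gr v w1 z ^ 2) C.T
  d2 : ∀ v, v = 1 ∨ v = I → IntegrableOn (fun z => C.gr v w2 z ^ 2) C.T
  e1 : C.lm = 0 → ∀ v, v = 1 ∨ v = I → ∫ z in C.T, C.gr v w1 z ^ 2 = 0
  e2 : C.lm = 0 → ∀ v, v = 1 ∨ v = I → ∫ z in C.T, C.gr v w2 z ^ 2 = 0

theorem exists_w (C : Cfg) : ∃ w1 w2, WSol C w1 w2 := by
  obtain ⟨a, b, w1, w2, L⟩ := C.exists_lim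
  have h1 : ∀ z ∈ C.T, z ∉ C.V → ∃ ρ > 0, ∃ G, C.PatA C.lm w1 z ρ G := fun z hz hV => by
    obtain ⟨ρ, hρ, h, -⟩ := L.loc hz hV; exact ⟨ρ, hρ, h⟩
  have h2 : ∀ z ∈ C.T, z ∉ C.V → ∃ ρ > 0, ∃ G, C.PatA C.lm w2 z ρ G := fun z hz hV => by
    obtain ⟨ρ, hρ, -, h⟩ := L.loc hz hV; exact ⟨ρ, hρ, h⟩
  have a1 := rep_ae h1
  have a2 := rep_ae h2
  have nv : ∀ v : ℂ, v = 1 ∨ v = I → ‖v‖ ≤ 1 := by rintro v (rfl | rfl) <;> simp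
  refine ⟨C.rep w1, C.rep w2, L.tsol, fun z => rep_nonneg h1 L.p1, fun z => rep_nonneg h2 L.p2, L.m1.ae_eq (EventuallyEq.symm a1),
    L.m2.ae_eq (EventuallyEq.symm a2), ?_, fun v hv => ?_, fun v hv => ?_, fun h0 v hv => ?_, fun h0 v hv => ?_⟩
  · rw [← L.one]
    congr 1
    · apply integral_congr_ae; filter_upwards [a1] with z hz; rw [hz]
    · apply integral_congr_ae; filter_upwards [a2] with z hz; rw [hz]
  · obtain ⟨W, mW, tW⟩ := L.d1 v (nv v hv)
    exact gr_l2 hv (fun n => (L.fld n).la) L.m1 L.t1 mW tW L.tsol.reg1 a1 |>.1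
  · obtain ⟨W, mW, tW⟩ := L.d2 v (nv v hv)
    exact gr_l2 hv (fun n => (L.fld n).lb) L.m2 L.t2 mW tW L.tsol.reg2 a2 |>.1
  · obtain ⟨W, mW, tW⟩ := L.d1 v (nv v hv)
    exact (gr_l2 hv (fun n => (L.fld n).la) L.m1 L.t1 mW tW L.tsol.reg1 a1).2 (L.zero h0 hv).1
  · obtain ⟨W, mW, tW⟩ := L.d2 v (nv v hv)
    exact (gr_l2 hv (fun n => (L.fld n).lb) L.m2 L.t2 mW tW L.tsol.reg2 a2).2 (L.zero h0 hv).2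

end Cfg
end HS
end

noncomputable section
namespace HS
open Complex Filter Topology MeasureTheory
open scoped ContDiff Convolution
namespace Cfg
variable {C : Cfg}

lemma side_pt (C : Cfg) (j : Fin 3) : ∃ z ∈ C.T, z ∉ C.V ∧ C.l j z = 0 := by
  have hp : ∀ k, 0 < C.h k := C.hpos
  have a1 : j + 1 ≠ j := by fin_cases j <;> decide
  have a2 : j + 2 ≠ j := by fin_cases j <;> decide
  have a3 : j + 1 ≠ j + 2 := by fin_cases j <;> decide
  have e k : C.l k ((1/2 : ℝ) • C.P (j + 1) + (1/2 : ℝ) • C.P (j + 2)) = 1/2 * C.l k (C.P (j + 1)) + 1/2 * C.l k (C.P (j + 2)) :=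
    l_comb C k _ _ (by norm_num)
  refine ⟨(1/2 : ℝ) • C.P (j + 1) + (1/2 : ℝ) • C.P (j + 2), C.T_convex (C.P_mem _) (C.P_mem _) (by norm_num) (by norm_num) (by norm_num), ?_, ?_⟩
  · rintro ⟨m, hm⟩
    have e1 := e (j + 1)
    have e2 := e (j + 2)
    rw [← hm, C.l_P_self, C.l_P_ne a3] at e1
    rw [← hm, C.l_P_self, C.l_P_ne a3.symm] at e2
    have p1 := hp (j + 1)
    have p2 := hp (j + 2)
    by_cases h : j + 1 = m
    · rw [C.l_P_ne (by rw [← h]; exact a3.symm)] at e2; linarith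
    · rw [C.l_P_ne h] at e1; linarith
  · rw [e, C.l_P_ne a1.symm, C.l_P_ne a2.symm]; norm_num

/-- T is the closure of its interior, local version -/
lemma T0_near {z : ℂ} (hz : z ∈ C.T) {r : ℝ} (hr : 0 < r) : ∃ y ∈ C.T0, y ∈ Metric.ball z r := by
  have h : z ∈ closure (interior C.T) := by
    rw [C.T_convex.closure_interior_eq_closure_of_nonempty_interior (by rw [interior_T]; exact C.T0_nonempty)]
    exact subset_closure hz
  rw [interior_T] at h
  obtain ⟨y, hy, hd⟩ := Metric.mem_closure_iff.1 h r hr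
  exact ⟨y, hy, by rw [Metric.mem_ball, dist_comm]; exact hd⟩

/-- values on T off V are determined by the interior -/
lemma Reg.ext0 {lam c : ℝ} {g : ℂ → ℝ} (h : C.Reg lam g) (h0 : ∀ z ∈ C.T0, g z = c) {z : ℂ} (hz : z ∈ C.T) (hV : z ∉ C.V) : g z = c := by
  obtain ⟨ρ, hρ, G, hG⟩ := h z hz hV
  by_contra hne
  rw [← hG.2.2 z hz (Metric.mem_ball_self hρ)] at hne
  have : ∀ᶠ y in 𝓝 z, G y ≠ c := hG.1.continuous.continuousAt.eventually_ne hne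
  obtain ⟨r, hr, hb⟩ := Metric.eventually_nhds_iff_ball.1 this
  obtain ⟨y, hy, hyb⟩ := T0_near hz (lt_min hr hρ)
  have b1 := Metric.ball_subset_ball (min_le_left r ρ) hyb
  have b2 := Metric.ball_subset_ball (min_le_right r ρ) hyb
  exact hb y b1 (by rw [hG.2.2 y (C.T0_sub hy) b2, h0 y hy])

lemma Reg.zero0 {lam : ℝ} (hlam : 0 ≤ lam) {g : ℂ → ℝ} (h : C.Reg lam g) (hn : ∀ z ∈ C.T, z ∉ C.V → 0 ≤ g z) {z0 : ℂ} (hz0 : z0 ∈ C.T0) (h0 : g z0 = 0) :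
    ∀ z ∈ C.T0, g z = 0 := by
  have o1 : IsOpen {z | z ∈ C.T0 ∧ g z = 0} := by
    rw [Metric.isOpen_iff]
    rintro z ⟨hz, hg⟩
    obtain ⟨r, hr, hb⟩ := Metric.isOpen_iff.1 C.T0_open z hz
    obtain ⟨ρ, hρ, G, hG⟩ := h z (C.T0_sub hz) (T0_notV hz)
    obtain ⟨R, hR, hRr, hl⟩ := exists_R lam (lt_min hr hρ)
    have b {y : ℂ} (hy : ‖y - z‖ < R) : y ∈ C.T0 ∧ y ∈ Metric.ball z ρ := by
      have : y ∈ Metric.ball z R := by rwa [Metric.mem_ball, dist_eq_norm]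
      exact ⟨hb (Metric.ball_subset_ball (hRr.trans (min_le_left _ _)) this), Metric.ball_subset_ball (hRr.trans (min_le_right _ _)) this⟩
    have e {y : ℂ} (hy : ‖y - z‖ < R) : G y = g y := hG.2.2 y (C.T0_sub (b hy).1) (b hy).2
    have key := strong_pos hlam hR hl hG.1 (fun y hy => hG.2.1 y (b hy).2)
      (fun y hy => by rw [e hy]; exact hn y (C.T0_sub (b hy).1) (T0_notV (b hy).1)) (by rw [e (by simpa using hR), hg])
    refine ⟨R, hR, fun y hy => ?_⟩
    rw [Metric.mem_ball, dist_eq_norm] at hy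
    exact ⟨(b hy).1, by rw [← e hy]; exact key y hy⟩
  have o2 : IsOpen {z | z ∈ C.T0 ∧ g z ≠ 0} :=
    ContinuousOn.isOpen_inter_preimage (h.cont.mono fun z hz => ⟨C.T0_sub hz, T0_notV hz⟩) C.T0_open isOpen_compl_singleton
  have := C.T0_convex.isPreconnected.subset_left_of_subset_union o1 o2
    (disjoint_left.2 fun z h1 h2 => h2.2 h1.2) (fun z hz => by by_cases hh : g z = 0; exacts [Or.inl ⟨hz, hh⟩, Or.inr ⟨hz, hh⟩]) ⟨z0, hz0, hz0, h0⟩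
  exact fun z hz => (this hz).2

lemma WSol.not_zero {w1 w2 : ℂ → ℝ} (W : WSol C w1 w2) (h1 : ∀ z ∈ C.T0, w1 z = 0) (h2 : ∀ z ∈ C.T0, w2 z = 0) : False := by
  have one := W.one
  have z1 : ∫ z in C.T, w1 z ^ 2 = 0 := integral_eq_zero_of_ae (by filter_upwards [C.T_ae] with z hz; simp [h1 z hz])
  have z2 : ∫ z in C.T, w2 z ^ 2 = 0 := integral_eq_zero_of_ae (by filter_upwards [C.T_ae] with z hz; simp [h2 z hz])
  rw [z1, z2] at one; norm_num at one

lemma WSol.side_ne {w1 w2 : ℂ → ℝ} (W : WSol C w1 w2) {z : ℂ} (hz : z ∈ C.T) (hV : z ∉ C.V) {j : Fin 3} (hj : C.l j z = 0) :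
    w1 z ≠ 0 ∧ w2 z ≠ 0 := by
  have hnu := (W.ts.od j).zero hz hV hj
  have ht : (C.τ j).re * w2 z = (C.τ j).im * w1 z := by
    obtain ⟨κ, k1, k2, k3⟩ := C.frame j
    simp only [k2, k3] at hnu
    linear_combination κ * hnu - ((C.τ j).re * w2 z - (C.τ j).im * w1 z) * k1
  have p1 := C.τre j
  have p2 := C.τim j
  have key : ¬ (w1 z = 0 ∧ w2 z = 0) := by
    rintro ⟨z1, z2⟩
    obtain ⟨r, hr, hb⟩ := exists_sideBall hz hV hj
    obtain ⟨R, hR, hRr, hl⟩ := exists_R C.lm hr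
    obtain ⟨G, hG, hS⟩ := W.ts.ev j z R hR hl (hb.mono hRr)
    have hb' := hb.mono (show R / 2 ≤ r by linarith)
    have hz0 : G z = 0 := by rw [hG.2.2 z hz (Metric.mem_ball_self (by positivity))]; simp [z1, z2]
    have pos0 {y : ℂ} (hy : y ∈ Metric.ball z (R / 2)) (hly : 0 ≤ C.l j y) : 0 ≤ G y := by
      have hT := C.side_mem hb' hy hly
      have hv := sideBall_notV hb' hy
      rw [hG.2.2 y hT hy]
      exact add_nonneg (mul_nonneg p1.le (W.n1 y hT hv)) (mul_nonneg p2.le (W.n2 y hT hv))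
    have G0 := strong_pos C.lm_nonneg (half_pos hR) (by nlinarith [C.lm_nonneg, sq_nonneg R, mul_nonneg C.lm_nonneg (sq_nonneg R)]) hG.1
      (fun y hy => hG.2.1 y (by rwa [Metric.mem_ball, dist_eq_norm])) (fun y hy => by
        have hy' : y ∈ Metric.ball z (R / 2) := by rwa [Metric.mem_ball, dist_eq_norm]
        by_cases hly : 0 ≤ C.l j y
        · exact pos0 hy' hly
        · have := pos0 (C.S_ball hj hy') (by rw [C.l_S]; linarith)
          rwa [hS, one_mul] at this) hz0
    obtain ⟨y, hy, hyb⟩ := T0_near hz (half_pos hR)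
    have hyT := C.T0_sub hy
    have hyV := T0_notV hy
    have e := G0 y (by rwa [Metric.mem_ball, dist_eq_norm] at hyb)
    rw [hG.2.2 y hyT hyb] at e
    have y1 := W.n1 y hyT hyV
    have y2 := W.n2 y hyT hyV
    have q1 := mul_nonneg p1.le y1
    have q2 := mul_nonneg p2.le y2
    simp only at e
    have x1 : w1 y = 0 := by
      have : (C.τ j).re * w1 y = 0 := by linarith
      exact (mul_eq_zero.1 this).resolve_left p1.ne'
    have x2 : w2 y = 0 := by
      have : (C.τ j).im * w2 y = 0 := by linarith
      exact (mul_eq_zero.1 this).resolve_left p2.ne'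
    exact W.not_zero (W.ts.reg1.zero0 C.lm_nonneg W.n1 hy x1) (W.ts.reg2.zero0 C.lm_nonneg W.n2 hy x2)
  constructor
  · intro h
    rw [h, mul_zero] at ht
    exact key ⟨h, (mul_eq_zero.1 ht).resolve_left p1.ne'⟩
  · intro h
    rw [h, mul_zero] at ht
    exact key ⟨(mul_eq_zero.1 ht.symm).resolve_left p2.ne', h⟩

lemma WSol.pos {w1 w2 : ℂ → ℝ} (W : WSol C w1 w2) {z : ℂ} (hz : z ∈ C.T) (hV : z ∉ C.V) : 0 < w1 z ∧ 0 < w2 z := by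
  obtain ⟨y, hy, hyV, hy0⟩ := C.side_pt 0
  rcases T0_or_side hz with h0 | ⟨j, hj⟩
  · constructor
    · refine (W.n1 z hz hV).lt_of_ne' fun h => ?_
      exact (W.side_ne hy hyV hy0).1 (W.ts.reg1.ext0 (W.ts.reg1.zero0 C.lm_nonneg W.n1 h0 h) hy hyV)
    · refine (W.n2 z hz hV).lt_of_ne' fun h => ?_
      exact (W.side_ne hy hyV hy0).2 (W.ts.reg2.ext0 (W.ts.reg2.zero0 C.lm_nonneg W.n2 h0 h) hy hyV)
  · have := W.side_ne hz hV hj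
    exact ⟨(W.n1 z hz hV).lt_of_ne' this.1, (W.n2 z hz hV).lt_of_ne' this.2⟩

/-- zero gradient on the interior gives constancy -/
lemma const_of_dd {g : ℂ → ℝ} (hd : ∀ z ∈ C.T0, DifferentiableAt ℝ g z) (h1 : ∀ z ∈ C.T0, dd 1 g z = 0) (hI : ∀ z ∈ C.T0, dd I g z = 0) :
    ∃ c, ∀ z ∈ C.T0, g z = c := by
  obtain ⟨x, hx⟩ := C.T0_nonempty
  refine ⟨g x, fun z hz => ?_⟩
  have hf : ∀ y ∈ C.T0, fderivWithin ℝ g C.T0 y = 0 := fun y hy => by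
    rw [fderivWithin_of_isOpen C.T0_open hy]
    ext v
    have := dd_lin v g y
    rw [h1 y hy, hI y hy, mul_zero, mul_zero, add_zero] at this
    exact this
  have hdo : DifferentiableOn ℝ g C.T0 := fun y hy => (hd y hy).differentiableWithinAt
  have := C.T0_convex.norm_image_sub_le_of_norm_fderivWithin_le (C := 0) hdo (fun y hy => by rw [hf y hy, norm_zero]) hx hz
  rw [zero_mul] at this
  exact sub_eq_zero.1 (norm_le_zero_iff.1 this)

lemma grad_zero {lam : ℝ} {g : ℂ → ℝ} (hg : C.Reg lam g) {v : ℂ} (hi : IntegrableOn (fun z => C.gr v g z ^ 2) C.T)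
    (h : ∫ z in C.T, C.gr v g z ^ 2 = 0) : ∀ z ∈ C.T0, dd v g z = 0 := by
  rw [integral_eq_zero_iff_of_nonneg (fun z => sq_nonneg _) hi] at h
  have hc : ContinuousOn (C.gr v g) C.T0 := (hg.gr v).cont.mono fun z hz => ⟨C.T0_sub hz, T0_notV hz⟩
  have : ∀ᵐ z ∂(volume.restrict C.T0), C.gr v g z = (fun _ => (0:ℝ)) z := by
    filter_upwards [ae_restrict_of_ae_restrict_of_subset C.T0_sub h] with z hz
    exact pow_eq_zero_iff (two_ne_zero) |>.1 hz
  have := Measure.eqOn_open_of_ae_eq this C.T0_open hc continuousOn_const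
  exact fun z hz => by rw [← gr_eq_dd hz]; exact this hz

theorem lm_pos (C : Cfg) : 0 < C.lm := by
  refine C.lm_nonneg.lt_of_ne' fun h0 => ?_
  obtain ⟨w1, w2, W⟩ := C.exists_w
  have r1 := W.ts.reg1
  have r2 := W.ts.reg2
  obtain ⟨c, hc⟩ := const_of_dd (fun z hz => cdda (r1.T0 hz).1) (grad_zero r1 (W.d1 1 (Or.inl rfl)) (W.e1 h0 1 (Or.inl rfl)))
    (grad_zero r1 (W.d1 I (Or.inr rfl)) (W.e1 h0 I (Or.inr rfl)))
  obtain ⟨d, hd⟩ := const_of_dd (fun z hz => cdda (r2.T0 hz).1) (grad_zero r2 (W.d2 1 (Or.inl rfl)) (W.e2 h0 1 (Or.inl rfl)))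
    (grad_zero r2 (W.d2 I (Or.inr rfl)) (W.e2 h0 I (Or.inr rfl)))
  have hj (j : Fin 3) : dot (C.ν j) ⟨c, d⟩ = 0 := by
    obtain ⟨z, hz, hV, hl⟩ := C.side_pt j
    have := (W.ts.od j).zero hz hV hl
    simp only [r1.ext0 hc hz hV, r2.ext0 hd hz hV] at this
    exact this
  obtain ⟨x, hx⟩ := C.T0_nonempty
  have e1 := C.sP x
  have e2 := C.sP (x + ⟨c, d⟩)
  simp only [C.l_add, hj, add_zero] at e2
  rw [e1] at e2
  have : (⟨c, d⟩ : ℂ) = 0 := by linear_combination -e2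
  have hc0 : c = 0 := congrArg Complex.re this
  have := (W.pos (C.T0_sub hx) (T0_notV hx)).1
  rw [hc x hx, hc0] at this
  exact lt_irrefl _ this

end Cfg
end HS
end

noncomputable section
namespace HS
open Complex Filter Topology MeasureTheory
open scoped ContDiff Convolution
namespace Cfg
variable {C : Cfg}

lemma TSol.ident {lam : ℝ} {w1 w2 : ℂ → ℝ} (h : TSol C lam w1 w2) {z : ℂ} (hz : z ∈ C.T) (hV : z ∉ C.V) :
    lam * w1 z = C.gr I (C.cl w1 w2) z - C.gr 1 (C.dv w1 w2) z ∧ lam * w2 z = - C.gr 1 (C.cl w1 w2) z - C.gr I (C.dv w1 w2) z := by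
  have r1 := h.reg1
  have r2 := h.reg2
  have rf := h.div.reg
  have rp := h.curl.reg
  have dvd (v y : ℂ) (hy : y ∈ C.T0) : dd v (C.dv w1 w2) y = dd v (dd 1 w1) y + dd v (dd I w2) y := by
    have ev : C.dv w1 w2 =ᶠ[𝓝 y] fun x => 1 * dd 1 w1 x + 1 * dd I w2 x := by
      filter_upwards [C.T0_open.mem_nhds hy] with x hx
      unfold dv; rw [gr_eq_dd hx, gr_eq_dd hx]
    rw [(dd_congr ev v), dd_comb (cdda (contDiffAt_dd (r1.T0 hy).1 1)) (cdda (contDiffAt_dd (r2.T0 hy).1 I))]; ring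
  have cld (v y : ℂ) (hy : y ∈ C.T0) : dd v (C.cl w1 w2) y = dd v (dd 1 w2) y - dd v (dd I w1) y := by
    have ev : C.cl w1 w2 =ᶠ[𝓝 y] fun x => 1 * dd 1 w2 x + (-1) * dd I w1 x := by
      filter_upwards [C.T0_open.mem_nhds hy] with x hx
      unfold cl; rw [gr_eq_dd hx, gr_eq_dd hx]
    rw [(dd_congr ev v), dd_comb (cdda (contDiffAt_dd (r2.T0 hy).1 1)) (cdda (contDiffAt_dd (r1.T0 hy).1 I))]; ring
  have A := ((r1.comb (rf.gr 1) lam 1).comb (rp.gr I) 1 (-1)).ext0 (c := 0) (fun y hy => by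
    have e := (r1.T0 hy).2
    unfold Lap at e
    rw [gr_eq_dd hy, gr_eq_dd hy, dvd 1 y hy, cld I y hy, dd_comm (r2.T0 hy).1 I 1]
    linear_combination e) hz hV
  have B := ((r2.comb (rf.gr I) lam 1).comb (rp.gr 1) 1 1).ext0 (c := 0) (fun y hy => by
    have e := (r2.T0 hy).2
    unfold Lap at e
    rw [gr_eq_dd hy, gr_eq_dd hy, dvd I y hy, cld 1 y hy, dd_comm (r1.T0 hy).1 I 1]
    linear_combination e) hz hV
  exact ⟨by linear_combination A, by linear_combination B⟩

lemma Reg.aesm {lam : ℝ} {g : ℂ → ℝ} (h : C.Reg lam g) : AEStronglyMeasurable g (volume.restrict C.T) := by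
  have h1 : ContinuousOn g C.T0 := h.cont.mono fun z hz => ⟨C.T0_sub hz, T0_notV hz⟩
  have h2 := h1.aestronglyMeasurable (μ := volume.restrict C.T) C.T0_open.measurableSet
  rwa [Measure.restrict_eq_self_of_ae_mem C.T_ae] at h2

lemma comb_sq {lam s : ℝ} (hs : s ^ 2 = 1) {a b : ℂ → ℝ} (ra : C.Reg lam a) (rb : C.Reg lam b) (ia : IntegrableOn (fun z => a z ^ 2) C.T)
    (ib : IntegrableOn (fun z => b z ^ 2) C.T) : IntegrableOn (fun z => (1 * a z + s * b z) ^ 2) C.T := by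
  have hi : IntegrableOn (fun z => 2 * a z ^ 2 + 2 * b z ^ 2) C.T := (ia.const_mul 2).add (ib.const_mul 2)
  refine hi.mono' ((ra.comb rb 1 s).aesm.pow 2) (Eventually.of_forall fun z => ?_)
  rw [Real.norm_eq_abs, abs_of_nonneg (sq_nonneg _)]
  have e : (s * b z) ^ 2 = b z ^ 2 := by rw [mul_pow, hs, one_mul]
  nlinarith [sq_nonneg (a z - s * b z)]

lemma rolle {g : ℂ → ℝ} (hc : ContinuousOn g C.T) (h0 : ∀ z ∈ C.T, z ∉ C.T0 → g z = 0) : ∃ z ∈ C.T0, fderiv ℝ g z = 0 := by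
  have ne : C.T.Nonempty := ⟨_, C.P_mem 0⟩
  obtain ⟨x, hx, mx⟩ := C.T_compact.exists_isMaxOn ne hc
  obtain ⟨y, hy, my⟩ := C.T_compact.exists_isMinOn ne hc
  have nb {z : ℂ} (hz : z ∈ C.T0) : C.T ∈ 𝓝 z := mem_of_superset (C.T0_open.mem_nhds hz) C.T0_sub
  by_cases x0 : x ∈ C.T0
  · exact ⟨x, x0, (mx.isLocalMax (nb x0)).fderiv_eq_zero⟩
  by_cases y0 : y ∈ C.T0
  · exact ⟨y, y0, (my.isLocalMin (nb y0)).fderiv_eq_zero⟩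
  obtain ⟨z, hz⟩ := C.T0_nonempty
  refine ⟨z, hz, IsLocalMax.fderiv_eq_zero ?_⟩
  have all : ∀ p ∈ C.T, g p = 0 := fun p hp => by
    have h1 : g p ≤ g x := mx hp
    have h2 : g y ≤ g p := my hp
    rw [h0 x hx x0] at h1
    rw [h0 y hy y0] at h2
    exact le_antisymm h1 h2
  filter_upwards [nb hz] with p hp
  rw [all p hp, all z (C.T0_sub hz)]

lemma toP {Q : ℂ → ℝ → Prop} {δ : ℝ} (hδ : 0 < δ) (h : ∀ z ∈ C.T, z ∉ C.V → C.dV z < δ → Q z (C.dV z)) (k : Fin 3) :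
    ∃ δ' > 0, ∀ z ∈ C.T, z ∉ C.V → ‖z - C.P k‖ < δ' → Q z ‖z - C.P k‖ := by
  have hh := C.hpos k
  refine ⟨min δ (C.h k / 2), lt_min hδ (by positivity), fun z hz hV hd => ?_⟩
  have e := C.near_dV (k := k) (z := z) (hd.le.trans (min_le_right _ _))
  have := h z hz hV (by rw [e]; exact hd.trans_le (min_le_left _ _))
  rwa [e] at this

lemma bdd_of_vertex {lam : ℝ} {a : ℂ → ℝ} (ha : C.Reg lam a)
    (h : ∀ k, ∃ B δ : ℝ, 0 < δ ∧ ∀ z ∈ C.T, z ∉ C.V → ‖z - C.P k‖ < δ → |a z| ≤ B) : ∃ B, 0 ≤ B ∧ ∀ z ∈ C.T, z ∉ C.V → |a z| ≤ B := by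
  choose B δ hδ hB using h
  have hK : IsCompact (C.T \ ⋃ k, Metric.ball (C.P k) (δ k)) := C.T_compact.diff (isOpen_iUnion fun k => Metric.isOpen_ball)
  have hc : ContinuousOn a (C.T \ ⋃ k, Metric.ball (C.P k) (δ k)) := ha.cont.mono fun z hz => ⟨hz.1, by
    rintro ⟨k, rfl⟩
    exact hz.2 (mem_iUnion.2 ⟨k, Metric.mem_ball_self (hδ k)⟩)⟩
  obtain ⟨M, hM⟩ := hK.exists_bound_of_continuousOn hc
  refine ⟨|M| + ∑ k, |B k|, by positivity, fun z hz hV => ?_⟩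
  have hs : 0 ≤ ∑ k, |B k| := by positivity
  by_cases hm : z ∈ ⋃ k, Metric.ball (C.P k) (δ k)
  · obtain ⟨k, hk⟩ := mem_iUnion.1 hm
    have h1 := hB k z hz hV (by rwa [Metric.mem_ball, dist_eq_norm] at hk)
    have h2 := Finset.single_le_sum (f := fun k => |B k|) (fun i _ => abs_nonneg (B i)) (Finset.mem_univ k)
    have := le_abs_self (B k)
    have := abs_nonneg M
    linarith
  · have := hM z ⟨hz, hm⟩
    rw [Real.norm_eq_abs] at this
    linarith [le_abs_self M]

lemma WSol.psi_bar {w1 w2 : ℂ → ℝ} (W : WSol C w1 w2) (k : Fin 3) :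
    ∃ A δ, 0 < A ∧ 0 < δ ∧ ∀ z ∈ C.T, z ∉ C.V → ‖z - C.P k‖ ≤ δ → |C.cl w1 w2 z| ≤ A * ‖z - C.P k‖ := by
  have hp := W.ts.curl
  refine barrier C.lm_nonneg hp.reg (fun z hz hV j _ hl => (hp.side j).zero hz hV hl) fun ε hε => ?_
  obtain ⟨δ, hδ, hd⟩ := C.l2_small C.lm_nonneg (by norm_num) hp
    (comb_sq (by norm_num) (W.ts.reg2.gr 1) (W.ts.reg1.gr I) (W.d2 1 (Or.inl rfl)) (W.d1 I (Or.inr rfl))) hε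
  exact toP (Q := fun z r => r * |C.cl w1 w2 z| ≤ ε) hδ hd k

lemma WSol.f_bdd {w1 w2 : ℂ → ℝ} (W : WSol C w1 w2) : ∃ B, 0 ≤ B ∧ ∀ z ∈ C.T, z ∉ C.V → |C.gr 1 (C.dv w1 w2) z| ≤ B ∧ |C.gr I (C.dv w1 w2) z| ≤ B := by
  have hf := W.ts.div
  have hlam := C.lm_nonneg
  have key k : ∃ B δ : ℝ, 0 < δ ∧ ∀ z ∈ C.T, z ∉ C.V → ‖z - C.P k‖ < δ → |C.gr 1 (C.dv w1 w2) z| ≤ B ∧ |C.gr I (C.dv w1 w2) z| ≤ B := by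
    apply vertex hlam hf k
    · intro ε hε
      obtain ⟨A, δ, hA, hδ, hbar⟩ := W.psi_bar k
      obtain ⟨B, δ1, hB, hδ1, hg⟩ := odd_grad hlam W.ts.curl.int (fun j _ => W.ts.curl.side j) hA hδ hbar
      have hi : IntegrableOn (fun y => w1 y ^ 2 + w2 y ^ 2) C.T := W.s1.integrable_sq.add W.s2.integrable_sq
      obtain ⟨δ0, hδ0, hd⟩ := C.l2_small_T hlam W.ts hi (ε := ε / 2 / (C.lm + 1)) (by positivity)
      obtain ⟨δ2, hδ2, hd2⟩ := toP (Q := fun z r => r * |w1 z| ≤ ε / 2 / (C.lm + 1) ∧ r * |w2 z| ≤ ε / 2 / (C.lm + 1)) hδ0 hd k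
      refine ⟨min (min δ1 δ2) (ε / 2 / B), by positivity, fun z hz hV hr => ?_⟩
      have q1 := hr.trans_le ((min_le_left _ _).trans (min_le_left δ1 δ2))
      have q2 := hr.trans_le ((min_le_left _ _).trans (min_le_right δ1 δ2))
      have q3 : ‖z - C.P k‖ < ε / 2 / B := hr.trans_le (min_le_right _ _)
      rw [lt_div_iff₀ hB] at q3
      obtain ⟨i1, i2⟩ := W.ts.ident hz hV
      obtain ⟨d1, d2⟩ := hd2 z hz hV q2
      have g1 := hg z hz hV q1.le 1 (by simp)
      have g2 := hg z hz hV q1.le I (by simp)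
      set r := ‖z - C.P k‖
      have hr0 : 0 ≤ r := norm_nonneg _
      have fin (x y p : ℝ) (hy : r * |y| ≤ ε / 2 / (C.lm + 1)) (hp : |p| ≤ B) (hx : |x| ≤ |p| + C.lm * |y|) : r * |x| ≤ ε := by
        rw [le_div_iff₀ (by positivity)] at hy
        have y0 : 0 ≤ r * |y| := by positivity
        have := mul_le_mul_of_nonneg_left hx hr0
        have := mul_le_mul_of_nonneg_left hp hr0
        nlinarith
      constructor
      · refine fin _ (w1 z) _ d1 g2 ?_
        rw [show C.gr 1 (C.dv w1 w2) z = C.gr I (C.cl w1 w2) z - C.lm * w1 z by linarith, ← abs_of_nonneg hlam, ← abs_mul, abs_of_nonneg hlam]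
        exact abs_sub _ _
      · refine fin _ (w2 z) _ d2 g1 ?_
        rw [show C.gr I (C.dv w1 w2) z = -C.gr 1 (C.cl w1 w2) z - C.lm * w2 z by linarith, ← abs_of_nonneg hlam, ← abs_mul, abs_of_nonneg hlam,
          ← abs_neg (C.gr 1 (C.cl w1 w2) z)]
        exact abs_sub _ _
    · obtain ⟨δ, hδ, hd⟩ := C.l2_small hlam (by norm_num) hf
        (comb_sq (by norm_num) (W.ts.reg1.gr 1) (W.ts.reg2.gr I) (W.d1 1 (Or.inl rfl)) (W.d2 I (Or.inr rfl))) one_pos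
      obtain ⟨δ', h1, h2⟩ := toP (Q := fun z r => r * |C.dv w1 w2 z| ≤ 1) hδ hd k
      exact ⟨1, δ', h1, h2⟩
  obtain ⟨B1, p1, h1⟩ := bdd_of_vertex (hf.reg.gr 1) fun k => by
    obtain ⟨B, δ, hδ, h⟩ := key k
    exact ⟨B, δ, hδ, fun z hz hV hd => (h z hz hV hd).1⟩
  obtain ⟨B2, p2, h2⟩ := bdd_of_vertex (hf.reg.gr I) fun k => by
    obtain ⟨B, δ, hδ, h⟩ := key k
    exact ⟨B, δ, hδ, fun z hz hV hd => (h z hz hV hd).2⟩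
  exact ⟨B1 + B2, by positivity, fun z hz hV => ⟨by linarith [h1 z hz hV], by linarith [h2 z hz hV]⟩⟩

lemma WSol.f_ne {w1 w2 : ℂ → ℝ} (W : WSol C w1 w2) : ∃ z ∈ C.T0, C.dv w1 w2 z ≠ 0 := by
  by_contra! hf
  have hp := W.ts.curl
  classical
  set g : ℂ → ℝ := fun z => if z ∈ C.V then 0 else C.cl w1 w2 z with hg
  have gV {z : ℂ} (h : z ∉ C.V) : g z = C.cl w1 w2 z := by simp only [hg, if_neg h]
  have gV' {z : ℂ} (h : z ∈ C.V) : g z = 0 := by simp only [hg, if_pos h]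
  have hev {z : ℂ} (h : z ∉ C.V) : ∀ᶠ y in 𝓝 z, y ∉ C.V := C.V_fin.isClosed.isOpen_compl.mem_nhds h
  have hc : ContinuousOn g C.T := by
    intro z hz
    by_cases hV : z ∈ C.V
    · obtain ⟨k, rfl⟩ := hV
      obtain ⟨A, δ, hA, hδ, hb⟩ := W.psi_bar k
      rw [ContinuousWithinAt, gV' (mem_range_self k), tendsto_zero_iff_abs_tendsto_zero]
      refine squeeze_zero' (Eventually.of_forall fun y => abs_nonneg _) (g := fun y => A * ‖y - C.P k‖) ?_ ?_
      · filter_upwards [self_mem_nhdsWithin, mem_nhdsWithin_of_mem_nhds (Metric.ball_mem_nhds _ hδ)] with y hy hyb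
        rw [Metric.mem_ball, dist_eq_norm] at hyb
        by_cases hv : y ∈ C.V
        · simp only [Function.comp, gV' hv, abs_zero]; positivity
        · simp only [Function.comp, gV hv]; exact hb y hy hv hyb.le
      · have : Continuous fun y : ℂ => A * ‖y - C.P k‖ := by fun_prop
        have := (this.tendsto (C.P k)).mono_left (nhdsWithin_le_nhds (s := C.T))
        simpa using this
    · have := (hp.reg.cdw hz hV).continuousWithinAt
      refine this.congr_of_eventuallyEq ?_ (gV hV)
      filter_upwards [mem_nhdsWithin_of_mem_nhds (hev hV)] with y hy using gV hy
  obtain ⟨z, hz, hd⟩ := rolle hc (fun z hz h0 => by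
    by_cases hV : z ∈ C.V
    · exact gV' hV
    · rw [gV hV]
      obtain ⟨j, hj⟩ := (T0_or_side hz).resolve_left h0
      exact (hp.side j).zero hz hV hj)
  have i := (W.ts.ident (C.T0_sub hz) (T0_notV hz)).1
  have e1 : dd I (C.cl w1 w2) z = 0 := by
    have ev : C.cl w1 w2 =ᶠ[𝓝 z] g := by
      filter_upwards [hev (T0_notV hz)] with y hy using (gV hy).symm
    rw [dd_congr ev I]; unfold dd; rw [hd]; rfl
  have e2 : dd 1 (C.dv w1 w2) z = 0 := by
    have ev : C.dv w1 w2 =ᶠ[𝓝 z] fun _ => 0 := by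
      filter_upwards [C.T0_open.mem_nhds hz] with y hy using hf y hy
    rw [dd_congr ev 1, dd_const]
  rw [gr_eq_dd hz, gr_eq_dd hz, e1, e2] at i
  have := mul_pos C.lm_pos (W.pos (C.T0_sub hz) (T0_notV hz)).1
  linarith

theorem cls_exists (C : Cfg) : ∃ F, Cls C C.lm F ∧ ∃ z ∈ C.T0, F z ≠ 0 := by
  obtain ⟨w1, w2, W⟩ := C.exists_w
  obtain ⟨B, hB, hb⟩ := W.f_bdd
  obtain ⟨z0, hz0, hne⟩ := W.f_ne
  have hp := W.ts.div
  have hr := hp.reg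
  set f := C.dv w1 w2
  have lip : LipschitzOnWith (Real.toNNReal (2 * B)) f C.T0 := by
    apply C.T0_convex.lipschitzOnWith_of_nnnorm_fderivWithin_le (𝕜 := ℝ)
    · exact fun y hy => (cdda (hr.T0 hy).1).differentiableWithinAt
    · intro y hy
      rw [fderivWithin_of_isOpen C.T0_open hy, ← NNReal.coe_le_coe, coe_nnnorm, Real.coe_toNNReal _ (by positivity)]
      refine ContinuousLinearMap.opNorm_le_bound _ (by positivity) fun v => ?_
      have e : fderiv ℝ f y v = v.re * dd 1 f y + v.im * dd I f y := dd_lin v f y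
      obtain ⟨b1, b2⟩ := hb y (C.T0_sub hy) (T0_notV hy)
      rw [gr_eq_dd hy] at b1 b2
      rw [e, Real.norm_eq_abs]
      have m1 := mul_le_mul (Complex.abs_re_le_norm v) b1 (abs_nonneg _) (norm_nonneg _)
      have m2 := mul_le_mul (Complex.abs_im_le_norm v) b2 (abs_nonneg _) (norm_nonneg _)
      rw [← abs_mul] at m1 m2
      have := abs_add_le (v.re * dd 1 f y) (v.im * dd I f y)
      linarith
  obtain ⟨F, hF, hE⟩ := lip.extend_real
  have eqV {z : ℂ} (hz : z ∈ C.T) (hV : z ∉ C.V) : F z = f z := by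
    obtain ⟨ρ, hρ, G, hG⟩ := hr z hz hV
    rw [← hG.2.2 z hz (Metric.mem_ball_self hρ)]
    refine C.ae_eq_on hF.continuous hG.1.continuous (p := z) (ρ := ρ) ?_ z hz (Metric.mem_ball_self hρ)
    filter_upwards [(ae_restrict_iff' C.T_meas).1 C.T_ae] with y hy h1 h2
    rw [hG.2.2 y h1 h2]; exact (hE (hy h1)).symm
  have ev {z : ℂ} (hV : z ∉ C.V) : F =ᶠ[𝓝[C.T] z] f := by
    filter_upwards [self_mem_nhdsWithin, mem_nhdsWithin_of_mem_nhds (C.V_fin.isClosed.isOpen_compl.mem_nhds hV)] with y h1 h2 using eqV h1 h2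
  have ev0 {z : ℂ} (hz : z ∈ C.T0) : F =ᶠ[𝓝 z] f := by
    filter_upwards [C.T0_open.mem_nhds hz] with y hy using (hE hy).symm
  refine ⟨F, ⟨hF.continuous.continuousOn, fun z hz hV => ?_, fun z hz => ?_, fun j z hz hl hV => ?_⟩, z0, hz0, by rwa [← hE hz0]⟩
  · exact (hr.cdw hz hV).congr_of_eventuallyEq (ev hV) (eqV hz hV)
  · rw [(Lap_congr (ev0 hz)), (hr.T0 hz).2, ← hE hz]
  · have h0 : C.gr (C.ν j) f z = 0 := ((hp.side j).gr_ν).zero hz hV hl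
    rw [← h0]; unfold gr
    rw [(ev hV).fderivWithin_eq (eqV hz hV)]

end Cfg
end HS
end

noncomputable section
namespace HS
open Complex Filter Topology MeasureTheory
open scoped ContDiff Convolution
namespace Cfg
variable {C : Cfg}

lemma Cls.grad_bdd {mu : ℝ} (hmu : 0 ≤ mu) {u : ℂ → ℝ} (h : Cls C mu u) :
    ∃ B, 0 ≤ B ∧ ∀ z ∈ C.T, z ∉ C.V → |C.gr 1 u z| ≤ B ∧ |C.gr I u z| ≤ B := by
  have hp := h.psol hmu
  obtain ⟨c, hc, hc8, hl, pat⟩ := C.patch mu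
  obtain ⟨K, hK, hk⟩ := C.good_grad mu hmu
  have key k : ∃ B δ : ℝ, 0 < δ ∧ ∀ z ∈ C.T, z ∉ C.V → ‖z - C.P k‖ < δ → |C.gr 1 u z| ≤ B ∧ |C.gr I u z| ≤ B := by
    apply vertex hmu hp k
    · intro ε hε
      have hh := C.hpos k
      obtain ⟨δ, hδ, hd⟩ := Metric.continuousWithinAt_iff.1 (h.cont _ (C.P_mem k)) (ε * c / K) (by positivity)
      refine ⟨min (δ / 2) (C.h k / 2), by positivity, fun z hz hV hr => ?_⟩
      have q1 := hr.trans_le (min_le_left _ _)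
      have e := C.near_dV (k := k) (z := z) (hr.le.trans (min_le_right _ _))
      have d0 := C.dV_pos.2 hV
      have hM : ∀ y ∈ C.T, ‖y - z‖ < C.dV z / 2 → |u y - u (C.P k)| ≤ ε * c / K := fun y hy hyz => by
        rw [← Real.dist_eq]
        refine (hd hy ?_).le
        rw [dist_eq_norm]
        have := norm_sub_le_norm_sub_add_norm_sub y z (C.P k)
        rw [e] at hyz
        have := norm_nonneg (z - C.P k)
        linarith
      have hg : C.Good mu z (c * C.dV z) (C.dV z / 2) u 1 := by
        rcases pat z hz hV with p | ⟨j, -, p⟩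
        · exact p u 1 hp.int
        · exact p u 1 (by norm_num) (hp.side j)
      have fin (v : ℂ) (hv : ‖v‖ ≤ 1) : ‖z - C.P k‖ * |C.gr v u z| ≤ ε := by
        have := hk z (c * C.dV z) _ u 1 (u (C.P k)) _ (by positivity) (hl z hz) hg hz (Or.inl rfl) hM v hv
        rw [← e]
        calc C.dV z * |C.gr v u z| ≤ C.dV z * (K / (c * C.dV z) * (ε * c / K)) := mul_le_mul_of_nonneg_left this d0.le
          _ = ε := by field_simp
      exact ⟨fin 1 (by simp), fin I (by simp)⟩
    · obtain ⟨M, hM⟩ := C.T_compact.exists_bound_of_continuousOn h.cont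
      refine ⟨M, 1, one_pos, fun z hz _ hr => ?_⟩
      have := hM z hz
      rw [Real.norm_eq_abs] at this
      nlinarith [abs_nonneg (u z), norm_nonneg (z - C.P k)]
  obtain ⟨B1, p1, h1⟩ := bdd_of_vertex (hp.reg.gr 1) fun k => by
    obtain ⟨B, δ, hδ, h⟩ := key k
    exact ⟨B, δ, hδ, fun z hz hV hd => (h z hz hV hd).1⟩
  obtain ⟨B2, p2, h2⟩ := bdd_of_vertex (hp.reg.gr I) fun k => by
    obtain ⟨B, δ, hδ, h⟩ := key k
    exact ⟨B, δ, hδ, fun z hz hV hd => (h z hz hV hd).2⟩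
  exact ⟨B1 + B2, by positivity, fun z hz hV => ⟨by linarith [h1 z hz hV], by linarith [h2 z hz hV]⟩⟩

lemma prop_of_pb {lam : ℝ} {a b : ℂ → ℝ} (ra : C.Reg lam a) (rb : C.Reg lam b) (hb : ∀ z ∈ C.T, z ∉ C.V → 0 < b z)
    (h1 : ∀ z ∈ C.T0, C.pb a b 1 z = 0) (h2 : ∀ z ∈ C.T0, C.pb a b I z = 0) : ∃ c, ∀ z ∈ C.T, z ∉ C.V → a z = c * b z := by
  have hbp z (hz : z ∈ C.T0) : 0 < b z := hb z (C.T0_sub hz) (T0_notV hz)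
  have dI z (hz : z ∈ C.T0) : DifferentiableAt ℝ (fun y => (b y)⁻¹) z := (cdda (rb.T0 hz).1).fun_inv (hbp z hz).ne'
  have e (v z : ℂ) (hz : z ∈ C.T0) (h : C.pb a b v z = 0) : dd v (fun y => a y * (b y)⁻¹) z = 0 := by
    have eI : dd v (fun y => (b y)⁻¹) z = - (b z ^ 2)⁻¹ * dd v b z := dd_chain (φ := fun s => s⁻¹) (hasDerivAt_inv (hbp z hz).ne') (cdda (rb.T0 hz).1) v
    rw [dd_mul (cdda (ra.T0 hz).1) (dI z hz), eI]
    unfold pb at h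
    rw [gr_eq_dd hz, gr_eq_dd hz] at h
    have h' : dd v a z = a z / b z * dd v b z := by linarith
    rw [h']
    have := (hbp z hz).ne'
    field_simp
    ring
  obtain ⟨c, hc⟩ := const_of_dd (fun z hz => (cdda (ra.T0 hz).1).fun_mul (dI z hz)) (fun z hz => e 1 z hz (h1 z hz)) (fun z hz => e I z hz (h2 z hz))
  refine ⟨c, fun z hz hV => ?_⟩
  have := (ra.comb rb 1 (-c)).ext0 (c := 0) (fun y hy => by
    have h3 := hc y hy
    have := (hbp y hy).ne'
    field_simp at h3
    linarith) hz hV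
  linarith

theorem no_crit {mu : ℝ} (hmu : 0 < mu) {u : ℂ → ℝ} (h : Cls C mu u) (hle : mu ≤ C.lm) (hnc : ∃ z ∈ C.T0, dd 1 u z ≠ 0 ∨ dd I u z ≠ 0)
    {z : ℂ} (hz : z ∈ C.T) (hV : z ∉ C.V) : C.gr 1 u z ≠ 0 := by
  obtain ⟨w1, w2, W⟩ := C.exists_w
  obtain ⟨B, hB, hb⟩ := h.grad_bdd hmu.le
  have hv := (h.psol hmu.le).grad
  set v1 := C.gr 1 u
  set v2 := C.gr I u
  have sqb (x : ℝ) (hx : |x| ≤ B) : x ^ 2 ≤ B ^ 2 := by rw [← sq_abs]; exact pow_le_pow_left₀ (abs_nonneg _) hx 2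
  have G : ∀ z ∈ C.T0, 2⁻¹ * (C.pb v1 w1 1 z ^ 2 + C.pb v1 w1 I z ^ 2 + C.pb v2 w2 1 z ^ 2 + C.pb v2 w2 I z ^ 2)
      + (C.lm - mu) * (v1 z ^ 2 + v2 z ^ 2) = 0 := fun z hz =>
    gs hle hv W.ts (fun z hz hV => (W.pos hz hV).1) (fun z hz hV => (W.pos hz hV).2) (M := B ^ 2)
      (fun z hz hV => sqb _ (hb z hz hV).1) (fun z hz hV => sqb _ (hb z hz hV).2) hz
  have split (a b c d e : ℝ) (he : 0 ≤ e) (h : 2⁻¹ * (a ^ 2 + b ^ 2 + c ^ 2 + d ^ 2) + e = 0) : a = 0 ∧ b = 0 ∧ c = 0 ∧ d = 0 ∧ e = 0 := by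
    have := sq_nonneg a; have := sq_nonneg b; have := sq_nonneg c; have := sq_nonneg d
    refine ⟨?_, ?_, ?_, ?_, by linarith⟩ <;> exact pow_eq_zero_iff two_ne_zero |>.1 (by linarith)
  have G2 z (hz : z ∈ C.T0) := split _ _ _ _ _ (mul_nonneg (sub_nonneg.2 hle) (by positivity)) (G z hz)
  obtain ⟨y, hy, hne⟩ := hnc
  have hne' : v1 y ≠ 0 ∨ v2 y ≠ 0 := by simp only [v1, v2, gr_eq_dd hy]; exact hne
  have heq : C.lm = mu := by
    have := (G2 y hy).2.2.2.2
    rcases mul_eq_zero.1 this with h | h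
    · linarith
    · exfalso
      have := sq_nonneg (v1 y); have := sq_nonneg (v2 y)
      rcases hne' with q | q
      · exact q (pow_eq_zero_iff two_ne_zero |>.1 (by linarith))
      · exact q (pow_eq_zero_iff two_ne_zero |>.1 (by linarith))
  rw [← heq] at hv
  obtain ⟨c1, e1⟩ := prop_of_pb hv.reg1 W.ts.reg1 (fun z hz hV => (W.pos hz hV).1) (fun z hz => (G2 z hz).1) (fun z hz => (G2 z hz).2.1)
  obtain ⟨c2, e2⟩ := prop_of_pb hv.reg2 W.ts.reg2 (fun z hz hV => (W.pos hz hV).2) (fun z hz => (G2 z hz).2.2.1) (fun z hz => (G2 z hz).2.2.2.1)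
  have c12 : c1 = c2 := by
    obtain ⟨x, hx, hxV, hl⟩ := C.side_pt 0
    have n1 : dot (C.ν 0) ⟨w1 x, w2 x⟩ = 0 := (W.ts.od 0).zero hx hxV hl
    have n2 : dot (C.ν 0) ⟨v1 x, v2 x⟩ = 0 := (hv.od 0).zero hx hxV hl
    have t1 := tang_id (j := 0) n1
    have t2 := tang_id (j := 0) n2
    rw [e1 x hx hxV, e2 x hx hxV] at t2
    have p : 0 < w1 x * (C.τ 0).im := mul_pos (W.pos hx hxV).1 (C.τim 0)
    exact mul_right_cancel₀ p.ne' (by linear_combination t2 - c2 * t1)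
  have c0 : c1 ≠ 0 := by
    rintro rfl
    rcases hne' with q | q
    · exact q (by rw [e1 y (C.T0_sub hy) (T0_notV hy), zero_mul])
    · exact q (by rw [e2 y (C.T0_sub hy) (T0_notV hy), ← c12, zero_mul])
  rw [e1 z hz hV]
  exact mul_ne_zero c0 (W.pos hz hV).1.ne'

end Cfg
end HS
end

noncomputable section
namespace HS
open Complex Filter Topology MeasureTheory
open scoped ContDiff Convolution

lemma mkCfg {P0 P1 P2 : ℂ} (h1 : 0 < (P1 - P0).re) (h2 : 0 < (P1 - P0).im)
    (h3 : 0 < (P2 - P1).re) (h4 : 0 < (P2 - P1).im)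
    (hD : (P1 - P0).re * (P2 - P1).im - (P1 - P0).im * (P2 - P1).re ≠ 0) :
    ∃ C : Cfg, C.P = ![P0, P1, P2] := by
  set D := (P1 - P0).re * (P2 - P1).im - (P1 - P0).im * (P2 - P1).re with hDd
  obtain ⟨s, hs2, hsD⟩ : ∃ s : ℝ, s * s = 1 ∧ 0 < s * D := by
    rcases lt_or_gt_of_ne hD with h | h
    · exact ⟨-1, by norm_num, by linarith⟩
    · exact ⟨1, by norm_num, by linarith⟩
  simp only [sub_re, sub_im] at h1 h2 h3 h4 hDd
  let e : Fin 3 → ℂ := ![P2 - P1, P2 - P0, P1 - P0]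
  let b : Fin 3 → ℂ := ![P1, P0, P0]
  let κ : Fin 3 → ℝ := ![s, -s, s]
  have hκ j : κ j * κ j = 1 := by fin_cases j <;> simp [κ, hs2]
  have er j : 0 < (e j).re := by fin_cases j <;> simp [e] <;> linarith
  have ei j : 0 < (e j).im := by fin_cases j <;> simp [e] <;> linarith
  have hn j : 0 < ‖e j‖ := norm_pos_iff.2 fun h => by have := er j; simp [h] at this
  have hnn j : (e j).re * (e j).re + (e j).im * (e j).im = ‖e j‖ * ‖e j‖ := by
    have := dot_self (e j); unfold dot at this; rw [this]; ring
  let ν : Fin 3 → ℂ := fun j => ⟨-(κ j) * (e j).im / ‖e j‖, κ j * (e j).re / ‖e j‖⟩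
  have key j z : (dot (ν j) z + -dot (ν j) (b j)) / (s * D / ‖e j‖)
      = κ j * ((e j).re * (z - b j).im - (e j).im * (z - b j).re) / (s * D) := by
    have := (hn j).ne'; have := hsD.ne'
    simp only [dot, ν, sub_re, sub_im]
    field_simp; ring
  have hs0 : s ≠ 0 := by rintro rfl; simp at hs2
  have hP j k : dot (ν j) (![P0, P1, P2] k) + -dot (ν j) (b j) = if j = k then s * D / ‖e j‖ else 0 := by
    have h5 := key j (![P0, P1, P2] k)
    rw [div_eq_iff (div_pos hsD (hn j)).ne'] at h5
    rw [h5]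
    have h6 : κ j * ((e j).re * (![P0, P1, P2] k - b j).im - (e j).im * (![P0, P1, P2] k - b j).re) = if j = k then s * D else 0 := by
      fin_cases j <;> fin_cases k <;> simp [κ, e, b, hDd] <;> ring_nf <;> simp
    rw [h6]
    split_ifs
    · rw [div_self hsD.ne', one_mul]
    · simp
  refine ⟨⟨![P0, P1, P2], ν, fun j => ⟨(e j).re / ‖e j‖, (e j).im / ‖e j‖⟩, fun j => -dot (ν j) (b j),
    fun j => s * D / ‖e j‖, ?_, ?_, ?_, fun j => div_pos (er j) (hn j), fun j => div_pos (ei j) (hn j), fun j => div_pos hsD (hn j), hP, ?_, ?_⟩, rfl⟩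
  · intro j
    have := (hn j).ne'
    simp only [dot, ν]
    field_simp
    linear_combination (hnn j) + ((e j).re ^ 2 + (e j).im ^ 2) * hκ j
  · intro j
    have := (hn j).ne'
    simp only [dot]
    field_simp
    linear_combination (hnn j)
  · intro j
    simp only [dot, ν]
    ring
  · intro z
    simp only [key, Fin.sum_univ_three]
    simp only [e, b, κ, Matrix.cons_val, sub_re, sub_im]
    field_simp
    rw [hDd]; ring
  · intro z
    simp only [key, Fin.sum_univ_three]
    simp only [e, b, κ, Matrix.cons_val, sub_re, sub_im]
    apply Complex.ext
    · simp only [add_re, real_smul, re_ofReal_mul]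
      field_simp
      rw [hDd]; ring
    · simp only [add_im, real_smul, im_ofReal_mul]
      field_simp
      rw [hDd]; ring

lemma exRot {a b : ℂ} (h : 0 < dot a b) : ∃ om : ℂ, ‖om‖ = 1 ∧ 0 < (om * a).re ∧ 0 < (om * a).im ∧
    0 < (om * b).re ∧ 0 < (om * b).im := by
  have ha : 0 < ‖a‖ := norm_pos_iff.2 fun h' => by simp [h', dot] at h
  have hb : 0 < ‖b‖ := norm_pos_iff.2 fun h' => by simp [h', dot] at h
  let m : ℂ := (starRingEnd ℂ) (‖b‖ * a + ‖a‖ * b) * (1 + I)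
  have hq : |a.re * b.im - a.im * b.re| ≤ ‖a‖ * ‖b‖ := by
    have := abs_dot_le (I * a) b
    simp only [norm_mul, norm_I, one_mul] at this
    convert this using 2
    simp [dot]; ring
  have haa : a.re * a.re + a.im * a.im = ‖a‖ * ‖a‖ := by
    have := dot_self a; unfold dot at this; rw [this]; ring
  have hbb : b.re * b.re + b.im * b.im = ‖b‖ * ‖b‖ := by
    have := dot_self b; unfold dot at this; rw [this]; ring
  obtain ⟨q1, q2⟩ := abs_le.1 hq
  have H : 0 < (m * a).re ∧ 0 < (m * a).im ∧ 0 < (m * b).re ∧ 0 < (m * b).im := by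
    have e1 : (m * a).re = ‖a‖ * (‖a‖ * ‖b‖ + dot a b + (a.im * b.re - a.re * b.im) * (-1)) := by
      simp [m, dot]; linear_combination ‖b‖ * haa
    have e2 : (m * a).im = ‖a‖ * (‖a‖ * ‖b‖ + dot a b + (a.im * b.re - a.re * b.im)) := by
      simp [m, dot]; linear_combination ‖b‖ * haa
    have e3 : (m * b).re = ‖b‖ * (‖a‖ * ‖b‖ + dot a b + (a.im * b.re - a.re * b.im)) := by
      simp [m, dot]; linear_combination ‖a‖ * hbb
    have e4 : (m * b).im = ‖b‖ * (‖a‖ * ‖b‖ + dot a b - (a.im * b.re - a.re * b.im)) := by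
      simp [m, dot]; linear_combination ‖a‖ * hbb
    rw [e1, e2, e3, e4]
    refine ⟨?_, ?_, ?_, ?_⟩ <;> apply mul_pos <;> first | assumption | linarith
  have hm : 0 < ‖m‖ := norm_pos_iff.2 fun h' => by simp [h'] at H
  refine ⟨((‖m‖⁻¹ : ℝ) : ℂ) * m, ?_, ?_⟩
  · rw [norm_mul, norm_real, Real.norm_of_nonneg (by positivity), inv_mul_cancel₀ hm.ne']
  · simp only [mul_assoc, re_ofReal_mul, im_ofReal_mul]
    have := inv_pos.2 hm
    exact ⟨mul_pos this H.1, mul_pos this H.2.1, mul_pos this H.2.2.1, mul_pos this H.2.2.2⟩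

section transfer
variable {C : Cfg} {v₁ v₂ v₃ : E2} {Φ : E2 ≃ₗᵢ[ℝ] ℂ}

lemma dot_map (a b : E2) : dot (Φ a) (Φ b) = @inner ℝ _ _ a b := by
  rw [← Φ.inner_map_map, Complex.inner]
  simp [dot, mul_comm]

lemma tri_pre (hP : C.P = ![Φ v₁, Φ v₂, Φ v₃]) : Φ ⁻¹' C.T = Tri v₁ v₂ v₃ := by
  have h1 : range C.P = Φ '' {v₁, v₂, v₃} := by
    rw [hP]
    ext z; simp [Fin.exists_fin_succ, image_insert_eq, eq_comm]; tauto
  rw [C.T_eq_hull, h1]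
  have h2 := LinearMap.image_convexHull (Φ.toLinearEquiv : E2 →ₗ[ℝ] ℂ) {v₁, v₂, v₃}
  have h3 : Φ '' (convexHull ℝ {v₁, v₂, v₃}) = convexHull ℝ (Φ '' {v₁, v₂, v₃}) := h2
  rw [← h3, preimage_image_eq _ Φ.injective]
  rfl

lemma mem_tri (hP : C.P = ![Φ v₁, Φ v₂, Φ v₃]) {p : E2} : p ∈ Tri v₁ v₂ v₃ ↔ Φ p ∈ C.T := by
  rw [← tri_pre hP]; rfl

lemma mem_vtx (hP : C.P = ![Φ v₁, Φ v₂, Φ v₃]) {p : E2} : p ∈ Vtx v₁ v₂ v₃ ↔ Φ p ∈ C.V := by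
  unfold Vtx Cfg.V
  rw [hP]
  simp [Fin.exists_fin_succ, eq_comm]; tauto

lemma mem_dom (hP : C.P = ![Φ v₁, Φ v₂, Φ v₃]) {p : E2} :
    p ∈ TriDom v₁ v₂ v₃ ↔ Φ p ∈ C.T ∧ Φ p ∉ C.V := by
  rw [← mem_tri hP, ← mem_vtx hP]; rfl

lemma mem_int (hP : C.P = ![Φ v₁, Φ v₂, Φ v₃]) {p : E2} :
    p ∈ interior (Tri v₁ v₂ v₃) ↔ Φ p ∈ C.T0 := by
  rw [← tri_pre hP, ← C.interior_T]
  have := Φ.toHomeomorph.preimage_interior C.T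
  exact (Set.ext_iff.1 this p).symm

lemma vtx_nhds {p : E2} (hp : p ∉ Vtx v₁ v₂ v₃) : (Vtx v₁ v₂ v₃)ᶜ ∈ 𝓝 p := by
  apply IsOpen.mem_nhds _ hp
  have : (Vtx v₁ v₂ v₃).Finite := by unfold Vtx; exact toFinite _
  exact this.isClosed.isOpen_compl

lemma fdw (hP : C.P = ![Φ v₁, Φ v₂, Φ v₃]) {p : E2} (hp : p ∈ TriDom v₁ v₂ v₃) (g : ℂ → ℝ) (w : E2) :
    fderivWithin ℝ (g ∘ Φ) (TriDom v₁ v₂ v₃) p w = C.gr (Φ w) g (Φ p) := by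
  have h1 : fderivWithin ℝ (g ∘ Φ) (TriDom v₁ v₂ v₃) p = fderivWithin ℝ (g ∘ Φ) (Tri v₁ v₂ v₃) p :=
    fderivWithin_inter (vtx_nhds hp.2)
  have hu : UniqueDiffOn ℝ (Φ.toContinuousLinearEquiv ⁻¹' C.T) :=
    (Φ.toContinuousLinearEquiv.uniqueDiffOn_preimage_iff).2 C.T_uniq
  rw [h1, ← tri_pre hP]
  have := Φ.toContinuousLinearEquiv.comp_right_fderivWithin (f := g) (s := C.T) (x := p)
    (hu p ((mem_tri hP).1 hp.1))
  exact congrArg (fun L => L w) this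

lemma fd (g : ℂ → ℝ) (p w : E2) : fderiv ℝ (g ∘ Φ) p w = dd (Φ w) g (Φ p) := by
  have := Φ.toContinuousLinearEquiv.comp_right_fderiv (f := g) (x := p)
  exact congrArg (fun L => L w) this

lemma negLap_eq {g : ℂ → ℝ} {p : E2} (hg : ContDiffAt ℝ ∞ g (Φ p)) : negLap (g ∘ Φ) p = -Lap g (Φ p) := by
  have h (v w : E2) : mixedDeriv (g ∘ Φ) p v w = dd (Φ w) (dd (Φ v) g) (Φ p) := by
    unfold mixedDeriv
    rw [show (fun y => fderiv ℝ (g ∘ Φ) y v) = (dd (Φ v) g) ∘ Φ from funext fun y => fd g y v, fd]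
  unfold negLap
  rw [h, h, Lap_rot hg]
  · rw [dot_map, EuclideanSpace.inner_single_left]; simp
  · rw [dot_map, EuclideanSpace.inner_single_left]; simp
  · rw [dot_map, EuclideanSpace.inner_single_left]; simp

lemma neu_iff (hP : C.P = ![Φ v₁, Φ v₂, Φ v₃]) {j k m : Fin 3} (hjk : j ≠ k) (hjm : j ≠ m) (hkm : k ≠ m)
    (hu : (Finset.univ : Finset (Fin 3)) = {j, k, m}) {a b : E2} (ha : Φ a = C.P k) (hb : Φ b = C.P m)
    (g : ℂ → ℝ) : NeumannOn (TriDom v₁ v₂ v₃) a b (g ∘ Φ) ↔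
      ∀ z ∈ C.T, C.l j z = 0 → z ∉ C.V → C.gr (C.ν j) g z = 0 := by
  have hd : dot (C.ν j) (C.P m - C.P k) = 0 := by
    rw [← C.l_sub_l, C.l_P_ne hjm, C.l_P_ne hjk, sub_zero]
  constructor
  · intro h z hz hl hV
    obtain ⟨p, rfl⟩ := Φ.surjective z
    have hs := C.s1 (Φ p)
    have hp := C.sP (Φ p)
    rw [hu, Finset.sum_insert (by simp [hjk, hjm]), Finset.sum_pair hkm, hl, zero_div] at hs hp
    rw [zero_smul, zero_add, ← ha, ← hb] at hp
    rw [zero_add] at hs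
    have hseg : p ∈ segment ℝ a b := by
      refine ⟨_, _, div_nonneg (hz k) (C.hpos k).le, div_nonneg (hz m) (C.hpos m).le, hs, ?_⟩
      apply Φ.injective
      rw [map_add, map_smul, map_smul, hp]
    have := h p hseg (fun e => hV ⟨k, by rw [e, ha]⟩) (fun e => hV ⟨m, by rw [e, hb]⟩) (Φ.symm (C.ν j))
      (by rw [← dot_map (Φ := Φ), map_sub, ha, hb, Φ.apply_symm_apply, hd])
    rwa [fdw hP ((mem_dom hP).2 ⟨hz, hV⟩), Φ.apply_symm_apply] at this
  · intro h p ⟨s, t, hs, ht, hst, hp⟩ hpa hpb w hw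
    have hp' : Φ p = s • C.P k + t • C.P m := by
      rw [← hp, map_add, map_smul, map_smul, ha, hb]
    have hT : Φ p ∈ C.T := by rw [hp']; exact C.T_convex (C.P_mem k) (C.P_mem m) hs ht hst
    have hl : C.l j (Φ p) = 0 := by
      rw [hp', C.l_comb j _ _ hst, C.l_P_ne hjk, C.l_P_ne hjm]; simp
    have hV : Φ p ∉ C.V := by
      rintro ⟨i, hi⟩
      have him : i ∈ ({j, k, m} : Finset (Fin 3)) := hu ▸ Finset.mem_univ i
      simp only [Finset.mem_insert, Finset.mem_singleton] at him
      rcases him with rfl | rfl | rfl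
      · rw [← hi, C.l_P_self] at hl; exact (C.hpos _).ne' hl
      · exact hpa (Φ.injective (by rw [ha, hi]))
      · exact hpb (Φ.injective (by rw [hb, hi]))
    have h0 := h _ hT hl hV
    rw [fdw hP ((mem_dom hP).2 ⟨hT, hV⟩)]
    rw [← dot_map (Φ := Φ), map_sub, ha, hb] at hw
    set e := C.P m - C.P k with he
    have hee : e ≠ 0 := by
      intro h'
      have h1 : C.P m = C.P k := sub_eq_zero.1 h'
      have h2 := C.l_P_self m
      rw [h1, C.l_P_ne hkm.symm] at h2
      exact (C.hpos m).ne h2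
    rw [C.gr_lin] at h0 ⊢
    have hn := C.hν j
    unfold dot at hw hd hn
    set x := Φ w
    set n := C.ν j
    have hc : x.re * n.im - x.im * n.re = 0 := by
      by_contra hc
      apply hee
      apply Complex.ext
      · apply mul_left_cancel₀ hc
        simp only [zero_re]; linear_combination n.im * hw - x.im * hd
      · apply mul_left_cancel₀ hc
        simp only [zero_im]; linear_combination x.re * hd - n.re * hw
    linear_combination (x.re * n.re + x.im * n.im) * h0 + (C.gr I g (Φ p) * n.re - C.gr 1 g (Φ p) * n.im) * hc * (-1) - (x.re * C.gr 1 g (Φ p) + x.im * C.gr I g (Φ p)) * hn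

lemma eig_iff (hP : C.P = ![Φ v₁, Φ v₂, Φ v₃]) (g : ℂ → ℝ) {mu : ℝ} (hmu : 0 < mu) :
    IsNeumannEigenfun v₁ v₂ v₃ mu (g ∘ Φ) ↔ C.Cls mu g ∧ ¬ ∃ c, ∀ z ∈ C.T, g z = c := by
  have hsm p (hp : p ∈ TriDom v₁ v₂ v₃) : ContDiffWithinAt ℝ ∞ (g ∘ Φ) (TriDom v₁ v₂ v₃) p ↔
      ContDiffWithinAt ℝ ∞ g C.T (Φ p) := by
    have h2 := Φ.toContinuousLinearEquiv.contDiffWithinAt_comp_iff (𝕜 := ℝ) (n := ∞) (f := g) (s := C.T) (x := Φ p)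
    rw [show Φ.toContinuousLinearEquiv.symm (Φ p) = p from Φ.symm_apply_apply p] at h2
    rw [← h2]
    have h3 : Φ.toContinuousLinearEquiv ⁻¹' C.T = Tri v₁ v₂ v₃ := tri_pre hP
    rw [h3]
    exact contDiffWithinAt_inter (vtx_nhds hp.2)
  have hat z (hz : z ∈ C.T0) (h : ContDiffWithinAt ℝ ∞ g C.T z) : ContDiffAt ℝ ∞ g z :=
    h.contDiffAt (mem_of_superset (C.T0_open.mem_nhds hz) C.T0_sub)
  have n12 := neu_iff hP (j := 2) (k := 0) (m := 1) (by decide) (by decide) (by decide) (by decide) (a := v₁) (b := v₂)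
    (by rw [hP]; rfl) (by rw [hP]; rfl) g
  have n23 := neu_iff hP (j := 0) (k := 1) (m := 2) (by decide) (by decide) (by decide) (by decide) (a := v₂) (b := v₃)
    (by rw [hP]; rfl) (by rw [hP]; rfl) g
  have n31 := neu_iff hP (j := 1) (k := 2) (m := 0) (by decide) (by decide) (by decide) (by decide) (a := v₃) (b := v₁)
    (by rw [hP]; rfl) (by rw [hP]; rfl) g
  have hcon : ContinuousOn (g ∘ Φ) (Tri v₁ v₂ v₃) ↔ ContinuousOn g C.T := by
    rw [← tri_pre hP]
    refine ⟨fun h => ?_, fun h => h.comp Φ.continuous.continuousOn fun x hx => hx⟩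
    have := h.comp (t := Φ ⁻¹' C.T) (s := C.T) Φ.symm.continuous.continuousOn fun x hx => by
      rw [mem_preimage, Φ.apply_symm_apply]; exact hx
    refine this.congr fun x _ => ?_
    simp
  have hnc : (∃ c : ℝ, ∀ z ∈ Tri v₁ v₂ v₃, (g ∘ Φ) z = c) ↔ ∃ c, ∀ z ∈ C.T, g z = c := by
    refine exists_congr fun c => ⟨fun h z hz => ?_, fun h z hz => h _ ((mem_tri hP).1 hz)⟩
    have := h (Φ.symm z) ((mem_tri hP).2 (by rwa [Φ.apply_symm_apply]))
    rwa [Function.comp_apply, Φ.apply_symm_apply] at this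
  constructor
  · intro H
    have S : ∀ q ∈ C.T, q ∉ C.V → ContDiffWithinAt ℝ ∞ g C.T q := by
      intro q hq hV
      obtain ⟨p, rfl⟩ := Φ.surjective q
      have hp := (mem_dom hP).2 ⟨hq, hV⟩
      exact (hsm p hp).1 (H.smooth p hp)
    refine ⟨⟨hcon.1 H.cont, S, ?_, ?_⟩, fun h => H.nonconst (hnc.2 h)⟩
    · intro z hz
      obtain ⟨p, rfl⟩ := Φ.surjective z
      have := H.eqn p ((mem_int hP).2 hz)
      rw [negLap_eq (hat _ hz (S _ (C.T0_sub hz) (Cfg.T0_notV hz)))] at this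
      simp only [Function.comp_apply] at this
      linarith
    · intro j
      fin_cases j
      · exact n23.1 H.neumann₂₃
      · exact n31.1 H.neumann₃₁
      · exact n12.1 H.neumann₁₂
  · rintro ⟨H, hn⟩
    refine ⟨hmu, fun h => hn (hnc.1 h), hcon.2 H.cont, fun p hp => ?_, fun p hp => ?_, n12.2 (H.neu 2), n23.2 (H.neu 0), n31.2 (H.neu 1)⟩
    · have := (mem_dom hP).1 hp
      exact (hsm p hp).2 (H.sm _ this.1 this.2)
    · have hz := (mem_int hP).1 hp
      rw [negLap_eq (hat _ hz (H.sm _ (C.T0_sub hz) (Cfg.T0_notV hz))), H.eq _ hz]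
      simp only [Function.comp_apply]; ring

end transfer

lemma no_crit_cfg {C : Cfg} {v₁ v₂ v₃ : E2} {Φ : E2 ≃ₗᵢ[ℝ] ℂ} (hP : C.P = ![Φ v₁, Φ v₂, Φ v₃])
    {u : E2 → ℝ} (hu : IsSecondNeumannEigenfun v₁ v₂ v₃ u) {p : E2} : ¬ IsCritPt v₁ v₂ v₃ u p := by
  rintro ⟨hp, hc⟩
  obtain ⟨mu, hmu, hmin⟩ := hu
  obtain ⟨g, rfl⟩ : ∃ g : ℂ → ℝ, u = g ∘ Φ := ⟨u ∘ Φ.symm, by ext x; simp⟩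
  obtain ⟨H, hn⟩ := (eig_iff hP g hmu.pos).1 hmu
  have hle : mu ≤ C.lm := by
    obtain ⟨F, hF, z, hz, hFz⟩ := Cfg.cls_exists C
    apply hmin C.lm (F ∘ Φ)
    refine (eig_iff hP F C.lm_pos).2 ⟨hF, ?_⟩
    rintro ⟨c, hcF⟩
    have he : F =ᶠ[𝓝 z] fun _ => c := by
      filter_upwards [C.T0_open.mem_nhds hz] with y hy using hcF y (C.T0_sub hy)
    have h1 (v : ℂ) : dd v F =ᶠ[𝓝 z] fun _ => 0 := by
      filter_upwards [he.eventuallyEq_nhds] with y hy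
      rw [dd_congr hy v]; simp [dd]
    have h2 : Lap F z = 0 := by
      unfold Lap
      rw [dd_congr (h1 1), dd_congr (h1 I)]; simp [dd]
    rw [hF.eq z hz] at h2
    have := C.lm_pos
    rcases mul_eq_zero.1 h2 with h | h
    · linarith
    · exact hFz h
  have hz := (mem_dom hP).1 hp
  refine Cfg.no_crit hmu.pos H hle ?_ hz.1 hz.2 ?_
  · by_contra! hno
    apply hn
    have hd z (hz : z ∈ C.T0) : DifferentiableAt ℝ g z :=
      ((H.sm z (C.T0_sub hz) (Cfg.T0_notV hz)).contDiffAt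
        (mem_of_superset (C.T0_open.mem_nhds hz) C.T0_sub)).differentiableAt (by simp)
    obtain ⟨c, hcc⟩ := Cfg.const_of_dd hd (fun z hz => (hno z hz).1) (fun z hz => (hno z hz).2)
    refine ⟨c, fun z hz => ?_⟩
    by_contra hne
    obtain ⟨δ, hδ, hh⟩ := Metric.continuousWithinAt_iff.1 (H.cont z hz) (|c - g z|) (abs_pos.2 (sub_ne_zero.2 (Ne.symm hne)))
    obtain ⟨y, hy, hyb⟩ := Cfg.T0_near hz hδ
    have := hh (C.T0_sub hy) hyb
    rw [hcc y hy, Real.dist_eq] at this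
    exact lt_irrefl _ this
  · have := fdw hP hp g (Φ.symm 1)
    rw [hc, Φ.apply_symm_apply] at this
    exact this.symm

lemma no_crit_mid {v₁ v₂ v₃ : E2} (hT : ¬ Collinear ℝ {v₁, v₂, v₃})
    (ho : Real.pi / 2 < EuclideanGeometry.angle v₁ v₂ v₃)
    {u : E2 → ℝ} (hu : IsSecondNeumannEigenfun v₁ v₂ v₃ u) {p : E2} : ¬ IsCritPt v₁ v₂ v₃ u p := by
  have hin : 0 < @inner ℝ _ _ (v₂ - v₁) (v₃ - v₂) := by
    unfold EuclideanGeometry.angle at ho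
    have h1 := InnerProductGeometry.cos_angle_mul_norm_mul_norm (v₁ -ᵥ v₂) (v₃ -ᵥ v₂)
    have h2 : Real.cos (InnerProductGeometry.angle (v₁ -ᵥ v₂) (v₃ -ᵥ v₂)) < 0 :=
      Real.cos_neg_of_pi_div_two_lt_of_lt ho (by linarith [InnerProductGeometry.angle_le_pi (v₁ -ᵥ v₂) (v₃ -ᵥ v₂), Real.pi_pos])
    have h3 : v₁ ≠ v₂ := by rintro rfl; apply hT; simp [collinear_pair]
    have h4 : v₃ ≠ v₂ := by rintro rfl; apply hT; simp [collinear_pair]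
    simp only [vsub_eq_sub] at h1 h2
    have h5 := norm_pos_iff.2 (sub_ne_zero.2 h3)
    have h6 := norm_pos_iff.2 (sub_ne_zero.2 h4)
    rw [← neg_sub v₁ v₂, inner_neg_left, ← h1]
    have := mul_pos h5 h6
    nlinarith
  let Φ0 : E2 ≃ₗᵢ[ℝ] ℂ := Complex.orthonormalBasisOneI.repr.symm
  rw [← dot_map (Φ := Φ0)] at hin
  obtain ⟨om, hom, a1, a2, a3, a4⟩ := exRot hin
  let Φ : E2 ≃ₗᵢ[ℝ] ℂ := Φ0.trans (rotation ⟨om, mem_sphere_zero_iff_norm.2 hom⟩)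
  have hΦ w : om * Φ0 w = Φ w := (rotation_apply ⟨om, mem_sphere_zero_iff_norm.2 hom⟩ (Φ0 w)).symm
  rw [hΦ] at a1 a2 a3 a4
  have hD : (Φ (v₂ - v₁)).re * (Φ (v₃ - v₂)).im - (Φ (v₂ - v₁)).im * (Φ (v₃ - v₂)).re ≠ 0 := by
    intro h
    have h1 : v₃ - v₂ = ((Φ (v₃ - v₂)).re / (Φ (v₂ - v₁)).re) • (v₂ - v₁) := by
      apply Φ.injective
      rw [map_smul]
      apply Complex.ext
      · rw [real_smul, re_ofReal_mul, div_mul_cancel₀ _ a1.ne']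
      · rw [real_smul, im_ofReal_mul]
        have := a1.ne'
        field_simp
        linarith
    apply hT
    rw [collinear_iff_of_mem (p₀ := v₁) (by simp)]
    refine ⟨v₂ - v₁, fun q hq => ?_⟩
    simp only [mem_insert_iff, mem_singleton_iff] at hq
    rcases hq with rfl | rfl | rfl
    · exact ⟨0, by simp⟩
    · exact ⟨1, by simp⟩
    · refine ⟨1 + (Φ (q - v₂)).re / (Φ (v₂ - v₁)).re, ?_⟩
      rw [add_smul, ← h1]; simp
  simp only [map_sub] at a1 a2 a3 a4 hD
  obtain ⟨C, hC⟩ := mkCfg a1 a2 a3 a4 hD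
  exact no_crit_cfg hC hu

lemma tri_cyc (v₁ v₂ v₃ : E2) : Tri v₂ v₃ v₁ = Tri v₁ v₂ v₃ := by
  unfold Tri; congr 1; ext; simp; tauto
lemma vtx_cyc (v₁ v₂ v₃ : E2) : Vtx v₂ v₃ v₁ = Vtx v₁ v₂ v₃ := by
  unfold Vtx; ext; simp; tauto
lemma dom_cyc (v₁ v₂ v₃ : E2) : TriDom v₂ v₃ v₁ = TriDom v₁ v₂ v₃ := by
  unfold TriDom; rw [tri_cyc, vtx_cyc]

lemma eig_cyc {v₁ v₂ v₃ : E2} {mu : ℝ} {u : E2 → ℝ} :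
    IsNeumannEigenfun v₂ v₃ v₁ mu u ↔ IsNeumannEigenfun v₁ v₂ v₃ mu u := by
  constructor
  · rintro ⟨a, b, c, d, e, f, g, h⟩
    simp only [tri_cyc, dom_cyc] at b c d e f g h
    exact ⟨a, b, c, d, e, h, f, g⟩
  · rintro ⟨a, b, c, d, e, f, g, h⟩
    simp only [← tri_cyc v₁ v₂ v₃, ← dom_cyc v₁ v₂ v₃] at b c d e f g h
    exact ⟨a, b, c, d, e, g, h, f⟩

lemma sec_cyc {v₁ v₂ v₃ : E2} {u : E2 → ℝ} (h : IsSecondNeumannEigenfun v₁ v₂ v₃ u) :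
    IsSecondNeumannEigenfun v₂ v₃ v₁ u := by
  obtain ⟨mu, h1, h2⟩ := h
  exact ⟨mu, eig_cyc.2 h1, fun m w hw => h2 m w (eig_cyc.1 hw)⟩

lemma crit_cyc {v₁ v₂ v₃ : E2} {u : E2 → ℝ} {p : E2} (h : IsCritPt v₁ v₂ v₃ u p) : IsCritPt v₂ v₃ v₁ u p := by
  unfold IsCritPt at *; rwa [dom_cyc]

lemma col_cyc {v₁ v₂ v₃ : E2} (h : ¬ Collinear ℝ {v₁, v₂, v₃}) : ¬ Collinear ℝ {v₂, v₃, v₁} := by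
  convert h using 2; ext; simp; tauto

lemma no_crit_all {v₁ v₂ v₃ : E2} (hT : AffineIndependent ℝ ![v₁, v₂, v₃])
    (ho : Real.pi / 2 < EuclideanGeometry.angle v₂ v₁ v₃ ∨ Real.pi / 2 < EuclideanGeometry.angle v₁ v₂ v₃ ∨
      Real.pi / 2 < EuclideanGeometry.angle v₁ v₃ v₂)
    {u : E2 → ℝ} (hu : IsSecondNeumannEigenfun v₁ v₂ v₃ u) : ¬ ∃ p, IsCritPt v₁ v₂ v₃ u p := by
  rintro ⟨p, hp⟩
  rw [affineIndependent_iff_not_collinear_set] at hT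
  rcases ho with h | h | h
  · rw [EuclideanGeometry.angle_comm] at h
    exact no_crit_mid (col_cyc (col_cyc hT)) h (sec_cyc (sec_cyc hu)) (crit_cyc (crit_cyc hp))
  · exact no_crit_mid hT h hu hp
  · rw [EuclideanGeometry.angle_comm] at h
    exact no_crit_mid (col_cyc hT) h (sec_cyc hu) (crit_cyc hp)

end HS
end

/-- A second Neumann eigenfunction of an obtuse triangle has no critical points. -/
theorem obtuse_triangle_no_critical_points
    (v₁ v₂ v₃ : E2) (hT : AffineIndependent ℝ ![v₁, v₂, v₃])
    (hobtuse : Real.pi / 2 < EuclideanGeometry.angle v₂ v₁ v₃ ∨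
      Real.pi / 2 < EuclideanGeometry.angle v₁ v₂ v₃ ∨
      Real.pi / 2 < EuclideanGeometry.angle v₁ v₃ v₂)
    (u : E2 → ℝ) (hu : IsSecondNeumannEigenfun v₁ v₂ v₃ u) :
    ¬ ∃ p, IsCritPt v₁ v₂ v₃ u p := by
  exact HS.no_crit_all hT hobtuse hu

end
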